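/- Let M_1,…,M_k be compact connected oriented n-dimensional manifolds, n ≥ 2, such that the fundamental group of every boundary component of every M_j is amenable, and let M be the (connected, oriented) manifold obtained by gluing M_1,…,M_k along some of their boundary components via orientation-reversing homeomorphisms. If every gluing f : S_1 → S_2 used in the construction of M is compatible, i.e. f_*(K_1) = K_2 where K_i is the kernel of the map π₁(S_i) → π₁(M_{j_i}) induced by the inclusion of the boundary component S_i into the manifold M_{j_i} containing it, then ‖M,∂M‖ = ‖M_1,∂M_1‖ + … + ‖M_k,∂M_k‖. -/

import Mathlib

noncomputable section

namespace BddCoh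

/-! ### Singular chains and homology -/

/-- The standard `n`-simplex. -/
abbrev Δ (n : ℕ) : Set (Fin (n + 1) → ℝ) := stdSimplex ℝ (Fin (n + 1))

/-- Singular `n`-simplices in `X`. -/
abbrev SSimplex (X : Type) [TopologicalSpace X] (n : ℕ) := C(Δ n, X)

/-- Singular `n`-chains in `X` with coefficients in `R`. -/
def SChain (R : Type) [Ring R] (X : Type) [TopologicalSpace X] (n : ℕ) : Type :=
  SSimplex X n →₀ R

instance (R : Type) [Ring R] (X : Type) [TopologicalSpace X] (n : ℕ) :
    AddCommGroup (SChain R X n) := Finsupp.instAddCommGroup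

instance (R : Type) [Ring R] (X : Type) [TopologicalSpace X] (n : ℕ) :
    Module R (SChain R X n) := Finsupp.module (SSimplex X n) R

/-- Chains are finitely supported functions on simplices. -/
def chainEquiv (R : Type) [Ring R] (X : Type) [TopologicalSpace X] (n : ℕ) :
    (SSimplex X n →₀ R) ≃ₗ[R] SChain R X n := LinearEquiv.refl R (SChain R X n)

/-- The `i`-th face inclusion of standard simplices. -/
def face {n : ℕ} (i : Fin (n + 2)) : C(Δ n, Δ (n + 1)) where
  toFun x := ⟨i.insertNth 0 x.1, by
    refine ⟨fun j => ?_, ?_⟩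
    · refine Fin.succAboveCases i ?_ (fun j => ?_) j
      · simp
      · simp [x.2.1 j]
    · rw [Fin.sum_univ_succAbove _ i]
      simp [x.2.2]⟩
  continuous_toFun := by
    refine Continuous.subtype_mk ?_ _
    exact Continuous.finInsertNth i continuous_const continuous_subtype_val

variable {X : Type} [TopologicalSpace X] {R : Type} [Ring R]

/-- The `i`-th face of a singular `(n+1)`-simplex. -/
def faceOf {n : ℕ} (σ : SSimplex X (n + 1)) (i : Fin (n + 2)) : SSimplex X n :=
  σ.comp (face i)

/-- The boundary of a singular `(n+1)`-simplex, as a chain. -/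
def bdryChain (R : Type) [Ring R] {n : ℕ} (σ : SSimplex X (n + 1)) : SChain R X n :=
  chainEquiv R X n (∑ i : Fin (n + 2), Finsupp.single (faceOf σ i) ((-1 : R) ^ (i : ℕ)))

/-- The singular boundary operator. -/
def bdry (R : Type) [Ring R] (X : Type) [TopologicalSpace X] (n : ℕ) :
    SChain R X (n + 1) →ₗ[R] SChain R X n :=
  (Finsupp.linearCombination R (bdryChain R)).comp (chainEquiv R X (n + 1)).symm.toLinearMap

/-- The ℓ¹-norm of a real singular chain. -/
def l1 {n : ℕ} (c : SChain ℝ X n) : ℝ :=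
  ((chainEquiv ℝ X n).symm c).sum fun _ r => |r|

/-- The submodule of chains supported on simplices with image contained in `Y`. -/
def chainsIn (R : Type) [Ring R] (X : Type) [TopologicalSpace X] (Y : Set X) (n : ℕ) :
    Submodule R (SChain R X n) :=
  (Finsupp.supported R R {σ : SSimplex X n | Set.range σ ⊆ Y}).map (chainEquiv R X n).toLinearMap

/-- Relative `(n+1)`-cycles of the pair `(X, Y)`. -/
def relCycles (R : Type) [Ring R] (X : Type) [TopologicalSpace X] (Y : Set X) (n : ℕ) :
    Submodule R (SChain R X (n + 1)) :=
  (chainsIn R X Y n).comap (bdry R X n)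

/-- Relative `(n+1)`-boundaries of the pair `(X, Y)`. -/
def relBdries (R : Type) [Ring R] (X : Type) [TopologicalSpace X] (Y : Set X) (n : ℕ) :
    Submodule R (SChain R X (n + 1)) :=
  LinearMap.range (bdry R X (n + 1)) ⊔ chainsIn R X Y (n + 1)

/-- Relative singular homology `H_{n+1}(X, Y; R)`. -/
def relHomology (R : Type) [Ring R] (X : Type) [TopologicalSpace X] (Y : Set X) (n : ℕ) :=
  relCycles R X Y n ⧸ ((relBdries R X Y n).comap (relCycles R X Y n).subtype)

instance (Y : Set X) (n : ℕ) : AddCommGroup (relHomology R X Y n) :=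
  Submodule.Quotient.addCommGroup _

instance (Y : Set X) (n : ℕ) : Module R (relHomology R X Y n) :=
  Submodule.Quotient.module _

/-- The class of a relative cycle in relative homology. -/
def relHomClass {Y : Set X} {n : ℕ} (c : relCycles R X Y n) : relHomology R X Y n :=
  Submodule.Quotient.mk c

/-- The ℓ¹-seminorm on relative singular homology. -/
def l1HomNorm {Y : Set X} {n : ℕ} (α : relHomology ℝ X Y n) : ℝ :=
  sInf {r : ℝ | ∃ c : relCycles ℝ X Y n, relHomClass c = α ∧ r = l1 c.1}


/-! ### Amenability and countable CW pairs -/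

/-- A group is amenable if it admits a left-invariant finitely additive
probability measure defined on all subsets. -/
def IsAmenable (G : Type*) [Group G] : Prop :=
  ∃ m : Set G → ℝ, (∀ A, 0 ≤ m A) ∧ m Set.univ = 1 ∧
    (∀ A B, Disjoint A B → m (A ∪ B) = m A + m B) ∧
    (∀ (g : G) (A : Set G), m ((g * ·) '' A) = m A)

section CW

open CategoryTheory

universe u

/-- A type witnessing that `X'` is obtained from `X` by attaching generalized cells `f : S ⟶ D`. -/
structure RelativeCWComplex.AttachGeneralizedCells {S D : TopCat.{u}} (f : S ⟶ D)
    (X X' : TopCat.{u}) where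
  /-- The index type over the generalized cells. -/
  cells : Type u
  /-- An attaching map for each generalized cell. -/
  attachMaps : cells → (S ⟶ X)
  /-- `X'` is the pushout of `∐ S ⟶ X` and `∐ S ⟶ ∐ D`. -/
  iso_pushout : X' ≅ Limits.pushout (Limits.Sigma.desc attachMaps)
    (Limits.Sigma.map fun (_ : cells) ↦ f)

/-- A type witnessing that `X'` is obtained from `X` by attaching `n`-disks. -/
def RelativeCWComplex.AttachCells (n : ℕ) (X X' : TopCat.{u}) :=
  RelativeCWComplex.AttachGeneralizedCells (TopCat.diskBoundaryInclusion.{u} n) X X'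

/-- A relative CW-complex consists of an expanding sequence of subspaces `sk i` (called the
`(i-1)`-skeleton) for `i ≥ 0`, where `sk 0` (i.e., the `(-1)`-skeleton) is an arbitrary
topological space, and each `sk (n + 1)` (i.e., the `n`-skeleton) is obtained from `sk n` (i.e.,
the `(n-1)`-skeleton) by attaching `n`-disks. -/
structure RelativeCWComplex where
  /-- The skeletons. -/
  sk : ℕ → TopCat.{u}
  /-- Each `sk (n + 1)` is obtained from `sk n` by attaching `n`-disks. -/
  attachCells (n : ℕ) : RelativeCWComplex.AttachCells n (sk n) (sk (n + 1))

/-- A CW-complex is a relative CW-complex whose `sk 0` (i.e., `(-1)`-skeleton) is empty. -/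
structure CWComplex extends RelativeCWComplex.{u} where
  /-- `sk 0` (i.e., the `(-1)`-skeleton) is empty. -/
  isEmpty_sk_zero : IsEmpty (sk 0)

/-- The inclusion map from `X` to `X'`, when `X'` is obtained from `X` by attaching
generalized cells. -/
def RelativeCWComplex.AttachGeneralizedCells.inclusion {S D : TopCat.{u}} {f : S ⟶ D}
    {X X' : TopCat.{u}} (att : RelativeCWComplex.AttachGeneralizedCells f X X') : X ⟶ X' :=
  Limits.pushout.inl _ _ ≫ att.iso_pushout.inv

/-- The inclusion map from `sk n` to `sk (n + 1)`. -/
def RelativeCWComplex.skInclusion (X : RelativeCWComplex.{u}) (n : ℕ) : X.sk n ⟶ X.sk (n + 1) :=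
  RelativeCWComplex.AttachGeneralizedCells.inclusion (X.attachCells n)

/-- The topology on a relative CW-complex. -/
def RelativeCWComplex.toTopCat (X : RelativeCWComplex.{u}) : TopCat.{u} :=
  Limits.colimit (Functor.ofSequence X.skInclusion)

end CW

open CategoryTheory in
/-- `X` carries the structure of a countable CW-complex. -/
def IsCountableCW (X : Type) [TopologicalSpace X] : Prop :=
  ∃ C : CWComplex.{0}, (∀ n, Countable ((C.attachCells n).cells)) ∧
    Nonempty ((RelativeCWComplex.toTopCat C.toRelativeCWComplex : TopCat) ≅ TopCat.of X)

open CategoryTheory in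
/-- `(X, Y)` is a pair of countable CW-complexes, i.e. `X` is a countable CW-complex and
`Y` is a subcomplex of `X` (realized as the `(-1)`-skeleton of a relative CW-structure on `X`),
which is itself a countable CW-complex. -/
def IsCountableCWPair (X : Type) [TopologicalSpace X] (Y : Set X) : Prop :=
  IsCountableCW X ∧ IsCountableCW Y ∧
  ∃ (C : RelativeCWComplex.{0}) (φ : (RelativeCWComplex.toTopCat C : TopCat) ≅ TopCat.of X),
    (∀ n, Countable ((C.attachCells n).cells)) ∧
    Set.range (fun y => φ.hom ((Limits.colimit.ι (Functor.ofSequence C.skInclusion) 0) y)) = Y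

/-- Every connected component of `Y` has amenable fundamental group. -/
def AmenableComponents (Y : Type) [TopologicalSpace Y] : Prop :=
  ∀ y : Y, IsAmenable (FundamentalGroup (connectedComponent y) ⟨y, mem_connectedComponent⟩)


/-- The inclusion of a subspace, as a continuous map. -/
def subIncl {X : Type} [TopologicalSpace X] (Y : Set X) : C(↥Y, X) :=
  ⟨Subtype.val, continuous_subtype_val⟩

open CategoryTheory in
/-- The map induced by a continuous map on fundamental groups. -/
def pi1Map {X Y : Type} [TopologicalSpace X] [TopologicalSpace Y] (f : C(X, Y)) (x : X) :
    FundamentalGroup X x →* FundamentalGroup Y (f x) :=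
  (FundamentalGroupoid.fundamentalGroupoidFunctor.map
    (show TopCat.of X ⟶ TopCat.of Y from TopCat.ofHom f)).mapEnd ⟨x⟩

/-! ### Topological manifolds with boundary and fundamental classes -/

/-- The closed upper half space `ℍⁿ = {x : ℝⁿ | x₀ ≥ 0}`. -/
def halfSpace (n : ℕ) : Set (Fin n → ℝ) := {x | ∀ j : Fin n, (j : ℕ) = 0 → 0 ≤ x j}

/-- `M` is a topological `n`-manifold with boundary `B`: every point has an open
neighbourhood homeomorphic to an open subset of the closed half space `ℍⁿ`, with points of
`B` (and only those) corresponding to points of the boundary hyperplane. -/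
def IsTopMfdWithBdry (n : ℕ) (M : Type) [TopologicalSpace M] (B : Set M) : Prop :=
  T2Space M ∧
  ∀ x : M, ∃ (U : Set M) (V : Set ↥(halfSpace n)) (e : ↥U ≃ₜ ↥V),
    IsOpen U ∧ IsOpen V ∧ x ∈ U ∧
    ∀ y : ↥U, ((∀ j : Fin n, (j : ℕ) = 0 → ((e y : ↥(halfSpace n)) : Fin n → ℝ) j = 0) ↔
      (y : M) ∈ B)

/-- Extension of coefficients from `ℤ` to `ℝ` on singular chains. -/
def intChain {M : Type} [TopologicalSpace M] {m : ℕ} (z : SChain ℤ M m) : SChain ℝ M m :=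
  chainEquiv ℝ M m
    (Finsupp.mapRange (Int.cast : ℤ → ℝ) (by simp) ((chainEquiv ℤ M m).symm z))

/-- `μ ∈ H_{n+1}(M, B; ℝ)` is a fundamental class (with regular set `reg`): it is the
image of an integral relative homology class which induces a generator of the local
homology group `H_{n+1}(M, M ∖ {x}; ℤ)` at every point `x ∈ reg`. For a compact connected
oriented `(n+1)`-manifold `M` with boundary `B` one takes `reg = Bᶜ` (the interior), and
for the pseudomanifolds arising from generalized Dehn fillings one takes `reg` to be the
image of the interior of the filled manifold. -/
def IsFundClassOn (M : Type) [TopologicalSpace M] (B : Set M) (reg : Set M) (n : ℕ)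
    (μ : relHomology ℝ M B n) : Prop :=
  ∃ (z : SChain ℤ M (n + 1)) (hz : z ∈ relCycles ℤ M B n),
    (∃ hzr : intChain z ∈ relCycles ℝ M B n, relHomClass ⟨intChain z, hzr⟩ = μ) ∧
    ∀ x ∈ reg,
      ∃ hloc : z ∈ relCycles ℤ M ({x}ᶜ) n,
        ∀ β : relHomology ℤ M ({x}ᶜ) n, ∃ k : ℤ, β = k • relHomClass ⟨z, hloc⟩

/-- The fundamental class of a compact connected oriented manifold with boundary:
its regular points are all the interior points. -/
def IsFundClass (M : Type) [TopologicalSpace M] (B : Set M) (n : ℕ)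
    (μ : relHomology ℝ M B n) : Prop :=
  IsFundClassOn M B Bᶜ n μ

/-! ### Gluings of manifolds along boundary components -/

/-- The data of a gluing of the manifolds-with-boundary `(piece j, bdry j)`, `j < k`,
along (some of) their boundary components: a finite set `E` of gluings, each of which
identifies a boundary component `S₁ e` of the piece `j₁ e` with a boundary component
`S₂ e` of the piece `j₂ e` via a homeomorphism `glue e`; each boundary component is used
at most once. -/
structure GluingData (k : ℕ) where
  piece : Fin k → Type
  top : ∀ j, TopologicalSpace (piece j)
  bdry : ∀ j, Set (piece j)
  E : Type
  finE : Finite E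
  j₁ : E → Fin k
  j₂ : E → Fin k
  S₁ : (e : E) → Set (piece (j₁ e))
  S₂ : (e : E) → Set (piece (j₂ e))
  comp₁ : ∀ e, ∃ y ∈ bdry (j₁ e), S₁ e = connectedComponentIn (bdry (j₁ e)) y
  comp₂ : ∀ e, ∃ y ∈ bdry (j₂ e), S₂ e = connectedComponentIn (bdry (j₂ e)) y
  sub₁ : ∀ e, S₁ e ⊆ bdry (j₁ e)
  sub₂ : ∀ e, S₂ e ⊆ bdry (j₂ e)
  glue : (e : E) → ↥(S₁ e) ≃ₜ ↥(S₂ e)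
  used_inj : Function.Injective (fun x : E ⊕ E =>
    match x with
    | Sum.inl e => (⟨j₁ e, S₁ e⟩ : Σ j : Fin k, Set (piece j))
    | Sum.inr e => ⟨j₂ e, S₂ e⟩)

attribute [instance] GluingData.top

namespace GluingData

variable {k : ℕ} (D : GluingData k)

/-- The identifications performed by the gluing. -/
def rel : (Σ j, D.piece j) → (Σ j, D.piece j) → Prop := fun a b =>
  ∃ (e : D.E) (s : ↥(D.S₁ e)), a = ⟨D.j₁ e, (s : D.piece (D.j₁ e))⟩ ∧
    b = ⟨D.j₂ e, (D.glue e s : D.piece (D.j₂ e))⟩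

/-- The glued space: the quotient of the disjoint union of the pieces by the
identifications given by the gluing homeomorphisms. -/
def Glued : Type := Quot D.rel

instance : TopologicalSpace D.Glued := by unfold Glued; infer_instance

/-- The canonical map from a piece to the glued space. -/
def emb (j : Fin k) : C(D.piece j, D.Glued) :=
  ⟨fun x => Quot.mk D.rel ⟨j, x⟩, by exact continuous_quot_mk.comp continuous_sigmaMk⟩

/-- The union `𝒮` of the glued hypersurfaces inside the glued space. -/
def gluedSet : Set D.Glued := ⋃ e : D.E, (D.emb (D.j₁ e)) '' (D.S₁ e)

/-- The boundary of the glued space: what remains of the boundaries of the pieces after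
removing the glued hypersurfaces. -/
def gluedBdry : Set D.Glued := (⋃ j, (D.emb j) '' (D.bdry j)) \ D.gluedSet

lemma emb_mapsTo_bdry (j : Fin k) :
    Set.MapsTo (D.emb j) (D.bdry j) (D.gluedBdry ∪ D.gluedSet) := by
  intro y hy
  by_cases hx : D.emb j y ∈ D.gluedSet
  · exact Or.inr hx
  · exact Or.inl ⟨Set.mem_iUnion.2 ⟨j, ⟨y, hy, rfl⟩⟩, hx⟩

/-- A gluing is compatible if every gluing homeomorphism `f : S₁ → S₂` satisfies
`f_*(K₁) = K₂`, where `K_i` is the kernel of the map induced on fundamental groups by the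
inclusion `S_i → M_{j_i}`. -/
def Compatible : Prop :=
  ∀ (e : D.E) (s : ↥(D.S₁ e)),
    Subgroup.map (pi1Map ((D.glue e) : C(↥(D.S₁ e), ↥(D.S₂ e))) s)
      (MonoidHom.ker (pi1Map (subIncl (D.S₁ e)) s)) =
    MonoidHom.ker (pi1Map (subIncl (D.S₂ e)) ((D.glue e) s))

end GluingData

open LinearMap renaming sub_apply → lsub, add_apply → ladd, smul_apply → lsmul
open Path.Homotopic renaming Quotient → PQ
open Finset (univ mem_univ sum_congr mul_sum sum_le_sum sum_add_distrib sum_const card_univ smul_sum mem_filter)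
open Finsupp (single linearCombination supported lmapDomain single_mem_supported supported_eq_span_single smul_single_one)
open LinearMap (comp_apply id_apply)
open Set (range Icc mem_iUnion MapsTo compl_subset_compl singleton_subset_iff preimage_compl image_subset_range preimage_image_eq projIcc projIcc_of_le_left projIcc_of_right_le)
open ContinuousMap (const coe_mk sigmaMk)
open Topology (IsOpenEmbedding IsEmbedding)
open Metric (ball closedBall)
open Function (Injective Surjective Bijective)
open Submodule (mem_sup mem_bot span_le mem_sup_left mem_sup_right)

/-! ### Basic operations on singular chains -/

section Chains

variable {Y Z : Type} [TopologicalSpace Y] [TopologicalSpace Z] {R : Type} [CommRing R]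

/-- The chain given by a single simplex. -/
def sgl (R : Type) [CommRing R] {n : ℕ} (σ : SSimplex X n) : SChain R X n :=
  chainEquiv R X n (single σ 1)

/-- The linear extension of a function on simplices. -/
def clift {N : Type*} [AddCommGroup N] [Module R N] {n : ℕ} (f : SSimplex X n → N) :
    SChain R X n →ₗ[R] N :=
  (linearCombination R f).comp (chainEquiv R X n).symm.toLinearMap

@[simp] lemma clift_sgl {N : Type*} [AddCommGroup N] [Module R N] {n : ℕ} (f : SSimplex X n → N)
    (σ : SSimplex X n) : clift f (sgl R σ) = f σ := by
  simp [clift, sgl]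

lemma chain_hom_ext {N : Type*} [AddCommGroup N] [Module R N] {n : ℕ}
    {f g : SChain R X n →ₗ[R] N} (h : ∀ σ, f (sgl R σ) = g (sgl R σ)) : f = g := by
  have : f.comp (chainEquiv R X n).toLinearMap = g.comp (chainEquiv R X n).toLinearMap := by
    apply Finsupp.lhom_ext'
    intro σ
    ext
    simpa [sgl] using h σ
  ext c
  simpa using LinearMap.congr_fun this ((chainEquiv R X n).symm c)

lemma chain_ext {N : Type*} [AddCommGroup N] [Module R N] {n : ℕ} {L G : SChain R X n → N}
    (c : SChain R X n) (h : ∀ σ, L (sgl R σ) = G (sgl R σ))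
    (hL : IsLinearMap R L := by constructor <;> intros <;> simp [smul_sub, add_smul, mul_smul] <;> abel)
    (hG : IsLinearMap R G := by constructor <;> intros <;> simp [smul_sub, add_smul, mul_smul] <;> abel) : L c = G c :=
  LinearMap.congr_fun (chain_hom_ext (f := hL.mk' L) (g := hG.mk' G) h) c

/-- A chain is the combination of its simplices. -/
lemma chain_eq_sum {n : ℕ} (c : SChain R X n) :
    c = ∑ σ ∈ ((chainEquiv R X n).symm c).support, ((chainEquiv R X n).symm c) σ • sgl R σ := by
  conv_lhs => rw [← (chainEquiv R X n).apply_symm_apply c,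
    ← Finsupp.sum_single ((chainEquiv R X n).symm c)]
  simp only [Finsupp.sum, map_sum]
  refine sum_congr rfl fun σ _ => ?_
  rw [sgl, ← map_smul, smul_single_one]

@[simp] lemma bdry_sgl {n : ℕ} (σ : SSimplex X (n + 1)) :
    bdry R X n (sgl R σ) = ∑ i : Fin (n + 2), (-1 : R) ^ (i : ℕ) • sgl R (faceOf σ i) := by
  simp only [bdry, sgl, bdryChain, comp_apply, LinearEquiv.coe_coe,
    LinearEquiv.symm_apply_apply, Finsupp.linearCombination_single, one_smul, map_sum]
  refine sum_congr rfl fun i _ => ?_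
  rw [← map_smul, smul_single_one]

lemma mem_chainsIn_iff {Y : Set X} {n : ℕ} {c : SChain R X n} : c ∈ chainsIn R X Y n ↔
      ∀ σ ∈ ((chainEquiv R X n).symm c).support, range σ ⊆ Y := by
  simp only [chainsIn, Submodule.mem_map, Finsupp.mem_supported]
  constructor
  · rintro ⟨d, hd, rfl⟩ σ hσ
    exact hd (by simpa using hσ)
  · intro h
    exact ⟨(chainEquiv R X n).symm c, fun σ hσ => h σ hσ, by simp⟩

lemma sgl_mem_chainsIn {Y : Set X} {n : ℕ} {σ : SSimplex X n} (h : range σ ⊆ Y) :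
    sgl R σ ∈ chainsIn R X Y n :=
  Submodule.mem_map.2 ⟨_, single_mem_supported R _ h, rfl⟩

lemma chainsIn_eq_span {Y : Set X} {n : ℕ} :
    chainsIn R X Y n = Submodule.span R (sgl R '' {σ | range σ ⊆ Y}) := by
  apply le_antisymm
  · intro c hc
    rw [mem_chainsIn_iff] at hc
    rw [chain_eq_sum c]
    exact sum_mem fun σ hσ => Submodule.smul_mem _ _ (Submodule.subset_span ⟨σ, hc σ hσ, rfl⟩)
  · rw [span_le]
    rintro _ ⟨σ, hσ, rfl⟩
    exact sgl_mem_chainsIn hσ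

lemma map_mem_of_chainsIn {Y : Set X} {n : ℕ} {N : Type*} [AddCommGroup N] [Module R N]
    (f : SChain R X n →ₗ[R] N) (S : Submodule R N)
    (h : ∀ σ : SSimplex X n, range σ ⊆ Y → f (sgl R σ) ∈ S) {c : SChain R X n}
    (hc : c ∈ chainsIn R X Y n) : f c ∈ S := by
  have : chainsIn R X Y n ≤ S.comap f := by
    rw [chainsIn_eq_span, span_le]
    rintro _ ⟨σ, hσ, rfl⟩
    exact h σ hσ
  exact this hc

lemma chainsIn_mono {Y Y' : Set X} (h : Y ⊆ Y') (n : ℕ) :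
    chainsIn R X Y n ≤ chainsIn R X Y' n := fun c hc => by
  rw [mem_chainsIn_iff] at hc ⊢
  exact fun σ hσ => (hc σ hσ).trans h

lemma mem_chainsIn_inter {Y Y' : Set X} {n : ℕ} {c : SChain R X n}
    (h : c ∈ chainsIn R X Y n) (h' : c ∈ chainsIn R X Y' n) : c ∈ chainsIn R X (Y ∩ Y') n := by
  rw [mem_chainsIn_iff] at h h' ⊢
  exact fun σ hσ => Set.subset_inter (h σ hσ) (h' σ hσ)

lemma mem_chainsIn_univ {n : ℕ} (c : SChain R X n) : c ∈ chainsIn R X Set.univ n :=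
  mem_chainsIn_iff.2 fun _ _ => Set.subset_univ _

lemma range_faceOf_subset {n : ℕ} (σ : SSimplex X (n + 1)) (i : Fin (n + 2)) :
    range (faceOf σ i) ⊆ range σ := by
  rintro _ ⟨x, rfl⟩
  exact ⟨face i x, rfl⟩

lemma bdry_mem_chainsIn {Y : Set X} {n : ℕ} {c : SChain R X (n + 1)}
    (hc : c ∈ chainsIn R X Y (n + 1)) : bdry R X n c ∈ chainsIn R X Y n := by
  refine map_mem_of_chainsIn _ _ (fun σ hσ => ?_) hc
  rw [bdry_sgl]
  exact sum_mem fun i _ => Submodule.smul_mem _ _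
    (sgl_mem_chainsIn ((range_faceOf_subset σ i).trans hσ))

/-- The map on singular chains induced by a continuous map. -/
def push (R : Type) [CommRing R] (f : C(X, Y)) (n : ℕ) : SChain R X n →ₗ[R] SChain R Y n :=
  clift fun σ => sgl R (f.comp σ)

@[simp] lemma push_sgl (f : C(X, Y)) {n : ℕ} (σ : SSimplex X n) :
    push R f n (sgl R σ) = sgl R (f.comp σ) := by simp [push]

lemma push_bdry (f : C(X, Y)) {n : ℕ} (c : SChain R X (n + 1)) :
    bdry R Y n (push R f (n + 1) c) = push R f n (bdry R X n c) := by
  apply chain_ext c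
  intro σ
  simp only [push_sgl, bdry_sgl, map_sum, map_smul]
  rfl

lemma push_push (g : C(Y, Z)) (f : C(X, Y)) {n : ℕ} (c : SChain R X n) :
    push R g n (push R f n c) = push R (g.comp f) n c := by
  apply chain_ext c
  intro σ
  simp [ContinuousMap.comp_assoc]

lemma push_id {n : ℕ} (c : SChain R X n) : push R (ContinuousMap.id X) n c = c := by
  apply chain_ext c
  intro σ
  simp

lemma push_mem_chainsIn (f : C(X, Y)) {n : ℕ} {S : Set X} {T : Set Y} (h : MapsTo f S T)
    {c : SChain R X n} (hc : c ∈ chainsIn R X S n) : push R f n c ∈ chainsIn R Y T n := by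
  refine map_mem_of_chainsIn _ _ (fun σ hσ => ?_) hc
  rw [push_sgl]
  refine sgl_mem_chainsIn ?_
  rintro _ ⟨x, rfl⟩
  exact h (hσ ⟨x, rfl⟩)

lemma push_mem_chainsIn_range (f : C(X, Y)) {n : ℕ} (c : SChain R X n) :
    push R f n c ∈ chainsIn R Y (range f) n :=
  push_mem_chainsIn f (S := Set.univ) (fun x _ => Set.mem_range_self x) (mem_chainsIn_univ c)

end Chains

/-! ### The complex of tuples -/

section Tuples

variable {V W U : Type} {R : Type} [CommRing R]

/-- Formal combinations of `m`-tuples of points of `V`. -/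
abbrev TC (R : Type) [CommRing R] (V : Type) (m : ℕ) := (Fin m → V) →₀ R

/-- Prepending a vertex to tuples. -/
def tcons (v : V) {m : ℕ} : TC R V m →ₗ[R] TC R V (m + 1) :=
  lmapDomain R R fun l => (Fin.cons v l : Fin (m + 1) → V)

/-- The simplicial boundary on tuples. -/
def td {m : ℕ} : TC R V (m + 1) →ₗ[R] TC R V m := linearCombination R fun v =>
    ∑ i : Fin (m + 1), (-1 : R) ^ (i : ℕ) • single (fun j => v (i.succAbove j)) (1 : R)

/-- The map on tuples induced by a map of vertices. -/
def tmap (f : V → W) {m : ℕ} : TC R V m →ₗ[R] TC R W m := lmapDomain R R fun l => f ∘ l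

@[simp] lemma tcons_single (v : V) {m : ℕ} (l : Fin m → V) (r : R) :
    tcons v (single l r) = single (Fin.cons v l : Fin (m + 1) → V) r := by
  simp [tcons, Finsupp.lmapDomain_apply]

@[simp] lemma tmap_single (f : V → W) {m : ℕ} (l : Fin m → V) (r : R) :
    tmap f (single l r) = single (f ∘ l) r := by
  simp [tmap, Finsupp.lmapDomain_apply]

lemma td_single {m : ℕ} (v : Fin (m + 1) → V) :
    td (single v (1 : R)) = ∑ i : Fin (m + 1), (-1 : R) ^ (i : ℕ) •
      single (fun j => v (i.succAbove j)) (1 : R) := by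
  simp [td]

lemma tc_hom_ext {N : Type*} [AddCommGroup N] [Module R N] {m : ℕ} {f g : TC R V m →ₗ[R] N}
    (h : ∀ v, f (single v 1) = g (single v 1)) : f = g := by
  apply Finsupp.lhom_ext'
  intro v
  ext
  simpa using h v

lemma tc_ext {N : Type*} [AddCommGroup N] [Module R N] {m : ℕ} {L G : TC R V m → N} (c : TC R V m)
    (h : ∀ v, L (single v 1) = G (single v 1))
    (hL : IsLinearMap R L := by constructor <;> intros <;> simp [smul_sub, add_smul, mul_smul] <;> abel)
    (hG : IsLinearMap R G := by constructor <;> intros <;> simp [smul_sub, add_smul, mul_smul] <;> abel) : L c = G c :=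
  LinearMap.congr_fun (tc_hom_ext (f := hL.mk' L) (g := hG.mk' G) h) c

lemma tc_ext_cons {N : Type*} [AddCommGroup N] [Module R N] {m : ℕ} {L G : TC R V (m + 1) → N}
    (c : TC R V (m + 1)) (h : ∀ v c, L (tcons v c) = G (tcons v c))
    (hL : IsLinearMap R L := by constructor <;> intros <;> simp [smul_sub, add_smul, mul_smul] <;> abel)
    (hG : IsLinearMap R G := by constructor <;> intros <;> simp [smul_sub, add_smul, mul_smul] <;> abel) : L c = G c :=
  tc_ext c (fun v => by simpa using h (v 0) (single (Fin.tail v) 1)) hL hG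

lemma td_tcons_zero (v : V) (c : TC R V 0) : td (tcons v c) = c := by
  apply tc_ext c
  intro l
  simp only [tcons_single, td_single]
  simp only [Nat.reduceAdd, Finset.univ_unique, Finset.sum_singleton, Fin.default_eq_zero,
    Fin.val_eq_zero, pow_zero, one_smul]
  congr 1

lemma td_tcons (v : V) {m : ℕ} (c : TC R V (m + 1)) : td (tcons v c) = c - tcons v (td c) := by
  apply tc_ext c
  intro l
  simp only [tcons_single, td_single, map_sum, map_smul]
  rw [Fin.sum_univ_succ, sub_eq_add_neg, ← Finset.sum_neg_distrib]
  congr 1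
  · simp
  · refine sum_congr rfl fun i _ => ?_
    rw [Fin.val_succ, pow_succ, mul_neg, mul_one, neg_smul]
    congr 3
    ext j
    refine Fin.cases ?_ (fun j => ?_) j
    · simp
    · simp

lemma td_td {m : ℕ} (c : TC R V (m + 2)) : td (td c) = 0 := by
  induction m with
  | zero =>
    apply tc_ext_cons c
    intro v c
    simp [td_tcons, td_tcons_zero]
  | succ m ih =>
    apply tc_ext_cons c
    intro v c
    simp [td_tcons, ih]

lemma tmap_tcons (f : V → W) (v : V) {m : ℕ} (c : TC R V m) :
    tmap f (tcons v c) = tcons (f v) (tmap f c) := by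
  apply tc_ext c
  intro l
  simp only [tcons_single, tmap_single]
  congr 1
  ext j
  refine Fin.cases ?_ (fun j => ?_) j <;> simp

lemma td_tmap (f : V → W) {m : ℕ} (c : TC R V (m + 1)) : td (tmap f c) = tmap f (td c) := by
  apply tc_ext c
  intro l
  simp only [tmap_single, td_single, map_sum, map_smul]
  rfl

lemma tmap_tmap (g : W → U) (f : V → W) {m : ℕ} (c : TC R V m) :
    tmap g (tmap f c) = tmap (g ∘ f) c := by
  apply tc_ext c
  intro l
  simp [Function.comp_assoc]

/-- The prism on a tuple: the combination of the tuples `(f v₀, …, f vᵢ, g vᵢ, …)`. -/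
def tprismAux (R : Type) [CommRing R] (f g : V → W) : (m : ℕ) → (Fin m → V) → TC R W (m + 1)
  | 0, _ => 0
  | m + 1, v => single (Fin.cons (f (v 0)) (g ∘ v) : Fin (m + 2) → W) 1 -
      tcons (f (v 0)) (tprismAux R f g m (Fin.tail v))

/-- The prism operator on tuples. -/
def tprism (f g : V → W) {m : ℕ} : TC R V m →ₗ[R] TC R W (m + 1) :=
  linearCombination R (tprismAux R f g m)

lemma tprism_tcons (f g : V → W) (v : V) {m : ℕ} (c : TC R V m) :
    tprism f g (tcons v c) = tcons (f v) (tcons (g v) (tmap g c)) - tcons (f v) (tprism f g c) := by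
  apply tc_ext c
  intro l
  simp only [tcons_single, tmap_single, tprism,
    Finsupp.linearCombination_single, one_smul, tprismAux, Fin.cons_zero, Fin.tail_cons]
  congr 3
  ext j
  refine Fin.cases ?_ (fun j => ?_) j <;> simp

lemma tprism_zero (f g : V → W) (c : TC R V 0) : tprism f g c = 0 := by
  apply tc_ext c
  intro l
  simp [tprism, tprismAux]

lemma td_tprism (f g : V → W) {m : ℕ} (c : TC R V (m + 1)) :
    td (tprism f g c) = tmap g c - tmap f c - tprism f g (td c) := by
  induction m with
  | zero =>
    apply tc_ext_cons c
    intro v c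
    have h0 : tmap g c = tmap f c := by
      apply tc_ext c
      intro l
      simp only [tmap_single]
      congr 1
      ext j
      exact j.elim0
    simp [tprism_tcons, td_tcons, td_tcons_zero, tprism_zero, tmap_tcons, h0]
  | succ m ih =>
    apply tc_ext_cons c
    intro v c
    simp only [tprism_tcons, map_sub, td_tcons, ih, tmap_tcons, td_tmap]
    abel

end Tuples

/-! ### Affine simplices -/

section Affine

variable {E E' : Type} [AddCommGroup E] [Module ℝ E] [TopologicalSpace E]
  [IsTopologicalAddGroup E] [ContinuousSMul ℝ E]
  [AddCommGroup E'] [Module ℝ E'] [TopologicalSpace E']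
  [IsTopologicalAddGroup E'] [ContinuousSMul ℝ E']
  {R : Type} [CommRing R]

/-- The affine simplex in a convex set with the given vertices. -/
def aff {K : Set E} (hK : Convex ℝ K) {m : ℕ} (v : Fin (m + 1) → K) : C(Δ m, K) where
  toFun x := ⟨∑ i, x.1 i • (v i : E), hK.sum_mem (fun i _ => x.2.1 i) x.2.2 fun i _ => (v i).2⟩
  continuous_toFun := by
    refine Continuous.subtype_mk ?_ _
    exact continuous_finsetSum _ fun i _ =>
      ((continuous_apply i).comp continuous_subtype_val).smul continuous_const

lemma faceOf_aff {K : Set E} (hK : Convex ℝ K) {m : ℕ} (v : Fin (m + 2) → K) (i : Fin (m + 2)) :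
    faceOf (aff hK v) i = aff hK fun j => v (i.succAbove j) := by
  ext x
  simp only [faceOf, aff, face, ContinuousMap.comp_apply, coe_mk]
  rw [Fin.sum_univ_succAbove _ i]
  simp

/-- The realization of combinations of tuples of points in a convex set. -/
def real (R : Type) [CommRing R] {K : Set E} (hK : Convex ℝ K) {m : ℕ} :
    TC R K (m + 1) →ₗ[R] SChain R K m :=
  linearCombination R fun v => sgl R (aff hK v)

@[simp] lemma real_single {K : Set E} (hK : Convex ℝ K) {m : ℕ} (v : Fin (m + 1) → K) :
    real R hK (single v 1) = sgl R (aff hK v) := by simp [real]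

lemma bdry_real {K : Set E} (hK : Convex ℝ K) {m : ℕ} (c : TC R K (m + 2)) :
    bdry R K m (real R hK c) = real R hK (td c) := by
  apply tc_ext c
  intro v
  simp only [real_single, bdry_sgl, td_single, faceOf_aff, map_sum, map_smul]

/-- A map between convex sets is affine if it commutes with convex combinations. -/
def IsAff {K : Set E} {K' : Set E'} (φ : K → K') : Prop :=
  ∀ (m : ℕ) (v : Fin (m + 1) → K) (x : Δ m) (y : K), (y : E) = ∑ i, x.1 i • (v i : E) →
    (φ y : E') = ∑ i, x.1 i • (φ (v i) : E')

lemma comp_aff {K : Set E} {K' : Set E'} (hK : Convex ℝ K) (hK' : Convex ℝ K') (φ : C(K, K'))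
    (hφ : IsAff φ) {m : ℕ} (v : Fin (m + 1) → K) : φ.comp (aff hK v) = aff hK' (φ ∘ v) := by
  ext x
  exact hφ m v x _ rfl

lemma push_real {K : Set E} {K' : Set E'} (hK : Convex ℝ K) (hK' : Convex ℝ K') (φ : C(K, K'))
    (hφ : IsAff φ) {m : ℕ} (c : TC R K (m + 1)) :
    push R φ m (real R hK c) = real R hK' (tmap φ c) := by
  apply tc_ext c
  intro v
  simp [comp_aff hK hK' φ hφ]

lemma convex_simplex (m : ℕ) : Convex ℝ (Δ m) := convex_stdSimplex ℝ _

/-- The vertices of the standard simplex. -/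
def vtx (m : ℕ) (i : Fin (m + 1)) : Δ m := ⟨Pi.single i 1, single_mem_stdSimplex ℝ i⟩

lemma aff_vtx (m : ℕ) : aff (convex_simplex m) (vtx m) = ContinuousMap.id _ := by
  refine ContinuousMap.ext fun x => Subtype.ext (funext fun j => ?_)
  simp [aff, vtx, Finset.sum_apply, Pi.single_apply]

lemma face_vtx {m : ℕ} (i : Fin (m + 2)) (j : Fin (m + 1)) :
    face i (vtx m j) = vtx (m + 1) (i.succAbove j) := by
  refine Subtype.ext (funext fun l => ?_)
  refine Fin.succAboveCases i ?_ (fun l => ?_) l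
  · simp [face, vtx, Fin.ne_succAbove]
  · simp [face, vtx, Pi.single_apply]

lemma isAff_face {m : ℕ} (i : Fin (m + 2)) : IsAff (face i : Δ m → Δ (m + 1)) := by
  intro k v x y hy
  ext l
  refine Fin.succAboveCases i ?_ (fun l => ?_) l
  · simp [face]
  · simp [face, hy]

lemma isAff_aff {K : Set E} (hK : Convex ℝ K) {m : ℕ} (w : Fin (m + 1) → K) :
    IsAff (aff hK w : Δ m → K) := by
  intro k v x y hy
  simp only [aff, coe_mk, hy, Finset.sum_apply, Pi.smul_apply, smul_eq_mul,
    Finset.sum_smul, smul_sum, mul_smul]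
  exact Finset.sum_comm

lemma sgl_eq_push {m : ℕ} (σ : SSimplex X m) :
    sgl R σ = push R σ m (real R (convex_simplex m) (single (vtx m) 1)) := by
  simp [aff_vtx]

/-- Operators on singular chains defined by their values on the standard simplices. -/
def op {e : ℕ} (u : ∀ m, TC R (Δ m) (m + e + 1)) {m : ℕ} : SChain R X m →ₗ[R] SChain R X (m + e) :=
  clift fun σ => push R σ (m + e) (real R (convex_simplex m) (u m))

@[simp] lemma op_sgl {e : ℕ} (u : ∀ m, TC R (Δ m) (m + e + 1)) {m : ℕ} (σ : SSimplex X m) :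
    op u (sgl R σ) = push R σ (m + e) (real R (convex_simplex m) (u m)) := by simp [op]

lemma op_push {Y : Type} [TopologicalSpace Y] {e : ℕ} (u : ∀ m, TC R (Δ m) (m + e + 1)) {m : ℕ}
    (f : C(X, Y)) (c : SChain R X m) : op u (push R f m c) = push R f (m + e) (op u c) := by
  apply chain_ext c
  intro σ
  simp [push_push]

lemma op_mem_chainsIn {e : ℕ} (u : ∀ m, TC R (Δ m) (m + e + 1)) {m : ℕ} {Y : Set X}
    {c : SChain R X m} (hc : c ∈ chainsIn R X Y m) : op u c ∈ chainsIn R X Y (m + e) := by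
  refine map_mem_of_chainsIn _ _ (fun σ hσ => ?_) hc
  rw [op_sgl]
  exact chainsIn_mono hσ _ (push_mem_chainsIn_range σ _)

lemma bdry_bdry {m : ℕ} (c : SChain R X (m + 2)) : bdry R X m (bdry R X (m + 1) c) = 0 := by
  apply chain_ext c
  intro σ
  rw [sgl_eq_push, push_bdry, push_bdry, bdry_real, bdry_real, td_td]
  simp

end Affine

/-! ### The prism of a homotopy of simplices -/

/-- The unit interval. -/
abbrev I01 : Set ℝ := unitInterval

section Prism

variable {R : Type} [CommRing R]

/-- The prism over the standard simplex as a convex set. -/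
abbrev Pr (m : ℕ) : Set ((Fin (m + 1) → ℝ) × ℝ) := Δ m ×ˢ Icc (0 : ℝ) 1

lemma convex_Pr (m : ℕ) : Convex ℝ (Pr m) := (convex_simplex m).prod (convex_Icc 0 1)

/-- The identification of the prism with a product. -/
def prMap (m : ℕ) : C(Pr m, Δ m × I01) where
  toFun z := (⟨z.1.1, z.2.1⟩, ⟨z.1.2, z.2.2⟩)
  continuous_toFun := by fun_prop

/-- The inclusion of a slice of the prism. -/
def prSlice (m : ℕ) (t : I01) : C(Δ m, Pr m) where
  toFun x := ⟨(x.1, t.1), x.2, t.2⟩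
  continuous_toFun := by fun_prop

/-- The map of prisms induced by a face inclusion. -/
def prFace {m : ℕ} (i : Fin (m + 2)) : C(Pr m, Pr (m + 1)) where
  toFun z := ⟨((face i ⟨z.1.1, z.2.1⟩).1, z.1.2), (face i ⟨z.1.1, z.2.1⟩).2, z.2.2⟩
  continuous_toFun := by fun_prop

lemma isAff_prFace {m : ℕ} (i : Fin (m + 2)) : IsAff (prFace i : Pr m → Pr (m + 1)) := by
  intro k v x y hy
  have h1 := congrArg Prod.fst hy
  have h2 := congrArg Prod.snd hy
  simp only [Prod.fst_sum, Prod.smul_fst, Prod.snd_sum, Prod.smul_snd] at h1 h2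
  refine Prod.ext ?_ ?_
  · simp only [Prod.fst_sum, Prod.smul_fst, prFace, coe_mk]
    exact isAff_face i k (fun j => ⟨(v j).1.1, (v j).2.1⟩) x ⟨y.1.1, y.2.1⟩ h1
  · simpa [prFace, Prod.snd_sum] using h2

lemma isAff_prSlice (m : ℕ) (t : I01) : IsAff (prSlice m t : Δ m → Pr m) := by
  intro k v x y hy
  refine Prod.ext ?_ ?_
  · simpa [prSlice, Prod.fst_sum] using hy
  · simp [prSlice, Prod.snd_sum, ← Finset.sum_mul, x.2.2]

/-- The prism chain of a homotopy of singular simplices. -/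
def prism (R : Type) [CommRing R] {m : ℕ} (H : C(Δ m × I01, X)) : SChain R X (m + 1) :=
  push R (H.comp (prMap m)) (m + 1) (real R (convex_Pr m)
    (tprism (prSlice m 0) (prSlice m 1) (single (vtx m) 1)))

/-- A homotopy of simplices at a fixed time. -/
def slice {m : ℕ} (H : C(Δ m × I01, X)) (t : I01) : SSimplex X m :=
  H.comp ((ContinuousMap.id _).prodMk (const _ t))

/-- The restriction of a homotopy of simplices to a face. -/
def faceH {m : ℕ} (H : C(Δ (m + 1) × I01, X)) (i : Fin (m + 2)) : C(Δ m × I01, X) :=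
  H.comp ((face i).prodMap (ContinuousMap.id I01))

@[simp] lemma faceH_apply {m : ℕ} (H : C(Δ (m + 1) × I01, X)) (i : Fin (m + 2)) (x : Δ m) (t : I01) :
    faceH H i (x, t) = H (face i x, t) := rfl

lemma push_slice {m : ℕ} (H : C(Δ m × I01, X)) (t : I01) :
    push R (H.comp (prMap m)) m (real R (convex_Pr m)
      (tmap (prSlice m t) (single (vtx m) 1))) = sgl R (slice H t) := by
  rw [← push_real (convex_simplex m) (convex_Pr m) _ (isAff_prSlice m t), push_push, real_single,
    aff_vtx, push_sgl]
  rfl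

lemma tprism_tmap {V W V' W' R : Type} [CommRing R] (f g : V → W) (f' g' : V' → W') (φ : V' → V)
    (ψ : W' → W) (hf : ∀ v, f (φ v) = ψ (f' v)) (hg : ∀ v, g (φ v) = ψ (g' v)) {m : ℕ}
    (c : TC R V' m) : tprism f g (tmap φ c) = tmap ψ (tprism f' g' c) := by
  induction m with
  | zero => simp [tprism_zero]
  | succ m ih =>
    apply tc_ext_cons c
    intro v c
    simp only [tmap_tcons, tprism_tcons, map_sub, hf, hg, tmap_tmap, ih]
    congr 5
    ext v
    simp [hg]

lemma td_vtx (m : ℕ) : td (single (vtx (m + 1)) (1 : R)) =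
    ∑ i : Fin (m + 2), (-1 : R) ^ (i : ℕ) • tmap (face i) (single (vtx m) 1) := by
  rw [td_single]
  refine sum_congr rfl fun i _ => ?_
  rw [tmap_single]
  congr 2
  ext j : 1
  exact (face_vtx i j).symm

lemma bdry_prism {m : ℕ} (H : C(Δ (m + 1) × I01, X)) :
    bdry R X (m + 1) (prism R H) = sgl R (slice H 1) - sgl R (slice H 0) -
      ∑ i : Fin (m + 2), (-1 : R) ^ (i : ℕ) • prism R (faceH H i) := by
  rw [prism, push_bdry, bdry_real, td_tprism, map_sub, map_sub, map_sub, map_sub, push_slice,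
    push_slice, td_vtx]
  congr 1
  simp only [map_sum, map_smul]
  refine sum_congr rfl fun i _ => ?_
  congr 1
  rw [tprism_tmap (prSlice (m + 1) 0) (prSlice (m + 1) 1) (prSlice m 0) (prSlice m 1) (face i)
    (prFace i) (fun v => rfl) (fun v => rfl),
    ← push_real (convex_Pr m) (convex_Pr (m + 1)) _ (isAff_prFace i), push_push]
  rfl

lemma prism_mem_chainsIn {m : ℕ} (H : C(Δ m × I01, X)) {Y : Set X} (h : range H ⊆ Y) :
    prism R H ∈ chainsIn R X Y (m + 1) := by
  refine chainsIn_mono (le_trans ?_ h) _ (push_mem_chainsIn_range _ _)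
  rintro _ ⟨x, rfl⟩
  exact ⟨_, rfl⟩

/-- The prism operator of a homotopy. -/
def hprism (R : Type) [CommRing R] {Y : Type} [TopologicalSpace Y] (H : C(X × I01, Y)) (m : ℕ) :
    SChain R X m →ₗ[R] SChain R Y (m + 1) :=
  clift fun σ => prism R (H.comp (σ.prodMap (ContinuousMap.id I01)))

lemma bdry_hprism {Y : Type} [TopologicalSpace Y] (H : C(X × I01, Y)) (f g : C(X, Y))
    (hf : ∀ x, H (x, 0) = f x) (hg : ∀ x, H (x, 1) = g x) {m : ℕ} (c : SChain R X (m + 1)) :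
    bdry R Y (m + 1) (hprism R H (m + 1) c) =
      push R g (m + 1) c - push R f (m + 1) c - hprism R H m (bdry R X m c) := by
  apply chain_ext c
  intro σ
  simp only [hprism, clift_sgl, bdry_prism, push_sgl, bdry_sgl, map_sum, map_smul]
  congr 3 <;> ext x
  exacts [hg _, hf _]

lemma hprism_mem_chainsIn {Y : Type} [TopologicalSpace Y] (H : C(X × I01, Y)) {m : ℕ} {S : Set X}
    {T : Set Y} (h : ∀ x ∈ S, ∀ t, H (x, t) ∈ T) {c : SChain R X m}
    (hc : c ∈ chainsIn R X S m) : hprism R H m c ∈ chainsIn R Y T (m + 1) := by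
  refine map_mem_of_chainsIn _ _ (fun σ hσ => ?_) hc
  rw [hprism, clift_sgl]
  refine prism_mem_chainsIn _ ?_
  rintro _ ⟨⟨x, t⟩, rfl⟩
  exact h _ (hσ ⟨x, rfl⟩) t

end Prism

/-! ### Barycentric subdivision -/

section Subdivision

variable {E E' : Type} [AddCommGroup E] [Module ℝ E] [TopologicalSpace E]
  [IsTopologicalAddGroup E] [ContinuousSMul ℝ E]
  [AddCommGroup E'] [Module ℝ E'] [TopologicalSpace E']
  [IsTopologicalAddGroup E'] [ContinuousSMul ℝ E']
  {R : Type} [CommRing R]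

/-- The barycenter of the standard simplex. -/
def centre (m : ℕ) : Δ m := ⟨fun _ => ((m : ℝ) + 1)⁻¹, fun _ => by positivity, by
    simp only [sum_const, card_univ, Fintype.card_fin, nsmul_eq_mul, Nat.cast_add, Nat.cast_one]
    field_simp⟩

/-- The barycentric subdivision of tuples in a convex set. -/
def tsd {K : Set E} (hK : Convex ℝ K) : (m : ℕ) → TC R K m →ₗ[R] TC R K m
  | 0 => LinearMap.id
  | m + 1 => linearCombination R fun v => tcons (aff hK v (centre m)) (tsd hK m (td (single v 1)))

/-- The homotopy between the identity and the barycentric subdivision. -/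
def tsdH {K : Set E} (hK : Convex ℝ K) : (m : ℕ) → TC R K m →ₗ[R] TC R K (m + 1)
  | 0 => 0
  | m + 1 => linearCombination R fun v =>
      tcons (aff hK v (centre m)) (single v 1 - tsdH hK m (td (single v 1)))

lemma tsd_succ_single {K : Set E} (hK : Convex ℝ K) {m : ℕ} (v : Fin (m + 1) → K) :
    tsd (R := R) hK (m + 1) (single v 1) =
      tcons (aff hK v (centre m)) (tsd hK m (td (single v 1))) := by
  simp [tsd]

lemma tsdH_succ_single {K : Set E} (hK : Convex ℝ K) {m : ℕ} (v : Fin (m + 1) → K) :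
    tsdH (R := R) hK (m + 1) (single v 1) = tcons (aff hK v (centre m))
      (single v 1 - tsdH hK m (td (single v 1))) := by
  simp [tsdH]

lemma td_tsd {K : Set E} (hK : Convex ℝ K) {m : ℕ} (c : TC R K (m + 1)) :
    td (tsd hK (m + 1) c) = tsd hK m (td c) := by
  induction m with
  | zero =>
    apply tc_ext c
    intro v
    rw [tsd_succ_single, td_tcons_zero]
  | succ m ih =>
    apply tc_ext c
    intro v
    rw [tsd_succ_single, td_tcons, ih, td_td]
    simp

lemma td_tsdH {K : Set E} (hK : Convex ℝ K) {m : ℕ} (c : TC R K (m + 1)) :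
    td (tsdH hK (m + 1) c) = c - tsd hK (m + 1) c - tsdH hK m (td c) := by
  induction m with
  | zero =>
    apply tc_ext c
    intro v
    rw [tsdH_succ_single, td_tcons, tsd_succ_single]
    simp [tsdH, tsd]
  | succ m ih =>
    apply tc_ext c
    intro v
    rw [tsdH_succ_single, td_tcons, tsd_succ_single, map_sub, ih, td_td]
    simp only [map_zero, sub_zero, map_sub]
    abel

lemma tmap_tsd {K : Set E} {K' : Set E'} (hK : Convex ℝ K) (hK' : Convex ℝ K') (φ : K → K')
    (hφ : IsAff φ) {m : ℕ} (c : TC R K m) : tmap φ (tsd hK m c) = tsd hK' m (tmap φ c) := by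
  induction m with
  | zero => rfl
  | succ m ih =>
    apply tc_ext c
    intro v
    simp only [tmap_single, tsd_succ_single, tmap_tcons, ih, ← td_tmap]
    rw [show φ (aff hK v (centre m)) = aff hK' (φ ∘ v) (centre m) from
      Subtype.ext (hφ m v (centre m) _ rfl)]

lemma tmap_tsdH {K : Set E} {K' : Set E'} (hK : Convex ℝ K) (hK' : Convex ℝ K') (φ : K → K')
    (hφ : IsAff φ) {m : ℕ} (c : TC R K m) : tmap φ (tsdH hK m c) = tsdH hK' m (tmap φ c) := by
  induction m with
  | zero => simp [tsdH]
  | succ m ih =>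
    apply tc_ext c
    intro v
    simp only [tmap_single, tsdH_succ_single, tmap_tcons, map_sub, ih, ← td_tmap]
    rw [show φ (aff hK v (centre m)) = aff hK' (φ ∘ v) (centre m) from
      Subtype.ext (hφ m v (centre m) _ rfl)]

/-- Barycentric subdivision of singular chains. -/
def sd (R : Type) [CommRing R] {X : Type} [TopologicalSpace X] (m : ℕ) :
    SChain R X m →ₗ[R] SChain R X m :=
  op (e := 0) fun m => tsd (convex_simplex m) (m + 1) (single (vtx m) 1)

/-- The homotopy between the identity and barycentric subdivision of singular chains. -/
def sdH (R : Type) [CommRing R] {X : Type} [TopologicalSpace X] (m : ℕ) :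
    SChain R X m →ₗ[R] SChain R X (m + 1) :=
  op (e := 1) fun m => tsdH (convex_simplex m) (m + 1) (single (vtx m) 1)

lemma sd_sgl {m : ℕ} (σ : SSimplex X m) : sd R m (sgl R σ) = push R σ m
    (real R (convex_simplex m) (tsd (convex_simplex m) (m + 1) (single (vtx m) 1))) :=
  op_sgl (e := 0) _ σ

lemma bdry_sd {m : ℕ} (c : SChain R X (m + 1)) :
    bdry R X m (sd R (m + 1) c) = sd R m (bdry R X m c) := by
  apply chain_ext c
  intro σ
  simp only [sd_sgl, bdry_sgl, map_sum, map_smul]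
  rw [push_bdry, bdry_real, td_tsd, td_vtx]
  simp only [map_sum, map_smul]
  refine sum_congr rfl fun i _ => ?_
  rw [← tmap_tsd (convex_simplex m) (convex_simplex (m + 1)) _ (isAff_face i),
    ← push_real (convex_simplex m) (convex_simplex (m + 1)) _ (isAff_face i), push_push]
  rfl

lemma bdry_sdH {m : ℕ} (c : SChain R X (m + 1)) :
    bdry R X (m + 1) (sdH R (m + 1) c) = c - sd R (m + 1) c - sdH R m (bdry R X m c) := by
  apply chain_ext c
  intro σ
  simp only [sd_sgl, sdH, op_sgl, bdry_sgl, map_sum, map_smul]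
  rw [push_bdry, bdry_real, td_tsdH, td_vtx, map_sub, map_sub, map_sub, map_sub, real_single,
    aff_vtx, push_sgl]
  simp only [map_sum, map_smul]
  congr 1
  refine sum_congr rfl fun i _ => ?_
  rw [← tmap_tsdH (convex_simplex m) (convex_simplex (m + 1)) _ (isAff_face i),
    ← push_real (convex_simplex m) (convex_simplex (m + 1)) _ (isAff_face i), push_push]
  rfl

lemma sd_mem_chainsIn {m : ℕ} {Y : Set X} {c : SChain R X m} (hc : c ∈ chainsIn R X Y m) :
    sd R m c ∈ chainsIn R X Y m := op_mem_chainsIn (e := 0) _ hc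

lemma sdH_mem_chainsIn {m : ℕ} {Y : Set X} {c : SChain R X m} (hc : c ∈ chainsIn R X Y m) :
    sdH R m c ∈ chainsIn R X Y (m + 1) := op_mem_chainsIn _ hc

/-- The homotopy between the identity and iterated barycentric subdivision. -/
def sdHIter (R : Type) [CommRing R] {X : Type} [TopologicalSpace X] (N m : ℕ) :
    SChain R X m →ₗ[R] SChain R X (m + 1) :=
  ∑ i ∈ Finset.range N, (sdH R m).comp ((sd R m) ^ i)

lemma bdry_sd_pow (N : ℕ) {m : ℕ} (c : SChain R X (m + 1)) :
    bdry R X m (((sd R (m + 1)) ^ N) c) = ((sd R m) ^ N) (bdry R X m c) := by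
  induction N with
  | zero => simp
  | succ N ih => rw [pow_succ', pow_succ', Module.End.mul_apply, Module.End.mul_apply, bdry_sd, ih]

lemma bdry_sdHIter (N : ℕ) {m : ℕ} (c : SChain R X (m + 1)) :
    bdry R X (m + 1) (sdHIter R N (m + 1) c) =
      c - ((sd R (m + 1)) ^ N) c - sdHIter R N m (bdry R X m c) := by
  induction N with
  | zero => simp [sdHIter]
  | succ N ih =>
    simp only [sdHIter, Finset.sum_range_succ, ladd, map_add, comp_apply] at ih ⊢
    rw [ih, bdry_sdH, bdry_sd_pow, pow_succ', Module.End.mul_apply]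
    abel

lemma sd_pow_mem_chainsIn (N : ℕ) {m : ℕ} {Y : Set X} {c : SChain R X m}
    (hc : c ∈ chainsIn R X Y m) : ((sd R m) ^ N) c ∈ chainsIn R X Y m := by
  induction N with
  | zero => simpa
  | succ N ih => rw [pow_succ', Module.End.mul_apply]; exact sd_mem_chainsIn ih

lemma sdHIter_mem_chainsIn (N : ℕ) {m : ℕ} {Y : Set X} {c : SChain R X m}
    (hc : c ∈ chainsIn R X Y m) : sdHIter R N m c ∈ chainsIn R X Y (m + 1) := by
  rw [sdHIter, LinearMap.sum_apply]
  exact sum_mem fun i _ => sdH_mem_chainsIn (sd_pow_mem_chainsIn i hc)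

lemma sd_real {K : Set E} (hK : Convex ℝ K) {m : ℕ} (c : TC R K (m + 1)) :
    sd R m (real R hK c) = real R hK (tsd hK (m + 1) c) := by
  apply tc_ext c
  intro v
  simp only [real_single, sd_sgl]
  rw [push_real (convex_simplex m) hK _ (isAff_aff hK v),
    tmap_tsd (convex_simplex m) hK _ (isAff_aff hK v), tmap_single]
  congr 3
  ext j
  simp [aff, vtx, Pi.single_apply]

lemma sd_push {Y : Type} [TopologicalSpace Y] (f : C(X, Y)) {m : ℕ} (c : SChain R X m) :
    sd R m (push R f m c) = push R f m (sd R m c) := op_push (e := 0) _ f c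

lemma sd_pow_sgl (N : ℕ) {m : ℕ} (σ : SSimplex X m) : ((sd R m) ^ N) (sgl R σ) =
    push R σ m (real R (convex_simplex m)
      (((tsd (convex_simplex m) (m + 1)) ^ N) (single (vtx m) 1))) := by
  induction N with
  | zero => simp [aff_vtx]
  | succ N ih => rw [pow_succ', pow_succ', Module.End.mul_apply, Module.End.mul_apply, ih, sd_push,
      sd_real]

end Subdivision

/-! ### Smallness of subdivisions -/

section Mesh

variable {E : Type} [NormedAddCommGroup E] [NormedSpace ℝ E] {R : Type} [CommRing R]

/-- Tuples contained in the convex hull of `v` with diameter at most `d`. -/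
def hullMesh {K : Set E} {l : ℕ} (v : Fin l → K) (d : ℝ) (m : ℕ) : Set (Fin m → K) :=
  {w | (∀ i, (w i : E) ∈ convexHull ℝ (range fun j => (v j : E))) ∧ ∀ i j, dist (w i : E) (w j) ≤ d}

lemma dist_centre_le {K : Set E} (hK : Convex ℝ K) {m : ℕ} (v : Fin (m + 1) → K) {d : ℝ}
    (hv : ∀ i j, dist (v i : E) (v j) ≤ d) (j : Fin (m + 1)) :
    dist (v j : E) (aff hK v (centre m)) ≤ (m / (m + 1)) * d := by
  have hpos : (0 : ℝ) < m + 1 := by positivity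
  have h1 : (v j : E) - (aff hK v (centre m) : E) =
      ((m : ℝ) + 1)⁻¹ • ∑ i, ((v j : E) - (v i : E)) := by
    simp only [aff, centre, coe_mk, Finset.sum_sub_distrib, sum_const,
      card_univ, Fintype.card_fin, ← smul_sum, smul_sub]
    congr 1
    rw [← Nat.cast_smul_eq_nsmul ℝ, smul_smul]
    push_cast
    rw [inv_mul_cancel₀ hpos.ne', one_smul]
  rw [dist_eq_norm, h1, norm_smul, norm_inv, Real.norm_of_nonneg hpos.le, div_mul_eq_mul_div,
    div_eq_inv_mul]
  refine mul_le_mul_of_nonneg_left ?_ (by positivity)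
  rw [Fin.sum_univ_succAbove _ j, sub_self, zero_add]
  refine (norm_sum_le _ _).trans ?_
  refine (sum_le_sum fun i _ => ?_).trans (by simp : ∑ _i : Fin m, d ≤ m * d)
  rw [← dist_eq_norm]
  exact hv _ _

lemma tsd_mem_supported {K : Set E} (hK : Convex ℝ K) {m : ℕ} (v : Fin m → K) {d : ℝ} (hd : 0 ≤ d)
    (hv : ∀ i j, dist (v i : E) (v j) ≤ d) :
    tsd hK m (single v 1) ∈ supported R R (hullMesh v (((m : ℝ) - 1) / m * d) m) := by
  induction m with
  | zero => exact single_mem_supported _ _ ⟨fun i => i.elim0, fun i => i.elim0⟩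
  | succ m ih =>
    rw [tsd_succ_single, td_single, map_sum, map_sum]
    refine sum_mem fun i _ => ?_
    rw [map_smul, map_smul]
    refine Submodule.smul_mem _ _ ?_
    have h := ih (fun j => v (i.succAbove j)) (fun a b => hv _ _)
    have hle : supported R R (hullMesh (fun j => v (i.succAbove j))
        (((m : ℝ) - 1) / m * d) m) ≤ (supported R R
        (hullMesh v ((((m + 1 : ℕ) : ℝ) - 1) / ((m + 1 : ℕ) : ℝ) * d) (m + 1))).comap
        (tcons (aff hK v (centre m))) := by
      rw [supported_eq_span_single, span_le]
      rintro _ ⟨w, hw, rfl⟩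
      simp only [Submodule.comap_coe, Set.mem_preimage, SetLike.mem_coe, tcons_single]
      refine single_mem_supported _ _ ?_
      have hc : ((m : ℝ) - 1) / m ≤ (m : ℝ) / (m + 1) := by
        rcases Nat.eq_zero_or_pos m with rfl | hm
        · simp
        · have : (0 : ℝ) < m := by exact_mod_cast hm
          rw [div_le_div_iff₀ this (by positivity)]
          nlinarith
      have hhull : convexHull ℝ (range fun j => (v (i.succAbove j) : E)) ⊆
          convexHull ℝ (range fun j => (v j : E)) := by
        refine convexHull_mono ?_
        rintro _ ⟨j, rfl⟩
        exact ⟨_, rfl⟩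
      have hball : convexHull ℝ (range fun j => (v j : E)) ⊆
          closedBall (aff hK v (centre m) : E) (m / (m + 1) * d) := by
        refine convexHull_min ?_ (convex_closedBall _ _)
        rintro _ ⟨j, rfl⟩
        exact dist_centre_le hK v hv j
      have hb : ∀ a, dist (w a : E) (aff hK v (centre m)) ≤ m / (m + 1) * d := fun a =>
        hball (hhull (hw.1 a))
      have hbm : (aff hK v (centre m) : E) ∈ convexHull ℝ (range fun j => (v j : E)) := by
        refine (convex_convexHull ℝ _).sum_mem (fun i _ => (centre m).2.1 i) (centre m).2.2
          fun i _ => subset_convexHull _ _ ⟨i, rfl⟩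
      push_cast
      rw [add_sub_cancel_right]
      refine ⟨fun a => ?_, fun a b => ?_⟩
      · refine Fin.cases ?_ (fun a => ?_) a
        · simpa using hbm
        · simpa using hhull (hw.1 a)
      · refine Fin.cases (Fin.cases ?_ (fun b => ?_) b) (fun a => Fin.cases ?_ (fun b => ?_) b) a
        · simp; positivity
        · simpa [dist_comm] using hb b
        · simpa using hb a
        · simpa using (hw.2 a b).trans (mul_le_mul_of_nonneg_right hc hd)
    exact hle h

lemma tsd_pow_mem_supported {K : Set E} (hK : Convex ℝ K) {m : ℕ} (v : Fin (m + 1) → K) {d : ℝ}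
    (hd : 0 ≤ d) (hv : ∀ i j, dist (v i : E) (v j) ≤ d) (N : ℕ) :
    ((tsd hK (m + 1)) ^ N) (single v 1) ∈ supported R R {w : Fin (m + 1) → K |
        ∀ i j, dist (w i : E) (w j) ≤ ((m : ℝ) / (m + 1)) ^ N * d} := by
  induction N with
  | zero =>
    refine single_mem_supported _ _ ?_
    simpa using hv
  | succ N ih =>
    rw [pow_succ' (tsd hK (m + 1)), Module.End.mul_apply]
    set S := {w : Fin (m + 1) → K | ∀ i j, dist (w i : E) (w j) ≤ ((m : ℝ) / (m + 1)) ^ N * d}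
    set S' := {w : Fin (m + 1) → K |
      ∀ i j, dist (w i : E) (w j) ≤ ((m : ℝ) / (m + 1)) ^ (N + 1) * d} with hS'
    have : supported R R S ≤ (supported R R S').comap (tsd hK (m + 1)) := by
      rw [supported_eq_span_single, span_le]
      rintro _ ⟨w, hw, rfl⟩
      refine Finsupp.supported_mono ?_ (tsd_mem_supported hK w (by positivity) hw)
      rintro w' ⟨-, h⟩ i j
      refine (h i j).trans (le_of_eq ?_)
      push_cast
      rw [add_sub_cancel_right]
      ring
    exact this ih

/-- Iterated subdivisions of a chain in `U ∪ V` are sums of a chain in `U` and a chain in `V`. -/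
lemma exists_sd_pow_mem_sup {U V : Set X} (hU : IsOpen U) (hV : IsOpen V) {m : ℕ}
    {c : SChain R X m} (hc : c ∈ chainsIn R X (U ∪ V) m) :
    ∃ N, ((sd R m) ^ N) c ∈ chainsIn R X U m ⊔ chainsIn R X V m := by
  have key : ∀ σ : SSimplex X m, range σ ⊆ U ∪ V →
      ∃ N, ((sd R m) ^ N) (sgl R σ) ∈ chainsIn R X U m ⊔ chainsIn R X V m := by
    intro σ hσ
    obtain ⟨δ, hδ, hleb⟩ := lebesgue_number_lemma_of_metric (s := (Set.univ : Set (Δ m)))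
      (c := fun b : Bool => σ ⁻¹' (if b then U else V)) isCompact_univ
      (fun b => by cases b <;> simp [hU.preimage σ.continuous, hV.preimage σ.continuous])
      (fun x _ => by
        rcases hσ ⟨x, rfl⟩ with h | h
        · exact mem_iUnion.2 ⟨true, by simpa using h⟩
        · exact mem_iUnion.2 ⟨false, by simpa using h⟩)
    obtain ⟨d, hd0, hd⟩ : ∃ d : ℝ, 0 ≤ d ∧ ∀ i j, dist ((vtx m i : Δ m) : Fin (m + 1) → ℝ) (vtx m j)
        ≤ d := by
      obtain ⟨d, hd⟩ := (Set.finite_range fun p : Fin (m + 1) × Fin (m + 1) =>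
        dist ((vtx m p.1 : Δ m) : Fin (m + 1) → ℝ) (vtx m p.2)).bddAbove
      exact ⟨d, dist_nonneg.trans (hd ⟨(0, 0), rfl⟩), fun i j => hd ⟨(i, j), rfl⟩⟩
    have hlim : Filter.Tendsto (fun N : ℕ => ((m : ℝ) / (m + 1)) ^ N * d) Filter.atTop
        (nhds 0) := by
      have := tendsto_pow_atTop_nhds_zero_of_lt_one (r := (m : ℝ) / (m + 1)) (by positivity)
        (by rw [div_lt_one (by positivity)]; linarith)
      simpa using this.mul_const d
    obtain ⟨N, hN⟩ := (hlim.eventually (gt_mem_nhds hδ)).exists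
    refine ⟨N, ?_⟩
    rw [sd_pow_sgl]
    have hsup := tsd_pow_mem_supported (R := R) (convex_simplex m) (vtx m) hd0 hd N
    set S := {w : Fin (m + 1) → Δ m |
      ∀ i j, dist (w i : Fin (m + 1) → ℝ) (w j) ≤ ((m : ℝ) / (m + 1)) ^ N * d}
    have : supported R R S ≤ (chainsIn R X U m ⊔ chainsIn R X V m).comap
        ((push R σ m).comp (real R (convex_simplex m))) := by
      rw [supported_eq_span_single, span_le]
      rintro _ ⟨w, hw, rfl⟩
      simp only [Submodule.comap_coe, Set.mem_preimage, comp_apply, real_single,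
        push_sgl, SetLike.mem_coe]
      obtain ⟨b, hb⟩ := hleb (w 0) trivial
      have hr : range (σ.comp (aff (convex_simplex m) w)) ⊆ if b then U else V := by
        rintro _ ⟨x, rfl⟩
        refine hb ?_
        rw [Metric.mem_ball]
        refine lt_of_le_of_lt ?_ hN
        have hmem : (aff (convex_simplex m) w x : Fin (m + 1) → ℝ) ∈
            closedBall (w 0 : Fin (m + 1) → ℝ) (((m : ℝ) / (m + 1)) ^ N * d) :=
          (convex_closedBall _ _).sum_mem (fun i _ => x.2.1 i) x.2.2 fun i _ => hw i 0
        exact hmem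
      cases b
      · exact mem_sup_right (sgl_mem_chainsIn (by simpa using hr))
      · exact mem_sup_left (sgl_mem_chainsIn (by simpa using hr))
    exact this hsup
  have hstable : ∀ (c : SChain R X m) (N : ℕ), c ∈ chainsIn R X U m ⊔ chainsIn R X V m →
      ((sd R m) ^ N) c ∈ chainsIn R X U m ⊔ chainsIn R X V m := by
    intro c N hc
    obtain ⟨a, ha, b, hb, rfl⟩ := mem_sup.1 hc
    rw [map_add]
    exact Submodule.add_mem_sup (sd_pow_mem_chainsIn N ha) (sd_pow_mem_chainsIn N hb)
  rw [chainsIn_eq_span] at hc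
  induction hc using Submodule.span_induction with
  | mem x hx => obtain ⟨σ, hσ, rfl⟩ := hx; exact key σ hσ
  | zero => exact ⟨0, by simp⟩
  | add x y _ _ hx hy =>
    obtain ⟨N, hN⟩ := hx
    obtain ⟨N', hN'⟩ := hy
    refine ⟨N + N', ?_⟩
    rw [map_add]
    refine add_mem ?_ ?_
    · rw [add_comm N, pow_add, Module.End.mul_apply]; exact hstable _ _ hN
    · rw [pow_add, Module.End.mul_apply]; exact hstable _ _ hN'
  | smul r x _ hx =>
    obtain ⟨N, hN⟩ := hx
    exact ⟨N, by rw [map_smul]; exact Submodule.smul_mem _ _ hN⟩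

end Mesh

/-! ### Excision and Mayer–Vietoris -/

section Excision

variable {R : Type} [CommRing R]

lemma mem_relCycles_iff {U : Set X} {n : ℕ} {w : SChain R X (n + 1)} :
    w ∈ relCycles R X U n ↔ bdry R X n w ∈ chainsIn R X U n := Iff.rfl

lemma mem_relBdries_iff {U : Set X} {n : ℕ} {w : SChain R X (n + 1)} : w ∈ relBdries R X U n ↔
      ∃ a, ∃ u ∈ chainsIn R X U (n + 1), bdry R X (n + 1) a + u = w := by
  simp [relBdries, mem_sup]

lemma bdry_mem_relBdries {U : Set X} {n : ℕ} (a : SChain R X (n + 2)) :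
    bdry R X (n + 1) a ∈ relBdries R X U n := mem_sup_left ⟨a, rfl⟩

lemma mem_relBdries_of_chainsIn {U : Set X} {n : ℕ} {a : SChain R X (n + 1)}
    (h : a ∈ chainsIn R X U (n + 1)) : a ∈ relBdries R X U n := mem_sup_right h

lemma relBdries_mono {U V : Set X} (h : U ⊆ V) (n : ℕ) :
    relBdries R X U n ≤ relBdries R X V n := sup_le_sup_left (chainsIn_mono h _) _

lemma relCycles_mono {U V : Set X} (h : U ⊆ V) (n : ℕ) :
    relCycles R X U n ≤ relCycles R X V n := Submodule.comap_mono (chainsIn_mono h _)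

lemma relBdries_le_relCycles (U : Set X) (n : ℕ) : relBdries R X U n ≤ relCycles R X U n := by
  intro w hw
  obtain ⟨a, u, hu, rfl⟩ := mem_relBdries_iff.1 hw
  rw [mem_relCycles_iff, map_add, bdry_bdry, zero_add]
  exact bdry_mem_chainsIn hu

/-- Vanishing of the relative homology of `(X, U)` in degree `n + 1`. -/
def Van (R : Type) [CommRing R] (X : Type) [TopologicalSpace X] (U : Set X) (n : ℕ) : Prop :=
  relCycles R X U n ≤ relBdries R X U n

lemma sub_sd_pow_mem (N : ℕ) {U : Set X} {n : ℕ} {w : SChain R X (n + 1)}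
    (hw : bdry R X n w ∈ chainsIn R X U n) : w - ((sd R (n + 1)) ^ N) w ∈ relBdries R X U n := by
  have h := bdry_sdHIter N w
  have : w - ((sd R (n + 1)) ^ N) w =
      bdry R X (n + 1) (sdHIter R N (n + 1) w) + sdHIter R N n (bdry R X n w) := by
    rw [h]; abel
  rw [this]
  exact add_mem (bdry_mem_relBdries _) (mem_relBdries_of_chainsIn (sdHIter_mem_chainsIn N hw))

lemma exists_split {U V : Set X} (hU : IsOpen U) (hV : IsOpen V) {m : ℕ} {f : SChain R X (m + 1)}
    (hf : f ∈ chainsIn R X (U ∪ V) (m + 1))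
    (hbf : bdry R X m f ∈ chainsIn R X U m ⊔ chainsIn R X V m) :
    ∃ g, ∃ a ∈ chainsIn R X U (m + 1), ∃ b ∈ chainsIn R X V (m + 1),
      f = bdry R X (m + 1) g + a + b := by
  obtain ⟨N, hN⟩ := exists_sd_pow_mem_sup hU hV hf
  obtain ⟨a, ha, b, hb, hab⟩ := mem_sup.1 hN
  obtain ⟨p, hp, q, hq, hpq⟩ := mem_sup.1 hbf
  refine ⟨sdHIter R N (m + 1) f, a + sdHIter R N m p,
    add_mem ha (sdHIter_mem_chainsIn N hp), b + sdHIter R N m q,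
    add_mem hb (sdHIter_mem_chainsIn N hq), ?_⟩
  rw [bdry_sdHIter, ← hab, ← hpq, map_add]
  abel

theorem mem_relBdries_inter {U V : Set X} (hU : IsOpen U) (hV : IsOpen V) {n : ℕ}
    (hUV : Van R X (U ∪ V) (n + 1)) {w : SChain R X (n + 1)} (hwU : w ∈ relBdries R X U n)
    (hwV : w ∈ relBdries R X V n) : w ∈ relBdries R X (U ∩ V) n := by
  obtain ⟨a, u, hu, rfl⟩ := mem_relBdries_iff.1 hwU
  obtain ⟨b, v, hv, hbv⟩ := mem_relBdries_iff.1 hwV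
  have hab : bdry R X (n + 1) (a - b) = v - u := by
    grind
  have hcyc : a - b ∈ relCycles R X (U ∪ V) (n + 1) := by
    rw [mem_relCycles_iff, hab]
    exact sub_mem (chainsIn_mono Set.subset_union_right _ hv)
      (chainsIn_mono Set.subset_union_left _ hu)
  obtain ⟨e, f, hf, hef⟩ := mem_relBdries_iff.1 (hUV hcyc)
  have hbf : bdry R X (n + 1) f = v - u := by rw [← hab, ← hef, map_add, bdry_bdry, zero_add]
  obtain ⟨g, fU, hfU, fV, hfV, hf'⟩ := exists_split hU hV hf (by
    rw [hbf, sub_eq_add_neg, add_comm v (-u)]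
    exact Submodule.add_mem_sup (neg_mem hu) hv)
  have hb2 : bdry R X (n + 1) fU + bdry R X (n + 1) fV = v - u := by
    rw [← hbf, hf', map_add, map_add, bdry_bdry, zero_add]
  have heq : u + bdry R X (n + 1) fU = v - bdry R X (n + 1) fV := by
    grind
  refine mem_relBdries_iff.2 ⟨a - fU, u + bdry R X (n + 1) fU, mem_chainsIn_inter ?_ ?_, ?_⟩
  · exact add_mem hu (bdry_mem_chainsIn hfU)
  · rw [heq]; exact sub_mem hv (bdry_mem_chainsIn hfV)
  · rw [map_sub]; abel

theorem van_union {U V : Set X} (hU : IsOpen U) (hV : IsOpen V) {n : ℕ}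
    (hVU : Van R X U (n + 1)) (hVV : Van R X V (n + 1)) (hI : Van R X (U ∩ V) n) :
    Van R X (U ∪ V) (n + 1) := by
  intro w hw
  obtain ⟨N, hN⟩ := exists_sd_pow_mem_sup hU hV hw
  obtain ⟨p, hp, q, hq, hpq⟩ := mem_sup.1 hN
  set w' := ((sd R (n + 2)) ^ N) w
  have hb : bdry R X (n + 1) w' = p + q := by rw [hpq]; exact bdry_sd_pow N w
  have hsum : bdry R X n p = - bdry R X n q := by
    rw [eq_neg_iff_add_eq_zero, ← map_add, ← hb, bdry_bdry]
  have hpc : p ∈ relCycles R X (U ∩ V) n := mem_chainsIn_inter (bdry_mem_chainsIn hp) (by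
    rw [hsum]; exact neg_mem (bdry_mem_chainsIn hq))
  obtain ⟨r, s, hs, hrs⟩ := mem_relBdries_iff.1 (hI hpc)
  have hr : r ∈ relCycles R X U (n + 1) := by
    rw [mem_relCycles_iff, eq_sub_of_add_eq hrs]
    exact sub_mem hp (chainsIn_mono Set.inter_subset_left _ hs)
  have hwr : w' - r ∈ relCycles R X V (n + 1) := by
    rw [mem_relCycles_iff, map_sub, hb, eq_sub_of_add_eq hrs, show p + q - (p - s) = q + s by abel]
    exact add_mem hq (chainsIn_mono Set.inter_subset_right _ hs)
  have h1 : r ∈ relBdries R X (U ∪ V) (n + 1) := relBdries_mono Set.subset_union_left _ (hVU hr)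
  have h2 : w' - r ∈ relBdries R X (U ∪ V) (n + 1) :=
    relBdries_mono Set.subset_union_right _ (hVV hwr)
  have h3 := sub_sd_pow_mem N hw
  have : w = (w - w') + (w' - r) + r := by abel
  rw [this]
  exact add_mem (add_mem h3 h2) h1

lemma push_sub_mem_relBdries (H : C(X × I01, X)) (g : C(X, X)) (h0 : ∀ x, H (x, 0) = x)
    (h1 : ∀ x, H (x, 1) = g x) {U : Set X} (hU : ∀ x ∈ U, ∀ t, H (x, t) ∈ U) {n : ℕ}
    {w : SChain R X (n + 1)} (hw : w ∈ relCycles R X U n) :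
    push R g (n + 1) w - w ∈ relBdries R X U n := by
  have h := bdry_hprism (R := R) H (ContinuousMap.id X) g h0 h1 w
  rw [push_id] at h
  rw [show push R g (n + 1) w - w = bdry R X (n + 1) (hprism R H (n + 1) w) +
    hprism R H n (bdry R X n w) by rw [h]; abel]
  exact add_mem (bdry_mem_relBdries _) (mem_relBdries_of_chainsIn (hprism_mem_chainsIn H hU hw))

lemma van_of_contraction (H : C(X × I01, X)) (p : X) (h0 : ∀ x, H (x, 0) = x)
    (h1 : ∀ x, H (x, 1) = p) {U : Set X} (hU : ∀ x ∈ U, ∀ t, H (x, t) ∈ U) (hp : p ∈ U) (n : ℕ) :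
    Van R X U n := by
  intro w hw
  have h := push_sub_mem_relBdries H (const X p) h0 h1 hU hw
  have h2 : push R (const X p) (n + 1) w ∈ relBdries R X U n := mem_relBdries_of_chainsIn
      (push_mem_chainsIn (S := Set.univ) _ (fun x _ => hp) (mem_chainsIn_univ w))
  have := sub_mem h2 h
  rwa [sub_sub_cancel] at this

lemma sgl_injective [Nontrivial R] {n : ℕ} {σ : SSimplex X n} {r : R} (h : r • sgl R σ = 0) :
    r = 0 := by
  rw [sgl, ← map_smul, LinearEquiv.map_eq_zero_iff, smul_single_one, Finsupp.single_eq_zero] at h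
  exact h

lemma van_empty_of_contraction (H : C(X × I01, X)) (p : X) (h0 : ∀ x, H (x, 0) = x)
    (h1 : ∀ x, H (x, 1) = p) (n : ℕ) : Van R X ∅ n := by
  intro w hw
  rcases subsingleton_or_nontrivial R with hR | hR
  · have := Module.subsingleton R (SChain R X (n + 1))
    rw [Subsingleton.elim w 0]
    exact Submodule.zero_mem _
  have h := push_sub_mem_relBdries (U := (∅ : Set X)) H (const X p) h0 h1 (fun x hx => hx.elim) hw
  have hw0 : bdry R X n w = 0 := by
    refine map_mem_of_chainsIn (LinearMap.id) (⊥ : Submodule R _) (fun σ hσ => ?_) hw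
    exact (hσ ⟨centre n, rfl⟩).elim
  have hpush : ∀ (m : ℕ) (c : SChain R X m), push R (const X p) m c =
      (clift (fun _ => (1 : R)) c) • sgl R (const _ p) := by
    intro m c
    apply chain_ext c
    intro σ
    simp
  have hconst : ∀ m : ℕ, bdry R X m (sgl R (const _ p)) =
      (if Even m then (0 : R) else 1) • sgl R (const _ p) := by
    intro m
    have hf : ∀ i : Fin (m + 2), faceOf (const (Δ (m + 1)) p) i = const _ p := fun i => rfl
    simp only [bdry_sgl, hf]
    rw [← Finset.sum_smul, Fin.sum_neg_one_pow]
    grind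
  have h2 : push R (const X p) (n + 1) w ∈ relBdries R X ∅ n := by
    rcases Nat.even_or_odd n with hn | hn
    · rw [hpush]
      refine Submodule.smul_mem _ _ ?_
      have := hconst (n + 1)
      rw [if_neg (by grind), one_smul] at this
      rw [← this]
      exact bdry_mem_relBdries _
    · have h3 : bdry R X n (push R (const X p) (n + 1) w) = 0 := by
        rw [push_bdry, hw0, map_zero]
      rw [hpush, map_smul, hconst, if_neg (Nat.not_even_iff_odd.2 hn), one_smul] at h3
      rw [hpush, sgl_injective h3, zero_smul]
      exact Submodule.zero_mem _
  have := sub_mem h2 h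
  rwa [sub_sub_cancel] at this

variable {O : Type} [TopologicalSpace O]

lemma push_eq_mapDomain (φ : C(O, X)) (n : ℕ) : push R φ n = (chainEquiv R X n).toLinearMap.comp
    ((lmapDomain R R fun σ : SSimplex O n => φ.comp σ).comp
      (chainEquiv R O n).symm.toLinearMap) := by
  refine chain_hom_ext fun σ => ?_
  simp [sgl, push, clift]

lemma push_injective {φ : C(O, X)} (hφ : Injective φ) (n : ℕ) : Injective (push R φ n) := by
  rw [push_eq_mapDomain]
  have hinj : Injective fun σ : SSimplex O n => φ.comp σ := fun σ τ h => by
    ext x : 1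
    exact hφ (DFunLike.congr_fun h x)
  intro a b h
  exact (chainEquiv R O n).symm.injective
    (Finsupp.mapDomain_injective hinj ((chainEquiv R X n).injective h))

lemma exists_push_eq {φ : C(O, X)} (hφ : IsEmbedding φ) {n : ℕ} {S : Set X}
    (hS : S ⊆ range φ) {w : SChain R X n} (hw : w ∈ chainsIn R X S n) :
    ∃ c ∈ chainsIn R O (φ ⁻¹' S) n, push R φ n c = w := by
  have : chainsIn R X S n ≤ (chainsIn R O (φ ⁻¹' S) n).map (push R φ n) := by
    rw [chainsIn_eq_span, span_le]
    rintro _ ⟨σ, hσ, rfl⟩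
    have hr : ∀ x, σ x ∈ range φ := fun x => hS (hσ ⟨x, rfl⟩)
    let τ : SSimplex O n := ⟨fun x => hφ.toHomeomorph.symm ⟨σ x, hr x⟩, by fun_prop⟩
    have hτ : ∀ x, φ (τ x) = σ x := fun x =>
      congrArg Subtype.val (hφ.toHomeomorph.apply_symm_apply ⟨σ x, hr x⟩)
    refine ⟨sgl R τ, sgl_mem_chainsIn ?_, ?_⟩
    · grind
    · rw [push_sgl]
      congr 1
      ext x : 1
      exact hτ x
  exact this hw

lemma mem_chainsIn_of_push {φ : C(O, X)} (hφ : IsEmbedding φ) {n : ℕ} {S : Set X}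
    {c : SChain R O n} (hc : push R φ n c ∈ chainsIn R X S n) : c ∈ chainsIn R O (φ ⁻¹' S) n := by
  obtain ⟨c', hc', h⟩ := exists_push_eq hφ Set.inter_subset_right
    (mem_chainsIn_inter hc (push_mem_chainsIn_range φ c))
  rw [← push_injective hφ.injective n h]
  exact chainsIn_mono (fun x hx => hx.1) _ hc'

theorem excision_surjective {φ : C(O, X)} (hφ : IsOpenEmbedding φ) {U : Set X}
    (hU : IsOpen U) (hcov : Uᶜ ⊆ range φ) {n : ℕ} {w : SChain R X (n + 1)}
    (hw : w ∈ relCycles R X U n) :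
    ∃ c ∈ relCycles R O (φ ⁻¹' U) n, w - push R φ (n + 1) c ∈ relBdries R X U n := by
  obtain ⟨N, hN⟩ := exists_sd_pow_mem_sup (R := R) hφ.isOpen_range hU (c := w)
    (chainsIn_mono (fun x _ => by
      grind) _ (mem_chainsIn_univ w))
  obtain ⟨a, ha, b, hb, hab⟩ := mem_sup.1 hN
  obtain ⟨c, -, rfl⟩ := exists_push_eq hφ.isEmbedding le_rfl ha
  refine ⟨c, mem_chainsIn_of_push hφ.isEmbedding ?_, ?_⟩
  · rw [← push_bdry, eq_sub_of_add_eq hab, map_sub, bdry_sd_pow]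
    exact sub_mem (sd_pow_mem_chainsIn N hw) (bdry_mem_chainsIn hb)
  · rw [eq_sub_of_add_eq hab, ← sub_add]
    exact add_mem (sub_sd_pow_mem N hw) (mem_relBdries_of_chainsIn hb)

theorem excision_injective {φ : C(O, X)} (hφ : IsOpenEmbedding φ) {U : Set X}
    (hU : IsOpen U) (hcov : Uᶜ ⊆ range φ) {n : ℕ} {c : SChain R O (n + 1)}
    (hc : c ∈ relCycles R O (φ ⁻¹' U) n) (h : push R φ (n + 1) c ∈ relBdries R X U n) :
    c ∈ relBdries R O (φ ⁻¹' U) n := by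
  obtain ⟨a, b, hb, hab⟩ := mem_relBdries_iff.1 h
  obtain ⟨N, hN⟩ := exists_sd_pow_mem_sup (R := R) hφ.isOpen_range hU (c := a)
    (chainsIn_mono (fun x _ => by
      grind) _ (mem_chainsIn_univ a))
  obtain ⟨a1, ha1, a2, ha2, ha12⟩ := mem_sup.1 hN
  obtain ⟨a', -, rfl⟩ := exists_push_eq hφ.isEmbedding le_rfl ha1
  have hpow : ∀ (M : ℕ) (d : SChain R O (n + 1)), push R φ (n + 1) (((sd R (n + 1)) ^ M) d) =
      ((sd R (n + 1)) ^ M) (push R φ (n + 1) d) := by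
    intro M d
    induction M with
    | zero => simp
    | succ M ih => rw [pow_succ', pow_succ', Module.End.mul_apply, Module.End.mul_apply, ← ih,
        sd_push]
  have hkey : push R φ (n + 1) (((sd R (n + 1)) ^ N) c - bdry R O (n + 1) a') =
      bdry R X (n + 1) a2 + ((sd R (n + 1)) ^ N) b := by
    rw [map_sub, hpow, ← hab, map_add, ← bdry_sd_pow, ← ha12, map_add, push_bdry]
    abel
  have h1 : ((sd R (n + 1)) ^ N) c - bdry R O (n + 1) a' ∈ chainsIn R O (φ ⁻¹' U) (n + 1) := by
    refine mem_chainsIn_of_push hφ.isEmbedding ?_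
    rw [hkey]
    exact add_mem (bdry_mem_chainsIn ha2) (sd_pow_mem_chainsIn N hb)
  rw [show c = (c - ((sd R (n + 1)) ^ N) c) + bdry R O (n + 1) a' +
    (((sd R (n + 1)) ^ N) c - bdry R O (n + 1) a') by abel]
  exact add_mem (add_mem (sub_sd_pow_mem N hc) (bdry_mem_relBdries _))
    (mem_relBdries_of_chainsIn h1)

lemma push_mem_relBdries (φ : C(O, X)) {S : Set O} {T : Set X} (h : MapsTo φ S T) {n : ℕ}
    {c : SChain R O (n + 1)} (hc : c ∈ relBdries R O S n) :
    push R φ (n + 1) c ∈ relBdries R X T n := by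
  obtain ⟨a, u, hu, rfl⟩ := mem_relBdries_iff.1 hc
  rw [map_add, ← push_bdry]
  exact add_mem (bdry_mem_relBdries _) (mem_relBdries_of_chainsIn (push_mem_chainsIn φ h hu))

lemma push_mem_relCycles (φ : C(O, X)) {S : Set O} {T : Set X} (h : MapsTo φ S T) {n : ℕ}
    {c : SChain R O (n + 1)} (hc : c ∈ relCycles R O S n) :
    push R φ (n + 1) c ∈ relCycles R X T n := by
  rw [mem_relCycles_iff, push_bdry]
  exact push_mem_chainsIn φ h hc

/-- Every chain in `U` is supported in a compact subset of `U`. -/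
lemma exists_compact_support {U : Set X} {n : ℕ} {c : SChain R X n} (hc : c ∈ chainsIn R X U n) :
    ∃ K ⊆ U, IsCompact K ∧ c ∈ chainsIn R X K n := by
  rw [mem_chainsIn_iff] at hc
  refine ⟨⋃ σ ∈ ((chainEquiv R X n).symm c).support, range σ, Set.iUnion₂_subset hc,
    Finset.isCompact_biUnion _ fun σ _ => isCompact_range σ.continuous, ?_⟩
  rw [mem_chainsIn_iff]
  exact fun σ hσ x hx => Set.mem_iUnion₂.2 ⟨σ, hσ, hx⟩

end Excision

/-! ### Local homology of Euclidean space and of manifolds -/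

section Euclidean

variable {R : Type} [CommRing R] {n : ℕ}

/-- The straight-line homotopy from the identity to an affine contraction or dilation at `p`. -/
def radial (p : Fin n → ℝ) (L : ℝ) : C((Fin n → ℝ) × I01, Fin n → ℝ) where
  toFun z := p + (1 + z.2.1 * L) • (z.1 - p)
  continuous_toFun := by fun_prop

lemma radial_zero (p : Fin n → ℝ) (L : ℝ) (x : Fin n → ℝ) : radial p L (x, 0) = x := by
  simp [radial]

lemma van_agree (y : Fin n → ℝ) (k : ℕ) (hk : k ≤ n) (i : ℕ) (hi : k ≤ i) :
    Van R (Fin n → ℝ) {x | ∀ j : Fin n, (j : ℕ) < k → x j = y j}ᶜ i := by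
  induction k generalizing i with
  | zero =>
    have : {x : Fin n → ℝ | ∀ j : Fin n, (j : ℕ) < 0 → x j = y j}ᶜ = ∅ := by simp
    rw [this]
    exact van_empty_of_contraction (radial y (-1)) y (radial_zero y _) (fun x => by simp [radial]) i
  | succ k ih =>
    obtain ⟨i, rfl⟩ : ∃ i', i = i' + 1 := ⟨i - 1, by omega⟩
    have hkn : k < n := hk
    set A := {x : Fin n → ℝ | ∀ j : Fin n, (j : ℕ) < k → x j = y j} with hA
    set P := {x : Fin n → ℝ | x ∈ A ∧ y ⟨k, hkn⟩ ≤ x ⟨k, hkn⟩} with hP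
    set Q := {x : Fin n → ℝ | x ∈ A ∧ x ⟨k, hkn⟩ ≤ y ⟨k, hkn⟩} with hQ
    have hAc : IsClosed A := by
      rw [hA]
      simp only [Set.ofPred_forall]
      exact isClosed_iInter fun j => isClosed_iInter fun _ =>
        isClosed_eq (continuous_apply j) continuous_const
    have hPc : IsClosed P := hAc.inter (isClosed_le continuous_const (continuous_apply _))
    have hQc : IsClosed Q := hAc.inter (isClosed_le (continuous_apply _) continuous_const)
    have hunion : Pᶜ ∪ Qᶜ = {x : Fin n → ℝ | ∀ j : Fin n, (j : ℕ) < k + 1 → x j = y j}ᶜ := by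
      rw [← Set.compl_inter]
      congr 1
      ext x
      simp only [hP, hQ, hA, Set.mem_inter_iff, Set.mem_ofPred_eq]
      constructor
      · rintro ⟨⟨h1, h2⟩, -, h3⟩ j hj
        rcases Nat.lt_succ_iff_lt_or_eq.1 hj with h | h
        · exact h1 j h
        · obtain rfl : j = ⟨k, hkn⟩ := Fin.ext h
          exact le_antisymm h3 h2
      grind
    have hinter : Pᶜ ∩ Qᶜ = Aᶜ := by
      rw [← Set.compl_union]
      congr 1
      ext x
      grind
    rw [← hunion]
    have hstar : ∀ ε : ℝ, (ε = 1 ∨ ε = -1) → ∀ x : Fin n → ℝ, ∀ t : I01,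
        radial (y + Pi.single ⟨k, hkn⟩ ε) (-1) (x, t) ∈ A →
        0 ≤ ε * (y ⟨k, hkn⟩ - radial (y + Pi.single ⟨k, hkn⟩ ε) (-1) (x, t) ⟨k, hkn⟩) →
        x ∈ A ∧ 0 ≤ ε * (y ⟨k, hkn⟩ - x ⟨k, hkn⟩) := by
      intro ε hε x t hA' hx
      have ht1 : 0 ≤ 1 - t.1 := by linarith [t.2.2]
      have hkk : radial (y + Pi.single ⟨k, hkn⟩ ε) (-1) (x, t) ⟨k, hkn⟩ =
          y ⟨k, hkn⟩ + ε + (1 - t.1) * (x ⟨k, hkn⟩ - (y ⟨k, hkn⟩ + ε)) := by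
        simp only [radial, coe_mk, Pi.add_apply, Pi.smul_apply, Pi.sub_apply,
          Pi.single_eq_same, smul_eq_mul]
        ring
      have hee : ε * ε = 1 := by grind
      rw [hkk] at hx
      have hx' : t.1 ≤ (1 - t.1) * (ε * (y ⟨k, hkn⟩ - x ⟨k, hkn⟩)) := by nlinarith
      rcases ht1.eq_or_lt with h0 | h0
      · exfalso
        rw [← h0] at hx'
        grind
      · refine ⟨fun j hj => ?_, ?_⟩
        · have := hA' j hj
          have hne : j ≠ ⟨k, hkn⟩ := by grind
          simp only [radial, coe_mk, Pi.add_apply, Pi.smul_apply, Pi.sub_apply,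
            Pi.single_apply, hne, if_false, add_zero, smul_eq_mul] at this
          grind
        · by_contra hneg
          push Not at hneg
          nlinarith [t.2.1, mul_neg_of_pos_of_neg h0 hneg]
    refine van_union hPc.isOpen_compl hQc.isOpen_compl ?_ ?_ ?_
    · refine van_of_contraction (radial (y + Pi.single ⟨k, hkn⟩ (-1)) (-1))
        (y + Pi.single ⟨k, hkn⟩ (-1)) (radial_zero _ _) (fun x => by simp [radial]) ?_ ?_ _
      · grind
      · intro h
        have := h.2
        simp at this
        linarith
    · refine van_of_contraction (radial (y + Pi.single ⟨k, hkn⟩ 1) (-1))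
        (y + Pi.single ⟨k, hkn⟩ 1) (radial_zero _ _) (fun x => by simp [radial]) ?_ ?_ _
      · grind
      · intro h
        have := h.2
        simp at this
        linarith
    grind

lemma van_point (y : Fin n → ℝ) (i : ℕ) (hi : n ≤ i) : Van R (Fin n → ℝ) {y}ᶜ i := by
  have := van_agree (R := R) y n le_rfl i hi
  convert this using 3
  ext x
  simp [funext_iff]

/-- A class vanishing at a point of a box vanishes on the box. -/
lemma mem_relBdries_box {a b y : Fin n → ℝ} (hy : y ∈ Icc a b) {i : ℕ}
    {w : SChain R (Fin n → ℝ) (i + 1)} (hw : w ∈ relCycles R _ (Icc a b)ᶜ i)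
    (h : w ∈ relBdries R _ {y}ᶜ i) : w ∈ relBdries R _ (Icc a b)ᶜ i := by
  obtain ⟨c, u, hu, rfl⟩ := mem_relBdries_iff.1 h
  obtain ⟨K, hK, hKc, hKu⟩ := exists_compact_support hu
  obtain ⟨r, hr, hrK⟩ : ∃ r > 0, ∀ x ∈ K, r ≤ dist x y := by
    have : Kᶜ ∈ nhds y := hKc.isClosed.isOpen_compl.mem_nhds fun hyK => hK hyK rfl
    obtain ⟨r, hr, hball⟩ := Metric.mem_nhds_iff.1 this
    exact ⟨r, hr, fun x hx => not_lt.1 fun hlt => hball hlt hx⟩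
  obtain ⟨D, hD⟩ : ∃ D, ∀ x ∈ Icc a b, dist x y ≤ D := by
    obtain ⟨D, hD⟩ := (isCompact_Icc (a := a) (b := b)).isBounded.subset_closedBall y
    exact ⟨D, fun x hx => hD hx⟩
  set L := |D| / r + 1
  have hL0 : 0 ≤ L := by positivity
  let g : C(Fin n → ℝ, Fin n → ℝ) := ⟨fun x => radial y L (x, 1), by fun_prop⟩
  have hpres : ∀ x ∈ (Icc a b)ᶜ, ∀ t, radial y L (x, t) ∈ (Icc a b)ᶜ := by
    intro x hx t hx'
    apply hx
    have hs : 0 < 1 + t.1 * L := by have := mul_nonneg t.2.1 hL0; linarith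
    have hconv := (convex_Icc a b).add_smul_sub_mem hy hx' (t := (1 + t.1 * L)⁻¹)
      ⟨by positivity, inv_le_one_of_one_le₀ (by have := mul_nonneg t.2.1 hL0; linarith)⟩
    convert hconv using 1
    simp only [radial, coe_mk, add_sub_cancel_left, smul_smul]
    rw [inv_mul_cancel₀ hs.ne', one_smul, add_sub_cancel]
  have h1 := push_sub_mem_relBdries (radial y L) g (radial_zero y L) (fun x => rfl) hpres hw
  have h2 : push R g (i + 1) (bdry R _ (i + 1) c + u) ∈ relBdries R _ (Icc a b)ᶜ i := by
    rw [map_add, ← push_bdry]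
    refine add_mem (bdry_mem_relBdries _) (mem_relBdries_of_chainsIn
      (push_mem_chainsIn (T := (Icc a b)ᶜ) g (fun x hx hx' => ?_) hKu))
    have h3 := hD _ hx'
    have h4 : dist (radial y L (x, 1)) y = (1 + L) * dist x y := by
      rw [dist_eq_norm, dist_eq_norm]
      simp only [radial, coe_mk, add_sub_cancel_left, norm_smul]
      rw [Real.norm_of_nonneg (by simp; linarith)]
      simp
    have h5 := hrK x hx
    rw [show g x = radial y L (x, 1) from rfl, h4] at h3
    have h6 : (1 + L) * r ≤ D := (mul_le_mul_of_nonneg_left h5 (by linarith)).trans h3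
    have h7 : L * r = |D| + r := by simp only [L]; field_simp
    nlinarith [le_abs_self D]
  have := sub_mem h2 h1
  rwa [sub_sub_cancel] at this

lemma van_box (a b : Fin n → ℝ) (i : ℕ) (hi : n ≤ i) : Van R (Fin n → ℝ) (Icc a b)ᶜ i := by
  intro w hw
  by_cases hab : a ≤ b
  · refine mem_relBdries_box (Set.left_mem_Icc.2 hab) hw (van_point a i hi ?_)
    exact relCycles_mono (compl_subset_compl.2
      (singleton_subset_iff.2 (Set.left_mem_Icc.2 hab))) _ hw
  · rw [Set.Icc_eq_empty hab, Set.compl_empty]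
    exact mem_relBdries_of_chainsIn (mem_chainsIn_univ w)

lemma van_boxes (l : List ((Fin n → ℝ) × (Fin n → ℝ))) (i : ℕ) (hi : n ≤ i) :
    Van R (Fin n → ℝ) (⋂ p ∈ l, (Icc p.1 p.2)ᶜ) i := by
  induction hl : l.length generalizing l i with
  | zero =>
    obtain rfl := List.length_eq_zero_iff.1 hl
    intro w _
    simpa using mem_relBdries_of_chainsIn (mem_chainsIn_univ w)
  | succ k ih =>
    obtain ⟨p, l, rfl⟩ := List.exists_cons_of_length_eq_add_one hl
    have hk : l.length = k := by simpa using hl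
    have hopen : IsOpen (⋂ q ∈ l, (Icc q.1 q.2)ᶜ) :=
      l.finite_toSet.isOpen_biInter fun q _ => isClosed_Icc.isOpen_compl
    have hcons : (⋂ q ∈ p :: l, (Icc q.1 q.2)ᶜ) = (Icc p.1 p.2)ᶜ ∩ ⋂ q ∈ l, (Icc q.1 q.2)ᶜ := by
      ext x; simp
    intro w hw
    rw [hcons] at hw ⊢
    refine mem_relBdries_inter isClosed_Icc.isOpen_compl hopen ?_ ?_ ?_
    · have := ih (l.map fun q => (p.1 ⊔ q.1, p.2 ⊓ q.2)) (i + 1) (by omega) (by simpa using hk)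
      convert this using 1
      ext x
      simp only [Set.mem_union, Set.mem_compl_iff, Set.mem_iInter, List.mem_map,
        forall_exists_index, and_imp, forall_apply_eq_imp_iff₂, ← Set.Icc_inter_Icc,
        Set.mem_inter_iff, not_and]
      tauto
    · exact van_box p.1 p.2 i hi (relCycles_mono Set.inter_subset_left _ hw)
    · exact ih l i hi hk (relCycles_mono Set.inter_subset_right _ hw)

lemma van_compact {Q : Set (Fin n → ℝ)} (hQ : IsCompact Q) (i : ℕ) (hi : n ≤ i) :
    Van R (Fin n → ℝ) Qᶜ i := by
  intro w hw
  obtain ⟨K, hK, hKc, hKw⟩ := exists_compact_support hw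
  have hbox : ∀ x ∈ Q, ∃ p : (Fin n → ℝ) × (Fin n → ℝ), Icc p.1 p.2 ∈ nhds x ∧
      Disjoint (Icc p.1 p.2) K := by
    intro x hx
    have : Kᶜ ∈ nhds x := hKc.isClosed.isOpen_compl.mem_nhds fun hxK => hK hxK hx
    obtain ⟨r, hr, hball⟩ := Metric.nhds_basis_closedBall.mem_iff.1 this
    refine ⟨(fun j => x j - r, fun j => x j + r), ?_, ?_⟩
    · refine Filter.mem_of_superset (Metric.ball_mem_nhds x hr) fun z hz => ?_
      rw [Metric.mem_ball, dist_pi_lt_iff hr] at hz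
      refine ⟨fun j => ?_, fun j => ?_⟩ <;>
      · have := abs_lt.1 (Real.dist_eq _ _ ▸ hz j)
        grind
    · refine Set.disjoint_left.2 fun z hz => ?_
      refine fun hzK => hball ?_ hzK
      rw [Metric.mem_closedBall, dist_pi_le_iff hr.le]
      intro j
      rw [Real.dist_eq, abs_le]
      have h1 := hz.1 j
      have h2 := hz.2 j
      grind
  choose! p hp hpK using hbox
  obtain ⟨t, htQ, hcov⟩ := hQ.elim_nhds_subcover (fun x => Icc (p x).1 (p x).2) hp
  have h := van_boxes (R := R) (t.toList.map p) i hi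
  have hsub : (⋂ q ∈ t.toList.map p, (Icc q.1 q.2)ᶜ) ⊆ Qᶜ := by
    intro x hx hxQ
    obtain ⟨y, hy, hxy⟩ := Set.mem_iUnion₂.1 (hcov hxQ)
    simp only [Set.mem_iInter] at hx
    exact hx (p y) (List.mem_map.2 ⟨y, by simpa using hy, rfl⟩) hxy
  refine relBdries_mono hsub _ (h (chainsIn_mono ?_ _ hKw))
  intro x hx
  simp only [Set.mem_iInter, List.mem_map, Finset.mem_toList, forall_exists_index, and_imp]
  grind

end Euclidean

/-! ### Charts and local homology of manifolds -/

section Charts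

variable {R : Type} [CommRing R] {n : ℕ} {M : Type} [TopologicalSpace M]

lemma closedBall_eq_Icc (p : Fin n → ℝ) {s : ℝ} (hs : 0 ≤ s) :
    closedBall p s = Icc (fun j => p j - s) (fun j => p j + s) := by
  rw [closedBall_pi p hs, ← Set.pi_univ_Icc]
  simp only [Real.closedBall_eq_Icc]

section Transfer

variable {O : Type} [TopologicalSpace O] [T2Space M]

lemma van_chart {φ : C(O, M)} (hφ : IsOpenEmbedding φ) {ψ : C(O, Fin n → ℝ)}
    (hψ : IsOpenEmbedding ψ) {Q : Set O} (hQ : IsCompact Q) {i : ℕ} (hi : n ≤ i) :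
    Van R M (φ '' Q)ᶜ i := by
  intro w hw
  have h1 : φ ⁻¹' (φ '' Q)ᶜ = Qᶜ := by rw [preimage_compl, preimage_image_eq _ hφ.injective]
  have h2 : ψ ⁻¹' (ψ '' Q)ᶜ = Qᶜ := by rw [preimage_compl, preimage_image_eq _ hψ.injective]
  obtain ⟨c, hc, hcw⟩ := excision_surjective hφ (hQ.image φ.continuous).isClosed.isOpen_compl
    (by rw [compl_compl]; exact image_subset_range _ _) hw
  rw [h1] at hc
  have hpc : push R ψ (i + 1) c ∈ relBdries R _ (ψ '' Q)ᶜ i :=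
    van_compact (hQ.image ψ.continuous) i hi
      (push_mem_relCycles ψ (by rw [Set.mapsTo_iff_subset_preimage, h2]) hc)
  have hcb := excision_injective hψ (hQ.image ψ.continuous).isClosed.isOpen_compl
    (by rw [compl_compl]; exact image_subset_range _ _) (by rw [h2]; exact hc) hpc
  rw [h2] at hcb
  have := push_mem_relBdries φ (T := (φ '' Q)ᶜ) (by rw [Set.mapsTo_iff_subset_preimage, h1]) hcb
  have h3 := add_mem hcw this
  rwa [sub_add_cancel] at h3

lemma mem_relBdries_chart_box {φ : C(O, M)} (hφ : IsOpenEmbedding φ)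
    {ψ : C(O, Fin n → ℝ)} (hψ : IsOpenEmbedding ψ) {a b : Fin n → ℝ}
    (hab : Icc a b ⊆ range ψ) {y : O} (hy : ψ y ∈ Icc a b) {i : ℕ}
    {w : SChain R M (i + 1)} (hw : w ∈ relCycles R M (φ '' (ψ ⁻¹' Icc a b))ᶜ i)
    (h : w ∈ relBdries R M {φ y}ᶜ i) : w ∈ relBdries R M (φ '' (ψ ⁻¹' Icc a b))ᶜ i := by
  set Q := ψ ⁻¹' Icc a b
  have hQ : IsCompact Q := hψ.isEmbedding.isInducing.isCompact_preimage' isCompact_Icc hab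
  have h1 : φ ⁻¹' (φ '' Q)ᶜ = Qᶜ := by rw [preimage_compl, preimage_image_eq _ hφ.injective]
  have h1' : φ ⁻¹' {φ y}ᶜ = {y}ᶜ := by
    rw [preimage_compl, ← Set.image_singleton, preimage_image_eq _ hφ.injective]
  obtain ⟨c, hc, hcw⟩ := excision_surjective hφ (hQ.image φ.continuous).isClosed.isOpen_compl
    (by rw [compl_compl]; exact image_subset_range _ _) hw
  have hyQ : (φ '' Q)ᶜ ⊆ {φ y}ᶜ := compl_subset_compl.2 (singleton_subset_iff.2 ⟨y, hy, rfl⟩)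
  have hpy : push R φ (i + 1) c ∈ relBdries R M {φ y}ᶜ i := by
    have := sub_mem h (relBdries_mono hyQ _ hcw)
    rwa [sub_sub_cancel] at this
  have hcy := excision_injective hφ isOpen_compl_singleton
    (by rw [compl_compl]; exact singleton_subset_iff.2 ⟨y, rfl⟩)
    (relCycles_mono (Set.preimage_mono hyQ) _ hc) hpy
  rw [h1'] at hcy
  have h2 : ψ ⁻¹' (Icc a b)ᶜ = Qᶜ := preimage_compl
  rw [h1] at hc
  have hbox : push R ψ (i + 1) c ∈ relBdries R _ (Icc a b)ᶜ i := by
    refine mem_relBdries_box hy (push_mem_relCycles ψ (fun x hx => hx) hc) ?_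
    exact push_mem_relBdries ψ (S := {y}ᶜ) (T := {ψ y}ᶜ) (fun x hx hx' => hx (hψ.injective hx')) hcy
  have hcb := excision_injective hψ isClosed_Icc.isOpen_compl
    (by rw [compl_compl]; exact hab) (by rw [h2]; exact hc) hbox
  rw [h2] at hcb
  have := push_mem_relBdries φ (T := (φ '' Q)ᶜ) (by rw [Set.mapsTo_iff_subset_preimage, h1]) hcb
  have h3 := add_mem hcw this
  rwa [sub_add_cancel] at h3

end Transfer

/-- Half balls in Euclidean space. -/
def halfBall (p : Fin (n + 1) → ℝ) (r : ℝ) : Set (Fin (n + 1) → ℝ) := {y | dist y p < r ∧ 0 ≤ y 0}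

lemma mem_halfSpace_iff {y : Fin (n + 1) → ℝ} : y ∈ halfSpace (n + 1) ↔ 0 ≤ y 0 :=
  ⟨fun h => h 0 rfl, fun h j hj => by obtain rfl : j = 0 := Fin.ext hj; exact h⟩

lemma convex_halfBall (p : Fin (n + 1) → ℝ) (r : ℝ) : Convex ℝ (halfBall p r) :=
  (convex_ball p r).inter (convex_halfSpace_ge (LinearMap.proj 0).isLinear 0)

lemma exists_chart {B : Set M} (h : IsTopMfdWithBdry (n + 1) M B) (x : M) {W : Set M}
    (hW : W ∈ nhds x) :
    ∃ (p : Fin (n + 1) → ℝ) (r : ℝ) (hp : p ∈ halfBall p r) (φ : C(halfBall p r, M)),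
      0 < r ∧ IsOpenEmbedding φ ∧ φ ⟨p, hp⟩ = x ∧ range φ ⊆ W ∧
      ∀ y, φ y ∈ B ↔ y.1 0 = 0 := by
  obtain ⟨U, V, e, hU, hV, hxU, hB⟩ := h.2 x
  obtain ⟨W', hW', rfl⟩ := isOpen_induced_iff.1 hV
  set p : Fin (n + 1) → ℝ := (e ⟨x, hxU⟩).1.1
  have hcont : Continuous fun v : ↥(Subtype.val ⁻¹' W' : Set (halfSpace (n + 1))) =>
    ((e.symm v).1 : M) := by fun_prop
  have hpre : (fun v : ↥(Subtype.val ⁻¹' W' : Set (halfSpace (n + 1))) =>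
      ((e.symm v).1 : M)) ⁻¹' W ∈ nhds (e ⟨x, hxU⟩) := by
    refine hcont.continuousAt.preimage_mem_nhds ?_
    simpa using hW
  have hind : Topology.IsInducing fun v : ↥(Subtype.val ⁻¹' W' : Set (halfSpace (n + 1))) =>
    v.1.1 := Topology.IsInducing.subtypeVal.comp Topology.IsInducing.subtypeVal
  rw [hind.nhds_eq_comap] at hpre
  obtain ⟨T, hT, hTW⟩ := hpre
  obtain ⟨r, hr, hball⟩ := Metric.mem_nhds_iff.1 (Filter.inter_mem hT (hW'.mem_nhds (e ⟨x, hxU⟩).2))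
  let f : C(halfBall p r, ↥(Subtype.val ⁻¹' W' : Set (halfSpace (n + 1)))) :=
    ⟨fun y => ⟨⟨y.1, mem_halfSpace_iff.2 y.2.2⟩, (hball y.2.1).2⟩, by fun_prop⟩
  have hf : IsOpenEmbedding f := by
    refine ⟨IsEmbedding.of_comp f.continuous hind.continuous IsEmbedding.subtypeVal, ?_⟩
    have : range f = (fun v => v.1.1) ⁻¹' ball p r := by
      ext v
      constructor
      · rintro ⟨y, rfl⟩; exact y.2.1
      · intro hv; exact ⟨⟨v.1.1, hv, mem_halfSpace_iff.1 v.1.2⟩, rfl⟩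
    rw [this]
    exact Metric.isOpen_ball.preimage hind.continuous
  refine ⟨p, r, ⟨by simpa using hr, mem_halfSpace_iff.1 (e ⟨x, hxU⟩).1.2⟩,
    ⟨fun y => (e.symm (f y)).1, by fun_prop⟩, hr, ?_, ?_, ?_, ?_⟩
  · exact hU.isOpenEmbedding_subtypeVal.comp (e.symm.isOpenEmbedding.comp hf)
  · exact congrArg Subtype.val (e.symm_apply_apply ⟨x, hxU⟩)
  · rintro _ ⟨y, rfl⟩
    exact hTW (a := f y) (hball y.2.1).1
  · intro y
    refine (hB (e.symm (f y))).symm.trans ?_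
    rw [e.apply_symm_apply]
    exact ⟨fun h => h 0 rfl, fun h j hj => by obtain rfl : j = 0 := Fin.ext hj; exact h⟩

lemma exists_interior_chart {B : Set M} (h : IsTopMfdWithBdry (n + 1) M B) {x : M} (hx : x ∉ B)
    {W : Set M} (hW : W ∈ nhds x) :
    ∃ (p : Fin (n + 1) → ℝ) (r : ℝ) (hp : p ∈ ball p r) (φ : C(ball p r, M)),
      0 < r ∧ IsOpenEmbedding φ ∧ φ ⟨p, hp⟩ = x ∧ range φ ⊆ W ∩ Bᶜ := by
  obtain ⟨p, r, hp, φ, hr, hφ, hpx, hφW, hB⟩ := exists_chart h x hW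
  have hp0 : 0 < p 0 := hp.2.lt_of_ne fun h0 => hx (hpx ▸ (hB ⟨p, hp⟩).2 h0.symm)
  have hpos : ∀ y ∈ ball p (min r (p 0)), 0 < y 0 := by
    intro y hy
    have h1 : dist (y 0) (p 0) < p 0 :=
      (dist_le_pi_dist y p 0).trans_lt (lt_of_lt_of_le hy (min_le_right _ _))
    rw [Real.dist_eq] at h1
    linarith [(abs_lt.1 h1).1]
  have hr' : 0 < min r (p 0) := lt_min hr hp0
  let ι : C(ball p (min r (p 0)), halfBall p r) :=
    ⟨fun y => ⟨y.1, lt_of_lt_of_le y.2 (min_le_left _ _), (hpos _ y.2).le⟩, by fun_prop⟩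
  have hι : IsOpenEmbedding ι := by
    refine ⟨IsEmbedding.of_comp ι.continuous continuous_subtype_val IsEmbedding.subtypeVal, ?_⟩
    have : range ι = Subtype.val ⁻¹' ball p (min r (p 0)) := by
      ext v
      constructor
      · rintro ⟨y, rfl⟩; exact y.2
      · intro hv; exact ⟨⟨v.1, hv⟩, rfl⟩
    rw [this]
    exact Metric.isOpen_ball.preimage continuous_subtype_val
  refine ⟨p, min r (p 0), Metric.mem_ball_self hr', φ.comp ι, hr', hφ.comp hι, hpx, ?_⟩
  rintro _ ⟨y, rfl⟩
  exact ⟨hφW ⟨_, rfl⟩, fun hy => (hpos _ y.2).ne' ((hB _).1 hy)⟩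

lemma isClosed_mfdBdry {B : Set M} (h : IsTopMfdWithBdry (n + 1) M B) : IsClosed B := by
  rw [← isOpen_compl_iff, isOpen_iff_mem_nhds]
  intro x hx
  obtain ⟨p, r, hp, φ, hr, hφ, rfl, hφW⟩ := exists_interior_chart h hx Filter.univ_mem
  exact Filter.mem_of_superset (hφ.isOpen_range.mem_nhds ⟨_, rfl⟩) fun y hy => (hφW hy).2

/-- A closed chart box around each point outside a closed set `A` containing the boundary. -/
lemma exists_chart_box {B A : Set M} (h : IsTopMfdWithBdry (n + 1) M B) (hA : IsClosed A)
    (hBA : B ⊆ A) {x : M} (hx : x ∉ A) :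
    ∃ Q : Set M, IsCompact Q ∧ Q ∈ nhds x ∧ Q ⊆ Aᶜ ∧
      (∀ Q' ⊆ Q, IsCompact Q' → ∀ (R : Type) [CommRing R], ∀ i, n + 1 ≤ i → Van R M Q'ᶜ i) ∧
      (∀ y ∈ Q, ∀ (R : Type) [CommRing R], ∀ i, ∀ w ∈ relCycles R M Qᶜ i,
        w ∈ relBdries R M {y}ᶜ i → w ∈ relBdries R M Qᶜ i) := by
  have := h.1
  obtain ⟨p, r, hp, φ, hr, hφ, rfl, hφW⟩ :=
    exists_interior_chart h (fun hB => hx (hBA hB)) (hA.isOpen_compl.mem_nhds hx)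
  let ψ : C(ball p r, Fin (n + 1) → ℝ) := ⟨Subtype.val, continuous_subtype_val⟩
  have hψ : IsOpenEmbedding ψ := Metric.isOpen_ball.isOpenEmbedding_subtypeVal
  have hsub : closedBall p (r / 2) ⊆ range ψ := fun y hy =>
    ⟨⟨y, lt_of_le_of_lt (Metric.mem_closedBall.1 hy) (half_lt_self hr)⟩, rfl⟩
  have hQc : IsCompact (ψ ⁻¹' closedBall p (r / 2)) :=
    hψ.isEmbedding.isInducing.isCompact_preimage' (isCompact_closedBall _ _) hsub
  refine ⟨φ '' (ψ ⁻¹' closedBall p (r / 2)), hQc.image φ.continuous, ?_, ?_, ?_, ?_⟩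
  · refine hφ.isOpenMap.image_mem_nhds (ψ.continuous.continuousAt.preimage_mem_nhds ?_)
    exact Metric.closedBall_mem_nhds _ (by linarith)
  · rintro _ ⟨y, _, rfl⟩
    exact (hφW ⟨y, rfl⟩).1
  · intro Q' hQ' hQ'c R _ i hi
    have : Q' = φ '' (φ ⁻¹' Q') := by
      rw [Set.image_preimage_eq_inter_range, Set.inter_eq_left.2]
      exact hQ'.trans (image_subset_range _ _)
    rw [this]
    refine van_chart hφ hψ ?_ hi
    exact hφ.isEmbedding.isInducing.isCompact_preimage' hQ'c (hQ'.trans (image_subset_range _ _))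
  · rintro _ ⟨y, hy, rfl⟩ R _ i w hw hwy
    have hr2 : 0 ≤ r / 2 := by linarith
    rw [closedBall_eq_Icc p hr2] at hy hw hsub ⊢
    exact mem_relBdries_chart_box hφ hψ hsub hy hw hwy

theorem mem_relBdries_of_local {B A : Set M} (h : IsTopMfdWithBdry (n + 1) M B)
    (hA : IsClosed A) (hBA : B ⊆ A) {w : SChain R M (n + 1)} (hw : w ∈ relCycles R M A n)
    (hloc : ∀ x ∉ A, w ∈ relBdries R M {x}ᶜ n) {K : Set M} (hK : IsCompact K)
    (hKA : K ⊆ Aᶜ) : w ∈ relBdries R M Kᶜ n := by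
  have := h.1
  have hbox : ∀ x : M, ∃ Q : Set M, x ∉ A → (IsCompact Q ∧ Q ∈ nhds x ∧ Q ⊆ Aᶜ ∧
      (∀ Q' ⊆ Q, IsCompact Q' → ∀ i, n + 1 ≤ i → Van R M Q'ᶜ i) ∧
      (∀ y ∈ Q, ∀ i, ∀ w ∈ relCycles R M Qᶜ i,
        w ∈ relBdries R M {y}ᶜ i → w ∈ relBdries R M Qᶜ i)) := by
    intro x
    by_cases hx : x ∈ A
    · exact ⟨∅, fun h => (h hx).elim⟩
    · obtain ⟨Q, h1, h2, h3, h4, h5⟩ := exists_chart_box h hA hBA hx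
      exact ⟨Q, fun _ => ⟨h1, h2, h3, fun Q' hQ' hc => h4 Q' hQ' hc R, fun y hy => h5 y hy R⟩⟩
  choose Q hQ using hbox
  have key : ∀ t : Finset M, (∀ x ∈ t, x ∉ A) → w ∈ relBdries R M (⋃ x ∈ t, Q x)ᶜ n := by
    classical
    intro t
    induction t using Finset.induction_on with
    | empty => intro _; simpa using mem_relBdries_of_chainsIn (mem_chainsIn_univ w)
    | insert x t hxt ih =>
      intro ht
      have hxA := ht x (Finset.mem_insert_self x t)
      have htA : ∀ y ∈ t, y ∉ A := fun y hy => ht y (Finset.mem_insert_of_mem hy)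
      obtain ⟨h1, h2, h3, h4, h5⟩ := hQ x hxA
      have htc : IsCompact (⋃ y ∈ t, Q y) := t.isCompact_biUnion fun y hy => (hQ y (htA y hy)).1
      rw [Finset.set_biUnion_insert, Set.compl_union]
      refine mem_relBdries_inter h1.isClosed.isOpen_compl htc.isClosed.isOpen_compl ?_ ?_ (ih htA)
      · rw [← Set.compl_inter]
        exact h4 _ Set.inter_subset_left (h1.inter htc) _ le_rfl
      · exact h5 x (mem_of_mem_nhds h2) _ w
          (relCycles_mono (Set.subset_compl_comm.1 h3) _ hw) (hloc x hxA)
  obtain ⟨t, ht, hcov⟩ := hK.elim_nhds_subcover Q fun x hx => (hQ x (hKA hx)).2.1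
  exact relBdries_mono (compl_subset_compl.2 hcov) _ (key t fun x hx => hKA (ht x hx))

/-- The set of points at which a relative cycle is locally trivial is relatively clopen. -/
lemma mem_relBdries_eventually_iff {B A : Set M} (h : IsTopMfdWithBdry (n + 1) M B)
    (hA : IsClosed A) (hBA : B ⊆ A) {w : SChain R M (n + 1)} (hw : w ∈ relCycles R M A n)
    {x : M} (hx : x ∉ A) :
    ∀ᶠ y in nhds x, (w ∈ relBdries R M {y}ᶜ n ↔ w ∈ relBdries R M {x}ᶜ n) := by
  obtain ⟨Q, h1, h2, h3, h4, h5⟩ := exists_chart_box h hA hBA hx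
  have key : ∀ y ∈ Q, (w ∈ relBdries R M {y}ᶜ n ↔ w ∈ relBdries R M Qᶜ n) := fun y hy =>
    ⟨h5 y hy R _ w (relCycles_mono (Set.subset_compl_comm.1 h3) _ hw),
      fun h => relBdries_mono (compl_subset_compl.2 (singleton_subset_iff.2 hy)) _ h⟩
  filter_upwards [h2] with y hy
  rw [key y hy, key x (mem_of_mem_nhds h2)]

lemma exists_near_interior {p : Fin (n + 1) → ℝ} {r : ℝ} (hr : 0 < r) (hp : 0 ≤ p 0) :
    ∃ y ∈ halfBall p r, 0 < y 0 := by
  refine ⟨p + Pi.single 0 (r / 2), ⟨?_, ?_⟩, ?_⟩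
  · rw [dist_eq_norm, add_sub_cancel_left, Pi.norm_single, Real.norm_of_nonneg (by linarith)]
    linarith
  · simp; linarith
  · simp; linarith

lemma dense_mfdInterior {B : Set M} (h : IsTopMfdWithBdry (n + 1) M B) : Dense Bᶜ := by
  intro x
  rw [mem_closure_iff_nhds]
  intro W hW
  obtain ⟨p, r, hp, φ, hr, hφ, rfl, hφW, hB⟩ := exists_chart h x hW
  obtain ⟨y, hy, hy0⟩ := exists_near_interior hr hp.2
  exact ⟨φ ⟨y, hy⟩, hφW ⟨_, rfl⟩, fun hyB => hy0.ne' ((hB _).1 hyB)⟩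

theorem isPreconnected_mfdInterior {B : Set M} (h : IsTopMfdWithBdry (n + 1) M B)
    [ConnectedSpace M] : IsPreconnected Bᶜ := by
  have hopen := (isClosed_mfdBdry h).isOpen_compl
  rw [isPreconnected_iff_subset_of_disjoint]
  intro u v hu hv huv hdis
  by_contra hcon
  push Not at hcon
  obtain ⟨a, haB, hau⟩ := Set.not_subset.1 hcon.1
  obtain ⟨b, hbB, hbv⟩ := Set.not_subset.1 hcon.2
  have hav : a ∈ Bᶜ ∩ v := ⟨haB, (huv haB).resolve_left hau⟩
  have hbu : b ∈ Bᶜ ∩ u := ⟨hbB, (huv hbB).resolve_right hbv⟩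
  have hcl : closure (Bᶜ ∩ u) ∪ closure (Bᶜ ∩ v) = Set.univ := by
    rw [← closure_union, ← Set.inter_union_distrib_left, Set.inter_eq_left.2 huv,
      (dense_mfdInterior h).closure_eq]
  obtain ⟨x, -, hxu, hxv⟩ := isPreconnected_closed_iff.1 (PreconnectedSpace.isPreconnected_univ
    (α := M)) _ _ isClosed_closure isClosed_closure hcl.ge ⟨b, trivial, subset_closure hbu⟩
    ⟨a, trivial, subset_closure hav⟩
  obtain ⟨p, r, hp, φ, hr, hφ, rfl, -, hB⟩ := exists_chart h x Filter.univ_mem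
  have hnb := hφ.isOpen_range.mem_nhds ⟨⟨p, hp⟩, rfl⟩
  have hC : IsPreconnected (φ '' {y | 0 < y.1 0}) := by
    refine IsPreconnected.image ?_ _ φ.continuous.continuousOn
    have hconv : Convex ℝ (halfBall p r ∩ {y | 0 < y 0}) :=
      (convex_halfBall p r).inter (convex_halfSpace_gt (LinearMap.proj 0).isLinear 0)
    have hpre := hconv.isPreconnected
    have hi := (Topology.IsInducing.subtypeVal (t := halfBall p r)).isPreconnected_image
      (s := {y | 0 < y.1 0})
    rw [← hi]
    convert hpre using 1
    ext y
    constructor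
    · rintro ⟨y, hy, rfl⟩; exact ⟨y.2, hy⟩
    · rintro ⟨h1, h2⟩; exact ⟨⟨y, h1⟩, h2, rfl⟩
  have hCB : φ '' {y | 0 < y.1 0} ⊆ Bᶜ := by
    rintro _ ⟨y, hy, rfl⟩ hyB
    exact hy.ne' ((hB y).1 hyB)
  have hmeet : ∀ s : Set M, φ ⟨p, hp⟩ ∈ closure (Bᶜ ∩ s) → (φ '' {y | 0 < y.1 0} ∩ s).Nonempty := by
    intro s hs
    obtain ⟨_, ⟨y, rfl⟩, hyB, hys⟩ := mem_closure_iff_nhds.1 hs _ hnb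
    exact ⟨φ y, ⟨y, y.2.2.lt_of_ne fun h0 => hyB ((hB y).2 h0.symm), rfl⟩, hys⟩
  obtain ⟨y, hyC, hyu, hyv⟩ := hC u v hu hv (hCB.trans huv) (hmeet u hxu) (hmeet v hxv)
  exact (Set.notMem_empty y) (hdis ▸ ⟨hCB hyC, hyu, hyv⟩)

end Charts

/-! ### Comparison of integral generators -/

section Signs

variable {M N : Type} [TopologicalSpace M] [TopologicalSpace N]

lemma intChain_eq {m : ℕ} (z : SChain ℤ M m) : intChain z = clift (fun σ => sgl ℝ σ) z := by
  have ha : ∀ a b : SChain ℤ M m, intChain (a + b) = intChain a + intChain b := fun a b => by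
    simp only [intChain, map_add]
    rw [Finsupp.mapRange_add (by simp), map_add]
  exact chain_ext z (fun σ => by rw [clift_sgl]; simp [intChain, sgl])
    ⟨ha, map_zsmul (AddMonoidHom.mk' _ ha)⟩

lemma intChain_add {m : ℕ} (a b : SChain ℤ M m) : intChain (a + b) = intChain a + intChain b := by
  simp only [intChain_eq, map_add]

lemma intChain_sub {m : ℕ} (a b : SChain ℤ M m) : intChain (a - b) = intChain a - intChain b := by
  simp only [intChain_eq, map_sub]

lemma intChain_smul {m : ℕ} (k : ℤ) (a : SChain ℤ M m) :
    intChain (k • a) = (k : ℝ) • intChain a := by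
  rw [intChain_eq, intChain_eq, map_zsmul, Int.cast_smul_eq_zsmul]

lemma intChain_mem_chainsIn {m : ℕ} {S : Set M} {a : SChain ℤ M m} (ha : a ∈ chainsIn ℤ M S m) :
    intChain a ∈ chainsIn ℝ M S m := by
  rw [intChain_eq]
  exact map_mem_of_chainsIn _ ((chainsIn ℝ M S m).restrictScalars ℤ)
    (fun σ hσ => by rw [clift_sgl]; exact sgl_mem_chainsIn hσ) ha

lemma bdry_intChain {m : ℕ} (a : SChain ℤ M (m + 1)) :
    bdry ℝ M m (intChain a) = intChain (bdry ℤ M m a) := by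
  simp only [intChain_eq]
  apply chain_ext a
  intro σ
  simp only [clift_sgl, bdry_sgl, map_sum, map_smul]
  refine sum_congr rfl fun i _ => ?_
  rw [← Int.cast_smul_eq_zsmul ℝ]
  simp

lemma push_intChain {m : ℕ} (f : C(N, M)) (a : SChain ℤ N m) :
    push ℝ f m (intChain a) = intChain (push ℤ f m a) := by
  simp only [intChain_eq]
  apply chain_ext a
  intro σ
  simp [push_sgl]

lemma intChain_mem_relBdries {m : ℕ} {S : Set M} {a : SChain ℤ M (m + 1)}
    (ha : a ∈ relBdries ℤ M S m) : intChain a ∈ relBdries ℝ M S m := by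
  obtain ⟨c, u, hu, rfl⟩ := mem_relBdries_iff.1 ha
  rw [intChain_add, ← bdry_intChain]
  exact add_mem (bdry_mem_relBdries _) (mem_relBdries_of_chainsIn (intChain_mem_chainsIn hu))

lemma exists_smul_sub_mem {m : ℕ} {S : Set M} {z : SChain ℤ M (m + 1)} {hz : z ∈ relCycles ℤ M S m}
    (h : ∀ β : relHomology ℤ M S m, ∃ k : ℤ, β = k • relHomClass ⟨z, hz⟩)
    {w : SChain ℤ M (m + 1)} (hw : w ∈ relCycles ℤ M S m) :
    ∃ k : ℤ, w - k • z ∈ relBdries ℤ M S m := by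
  obtain ⟨k, hk⟩ := h (relHomClass ⟨w, hw⟩)
  refine ⟨k, ?_⟩
  have : (relHomClass ⟨w, hw⟩ : relHomology ℤ M S m) = relHomClass (k • ⟨z, hz⟩) := hk
  exact (Submodule.Quotient.eq ((relBdries ℤ M S m).comap (relCycles ℤ M S m).subtype)).1 this

lemma exists_local_sign {O : Type} [TopologicalSpace O] [T1Space M] (f : C(N, M)) (ψ : C(O, N))
    (hφ : IsOpenEmbedding (f.comp ψ)) (y : O) (hy : ∀ y', f y' = f (ψ y) → y' = ψ y)
    {m : ℕ} {z : SChain ℤ M (m + 1)} {zN : SChain ℤ N (m + 1)}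
    (hz : z ∈ relCycles ℤ M {f (ψ y)}ᶜ m) (hzN : zN ∈ relCycles ℤ N {ψ y}ᶜ m)
    (hgen : ∀ w ∈ relCycles ℤ M {f (ψ y)}ᶜ m, ∃ k : ℤ, w - k • z ∈ relBdries ℤ M {f (ψ y)}ᶜ m)
    (hgenN : ∀ w ∈ relCycles ℤ N {ψ y}ᶜ m, ∃ k : ℤ, w - k • zN ∈ relBdries ℤ N {ψ y}ᶜ m) :
    ∃ ε : ℝ, (ε = 1 ∨ ε = -1) ∧
      intChain z - ε • push ℝ f (m + 1) (intChain zN) ∈ relBdries ℝ M {f (ψ y)}ᶜ m := by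
  set x := f (ψ y)
  have hmaps : MapsTo f {ψ y}ᶜ {x}ᶜ := fun y' hy' h => hy' (hy y' h)
  obtain ⟨c, hc, hcz⟩ := excision_surjective hφ isOpen_compl_singleton
    (by rw [compl_compl]; exact singleton_subset_iff.2 ⟨y, rfl⟩) hz
  have hψc : push ℤ ψ (m + 1) c ∈ relCycles ℤ N {ψ y}ᶜ m :=
    push_mem_relCycles ψ (S := (f.comp ψ) ⁻¹' {x}ᶜ) (T := {ψ y}ᶜ) (fun o ho h => ho (congrArg f h)) hc
  obtain ⟨k, hk⟩ := hgenN _ hψc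
  obtain ⟨l, hl⟩ := hgen _ (push_mem_relCycles f hmaps hzN)
  have h1 : z - k • push ℤ f (m + 1) zN ∈ relBdries ℤ M {x}ᶜ m := by
    have h2 := push_mem_relBdries f hmaps hk
    rw [map_sub, push_push, map_zsmul] at h2
    have := add_mem hcz h2
    rwa [sub_add_sub_cancel] at this
  have r1 := intChain_mem_relBdries h1
  have r2 := intChain_mem_relBdries hl
  rw [intChain_sub, intChain_smul, ← push_intChain] at r1 r2
  by_cases hkl : k * l = 1
  · refine ⟨k, ?_, r1⟩
    rcases Int.eq_one_or_neg_one_of_mul_eq_one hkl with rfl | rfl <;> simp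
  · refine ⟨1, Or.inl rfl, ?_⟩
    have h3 : (1 - (k : ℝ) * l) • intChain z ∈ relBdries ℝ M {x}ᶜ m := by
      have := add_mem r1 (Submodule.smul_mem _ (k : ℝ) r2)
      rw [smul_sub, sub_add_sub_cancel, smul_smul] at this
      rwa [sub_smul, one_smul]
    have hne : (1 - (k : ℝ) * l) ≠ 0 := by
      rw [sub_ne_zero]
      exact fun h => hkl (by exact_mod_cast h.symm)
    have h4 : intChain z ∈ relBdries ℝ M {x}ᶜ m := (Submodule.smul_mem_iff _ hne).1 h3
    have h5 : push ℝ f (m + 1) (intChain zN) ∈ relBdries ℝ M {x}ᶜ m := by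
      have := add_mem r2 (Submodule.smul_mem _ (l : ℝ) h4)
      rwa [sub_add_cancel] at this
    rw [one_smul]
    exact sub_mem h4 h5

end Signs

/-! ### The structure of the glued space -/

namespace GluingData

variable {k : ℕ} (D : GluingData k)

/-- The disjoint union of the pieces. -/
abbrev Tot := Σ j, D.piece j

/-- The ends of the gluings. -/
abbrev End := D.E ⊕ D.E

/-- The pieces are compact. -/
abbrev Cpt : Prop := ∀ j, CompactSpace (D.piece j)

/-- The pieces are connected. -/
abbrev Conn : Prop := ∀ j, ConnectedSpace (D.piece j)

/-- The pieces are manifolds with boundary. -/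
abbrev Mfd (n : ℕ) : Prop := ∀ j, IsTopMfdWithBdry (n + 1) (D.piece j) (D.bdry j)

/-- The piece containing a given end of a gluing. -/
def ej : D.End → Fin k
  | Sum.inl e => D.j₁ e
  | Sum.inr e => D.j₂ e

/-- The boundary component at a given end of a gluing. -/
def eS : (a : D.End) → Set (D.piece (D.ej a))
  | Sum.inl e => D.S₁ e
  | Sum.inr e => D.S₂ e

/-- The gluing homeomorphism from one end to the opposite end. -/
def eglue : (a : D.End) → D.eS a ≃ₜ D.eS a.swap
  | Sum.inl e => D.glue e
  | Sum.inr e => (D.glue e).symm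

lemma eS_subset (a : D.End) : D.eS a ⊆ D.bdry (D.ej a) := by
  cases a with
  | inl e => exact D.sub₁ e
  | inr e => exact D.sub₂ e

lemma eS_eq (a : D.End) {s : D.piece (D.ej a)} (hs : s ∈ D.eS a) :
    D.eS a = connectedComponentIn (D.bdry (D.ej a)) s := by
  cases a with
  | inl e =>
    obtain ⟨y, hy, h⟩ := D.comp₁ e
    exact h.trans (connectedComponentIn_eq (h ▸ hs))
  | inr e =>
    obtain ⟨y, hy, h⟩ := D.comp₂ e
    exact h.trans (connectedComponentIn_eq (h ▸ hs))

lemma end_injective :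
    Injective fun a : D.End => (⟨D.ej a, D.eS a⟩ : Σ j : Fin k, Set (D.piece j)) := by
  intro a b h
  refine D.used_inj ?_
  cases a <;> cases b <;> exact h

/-- A boundary point lies on at most one end. -/
lemma end_unique {a b : D.End} {s : D.piece (D.ej a)} {t : D.piece (D.ej b)}
    (hs : s ∈ D.eS a) (ht : t ∈ D.eS b)
    (h : (⟨D.ej a, s⟩ : D.Tot) = ⟨D.ej b, t⟩) : a = b := by
  refine D.end_injective ?_
  have := congrArg (fun p : D.Tot =>
    (⟨p.1, connectedComponentIn (D.bdry p.1) p.2⟩ : Σ j : Fin k, Set (D.piece j))) h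
  simp only at this ⊢
  rw [D.eS_eq a hs, D.eS_eq b ht]
  exact this

/-- Two points of the disjoint union of the pieces are identified by the gluing. -/
def Ident (p q : D.Tot) : Prop :=
  p = q ∨ ∃ (a : D.End) (s : D.eS a), p = ⟨D.ej a, s.1⟩ ∧ q = ⟨D.ej a.swap, (D.eglue a s).1⟩

lemma eglue_eglue (a : D.End) (s : D.eS a) :
    (⟨D.ej a.swap.swap, (D.eglue a.swap (D.eglue a s)).1⟩ : D.Tot) = ⟨D.ej a, s.1⟩ := by
  cases a with
  | inl e =>
    have h := (D.glue e).symm_apply_apply s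
    exact congrArg (fun s' : D.S₁ e => (⟨D.j₁ e, s'.1⟩ : D.Tot)) h
  | inr e =>
    have h := (D.glue e).apply_symm_apply s
    exact congrArg (fun s' : D.S₂ e => (⟨D.j₂ e, s'.1⟩ : D.Tot)) h

lemma ident_equivalence : Equivalence D.Ident where
  refl _ := Or.inl rfl
  symm := by
    rintro p q (rfl | ⟨a, s, rfl, rfl⟩)
    · exact Or.inl rfl
    · exact Or.inr ⟨a.swap, D.eglue a s, rfl, (D.eglue_eglue a s).symm⟩
  trans := by
    rintro p q r (rfl | ⟨a, s, rfl, rfl⟩) (rfl | ⟨b, t, h, rfl⟩)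
    · exact Or.inl rfl
    · exact Or.inr ⟨b, t, h, rfl⟩
    · exact Or.inr ⟨a, s, rfl, rfl⟩
    · obtain rfl := D.end_unique (D.eglue a s).2 t.2 h
      have : D.eglue a s = t := Subtype.ext (sigma_mk_injective h)
      subst this
      exact Or.inl (D.eglue_eglue a s).symm

lemma mk_eq_iff {p q : D.Tot} : (Quot.mk D.rel p = Quot.mk D.rel q) ↔ D.Ident p q := by
  constructor
  · intro h
    refine (D.ident_equivalence.eqvGen_iff).1 ((Quot.eqvGen_exact h).mono ?_)
    rintro a b ⟨e, s, rfl, rfl⟩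
    exact Or.inr ⟨Sum.inl e, s, rfl, rfl⟩
  · rintro (rfl | ⟨a, s, rfl, rfl⟩)
    · rfl
    · cases a with
      | inl e => exact Quot.sound ⟨e, s, rfl, rfl⟩
      | inr e =>
        have h := (D.glue e).apply_symm_apply s
        exact (Quot.sound ⟨e, (D.glue e).symm s, rfl, (congrArg
          (fun s' : D.S₂ e => (⟨D.j₂ e, s'.1⟩ : D.Tot)) h).symm⟩).symm

lemma emb_eglue (a : D.End) (s : D.eS a) :
    D.emb (D.ej a.swap) (D.eglue a s) = D.emb (D.ej a) s :=
  ((D.mk_eq_iff).2 (Or.inr ⟨a, s, rfl, rfl⟩)).symm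

lemma emb_eq_iff {i j : Fin k} {x : D.piece i} {y : D.piece j} :
    D.emb i x = D.emb j y ↔ D.Ident ⟨i, x⟩ ⟨j, y⟩ := D.mk_eq_iff

lemma eq_of_emb_eq {i j : Fin k} {x : D.piece i} {y : D.piece j} (hx : x ∉ D.bdry i)
    (h : D.emb j y = D.emb i x) : (⟨j, y⟩ : D.Tot) = ⟨i, x⟩ := by
  rcases D.emb_eq_iff.1 h with h | ⟨a, s, -, h⟩
  · exact h
  · exfalso
    apply hx
    have hs := D.eS_subset _ (D.eglue a s).2
    obtain ⟨rfl, h2⟩ := Sigma.mk.inj_iff.1 h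
    rw [eq_of_heq h2]
    exact hs

lemma exists_emb (x : D.Glued) : ∃ j y, D.emb j y = x := by
  induction x using Quot.ind with
  | mk p => exact ⟨p.1, p.2, rfl⟩

/-- The union of the images of the boundaries of the pieces. -/
def walls : Set D.Glued := ⋃ j, D.emb j '' D.bdry j

lemma gluedBdry_subset : D.gluedBdry ⊆ D.walls := fun _ hx => hx.1

lemma emb_mem_walls_iff {j : Fin k} {y : D.piece j} : D.emb j y ∈ D.walls ↔ y ∈ D.bdry j := by
  constructor
  · intro h
    obtain ⟨i, x, hx, hxy⟩ := mem_iUnion.1 h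
    by_contra hy
    obtain ⟨rfl, h2⟩ := Sigma.mk.inj_iff.1 (D.eq_of_emb_eq hy hxy)
    exact hy (eq_of_heq h2 ▸ hx)
  · exact fun h => mem_iUnion.2 ⟨j, y, h, rfl⟩

/-- The quotient map onto the glued space. -/
def proj : C(D.Tot, D.Glued) := ⟨fun p => D.emb p.1 p.2, continuous_sigma fun j =>
  (D.emb j).continuous⟩

lemma proj_surjective : Surjective D.proj := fun x => by
  obtain ⟨j, y, h⟩ := D.exists_emb x
  exact ⟨⟨j, y⟩, h⟩

lemma isOpen_iff_preimage {U : Set D.Glued} : IsOpen U ↔ ∀ j, IsOpen (D.emb j ⁻¹' U) := by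
  have h : IsOpen U ↔ IsOpen (Quot.mk D.rel ⁻¹' U) :=
    (isQuotientMap_quot_mk (r := D.rel)).isOpen_preimage.symm
  rw [h, isOpen_sigma_iff]
  rfl

/-- The interior of a piece embeds as an open subset of the glued space. -/
lemma isOpenEmbedding_interior {j : Fin k} (hj : IsClosed (D.bdry j)) :
    IsOpenEmbedding ((D.emb j).comp (subIncl (D.bdry j)ᶜ)) := by
  refine IsOpenEmbedding.of_continuous_injective_isOpenMap (map_continuous _) ?_ ?_
  · intro x y h
    exact Subtype.ext (sigma_mk_injective (D.eq_of_emb_eq y.2 h))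
  · intro W hW
    have hW' : IsOpen (Subtype.val '' W) := hj.isOpen_compl.isOpenMap_subtype_val W hW
    rw [isOpen_iff_preimage]
    intro i
    by_cases hij : i = j
    · subst hij
      convert hW' using 1
      ext x
      constructor
      · rintro ⟨y, hy, hxy⟩
        exact ⟨y, hy, (sigma_mk_injective (D.eq_of_emb_eq y.2 hxy.symm)).symm⟩
      · rintro ⟨y, hy, rfl⟩
        exact ⟨y, hy, rfl⟩
    · convert isOpen_empty
      rw [Set.eq_empty_iff_forall_notMem]
      rintro x ⟨y, hy, hxy⟩
      exact hij (Sigma.mk.inj_iff.1 (D.eq_of_emb_eq y.2 hxy.symm)).1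

end GluingData

/-! ### Pushing a collar into the boundary -/

section Collar

variable {n : ℕ} {M : Type} [TopologicalSpace M]

/-- Lowering the first coordinate near the centre of a half ball. -/
def lowered (p : Fin (n + 1) → ℝ) (r : ℝ) (y : Fin (n + 1) → ℝ) (t : ℝ) : Fin (n + 1) → ℝ :=
  Function.update y 0 (max 0 (y 0 - t * max 0 (r / 2 - dist y p)))

lemma lowered_mem {p : Fin (n + 1) → ℝ} {r : ℝ} (hp : p 0 = 0) {y : Fin (n + 1) → ℝ}
    (hy : y ∈ halfBall p r) (t : I01) : lowered p r y t ∈ halfBall p r := by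
  have hr : 0 < r := dist_nonneg.trans_lt hy.1
  refine ⟨?_, by simp [lowered]⟩
  refine lt_of_le_of_lt ((dist_pi_le_iff dist_nonneg).2 fun j => ?_) hy.1
  by_cases hj : j = 0
  · subst hj
    refine le_trans ?_ (dist_le_pi_dist y p 0)
    have h0 : 0 ≤ t.1 * max 0 (r / 2 - dist y p) := mul_nonneg t.2.1 (le_max_left _ _)
    simp only [lowered, Function.update_self, hp, Real.dist_eq, sub_zero]
    rw [abs_of_nonneg (le_max_left _ _), abs_of_nonneg hy.2]
    exact max_le hy.2 (by linarith)
  · simp only [lowered, Function.update_of_ne hj]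
    exact dist_le_pi_dist y p j

lemma exists_local_collar_push {B : Set M} (h : IsTopMfdWithBdry (n + 1) M B) {x : M} (hx : x ∈ B) :
    ∃ H : C(M × I01, M), (∀ y, H (y, 0) = y) ∧ (∀ y ∈ B, ∀ t, H (y, t) = y) ∧
      ∃ V, IsOpen V ∧ x ∈ V ∧ ∀ y ∈ V, H (y, 1) ∈ B := by
  classical
  have := h.1
  obtain ⟨p, r, hp, φ, hr, hφ, rfl, -, hB⟩ := exists_chart h x Filter.univ_mem
  have hp0 : p 0 = 0 := (hB _).1 hx
  let L : halfBall p r × I01 → halfBall p r := fun z => ⟨lowered p r z.1.1 z.2.1,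
    lowered_mem hp0 z.1.2 z.2⟩
  have hL : Continuous L := .subtype_mk (.update (by fun_prop) 0 (continuous_const.max
    (.sub ((continuous_apply 0).comp (by fun_prop)) (.mul (by fun_prop) (continuous_const.max (by fun_prop)))))) _
  let F : M × I01 → M := fun z => if hz : ∃ y, φ y = z.1 then φ (L (hz.choose, z.2)) else z.1
  have hF : ∀ y t, F (φ y, t) = φ (L (y, t)) := by
    intro y t
    have hz : ∃ y', φ y' = φ y := ⟨y, rfl⟩
    simp only [F, dif_pos hz]
    rw [hφ.injective hz.choose_spec]
  have hfix : ∀ y : halfBall p r, ∀ t, (r / 2 ≤ dist y.1 p ∨ y.1 0 = 0) → L (y, t) = y := by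
    intro y t hy
    refine Subtype.ext ?_
    show lowered p r y.1 t.1 = y.1
    have : max 0 (y.1 0 - t.1 * max 0 (r / 2 - dist y.1 p)) = y.1 0 := by
      rcases hy with hy | hy
      · rw [max_eq_left (a := 0) (b := r / 2 - _) (by linarith), mul_zero, sub_zero,
          max_eq_right y.2.2]
      · rw [hy, zero_sub, max_eq_left]
        exact neg_nonpos.2 (mul_nonneg t.2.1 (le_max_left _ _))
    rw [lowered, this, Function.update_eq_self]
  have hK : IsCompact (φ '' {y | dist y.1 p ≤ r / 2}) := by
    refine IsCompact.image ?_ φ.continuous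
    have hcl : IsCompact (closedBall p (r / 2) ∩ {y : Fin (n + 1) → ℝ | 0 ≤ y 0}) :=
      (isCompact_closedBall p (r / 2)).inter_right
        (isClosed_le continuous_const (continuous_apply 0))
    have := Topology.IsInducing.isCompact_preimage' (f := (Subtype.val : halfBall p r → _))
      Topology.IsInducing.subtypeVal hcl (by
        rintro y ⟨h1, h2⟩
        exact ⟨⟨y, lt_of_le_of_lt (Metric.mem_closedBall.1 h1) (half_lt_self hr), h2⟩, rfl⟩)
    convert this using 1
    ext y
    exact ⟨fun hy => ⟨hy, y.2.2⟩, fun hy => hy.1⟩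
  have hFc : Continuous F := by
    rw [continuous_iff_continuousAt]
    rintro ⟨z, t⟩
    by_cases hz : z ∈ range φ
    · obtain ⟨y, rfl⟩ := hz
      have he : IsOpenEmbedding (Prod.map φ (id : I01 → I01)) := hφ.prodMap IsOpenEmbedding.id
      have : ContinuousAt (F ∘ Prod.map φ (id : I01 → I01)) (y, t) := by
        have h1 : F ∘ Prod.map φ (id : I01 → I01) = fun z => φ (L z) := by ext ⟨y, t⟩; exact hF y t
        rw [h1]
        fun_prop
      exact he.continuousAt_iff.1 this
    · have hopen : IsOpen (Prod.fst ⁻¹' (φ '' {y | dist y.1 p ≤ r / 2})ᶜ : Set (M × I01)) :=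
        hK.isClosed.isOpen_compl.preimage continuous_fst
      have hev : F =ᶠ[nhds (z, t)] Prod.fst := by
        filter_upwards [hopen.mem_nhds (show (z, t) ∈ _ from fun ⟨y, _, hy⟩ => hz ⟨y, hy⟩)]
        rintro ⟨w, s⟩ hw
        by_cases hwr : w ∈ range φ
        · obtain ⟨y, rfl⟩ := hwr
          rw [hF, hfix y s (Or.inl (le_of_lt (not_le.1 fun hle => hw ⟨y, hle, rfl⟩)))]
        · exact dif_neg hwr
      exact continuousAt_fst.congr hev.symm
  refine ⟨⟨F, hFc⟩, ?_, ?_, φ '' {y | y.1 0 < r / 2 - dist y.1 p}, ?_, ?_, ?_⟩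
  · intro z
    by_cases hz : z ∈ range φ
    · obtain ⟨y, rfl⟩ := hz
      show F (φ y, 0) = φ y
      rw [hF]
      congr 1
      refine Subtype.ext ?_
      show lowered p r y.1 ((0 : I01) : ℝ) = y.1
      have h0 : ((0 : I01) : ℝ) = 0 := rfl
      rw [lowered, h0, zero_mul, sub_zero, max_eq_right y.2.2, Function.update_eq_self]
    · exact dif_neg hz
  · intro z hz t
    by_cases hzr : z ∈ range φ
    · obtain ⟨y, rfl⟩ := hzr
      show F (φ y, t) = φ y
      rw [hF, hfix y t (Or.inr ((hB y).1 hz))]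
    · exact dif_neg hzr
  · exact hφ.isOpenMap _ (isOpen_lt ((continuous_apply 0).comp continuous_subtype_val)
      (continuous_const.sub (continuous_subtype_val.dist continuous_const)))
  · exact ⟨⟨p, hp⟩, by simp [hp0, hr], rfl⟩
  · rintro _ ⟨y, hy, rfl⟩
    show F (φ y, 1) ∈ B
    rw [hF, hB]
    show lowered p r y.1 ((1 : I01) : ℝ) 0 = 0
    have h1 : ((1 : I01) : ℝ) = 1 := rfl
    have h2 : y.1 0 < r / 2 - dist y.1 p := hy
    rw [lowered, Function.update_self, h1, one_mul, max_eq_left]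
    have := le_max_right 0 (r / 2 - dist y.1 p)
    linarith

/-- A homotopy fixing the boundary which pushes a neighbourhood of it into it. -/
theorem exists_collar_push {B : Set M} (h : IsTopMfdWithBdry (n + 1) M B) [CompactSpace M] :
    ∃ H : C(M × I01, M), (∀ y, H (y, 0) = y) ∧ (∀ y ∈ B, ∀ t, H (y, t) = y) ∧
      ∃ V, IsOpen V ∧ B ⊆ V ∧ ∀ y ∈ V, H (y, 1) ∈ B := by
  simpa only [Set.inter_self] using (isClosed_mfdBdry h).isCompact.induction_on
    (p := fun s => ∃ H : C(M × I01, M), (∀ y, H (y, 0) = y) ∧ (∀ y ∈ B, ∀ t, H (y, t) = y) ∧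
      ∃ V, IsOpen V ∧ s ∩ B ⊆ V ∧ ∀ y ∈ V, H (y, 1) ∈ B)
    ⟨⟨Prod.fst, continuous_fst⟩, fun _ => rfl, fun _ _ _ => rfl, ∅, isOpen_empty, by simp,
      fun y hy => hy.elim⟩
    (fun s t hst ⟨H, h0, hB, V, hV, ht, h1⟩ =>
      ⟨H, h0, hB, V, hV, (Set.inter_subset_inter_left _ hst).trans ht, h1⟩)
    (fun s t ⟨G, hG0, hGB, W, hW, hsW, hWB⟩ ⟨H, hH0, hHB, V, hV, htV, hVB⟩ => by
      refine ⟨⟨fun z => H (G z, z.2), by fun_prop⟩, fun y => ?_, fun y hy t => ?_,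
        W ∪ (fun y => G (y, 1)) ⁻¹' V, hW.union (hV.preimage (by fun_prop)), ?_, ?_⟩
      · simp [hG0, hH0]
      · simp [hGB y hy, hHB y hy]
      · rintro y ⟨hy | hy, hyB⟩
        · exact Or.inl (hsW ⟨hy, hyB⟩)
        · exact Or.inr (by simpa [hGB y hyB] using htV ⟨hy, hyB⟩)
      · rintro y (hy | hy)
        · simpa [hHB _ (hWB y hy)] using hWB y hy
        · exact hVB _ hy)
    fun x hx => by
      obtain ⟨H, h1, h2, V, h3, h4, h5⟩ := exists_local_collar_push h hx
      exact ⟨V, mem_nhdsWithin_of_mem_nhds (h3.mem_nhds h4), H, h1, h2, V, h3,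
        Set.inter_subset_left, h5⟩

end Collar

/-! ### Comparison of fundamental cycles -/

lemma eq_zero_of_relBdries {M : Type} [TopologicalSpace M] {A : Set M} {n : ℕ}
    {β : SChain ℝ M (n + 1) →ₗ[ℝ] ℝ} (hβ : ∀ c, β (bdry ℝ M (n + 1) c) = 0)
    (hβA : ∀ c ∈ chainsIn ℝ M A (n + 1), β c = 0) {w : SChain ℝ M (n + 1)}
    (hw : w ∈ relBdries ℝ M A n) : β w = 0 := by
  obtain ⟨a, u, hu, rfl⟩ := mem_relBdries_iff.1 hw
  rw [map_add, hβ, hβA u hu, add_zero]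

lemma eq_of_relHomClass_eq {M : Type} [TopologicalSpace M] {A : Set M} {n : ℕ}
    {β : SChain ℝ M (n + 1) →ₗ[ℝ] ℝ} (hβ : ∀ c, β (bdry ℝ M (n + 1) c) = 0)
    (hβA : ∀ c ∈ chainsIn ℝ M A (n + 1), β c = 0) {c c' : relCycles ℝ M A n}
    (h : relHomClass c = relHomClass c') : β c = β c' := by
  have h1 : c.1 - c'.1 ∈ relBdries ℝ M A n := (Submodule.Quotient.eq
    ((relBdries ℝ M A n).comap (relCycles ℝ M A n).subtype)).1 h
  have := eq_zero_of_relBdries hβ hβA h1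
  rw [map_sub] at this
  exact sub_eq_zero.1 this

namespace GluingData

variable {k : ℕ} (D : GluingData k) {n : ℕ}

lemma compactSpace_glued (hcomp : D.Cpt) : CompactSpace D.Glued := by
  have : CompactSpace D.Tot := inferInstance
  exact D.proj_surjective.compactSpace D.proj.continuous

lemma isClosed_walls [T2Space D.Glued] (hcomp : D.Cpt)
    (hb : ∀ j, IsClosed (D.bdry j)) : IsClosed D.walls :=
  isClosed_iUnion_of_finite fun j => ((hb j).isCompact.image (D.emb j).continuous).isClosed

theorem exists_collar_push_glued [T2Space D.Glued] (hcomp : D.Cpt) (hmfd : D.Mfd n) :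
    ∃ H : C(D.Glued × I01, D.Glued), (∀ y, H (y, 0) = y) ∧ (∀ y ∈ D.walls, ∀ t, H (y, t) = y) ∧
      ∃ V, IsOpen V ∧ D.walls ⊆ V ∧ ∀ y ∈ V, H (y, 1) ∈ D.walls := by
  choose H hH0 hHB V hV hBV hVB using fun j => exists_collar_push (hmfd j)
  let q : C(D.Tot × I01, D.Glued × I01) := D.proj.prodMap (ContinuousMap.id I01)
  have hq : Topology.IsQuotientMap q := by
    refine q.continuous.isClosedMap.isQuotientMap q.continuous ?_
    exact D.proj_surjective.prodMap Function.surjective_id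
  let g : C(D.Tot × I01, D.Glued) := ⟨fun z => D.emb z.1.1 (H z.1.1 (z.1.2, z.2)), by
      have h1 : Continuous fun w : Σ j, D.piece j × I01 => D.emb w.1 (H w.1 w.2) :=
        continuous_sigma fun j => (D.emb j).continuous.comp (H j).continuous
      exact h1.comp Homeomorph.sigmaProdDistrib.continuous⟩
  have hg : ∀ a b, q a = q b → g a = g b := by
    rintro ⟨p, s⟩ ⟨p', s'⟩ hab
    have h1 : D.proj p = D.proj p' := congrArg Prod.fst hab
    obtain rfl : s = s' := congrArg Prod.snd hab
    rcases (D.mk_eq_iff (p := p) (q := p')).1 h1 with rfl | ⟨a, t, rfl, rfl⟩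
    · rfl
    · show D.emb _ (H _ (_, s)) = D.emb _ (H _ (_, s))
      rw [hHB _ _ (D.eS_subset a t.2), hHB _ _ (D.eS_subset _ (D.eglue a t).2), D.emb_eglue]
  have hlift : ∀ j y t, hq.lift g hg (D.emb j y, t) = D.emb j (H j (y, t)) := by
    intro j y t
    exact DFunLike.congr_fun (hq.lift_comp g hg) (⟨j, y⟩, t)
  refine ⟨hq.lift g hg, ?_, ?_, (D.proj '' {p | p.2 ∉ V p.1})ᶜ, ?_, ?_, ?_⟩
  · intro x
    obtain ⟨j, y, rfl⟩ := D.exists_emb x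
    rw [hlift, hH0]
  · intro x hx t
    obtain ⟨j, y, hy, rfl⟩ := mem_iUnion.1 hx
    rw [hlift, hHB j y hy]
  · rw [isOpen_compl_iff]
    refine D.proj.continuous.isClosedMap _ ?_
    rw [← isOpen_compl_iff, isOpen_sigma_iff]
    intro j
    convert hV j using 1
    ext y
    simp
  · rintro x hx ⟨⟨j, y⟩, hy, rfl⟩
    exact hy (hBV j (D.emb_mem_walls_iff.1 hx))
  · intro x hx
    obtain ⟨j, y, rfl⟩ := D.exists_emb x
    rw [hlift]
    refine D.emb_mem_walls_iff.2 (hVB j y ?_)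
    by_contra hy
    exact hx ⟨⟨j, y⟩, hy, rfl⟩

lemma exists_piece_sign [T2Space D.Glued] (hcomp : D.Cpt) (j : Fin k) [ConnectedSpace (D.piece j)]
    (hmfd : D.Mfd n)
    (hgmfd : IsTopMfdWithBdry (n + 1) D.Glued D.gluedBdry)
    {z : SChain ℤ D.Glued (n + 1)}
    (hzr : intChain z ∈ relCycles ℝ _ D.gluedBdry n)
    (hgen : ∀ x ∈ D.gluedBdryᶜ, ∃ hloc : z ∈ relCycles ℤ _ ({x}ᶜ) n,
      ∀ β : relHomology ℤ D.Glued ({x}ᶜ) n, ∃ k : ℤ, β = k • relHomClass ⟨z, hloc⟩)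
    {zj : SChain ℤ (D.piece j) (n + 1)}
    (hzjr : intChain zj ∈ relCycles ℝ _ (D.bdry j) n)
    (hgenj : ∀ x ∈ (D.bdry j)ᶜ, ∃ hloc : zj ∈ relCycles ℤ _ ({x}ᶜ) n,
      ∀ β : relHomology ℤ (D.piece j) ({x}ᶜ) n, ∃ k : ℤ, β = k • relHomClass ⟨zj, hloc⟩) :
    ∃ ε : ℝ, (ε = 1 ∨ ε = -1) ∧ ∀ y ∉ D.bdry j,
      intChain z - ε • push ℝ (D.emb j) (n + 1) (intChain zj) ∈ relBdries ℝ _ {D.emb j y}ᶜ n := by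
  have hbc : ∀ j, IsClosed (D.bdry j) := fun j => isClosed_mfdBdry (hmfd j)
  have hA := D.isClosed_walls hcomp hbc
  set P : ℝ → D.piece j → Prop := fun ε y =>
    intChain z - ε • push ℝ (D.emb j) (n + 1) (intChain zj) ∈ relBdries ℝ _ {D.emb j y}ᶜ n
  have hcyc : ∀ ε : ℝ, intChain z - ε • push ℝ (D.emb j) (n + 1) (intChain zj) ∈
      relCycles ℝ _ D.walls n := fun ε =>
    sub_mem (relCycles_mono D.gluedBdry_subset _ hzr) (Submodule.smul_mem _ _
      (push_mem_relCycles _ (fun y hy => D.emb_mem_walls_iff.2 hy) hzjr))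
  have hloc : ∀ ε : ℝ, ∀ y ∉ D.bdry j, ∀ᶠ y' in nhds y, (P ε y' ↔ P ε y) := fun ε y hy =>
    (D.emb j).continuous.continuousAt.eventually (mem_relBdries_eventually_iff hgmfd hA
      D.gluedBdry_subset (hcyc ε) (fun h => hy (D.emb_mem_walls_iff.1 h)))
  have hor : ∀ y ∉ D.bdry j, P 1 y ∨ P (-1) y := by
    intro y hy
    have hyg : D.emb j y ∉ D.gluedBdry := fun h => hy (D.emb_mem_walls_iff.1 (D.gluedBdry_subset h))
    obtain ⟨h1, h2⟩ := hgen _ hyg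
    obtain ⟨h3, h4⟩ := hgenj y hy
    obtain ⟨ε, rfl | rfl, h⟩ := exists_local_sign (D.emb j) (subIncl (D.bdry j)ᶜ)
      (D.isOpenEmbedding_interior (hbc j)) ⟨y, hy⟩
      (fun y' h => sigma_mk_injective (D.eq_of_emb_eq hy h)) h1 h3
      (fun w hw => exists_smul_sub_mem h2 hw) (fun w hw => exists_smul_sub_mem h4 hw)
    · exact Or.inl h
    · exact Or.inr h
  have hpre := isPreconnected_mfdInterior (hmfd j)
  rw [isPreconnected_iff_subset_of_disjoint] at hpre
  have hopen : ∀ Q : Prop → Prop, IsOpen {y | y ∉ D.bdry j ∧ Q (P 1 y)} := by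
    intro Q
    rw [isOpen_iff_mem_nhds]
    rintro y ⟨hy, hPy⟩
    filter_upwards [(hbc j).isOpen_compl.mem_nhds hy, hloc 1 y hy] with y' h1 h2
    exact ⟨h1, (propext h2) ▸ hPy⟩
  rcases hpre _ _ (hopen id) (hopen Not) (fun y hy => by
      by_cases h : P 1 y
      · exact Or.inl ⟨hy, h⟩
      · exact Or.inr ⟨hy, h⟩)
    (Set.eq_empty_of_forall_notMem fun y hy => hy.2.2.2 hy.2.1.2) with h | h
  · exact ⟨1, Or.inl rfl, fun y hy => (h hy).2⟩
  · exact ⟨-1, Or.inr rfl, fun y hy => (hor y hy).resolve_left (h hy).2⟩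

/-- Up to signs, a fundamental cycle of the glued manifold is the sum of fundamental cycles of the
pieces, as seen by cocycles vanishing on the walls. -/
theorem exists_signs (hcomp : D.Cpt) (hconn : D.Conn) (hmfd : D.Mfd n)
    (hgmfd : IsTopMfdWithBdry (n + 1) D.Glued D.gluedBdry)
    {μ : relHomology ℝ D.Glued D.gluedBdry n} (hμ : IsFundClass D.Glued D.gluedBdry n μ)
    {μp : ∀ j, relHomology ℝ (D.piece j) (D.bdry j) n}
    (hμp : ∀ j, IsFundClass (D.piece j) (D.bdry j) n (μp j)) :
    ∃ ε : Fin k → ℝ, (∀ j, ε j = 1 ∨ ε j = -1) ∧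
      ∀ β : SChain ℝ D.Glued (n + 1) →ₗ[ℝ] ℝ, (∀ c, β (BddCoh.bdry ℝ _ (n + 1) c) = 0) →
      (∀ c ∈ chainsIn ℝ _ D.walls (n + 1), β c = 0) →
      ∀ c : relCycles ℝ D.Glued D.gluedBdry n, relHomClass c = μ →
      ∀ cp : ∀ j, relCycles ℝ (D.piece j) (D.bdry j) n, (∀ j, relHomClass (cp j) = μp j) →
      β c = ∑ j, ε j * β (push ℝ (D.emb j) (n + 1) (cp j)) := by
  have hT2 := hgmfd.1
  have hcG := D.compactSpace_glued hcomp
  obtain ⟨z, hz, ⟨hzr, hzμ⟩, hgen⟩ := hμ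
  have hμp' := hμp
  choose zp hzp hzpr' hgenp using hμp'
  choose hzpr hzpμ using hzpr'
  choose ε hε hεloc using fun j =>
    have := hconn j
    D.exists_piece_sign hcomp j hmfd hgmfd hzr hgen (hzpr j) (hgenp j)
  refine ⟨ε, hε, fun β hβ hβA c hc cp hcp => ?_⟩
  have hA := D.isClosed_walls hcomp fun j => isClosed_mfdBdry (hmfd j)
  set w := intChain z - ∑ j, ε j • push ℝ (D.emb j) (n + 1) (intChain (zp j)) with hw
  have hmaps : ∀ j, MapsTo (D.emb j) (D.bdry j) D.walls := fun j y hy => D.emb_mem_walls_iff.2 hy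
  have hwc : w ∈ relCycles ℝ _ D.walls n :=
    sub_mem (relCycles_mono D.gluedBdry_subset _ hzr) (sum_mem fun j _ =>
      Submodule.smul_mem _ _ (push_mem_relCycles _ (hmaps j) (hzpr j)))
  have hloc : ∀ x ∉ D.walls, w ∈ relBdries ℝ _ {x}ᶜ n := by
    intro x hx
    obtain ⟨j, y, rfl⟩ := D.exists_emb x
    have hy : y ∉ D.bdry j := fun h => hx (D.emb_mem_walls_iff.2 h)
    have : w = (intChain z - ε j • push ℝ (D.emb j) (n + 1) (intChain (zp j))) -
        ∑ i ∈ univ.erase j, ε i • push ℝ (D.emb i) (n + 1) (intChain (zp i)) := by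
      rw [hw, ← Finset.add_sum_erase _ _ (mem_univ j)]
      abel
    rw [this]
    refine sub_mem (hεloc j y hy) (sum_mem fun i hi =>
      Submodule.smul_mem _ _ (mem_relBdries_of_chainsIn (chainsIn_mono ?_ _
        (push_mem_chainsIn_range _ _))))
    rintro _ ⟨y', rfl⟩ h
    exact Finset.ne_of_mem_erase hi (Sigma.mk.inj_iff.1 (D.eq_of_emb_eq hy h)).1
  have hw0 : β w = 0 := by
    obtain ⟨H, hH0, hHA, V, hV, hAV, hVA⟩ := D.exists_collar_push_glued hcomp hmfd
    have hK := mem_relBdries_of_local hgmfd hA D.gluedBdry_subset hwc hloc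
      (K := Vᶜ) hV.isClosed_compl.isCompact (compl_subset_compl.2 hAV)
    rw [compl_compl] at hK
    let g : C(D.Glued, D.Glued) := ⟨fun x => H (x, 1), by fun_prop⟩
    have h1 := eq_zero_of_relBdries hβ hβA (push_sub_mem_relBdries H g hH0 (fun _ => rfl)
      (fun x hx t => by rw [hHA x hx]; exact hx) hwc)
    have h2 := eq_zero_of_relBdries hβ hβA (push_mem_relBdries g (fun x hx => hVA x hx) hK)
    rw [map_sub, h2, zero_sub, neg_eq_zero] at h1
    exact h1
  have h1 : β c = β (intChain z) := eq_of_relHomClass_eq hβ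
    (fun c hc => hβA c (chainsIn_mono D.gluedBdry_subset _ hc))
    (c := c) (c' := ⟨_, hzr⟩) (hc.trans hzμ.symm)
  have h2 : ∀ j, β (push ℝ (D.emb j) (n + 1) (cp j)) =
      β (push ℝ (D.emb j) (n + 1) (intChain (zp j))) := fun j =>
    eq_of_relHomClass_eq (β := β.comp (push ℝ (D.emb j) (n + 1)))
      (fun c => by rw [comp_apply, ← push_bdry, hβ])
      (fun c hc => hβA _ (push_mem_chainsIn _ (hmaps j) hc))
      (c := cp j) (c' := ⟨_, hzpr j⟩) ((hcp j).trans (hzpμ j).symm)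
  rw [hw, map_sub, map_sum, sub_eq_zero] at hw0
  rw [h1, hw0]
  refine sum_congr rfl fun j _ => ?_
  rw [map_smul, smul_eq_mul, h2]

end GluingData

/-! ### Means -/

/-- A finitely additive mean on a type; it is a linear functional on all functions, which is only
meaningful on bounded ones. -/
structure Mean (α : Type) where
  E : (α → ℝ) →ₗ[ℝ] ℝ
  const : ∀ c : ℝ, E (fun _ => c) = c
  bound : ∀ (f : α → ℝ) (C : ℝ), (∀ a, |f a| ≤ C) → |E f| ≤ C

namespace Mean

variable {α β : Type}

/-- The push-forward of a mean. -/
def map (g : α → β) (M : Mean α) : Mean β where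
  E := M.E.comp (LinearMap.funLeft ℝ ℝ g)
  const c := M.const c
  bound _ C h := M.bound _ C fun a => h (g a)

@[simp] lemma map_E (g : α → β) (M : Mean α) (f : β → ℝ) : (M.map g).E f = M.E fun a => f (g a) :=
  rfl

lemma E_add (M : Mean α) (f g : α → ℝ) : M.E (fun a => f a + g a) = M.E f + M.E g := M.E.map_add f g

lemma E_mul (M : Mean α) (c : ℝ) (f : α → ℝ) : M.E (fun a => c * f a) = c * M.E f :=
  M.E.map_smul c f

lemma E_sum (M : Mean α) {ι : Type} (s : Finset ι) (f : ι → α → ℝ) :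
    M.E (fun a => ∑ i ∈ s, f i a) = ∑ i ∈ s, M.E (f i) := by
  rw [← map_sum]
  congr 1
  ext a
  simp

/-- The iterated mean. -/
def iter : (n : ℕ) → (Fin n → Mean α) → Mean (Fin n → α)
  | 0, _ =>
    ⟨LinearMap.proj fun i => i.elim0, fun _ => rfl, fun _ _ h => h _⟩
  | n + 1, M =>
    { E :=
        { toFun := fun f => (M 0).E fun a => (iter n fun i => M i.succ).E fun w => f (Fin.cons a w)
          map_add' := fun f g => by
            rw [← E_add]
            congr 1
            ext a
            exact E_add _ _ _
          map_smul' := fun c f => by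
            refine Eq.trans ?_ (E_mul _ c _)
            congr 1
            ext a
            exact E_mul _ c _ }
      const := fun c => by
        show (M 0).E (fun _ => (iter n _).E fun _ => c) = c
        simp only [(iter n _).const, (M 0).const]
      bound := fun f C h => (M 0).bound _ C fun a => (iter n _).bound _ C fun w => h _ }

lemma iter_zero (M : Fin 0 → Mean α) (f : (Fin 0 → α) → ℝ) (w : Fin 0 → α) :
    (iter 0 M).E f = f w := congrArg f (Subsingleton.elim _ _)

lemma iter_succ {n : ℕ} (M : Fin (n + 1) → Mean α) (f : (Fin (n + 1) → α) → ℝ) :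
    (iter (n + 1) M).E f = (M 0).E fun a => (iter n fun i => M i.succ).E
      fun w => f (Fin.cons a w) := rfl

/-- An iterated mean of a function not depending on one of the variables. -/
lemma iter_removeNth {n : ℕ} (M : Fin (n + 1) → Mean α) (i : Fin (n + 1)) (f : (Fin n → α) → ℝ) :
    (iter (n + 1) M).E (fun w => f fun j => w (i.succAbove j)) =
      (iter n fun j => M (i.succAbove j)).E f := by
  induction n with
  | zero =>
    obtain rfl : i = 0 := Fin.ext (by omega)
    rw [iter_succ]
    refine Eq.trans ?_ ((M 0).const ((iter 0 fun j => M (Fin.succAbove 0 j)).E f))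
    congr 1
  | succ n ih =>
    induction i using Fin.cases with
    | zero =>
      rw [iter_succ]
      exact (M 0).const ((iter (n + 1) fun j => M (Fin.succAbove 0 j)).E f)
    | succ i =>
      rw [iter_succ, iter_succ]
      simp only [Fin.succ_succAbove_zero, Fin.succ_succAbove_succ]
      congr 1
      ext a
      rw [← ih (fun j => M j.succ) i (fun w => f (Fin.cons a w))]
      congr 1
      ext w
      congr 1
      ext j
      induction j using Fin.cases with
      | zero => simp
      | succ j => simp

/-- An iterated mean of a bounded function only depends on the values of the means on bounded
functions. -/
lemma iter_congr {n : ℕ} (M M' : Fin n → Mean α)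
    (hM : ∀ i (f : α → ℝ) (C : ℝ), (∀ a, |f a| ≤ C) → (M i).E f = (M' i).E f)
    (f : (Fin n → α) → ℝ) (C : ℝ) (hf : ∀ w, |f w| ≤ C) : (iter n M).E f = (iter n M').E f := by
  induction n with
  | zero => rfl
  | succ n ih =>
    rw [iter_succ, iter_succ, hM 0 _ C fun a => (iter n _).bound _ C fun w => hf _]
    congr 1
    ext a
    exact ih _ _ (fun i => hM i.succ) _ fun w => hf _

/-- Change of variables in an iterated mean. -/
lemma iter_map {n : ℕ} (M : Fin n → Mean α) (T : α → β) (f : (Fin n → β) → ℝ) :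
    (iter n fun i => (M i).map T).E f = (iter n M).E fun w => f fun i => T (w i) := by
  induction n with
  | zero => exact congrArg f (Subsingleton.elim _ _)
  | succ n ih =>
    rw [iter_succ, iter_succ, map_E]
    congr 1
    ext a
    rw [ih]
    congr 1
    ext w
    congr 1
    ext i
    induction i using Fin.cases with
    | zero => rfl
    | succ i => rfl

/-- The functions bounded by some constant. -/
def bdd (α : Type) : Submodule ℝ (α → ℝ) where
  carrier := {f | ∃ C, ∀ a, |f a| ≤ C}
  zero_mem' := ⟨0, fun a => by simp⟩
  add_mem' := by
    rintro f g ⟨C, hC⟩ ⟨D, hD⟩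
    exact ⟨C + D, fun a => (abs_add_le _ _).trans (add_le_add (hC a) (hD a))⟩
  smul_mem' := by
    rintro c f ⟨C, hC⟩
    refine ⟨|c| * C, fun a => ?_⟩
    rw [Pi.smul_apply, smul_eq_mul, abs_mul]
    exact mul_le_mul_of_nonneg_left (hC a) (abs_nonneg _)

lemma exists_le_sublinear (N : (α → ℝ) → ℝ) (hhom : ∀ f ∈ bdd α, ∀ c, 0 < c → N (c • f) = c * N f)
    (hadd : ∀ f ∈ bdd α, ∀ g ∈ bdd α, N (f + g) ≤ N f + N g)
    (hle : ∀ f ∈ bdd α, ∀ C, (∀ a, f a ≤ C) → N f ≤ C) :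
    ∃ M : Mean α, ∀ f ∈ bdd α, M.E f ≤ N f := by
  have hN0 : 0 ≤ N 0 := by
    have := hadd 0 (Submodule.zero_mem _) 0 (Submodule.zero_mem _)
    rw [add_zero] at this
    linarith
  obtain ⟨g, -, hg⟩ := exists_extension_of_le_sublinear (⟨⊥, 0⟩ : bdd α →ₗ.[ℝ] ℝ)
    (fun f => N f.1) (fun c hc f => hhom f.1 f.2 c hc) (fun f g => hadd f.1 f.2 g.1 g.2)
    (fun x => by
      have hx : (x : bdd α) = 0 := (mem_bot ℝ).1 x.2
      show (0 : ℝ) ≤ N ((x : bdd α) : α → ℝ)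
      rw [hx]
      exact hN0)
  obtain ⟨G, hG⟩ := LinearMap.exists_extend g
  have hG' : ∀ f (hf : f ∈ bdd α), G f ≤ N f := fun f hf => by
    have : G f = g ⟨f, hf⟩ := DFunLike.congr_fun hG ⟨f, hf⟩
    rw [this]
    exact hg ⟨f, hf⟩
  have hup : ∀ f ∈ bdd α, ∀ C, (∀ a, f a ≤ C) → G f ≤ C := fun f hf C h =>
    (hG' f hf).trans (hle f hf C h)
  have hlo : ∀ f ∈ bdd α, ∀ C, (∀ a, C ≤ f a) → C ≤ G f := fun f hf C h => by
    have := hup (-f) (neg_mem hf) (-C) fun a => neg_le_neg (h a)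
    rw [map_neg] at this
    linarith
  refine ⟨⟨G, fun c => ?_, fun f C h => ?_⟩, hG'⟩
  · have hc : (fun _ => c : α → ℝ) ∈ bdd α := ⟨|c|, fun _ => le_rfl⟩
    exact le_antisymm (hup _ hc c fun _ => le_rfl) (hlo _ hc c fun _ => le_rfl)
  · have hf : f ∈ bdd α := ⟨C, h⟩
    exact abs_le.2 ⟨hlo f hf _ fun a => (abs_le.1 (h a)).1, hup f hf _ fun a => (abs_le.1 (h a)).2⟩

open scoped Pointwise in
/-- Construction of means from upper integrals. -/
lemma exists_le_upper (S : (α → ℝ) → Set ℝ)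
    (hsum : ∀ f g c d, c ∈ S f → d ∈ S g → c + d ∈ S (f + g))
    (hsc : ∀ (c : ℝ), 0 < c → ∀ f x, x ∈ S f → c * x ∈ S (c • f))
    (hup : ∀ f C, (∀ a, f a ≤ C) → C ∈ S f)
    (hlow : ∀ f C, (∀ a, C ≤ f a) → ∀ c ∈ S f, C ≤ c) :
    ∃ M : Mean α, ∀ f ∈ bdd α, ∀ c ∈ S f, M.E f ≤ c := by
  have hbb : ∀ f ∈ bdd α, BddBelow (S f) := by
    rintro f ⟨C, hC⟩
    exact ⟨-C, fun c hc => hlow f (-C) (fun a => (abs_le.1 (hC a)).1) c hc⟩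
  have hne : ∀ f ∈ bdd α, (S f).Nonempty := by
    rintro f ⟨C, hC⟩
    exact ⟨C, hup f C fun a => (abs_le.1 (hC a)).2⟩
  obtain ⟨M, hM⟩ := exists_le_sublinear (fun f => sInf (S f)) (by
    intro f hf c hc
    have : S (c • f) = (fun x => c * x) '' S f := by
      ext x
      constructor
      · intro h
        have := hsc c⁻¹ (inv_pos.2 hc) _ _ h
        rw [inv_smul_smul₀ hc.ne'] at this
        exact ⟨_, this, mul_inv_cancel_left₀ hc.ne' x⟩
      · rintro ⟨y, hy, rfl⟩
        exact hsc c hc _ _ hy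
    rw [this]
    exact (Real.sInf_smul_of_nonneg hc.le (S f))) (by
    intro f hf g hg
    refine le_of_forall_pos_lt_add fun ε hε => ?_
    obtain ⟨c, hc, hcε⟩ := exists_lt_of_csInf_lt (hne f hf) (lt_add_of_pos_right _ (half_pos hε))
    obtain ⟨d, hd, hdε⟩ := exists_lt_of_csInf_lt (hne g hg) (lt_add_of_pos_right _ (half_pos hε))
    have := csInf_le (hbb _ (add_mem hf hg)) (hsum f g c d hc hd)
    linarith) (fun f hf C h => csInf_le (hbb f hf) (hup f C h))
  exact ⟨M, fun f hf c hc => (hM f hf).trans (csInf_le (hbb f hf) hc)⟩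

end Mean

section Groups

variable {G : Type} [Group G]

/-- Right-invariance of a mean on a group. -/
def RightInvariant (M : Mean G) : Prop :=
  ∀ (a : G) (f : G → ℝ), f ∈ Mean.bdd G → M.E (fun g => f (g * a)) = M.E f

lemma eq_of_sub_le {α : Type} {M : Mean α} {T : (α → ℝ) → α → ℝ}
    (hTn : ∀ f, T (-f) = -T f) (h : ∀ f ∈ Mean.bdd α, M.E (T f - f) ≤ 0) {f : α → ℝ}
    (hf : f ∈ Mean.bdd α) : M.E (T f) = M.E f := by
  have h1 := h f hf
  have h2 := h (-f) (neg_mem hf)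
  rw [hTn] at h2
  simp only [map_sub, map_neg] at h1 h2
  linarith

lemma comp_mem_bdd {α β : Type} {f : β → ℝ} (hf : f ∈ Mean.bdd β) (g : α → β) :
    (fun a => f (g a)) ∈ Mean.bdd α := by
  obtain ⟨C, hC⟩ := hf
  exact ⟨C, fun a => hC _⟩

/-- Commutative groups carry invariant means. -/
theorem exists_mean_of_comm (hcomm : ∀ a b : G, a * b = b * a) :
    ∃ M : Mean G, RightInvariant M := by
  let S : (G → ℝ) → Set ℝ := fun f => {c | ∃ (ι : Type) (_ : Fintype ι) (_ : Nonempty ι)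
    (a : ι → G), ∀ x, ∑ i, f (x * a i) ≤ c * Fintype.card ι}
  have hcard : ∀ (ι : Type) [Fintype ι] [Nonempty ι], (0 : ℝ) < Fintype.card ι := fun ι _ _ => by
    exact_mod_cast Fintype.card_pos
  have hup : ∀ f C, (∀ a, f a ≤ C) → C ∈ S f := fun f C h =>
    ⟨Unit, inferInstance, inferInstance, fun _ => 1, fun x => by simpa using h x⟩
  have hlow : ∀ f C, (∀ a, C ≤ f a) → ∀ c ∈ S f, C ≤ c := by
    rintro f C h c ⟨ι, _, _, a, ha⟩
    have h1 : (Fintype.card ι : ℝ) * C ≤ ∑ i, f (1 * a i) := by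
      simpa using Finset.card_nsmul_le_sum univ (fun i => f (1 * a i)) C fun i _ => h _
    have h2 := h1.trans (ha 1)
    rw [mul_comm] at h2
    exact le_of_mul_le_mul_right h2 (hcard ι)
  obtain ⟨M, hM⟩ := Mean.exists_le_upper S (by
    rintro f g c d ⟨ι, _, _, a, ha⟩ ⟨κ, _, _, b, hb⟩
    refine ⟨ι × κ, inferInstance, inferInstance, fun p => a p.1 * b p.2, fun x => ?_⟩
    simp only [Pi.add_apply, sum_add_distrib, Fintype.card_prod, Nat.cast_mul]
    have h1 : ∑ p : ι × κ, f (x * (a p.1 * b p.2)) ≤ c * Fintype.card ι * Fintype.card κ := by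
      rw [Fintype.sum_prod_type_right]
      calc _ ≤ ∑ _j : κ, c * Fintype.card ι := sum_le_sum fun j _ => by
            have := ha (x * b j)
            refine le_trans (le_of_eq (sum_congr rfl fun i _ => ?_)) this
            rw [hcomm (a i), mul_assoc]
        _ = _ := by simp [mul_comm]
    have h2 : ∑ p : ι × κ, g (x * (a p.1 * b p.2)) ≤ d * Fintype.card κ * Fintype.card ι := by
      rw [Fintype.sum_prod_type]
      calc _ ≤ ∑ _i : ι, d * Fintype.card κ := sum_le_sum fun i _ => by
            have := hb (x * a i)
            refine le_trans (le_of_eq (sum_congr rfl fun j _ => ?_)) this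
            rw [mul_assoc]
        _ = _ := by simp [mul_comm]
    nlinarith) (by
    rintro c hc f x ⟨ι, i1, i2, a, ha⟩
    refine ⟨ι, i1, i2, a, fun y => ?_⟩
    simp only [Pi.smul_apply, smul_eq_mul, ← mul_sum, mul_assoc]
    exact mul_le_mul_of_nonneg_left (ha y) hc.le) hup hlow
  refine ⟨M, fun a f hf => ?_⟩
  refine eq_of_sub_le (T := fun f g => f (g * a)) (fun f => rfl) (fun f hf => ?_) hf
  obtain ⟨C, hC⟩ := hf
  have hmem : ∀ k : ℕ, 2 * C * (1 / (k + 1)) ∈ S ((fun g => f (g * a)) - f) := by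
    intro k
    refine ⟨Fin (k + 1), inferInstance, inferInstance, fun i => a ^ (i : ℕ), fun x => ?_⟩
    rw [Fin.sum_univ_eq_sum_range (fun i => ((fun g => f (g * a)) - f) (x * a ^ i))]
    have h1 : ∑ i ∈ Finset.range (k + 1), ((fun g => f (g * a)) - f) (x * a ^ i) =
        f (x * a ^ (k + 1)) - f (x * a ^ 0) := by
      rw [← Finset.sum_range_sub (fun i => f (x * a ^ i))]
      refine sum_congr rfl fun i _ => ?_
      rw [Pi.sub_apply, pow_succ, mul_assoc]
    rw [h1, Fintype.card_fin]
    push_cast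
    rw [mul_assoc, one_div_mul_cancel (by positivity), mul_one]
    linarith [(abs_le.1 (hC (x * a ^ (k + 1)))).2, (abs_le.1 (hC (x * a ^ 0))).1]
  have hlim := (tendsto_one_div_add_atTop_nhds_zero_nat (𝕜 := ℝ)).const_mul (2 * C)
  rw [mul_zero] at hlim
  exact ge_of_tendsto' hlim fun k => hM _ (sub_mem (comp_mem_bdd ⟨C, hC⟩ _) ⟨C, hC⟩)
    _ (hmem k)

lemma finite_additivity {G : Type} {m : Set G → ℝ} (h : ∀ A B, Disjoint A B → m (A ∪ B) = m A + m B)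
    {ι : Type} [Fintype ι] (a : G → ι) (A : Set G) : m A = ∑ i, m (A ∩ a ⁻¹' {i}) := by
  classical
  have h0 : m ∅ = 0 := by
    have := h ∅ ∅ (Set.disjoint_empty _)
    rw [Set.union_empty] at this
    linarith
  have key : ∀ s : Finset ι, m (A ∩ a ⁻¹' s) = ∑ i ∈ s, m (A ∩ a ⁻¹' {i}) := by
    intro s
    induction s using Finset.induction_on with
    | empty => simp [h0]
    | insert i s his ih =>
      rw [Finset.sum_insert his, ← ih, ← h]
      · congr 1
        ext x
        simp
        tauto
      · refine Set.disjoint_left.2 fun x hx hx' => his ?_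
        have h1 : a x = i := hx.2
        have h2 : a x ∈ s := hx'.2
        rwa [h1] at h2
  have := key univ
  simpa using this

/-- Amenable groups carry invariant means. -/
theorem exists_mean_of_isAmenable (hG : IsAmenable G) : ∃ M : Mean G, RightInvariant M := by
  obtain ⟨m', hm0', hm1', hadd', hinv'⟩ := hG
  let m : Set G → ℝ := fun A => m' A⁻¹
  have hm0 : ∀ A, 0 ≤ m A := fun A => hm0' _
  have hm1 : m Set.univ = 1 := by simpa [m] using hm1'
  have hadd : ∀ A B, Disjoint A B → m (A ∪ B) = m A + m B := fun A B h => by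
    simp only [m, Set.union_inv]
    exact hadd' _ _ (h.preimage _)
  have hinv : ∀ (g : G) (A : Set G), m {x | x * g ∈ A} = m A := fun g A => by
    simp only [m]
    rw [← hinv' g A⁻¹]
    congr 1
    ext x
    simp only [Set.mem_inv, Set.mem_ofPred_eq, Set.mem_image]
    constructor
    · intro h
      exact ⟨g⁻¹ * x, by simpa using h, by simp⟩
    · rintro ⟨y, hy, rfl⟩
      simpa using hy
  let S : (G → ℝ) → Set ℝ := fun f => {c | ∃ (ι : Type) (_ : Fintype ι)
    (a : G → ι) (v : ι → ℝ), (∀ x, f x ≤ v (a x)) ∧ ∑ i, v i * m (a ⁻¹' {i}) = c}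
  have hone : ∀ {ι : Type} [Fintype ι] (a : G → ι), ∑ i, m (a ⁻¹' {i}) = 1 := fun a => by
    rw [← hm1, finite_additivity hadd a]
    simp
  have hup : ∀ f C, (∀ a, f a ≤ C) → C ∈ S f := fun f C h =>
    ⟨Unit, inferInstance, fun _ => (), fun _ => C, h, by rw [← mul_sum, hone, mul_one]⟩
  have hlow : ∀ f C, (∀ a, C ≤ f a) → ∀ c ∈ S f, C ≤ c := by
    rintro f C h _ ⟨ι, _, a, v, hv, rfl⟩
    rw [← mul_one C, ← hone a, mul_sum]
    refine sum_le_sum fun i _ => ?_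
    by_cases hi : ∃ x, a x = i
    · obtain ⟨x, rfl⟩ := hi
      exact mul_le_mul_of_nonneg_right ((h x).trans (hv x)) (hm0 _)
    · have : a ⁻¹' {i} = ∅ := Set.eq_empty_of_forall_notMem fun x hx => hi ⟨x, hx⟩
      have h0 : m ∅ = 0 := by
        have := hadd ∅ ∅ (Set.disjoint_empty _)
        rw [Set.union_empty] at this
        linarith
      rw [this, h0, mul_zero, mul_zero]
  have hsum : ∀ f g c d, c ∈ S f → d ∈ S g → c + d ∈ S (f + g) := by
    rintro f g _ _ ⟨ι, _, a, v, hv, rfl⟩ ⟨κ, _, b, w, hw, rfl⟩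
    refine ⟨ι × κ, inferInstance, fun x => (a x, b x), fun p => v p.1 + w p.2,
      fun x => add_le_add (hv x) (hw x), ?_⟩
    have h1 : ∀ i j, (fun x => (a x, b x)) ⁻¹' {(i, j)} = a ⁻¹' {i} ∩ b ⁻¹' {j} := by
      intro i j
      ext x
      simp
    simp only [add_mul, sum_add_distrib]
    congr 1
    · rw [Fintype.sum_prod_type]
      refine sum_congr rfl fun i _ => ?_
      rw [finite_additivity hadd b (a ⁻¹' {i}), mul_sum]
      simp only [h1]
    · rw [Fintype.sum_prod_type_right]
      refine sum_congr rfl fun j _ => ?_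
      rw [finite_additivity hadd a (b ⁻¹' {j}), mul_sum]
      simp only [h1, Set.inter_comm]
  obtain ⟨M, hM⟩ := Mean.exists_le_upper S hsum (by
    rintro c hc f _ ⟨ι, i1, a, v, hv, rfl⟩
    refine ⟨ι, i1, a, fun i => c * v i, fun x => mul_le_mul_of_nonneg_left (hv x) hc.le, ?_⟩
    rw [mul_sum]
    simp only [mul_assoc]) hup hlow
  refine ⟨M, fun a f hf => ?_⟩
  refine eq_of_sub_le (T := fun f g => f (g * a)) (fun f => rfl) (fun f hf => ?_) hf
  obtain ⟨C, hC⟩ := hf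
  have hmem : ∀ k : ℕ, 1 / ((k : ℝ) + 1) ∈ S ((fun g => f (g * a)) - f) := by
    intro k
    have hk : (0 : ℝ) < k + 1 := by positivity
    set t : G → ℤ := fun x => ⌊f x * (k + 1)⌋
    have ht : ∀ x, t x ∈ Finset.Icc (⌊-(C * (k + 1))⌋) ⌊C * (k + 1)⌋ := by
      intro x
      rw [Finset.mem_Icc]
      have := abs_le.1 (hC x)
      exact ⟨Int.floor_le_floor (by nlinarith), Int.floor_le_floor (by nlinarith)⟩
    let a' : G → Finset.Icc (⌊-(C * ((k : ℝ) + 1))⌋) ⌊C * ((k : ℝ) + 1)⌋ := fun x => ⟨t x, ht x⟩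
    have hlo : ∀ x, (t x : ℝ) / (k + 1) ≤ f x := fun x => by
      rw [div_le_iff₀ hk]
      exact Int.floor_le _
    have hhi : ∀ x, f x ≤ ((t x : ℝ) + 1) / (k + 1) := fun x => by
      rw [le_div_iff₀ hk]
      exact (Int.lt_floor_add_one _).le
    have h1 := hsum (fun g => f (g * a)) (-f) (∑ i, ((i.1 : ℝ) + 1) / (k + 1) * m (a' ⁻¹' {i}))
      (∑ i, (-((i.1 : ℝ) / (k + 1))) * m (a' ⁻¹' {i}))
      ⟨_, inferInstance, fun x => a' (x * a), fun i => ((i.1 : ℝ) + 1) / (k + 1),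
        fun x => hhi _, sum_congr rfl fun i _ => by
          congr 1
          exact hinv a (a' ⁻¹' {i})⟩
      ⟨_, inferInstance, a', fun i => (-((i.1 : ℝ) / (k + 1))), fun x => neg_le_neg (hlo x), rfl⟩
    rw [← sum_add_distrib, ← sub_eq_add_neg] at h1
    convert h1 using 1
    have h2 : 1 / ((k : ℝ) + 1) = ∑ i, 1 / ((k : ℝ) + 1) * m (a' ⁻¹' {i}) := by
      rw [← mul_sum, hone, mul_one]
    rw [h2]
    refine sum_congr rfl fun i _ => ?_
    ring
  exact ge_of_tendsto' (tendsto_one_div_add_atTop_nhds_zero_nat (𝕜 := ℝ))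
    fun k => hM _ (sub_mem (comp_mem_bdd ⟨C, hC⟩ _) ⟨C, hC⟩) _ (hmem k)

/-- Amenability passes to quotients. -/
lemma IsAmenable.of_surjective {H : Type} [Group H] (hG : IsAmenable G) (φ : G →* H)
    (hφ : Surjective φ) : IsAmenable H := by
  obtain ⟨m, h0, h1, hadd, hinv⟩ := hG
  refine ⟨fun A => m (φ ⁻¹' A), fun A => h0 _, by simpa using h1, fun A B h => ?_, fun h A => ?_⟩
  · exact hadd _ _ (h.preimage φ)
  · obtain ⟨g, rfl⟩ := hφ h
    refine Eq.trans ?_ (hinv g (φ ⁻¹' A))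
    show m _ = m _
    congr 1
    ext x
    simp only [Set.mem_preimage, Set.mem_image]
    constructor
    · rintro ⟨a, ha, hax⟩
      exact ⟨g⁻¹ * x, by simp [← hax, ha], by simp⟩
    · rintro ⟨y, hy, rfl⟩
      exact ⟨φ y, hy, by simp⟩

end Groups

/-- A mean on the natural numbers not seeing finite sets. -/
lemma exists_free_mean : ∃ M : Mean ℕ, ∀ f g : ℕ → ℝ, (∀ᶠ n in Filter.atTop, f n = g n) →
    M.E f = M.E g := by
  obtain ⟨M, hM⟩ := Mean.exists_le_upper (α := ℕ) (fun f => {c | ∀ᶠ n in Filter.atTop, f n ≤ c}) (by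
      intro f g c d hc hd
      filter_upwards [hc, hd] with n h1 h2 using add_le_add h1 h2) (by
      intro c hc f x hx
      filter_upwards [hx] with n h1 using mul_le_mul_of_nonneg_left h1 hc.le)
    (fun f C h => Filter.Eventually.of_forall h) (by
      intro f C h c hc
      obtain ⟨n, hn⟩ := hc.exists
      exact (h n).trans hn)
  refine ⟨M, fun f g h => ?_⟩
  have key : ∀ f : ℕ → ℝ, (∀ᶠ n in Filter.atTop, f n = 0) → M.E f ≤ 0 := by
    intro f hf
    have hb : f ∈ Mean.bdd ℕ := by
      obtain ⟨N, hN⟩ := Filter.eventually_atTop.1 hf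
      refine ⟨∑ i ∈ Finset.range N, |f i|, fun n => ?_⟩
      by_cases hn : n < N
      · exact Finset.single_le_sum (f := fun i => |f i|) (fun i _ => abs_nonneg _)
          (Finset.mem_range.2 hn)
      · rw [hN n (not_lt.1 hn), abs_zero]
        exact Finset.sum_nonneg fun i _ => abs_nonneg _
    exact hM f hb 0 (hf.mono fun n hn => hn.le)
  have h1 := key (f - g) (h.mono fun n hn => by simp [hn])
  have h2 := key (g - f) (h.mono fun n hn => by simp [hn])
  rw [map_sub] at h1 h2
  linarith

/-- The iterated free mean only sees injective tuples. -/
lemma iter_free_congr {M : Mean ℕ} (hM : ∀ f g : ℕ → ℝ, (∀ᶠ n in Filter.atTop, f n = g n) →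
    M.E f = M.E g) {n : ℕ} (f g : (Fin n → ℕ) → ℝ)
    (h : ∀ z : Fin n → ℕ, Injective z → f z = g z) :
    (Mean.iter n fun _ => M).E f = (Mean.iter n fun _ => M).E g := by
  have key : ∀ (n : ℕ) (A : Finset ℕ) (f g : (Fin n → ℕ) → ℝ),
      (∀ z : Fin n → ℕ, Injective z → (∀ i, z i ∉ A) → f z = g z) →
      (Mean.iter n fun _ => M).E f = (Mean.iter n fun _ => M).E g := by
    intro n
    induction n with
    | zero =>
      intro A f g h
      rw [Mean.iter_zero _ _ (fun i => i.elim0), Mean.iter_zero _ _ (fun i => i.elim0)]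
      exact h _ (fun i => i.elim0) (fun i => i.elim0)
    | succ n ih =>
      intro A f g h
      rw [Mean.iter_succ, Mean.iter_succ]
      refine hM _ _ ?_
      have hA : ∀ᶠ a in Filter.atTop, a ∉ A := by
        filter_upwards [Filter.eventually_gt_atTop (A.sup id)] with a ha haA
        exact absurd (Finset.le_sup (f := id) haA) (not_le.2 ha)
      filter_upwards [hA] with a ha
      refine ih (insert a A) _ _ fun z hz hzA => h _ ?_ ?_
      · refine Fin.cons_injective_iff.2 ⟨?_, hz⟩
        rintro ⟨i, hi⟩
        exact hzA i (hi ▸ Finset.mem_insert_self a A)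
      · intro i
        induction i using Fin.cases with
        | zero => exact ha
        | succ i => exact fun hi => hzA i (Finset.mem_insert_of_mem hi)
  exact key n ∅ f g fun z hz _ => h z hz

/-! ### The space of maps of a simplex with fixed boundary values -/

/-- The boundary of the standard simplex. -/
def bd (r : ℕ) : Set (Δ r) := {y | ∃ i, y.1 i = 0}

/-- Singular simplices, with the topology whose paths are the homotopies relative to the boundary. -/
def RelMap (r : ℕ) (X : Type) [TopologicalSpace X] : Type := C(Δ r, X)

instance (r : ℕ) : TopologicalSpace (RelMap r X) := (inferInstance : TopologicalSpace C(Δ r, X)) ⊓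
    TopologicalSpace.induced (fun (f : C(Δ r, X)) (y : bd r) => f y) ⊥

/-- The underlying map. -/
def RelMap.toMap {r : ℕ} (f : RelMap r X) : C(Δ r, X) := f

namespace RelMap

variable {r : ℕ} {Z : Type} [TopologicalSpace Z]

lemma continuous_iff {F : Z → RelMap r X} : Continuous F ↔ Continuous (fun z => (F z).toMap) ∧
      @Continuous _ _ _ ⊥ (fun z (y : bd r) => (F z).toMap y) := by
  have h : Continuous F ↔ Continuous (fun z => (F z).toMap) ∧ @Continuous _ _ _
      (TopologicalSpace.induced (fun (f : C(Δ r, X)) (y : bd r) => f y) ⊥)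
      (fun z => (F z).toMap) := @continuous_inf_rng _ _ (fun z => (F z).toMap) _ _ _
  rw [h, continuous_induced_rng]
  rfl

lemma continuous_eval {F : Z → RelMap r X} (hF : Continuous F) :
    Continuous fun z : Δ r × Z => (F z.2).toMap z.1 := by
  have h1 : Continuous fun z => (F z).toMap := (continuous_iff.1 hF).1
  have h2 : Continuous fun z : Δ r × Z => ((F z.2).toMap, z.1) :=
    (h1.comp continuous_snd).prodMk continuous_fst
  exact ContinuousEval.continuous_eval.comp h2

lemma eval_bd_eq [PreconnectedSpace Z] {F : Z → RelMap r X} (hF : Continuous F) {y : Δ r}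
    (hy : y ∈ bd r) (z z' : Z) : (F z).toMap y = (F z').toMap y := by
  have h1 := (continuous_iff.1 hF).2
  let : TopologicalSpace (bd r → X) := ⊥
  have : DiscreteTopology (bd r → X) := ⟨rfl⟩
  have h2 : (fun (y : bd r) => (F z).toMap y) = fun (y : bd r) => (F z').toMap y :=
    PreconnectedSpace.constant inferInstance h1 (x := z) (y := z')
  exact congrFun h2 ⟨y, hy⟩

lemma continuous_of_uncurry {F : Z → RelMap r X}
    (hF : Continuous fun z : Δ r × Z => (F z.2).toMap z.1)
    (hbd : ∀ z z', ∀ y ∈ bd r, (F z).toMap y = (F z').toMap y) : Continuous F := by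
  refine continuous_iff.2 ⟨?_, ?_⟩
  · exact ContinuousMap.continuous_of_continuous_uncurry (fun z => (F z).toMap)
      (hF.comp continuous_swap)
  · rcases isEmpty_or_nonempty Z with hZ | ⟨⟨z0⟩⟩
    · exact @continuous_of_const _ _ _ ⊥ _ fun z => hZ.elim z
    · have : (fun z (y : bd r) => (F z).toMap y) = fun _ (y : bd r) => (F z0).toMap y := by
        ext z y
        exact hbd z z0 y y.2
      rw [this]
      exact @continuous_const _ _ _ ⊥ _

/-- The path of maps given by a homotopy relative to the boundary. -/
def mkPath (G : C(Δ r × I01, X)) {g g' : RelMap r X} (h0 : ∀ y, G (y, 0) = g.toMap y)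
    (h1 : ∀ y, G (y, 1) = g'.toMap y) (hbd : ∀ y ∈ bd r, ∀ t, G (y, t) = g.toMap y) :
    Path g g' where
  toFun t := (slice G t : C(Δ r, X))
  continuous_toFun := continuous_of_uncurry G.continuous
    fun z z' y hy => (hbd y hy z).trans (hbd y hy z').symm
  source' := ContinuousMap.ext h0
  target' := ContinuousMap.ext h1

@[simp] lemma path_bd {g g' : RelMap r X} (p : Path g g') {y : Δ r} (hy : y ∈ bd r) (t : I01) :
    (p t).toMap y = g.toMap y := by
  rw [eval_bd_eq p.continuous hy t 0, p.source]

lemma continuous_path {g g' : RelMap r X} (p : Path g g') :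
    Continuous fun z : Δ r × I01 => (p z.2).toMap z.1 := continuous_eval p.continuous

lemma homotopic_mk {g g' : RelMap r X} (p q : Path g g') (J : C(Δ r × (I01 × I01), X))
    (h0 : ∀ y t, J (y, (0, t)) = (p t).toMap y) (h1 : ∀ y t, J (y, (1, t)) = (q t).toMap y)
    (hs : ∀ y w, J (y, (w, 0)) = g.toMap y) (ht : ∀ y w, J (y, (w, 1)) = g'.toMap y)
    (hbd : ∀ y ∈ bd r, ∀ z, J (y, z) = g.toMap y) : p.Homotopic q := by
  let F : I01 × I01 → RelMap r X := fun z => (⟨fun y => J (y, z), by fun_prop⟩ : C(Δ r, X))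
  have hF : Continuous F := continuous_of_uncurry J.continuous
    fun z z' y hy => (hbd y hy z).trans (hbd y hy z').symm
  refine ⟨⟨⟨⟨F, hF⟩, fun t => ContinuousMap.ext fun y => h0 y t,
    fun t => ContinuousMap.ext fun y => h1 y t⟩, ?_⟩⟩
  rintro w t (rfl | rfl)
  · refine ContinuousMap.ext fun y => (hs y w).trans ?_
    exact congrArg (fun f : RelMap r X => f.toMap y) p.source.symm
  · refine ContinuousMap.ext fun y => (ht y w).trans ?_
    exact congrArg (fun f : RelMap r X => f.toMap y) p.target.symm

end RelMap

/-! ### Commutativity of the fundamental groups of spaces of maps with fixed boundary values -/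

section Commute

variable {r : ℕ}

/-- The Minkowski gauge of the simplex with respect to an interior point. -/
def gauge' (c : Δ r) (x : Δ r) : ℝ := univ.sup' Finset.univ_nonempty fun i => 1 - x.1 i / c.1 i

lemma continuous_gauge' (c : Δ r) : Continuous (gauge' c) := by
  refine Continuous.finset_sup'_apply _ fun i _ => ?_
  exact continuous_const.sub (((continuous_apply i).comp continuous_subtype_val).div_const _)

lemma le_gauge' (c x : Δ r) (i : Fin (r + 1)) : 1 - x.1 i / c.1 i ≤ gauge' c x :=
  Finset.le_sup' (fun i => 1 - x.1 i / c.1 i) (mem_univ i)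

lemma gauge'_le_one {c : Δ r} (hc : ∀ i, 0 < c.1 i) (x : Δ r) : gauge' c x ≤ 1 :=
  Finset.sup'_le _ _ fun i _ => by
    have := div_nonneg (x.2.1 i) (hc i).le
    linarith

lemma gauge'_bd {c : Δ r} (hc : ∀ i, 0 < c.1 i) {x : Δ r} (hx : x ∈ bd r) : gauge' c x = 1 := by
  obtain ⟨i, hi⟩ := hx
  refine le_antisymm (gauge'_le_one hc x) ?_
  have := le_gauge' c x i
  rwa [hi, zero_div, sub_zero] at this

/-- Radial dilation at an interior point, truncated at the boundary. -/
def dil {c : Δ r} (hc : ∀ i, 0 < c.1 i) (x : Δ r) (τ : ℝ) (hτ : 0 < τ) : Δ r :=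
  ⟨fun i => c.1 i + (x.1 i - c.1 i) / max (gauge' c x) τ, by
    have hm : 0 < max (gauge' c x) τ := lt_max_of_lt_right hτ
    refine ⟨fun i => ?_, ?_⟩
    · have h1 : 1 - x.1 i / c.1 i ≤ max (gauge' c x) τ := (le_gauge' c x i).trans (le_max_left _ _)
      have h2 : c.1 i - x.1 i ≤ c.1 i * max (gauge' c x) τ := by
        have := mul_le_mul_of_nonneg_left h1 (hc i).le
        rwa [mul_sub, mul_one, mul_div_cancel₀ _ (hc i).ne'] at this
      have h3 : (c.1 i - x.1 i) / max (gauge' c x) τ ≤ c.1 i := by rwa [div_le_iff₀ hm]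
      have h4 : (x.1 i - c.1 i) / max (gauge' c x) τ = -((c.1 i - x.1 i) / max (gauge' c x) τ) := by
        rw [← neg_div, neg_sub]
      linarith
    · rw [sum_add_distrib, ← Finset.sum_div, Finset.sum_sub_distrib, c.2.2, x.2.2, sub_self,
        zero_div, add_zero]⟩

lemma dil_one {c : Δ r} (hc : ∀ i, 0 < c.1 i) (x : Δ r) {τ : ℝ} (hτ : τ = 1) :
    dil hc x τ (hτ ▸ one_pos) = x := by
  subst hτ
  refine Subtype.ext (funext fun i => ?_)
  simp only [dil]
  rw [max_eq_right (gauge'_le_one hc x), div_one, add_sub_cancel]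

lemma dil_bd {c : Δ r} (hc : ∀ i, 0 < c.1 i) {x : Δ r} (hx : x ∈ bd r) {τ : ℝ} (hτ : 0 < τ)
    (hτ1 : τ ≤ 1) : dil hc x τ hτ = x := by
  refine Subtype.ext (funext fun i => ?_)
  simp only [dil]
  rw [gauge'_bd hc hx, max_eq_left hτ1, div_one, add_sub_cancel]

lemma dil_mem_bd {c : Δ r} (hc : ∀ i, 0 < c.1 i) {x : Δ r} {τ : ℝ} (hτ : 0 < τ)
    (h : τ ≤ gauge' c x) : dil hc x τ hτ ∈ bd r := by
  obtain ⟨i, -, hi⟩ := Finset.exists_mem_eq_sup' Finset.univ_nonempty fun i => 1 - x.1 i / c.1 i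
  have hi' : gauge' c x = 1 - x.1 i / c.1 i := hi
  refine ⟨i, ?_⟩
  have hg : 0 < gauge' c x := hτ.trans_le h
  simp only [dil]
  rw [max_eq_left h]
  have h2 : x.1 i - c.1 i = - (c.1 i * gauge' c x) := by
    rw [hi', mul_sub, mul_one, mul_div_cancel₀ _ (hc i).ne']
    ring
  rw [h2, neg_div, mul_div_cancel_right₀ _ hg.ne', add_neg_cancel]

lemma continuous_dil {c : Δ r} (hc : ∀ i, 0 < c.1 i) {Z : Type} [TopologicalSpace Z] {x : Z → Δ r}
    (hx : Continuous x) {τ : Z → ℝ} (hτ : Continuous τ) (h : ∀ z, 0 < τ z) :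
    Continuous fun z => dil hc (x z) (τ z) (h z) := by
  refine Continuous.subtype_mk (continuous_pi fun i => ?_) _
  have h1 : Continuous fun z => (x z).1 i := (continuous_apply i).comp
    (continuous_subtype_val.comp hx)
  exact continuous_const.add ((h1.sub continuous_const).div
    (((continuous_gauge' c).comp hx).max hτ) fun z => (lt_max_of_lt_right (h z)).ne')

/-- Reparametrization: down from `1` to `a`, stay there, and back. -/
def downUp (a : ℝ) (t : ℝ) : ℝ := max a (1 - 3 * min t (1 - t))

/-- Reparametrization concentrated in the middle third. -/
def middle (t : I01) : I01 := projIcc 0 1 zero_le_one (3 * t.1 - 1)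

lemma continuous_middle : Continuous middle := continuous_projIcc.comp (by fun_prop)

/-- Linear interpolation in the unit interval. -/
def mix (w s t : I01) : I01 := ⟨(1 - w.1) * s.1 + w.1 * t.1, by
  have h1 := w.2; have h2 := s.2; have h3 := t.2
  constructor
  · have := mul_nonneg (sub_nonneg.2 h1.2) h2.1
    have := mul_nonneg h1.1 h3.1
    linarith
  · have := mul_le_mul_of_nonneg_left h2.2 (sub_nonneg.2 h1.2)
    have := mul_le_mul_of_nonneg_left h3.2 h1.1
    linarith⟩

lemma middle_eq (t : I01) {a : ℝ} (h : a < downUp a t.1) (ha0 : 0 ≤ a) :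
    middle t = 0 ∨ middle t = 1 := by
  have h1 : a < 1 - 3 * min t.1 (1 - t.1) := by
    rcases lt_max_iff.1 h with h | h
    · exact absurd h (lt_irrefl _)
    · exact h
  rcases le_total t.1 (1 - t.1) with h2 | h2
  · left
    rw [min_eq_left h2] at h1
    exact projIcc_of_le_left _ (by linarith)
  · right
    rw [min_eq_right h2] at h1
    exact projIcc_of_right_le _ (by linarith)

section Concentrate

variable {a : ℝ}

lemma downUp_pos (ha0 : 0 < a) (t : ℝ) : 0 < downUp a t := lt_max_of_lt_left ha0

lemma downUp_le_one (ha1 : a ≤ 1) (t : I01) : downUp a t.1 ≤ 1 := max_le ha1 (by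
  have := le_min t.2.1 (sub_nonneg.2 t.2.2)
  linarith)

lemma downUp_zero (ha1 : a ≤ 1) : downUp a 0 = 1 := by simp [downUp, ha1]

lemma downUp_one (ha1 : a ≤ 1) : downUp a 1 = 1 := by simp [downUp, ha1]

lemma continuous_downUp : Continuous (downUp a) := by unfold downUp; fun_prop

/-- Every loop is homotopic to one which is a dilation of the base point away from a given
interior point. -/
lemma exists_dilated {c : Δ r} (hc : ∀ i, 0 < c.1 i) (κ : RelMap r X) (γ : Path κ κ)
    (ha0 : 0 < a) (ha1 : a ≤ 1) :
    ∃ γ' : Path κ κ, γ.Homotopic γ' ∧ ∀ y (t : I01), a ≤ gauge' c y →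
      (γ' t).toMap y = κ.toMap (dil hc y (downUp a t.1) (downUp_pos ha0 _)) := by
  have hγ := RelMap.continuous_path γ
  have hγ0 : ∀ y, (γ 0).toMap y = κ.toMap y := fun y => by rw [γ.source]
  have hγ1 : ∀ y, (γ 1).toMap y = κ.toMap y := fun y => by rw [γ.target]
  have hcdu : Continuous (downUp a) := continuous_downUp
  have hdu0 : ∀ t, 0 < downUp a t := downUp_pos ha0
  have hdu1 : ∀ t : I01, downUp a t.1 ≤ 1 := downUp_le_one ha1
  have hdua : ∀ t, a ≤ downUp a t := fun t => le_max_left _ _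
  have hduz := downUp_zero ha1
  have hduo := downUp_one ha1
  have hmz : middle 0 = 0 := projIcc_of_le_left _ (by norm_num)
  have hmo : middle 1 = 1 := projIcc_of_right_le _ (by norm_num)
  have hz : ((0 : I01) : ℝ) = 0 := rfl
  have ho : ((1 : I01) : ℝ) = 1 := rfl
  have hτ1 : ∀ z : Δ r × (I01 × I01), 0 < 1 - z.2.1.1 * (1 - downUp a z.2.2.1) := fun z => by
    have h1 := z.2.1.2
    have h2 := hdu0 z.2.2.1
    nlinarith [h1.1, h1.2, hdu1 z.2.2, mul_le_mul_of_nonneg_right h1.2 (sub_nonneg.2 (hdu1 z.2.2))]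
  let J1 : C(Δ r × (I01 × I01), X) := ⟨fun z => (γ (mix z.2.1 z.2.2 (middle z.2.2))).toMap
      (dil hc z.1 (1 - z.2.1.1 * (1 - downUp a z.2.2.1)) (hτ1 z)), by
      have h1 : Continuous fun z : Δ r × (I01 × I01) => dil hc z.1
          (1 - z.2.1.1 * (1 - downUp a z.2.2.1)) (hτ1 z) := continuous_dil hc continuous_fst
        (by fun_prop) hτ1
      have h2 : Continuous fun z : Δ r × (I01 × I01) => mix z.2.1 z.2.2 (middle z.2.2) := by
        refine Continuous.subtype_mk ?_ _
        have := continuous_middle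
        fun_prop
      exact hγ.comp (h1.prodMk h2)⟩
  have hJ1s : ∀ y w, J1 (y, (w, 0)) = κ.toMap y := fun y w => by
    show (γ (mix w 0 (middle 0))).toMap (dil hc y (1 - w.1 * (1 - downUp a ((0 : I01) : ℝ))) _) = _
    have : mix w 0 (middle 0) = 0 := by rw [hmz]; exact Subtype.ext (by simp [mix])
    rw [this, hγ0, dil_one hc y (by rw [hz, hduz]; ring)]
  have hJ1t : ∀ y w, J1 (y, (w, 1)) = κ.toMap y := fun y w => by
    show (γ (mix w 1 (middle 1))).toMap (dil hc y (1 - w.1 * (1 - downUp a ((1 : I01) : ℝ))) _) = _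
    have : mix w 1 (middle 1) = 1 := by rw [hmo]; exact Subtype.ext (by simp [mix])
    rw [this, hγ1, dil_one hc y (by rw [ho, hduo]; ring)]
  have hJ1b : ∀ y ∈ bd r, ∀ z, J1 (y, z) = κ.toMap y := fun y hy z => by
    show (γ _).toMap (dil hc y _ _) = _
    rw [dil_bd hc hy _ (by nlinarith [mul_nonneg z.1.2.1 (sub_nonneg.2 (hdu1 z.2))]),
      RelMap.path_bd γ hy]
  let γ₁ : Path κ κ := RelMap.mkPath (J1.comp ((ContinuousMap.id _).prodMap
    ⟨fun t : I01 => ((1 : I01), t), by fun_prop⟩)) (fun y => hJ1s y 1) (fun y => hJ1t y 1)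
    (fun y hy t => hJ1b y hy _)
  have hom1 : γ.Homotopic γ₁ := by
    refine RelMap.homotopic_mk γ γ₁ J1 (fun y t => ?_) (fun y t => rfl) hJ1s hJ1t hJ1b
    show (γ (mix 0 t (middle t))).toMap (dil hc y (1 - ((0 : I01) : ℝ) * (1 - downUp a t.1)) _) = _
    have : mix 0 t (middle t) = t := Subtype.ext (by simp [mix])
    rw [this, dil_one hc y (by rw [hz]; ring)]
  refine ⟨γ₁, hom1, ?_⟩
  · intro y t hy
    have h0 : (γ₁ t).toMap y = (γ (middle t)).toMap (dil hc y (downUp a t.1) (hdu0 _)) := by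
      show (γ (mix 1 t (middle t))).toMap (dil hc y (1 - ((1 : I01) : ℝ) * (1 - downUp a t.1)) _) = _
      have h1 : mix 1 t (middle t) = middle t := Subtype.ext (by simp [mix])
      rw [h1]
      congr 1
      simp only [ho, one_mul, sub_sub_cancel]
    rw [h0]
    rcases (hdua t.1).eq_or_lt with h | h
    · rw [RelMap.path_bd γ]
      exact dil_mem_bd hc _ (h ▸ hy)
    · rcases middle_eq t h ha0.le with h | h <;> rw [h]
      · exact hγ0 _
      · exact hγ1 _

/-- Every loop is homotopic to a loop supported near a given interior point. -/
lemma exists_concentrated {c : Δ r} (hc : ∀ i, 0 < c.1 i) (κ : RelMap r X) (γ : Path κ κ) :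
    ∃ γ' : Path κ κ, γ.Homotopic γ' ∧ ∀ y t, 1 / 4 ≤ gauge' c y → (γ' t).toMap y = κ.toMap y := by
  obtain ⟨a, ha⟩ : ∃ a : ℝ, a = 1 / 8 := ⟨_, rfl⟩
  have ha0 : 0 < a := by norm_num [ha]
  have ha1 : a ≤ 1 := by norm_num [ha]
  obtain ⟨γ₁, hom1, hγ₁⟩ := exists_dilated hc κ γ ha0 ha1
  have hκ : Continuous κ.toMap := κ.toMap.continuous
  have hcdu : Continuous (downUp a) := continuous_downUp
  have hdu0 : ∀ t, 0 < downUp a t := downUp_pos ha0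
  have hdu1 : ∀ t : I01, downUp a t.1 ≤ 1 := downUp_le_one ha1
  have hdua : ∀ t, a ≤ downUp a t := fun t => le_max_left _ _
  have hduz := downUp_zero ha1
  have hduo := downUp_one ha1
  have hz : ((0 : I01) : ℝ) = 0 := rfl
  have ho : ((1 : I01) : ℝ) = 1 := rfl
  let T : Δ r × (I01 × I01) → ℝ := fun z =>
    max (downUp a z.2.2.1) (a + z.2.1.1 * (min (8 * gauge' c z.1 - 1) 1 * (1 - a)))
  have hT0 : ∀ z, 0 < T z := fun z => lt_max_of_lt_left (hdu0 _)
  have hTc : Continuous T := by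
    have hg : Continuous fun z : Δ r × (I01 × I01) => gauge' c z.1 :=
      (continuous_gauge' c).comp continuous_fst
    have h1 : Continuous fun z : Δ r × (I01 × I01) => downUp a z.2.2.1 := hcdu.comp (by fun_prop)
    have h2 : Continuous fun z : Δ r × (I01 × I01) => z.2.1.1 := by fun_prop
    exact h1.max (continuous_const.add (h2.mul
      ((((continuous_const.mul hg).sub continuous_const).min continuous_const).mul
        continuous_const)))
  have hT1 : ∀ z, T z ≤ 1 := fun z => max_le (hdu1 _) (by
    have h1 : min (8 * gauge' c z.1 - 1) 1 * (1 - a) ≤ 1 - a := by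
      have : (0 : ℝ) ≤ 1 - a := by norm_num [ha]
      nlinarith [min_le_right (8 * gauge' c z.1 - 1) 1]
    have h2 : z.2.1.1 * (min (8 * gauge' c z.1 - 1) 1 * (1 - a)) ≤ 1 - a := by
      rcases le_total 0 (min (8 * gauge' c z.1 - 1) 1 * (1 - a)) with h | h
      · nlinarith [z.2.1.2.2]
      · have : (0 : ℝ) ≤ 1 - a := by norm_num [ha]
        nlinarith [z.2.1.2.1]
    linarith)
  classical
  let J2f : Δ r × (I01 × I01) → X := fun z => if gauge' c z.1 ≤ a then (γ₁ z.2.2).toMap z.1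
    else κ.toMap (dil hc z.1 (T z) (hT0 z))
  have hJ2c : Continuous J2f := by
    refine Continuous.if_le ?_ ?_ ((continuous_gauge' c).comp continuous_fst) continuous_const ?_
    · exact (RelMap.continuous_path γ₁).comp
        (continuous_fst.prodMk (continuous_snd.comp continuous_snd))
    · exact hκ.comp (continuous_dil hc continuous_fst hTc hT0)
    · intro z hz
      rw [hγ₁ _ _ hz.ge]
      congr 2
      have : (8 * gauge' c z.1 - 1) = 0 := by rw [hz, ha]; norm_num
      simp only [T, this]
      rw [min_eq_left zero_le_one, zero_mul, mul_zero, add_zero, max_eq_left (hdua _)]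
  let J2 : C(Δ r × (I01 × I01), X) := ⟨J2f, hJ2c⟩
  have hJ2b : ∀ y ∈ bd r, ∀ z, J2 (y, z) = κ.toMap y := fun y hy z => by
    have : ¬ gauge' c y ≤ a := by rw [gauge'_bd hc hy]; norm_num [ha]
    show J2f (y, z) = _
    simp only [J2f, this, if_false]
    rw [dil_bd hc hy _ (hT1 _)]
  have hJ2s : ∀ y w (t : I01), downUp a t.1 = 1 → (γ₁ t).toMap y = κ.toMap y →
      J2 (y, (w, t)) = κ.toMap y := fun y w t ht hy => by
    show J2f (y, (w, t)) = _
    simp only [J2f]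
    split_ifs with h
    · exact hy
    · rw [dil_one hc y (le_antisymm (hT1 _) (ht ▸ le_max_left _ _))]
  have hJ2z : ∀ y w, J2 (y, (w, 0)) = κ.toMap y := fun y w => hJ2s y w 0 hduz (by rw [γ₁.source])
  have hJ2o : ∀ y w, J2 (y, (w, 1)) = κ.toMap y := fun y w => hJ2s y w 1 hduo (by rw [γ₁.target])
  let γ₂ : Path κ κ := RelMap.mkPath (J2.comp ((ContinuousMap.id _).prodMap
    ⟨fun t : I01 => ((1 : I01), t), by fun_prop⟩)) (fun y => hJ2z y 1) (fun y => hJ2o y 1)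
    (fun y hy t => hJ2b y hy _)
  refine ⟨γ₂, hom1.trans ?_, ?_⟩
  · refine RelMap.homotopic_mk γ₁ γ₂ J2 (fun y t => ?_) (fun y t => rfl) hJ2z hJ2o hJ2b
    show J2f (y, (0, t)) = _
    simp only [J2f]
    split_ifs with h
    · rfl
    · rw [hγ₁ y t (not_le.1 h).le]
      congr 2
      simp only [T, hz, zero_mul, add_zero]
      exact max_eq_left (hdua _)
  · intro y t hy
    have : ¬ gauge' c y ≤ a := by rw [not_le]; norm_num [ha]; linarith
    show J2f (y, (1, t)) = _
    simp only [J2f, this, if_false]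
    rw [dil_one hc y]
    refine le_antisymm (hT1 _) (le_trans ?_ (le_max_right _ _))
    rw [min_eq_right (by linarith), ho]
    linarith

end Concentrate

/-- Loops with disjoint supports commute up to homotopy. -/
lemma trans_homotopic_of_disjoint {c : Δ r} (κ : RelMap r X) (γ δ : Path κ κ)
    (hγ : ∀ y t, 1 / 4 ≤ gauge' c y → (γ t).toMap y = κ.toMap y)
    (hδ : ∀ y t, gauge' c y ≤ 1 / 4 → (δ t).toMap y = κ.toMap y)
    (hcb : ∀ y ∈ bd r, gauge' c y = 1) :
    PQ.trans (.mk γ) (.mk δ) = .trans (.mk δ) (.mk γ) := by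
  classical
  let Φf : I01 × I01 → Δ r → X := fun z y =>
    if gauge' c y ≤ 1 / 4 then (γ z.1).toMap y else (δ z.2).toMap y
  have hΦ : Continuous fun z : Δ r × (I01 × I01) => Φf z.2 z.1 := by
    refine Continuous.if_le ?_ ?_ ((continuous_gauge' c).comp continuous_fst) continuous_const ?_
    · exact (RelMap.continuous_path γ).comp
        (continuous_fst.prodMk (continuous_fst.comp continuous_snd))
    · exact (RelMap.continuous_path δ).comp
        (continuous_fst.prodMk (continuous_snd.comp continuous_snd))
    · intro z hz
      rw [hγ _ _ hz.ge, hδ _ _ hz.le]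
  let Φ : C(I01 × I01, RelMap r X) := ⟨fun z => (⟨Φf z, by
    exact hΦ.comp (continuous_id.prodMk continuous_const)⟩ : C(Δ r, X)), by
    refine RelMap.continuous_of_uncurry hΦ fun z z' y hy => ?_
    have h : ¬ gauge' c y ≤ 1 / 4 := by rw [hcb y hy]; norm_num
    show Φf z y = Φf z' y
    simp only [Φf, h, if_false]
    rw [RelMap.path_bd δ hy, RelMap.path_bd δ hy]⟩
  have hl : ∀ s (t : I01), (δ t = κ) → Φ (s, t) = γ s := fun s t ht => by
    refine ContinuousMap.ext fun y => ?_
    show Φf (s, t) y = (γ s).toMap y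
    simp only [Φf]
    split_ifs with h
    · rfl
    · rw [hγ y s (not_le.1 h).le, ht]
  have hr : ∀ (s : I01) t, (γ s = κ) → Φ (s, t) = δ t := fun s t hs => by
    refine ContinuousMap.ext fun y => ?_
    show Φf (s, t) y = (δ t).toMap y
    simp only [Φf]
    split_ifs with h
    · rw [hδ y t h, hs]
    · rfl
  let hor : Path (0 : I01) 1 := ⟨⟨id, continuous_id⟩, rfl, rfl⟩
  have : ContractibleSpace I01 := (convex_Icc (0 : ℝ) 1).contractibleSpace ⟨0, by simp⟩
  obtain ⟨F⟩ : ((hor.prod (Path.refl (0 : I01))).trans ((Path.refl (1 : I01)).prod hor)).Homotopic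
      (((Path.refl (0 : I01)).prod hor).trans (hor.prod (Path.refl (1 : I01)))) :=
    SimplyConnectedSpace.paths_homotopic _ _
  refine PQ.eq.2 ⟨⟨⟨⟨fun z => Φ (F z), by fun_prop⟩, ?_, ?_⟩, ?_⟩⟩
  · intro t
    show Φ (F (0, t)) = (γ.trans δ) t
    rw [F.apply_zero]
    show Φ (((hor.prod (Path.refl (0 : I01))).trans ((Path.refl (1 : I01)).prod hor)) t) = _
    rw [Path.trans_apply, Path.trans_apply]
    split_ifs
    · exact hl _ _ δ.source
    · exact hr _ _ γ.target
  · intro t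
    show Φ (F (1, t)) = (δ.trans γ) t
    rw [F.apply_one]
    show Φ ((((Path.refl (0 : I01)).prod hor).trans (hor.prod (Path.refl (1 : I01)))) t) = _
    rw [Path.trans_apply, Path.trans_apply]
    split_ifs
    · exact hr _ _ γ.source
    · exact hl _ _ δ.target
  · rintro w t (rfl | rfl)
    · show Φ (F (w, 0)) = (γ.trans δ) 0
      rw [F.source, hl _ _ δ.source, γ.source, Path.source]
    · show Φ (F (w, 1)) = (γ.trans δ) 1
      rw [F.target, hl _ _ δ.target, γ.target, Path.target]

lemma coord_le_of_gauge'_lt {c : Δ r} (hc : ∀ i, 0 < c.1 i) {x : Δ r} {a : ℝ}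
    (h : gauge' c x ≤ a) (i : Fin (r + 1)) : (1 - a) * c.1 i ≤ x.1 i := by
  have h1 := (le_gauge' c x i).trans h
  have h2 : 1 - a ≤ x.1 i / c.1 i := by linarith
  rwa [le_div_iff₀ (hc i)] at h2

/-- The fundamental groups of the space of maps of a simplex of positive dimension with fixed
boundary values are commutative. -/
lemma RelMap.mul_comm (κ : RelMap (r + 1) X) (a b : FundamentalGroup (RelMap (r + 1) X) κ) :
    a * b = b * a := by
  have hr : (0 : ℝ) < r + 1 := by positivity
  have mk : ∀ s : ℝ, 0 < s → s < 1 → ∃ c : Δ (r + 1), (∀ i, 0 < c.1 i) ∧ c.1 0 = s := by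
    intro s h0 h1
    refine ⟨⟨Fin.cons s fun _ => (1 - s) / (r + 1), fun i => ?_, ?_⟩, fun i => ?_, rfl⟩
    · refine Fin.cases h0.le (fun i => ?_) i
      exact div_nonneg (by linarith) hr.le
    · rw [Fin.sum_univ_succ]
      simp only [Fin.cons_zero, Fin.cons_succ, sum_const, card_univ, Fintype.card_fin, nsmul_eq_mul]
      push_cast
      field_simp
      ring
    · refine Fin.cases h0 (fun i => ?_) i
      exact div_pos (by linarith) hr
  obtain ⟨c, hc, hc0⟩ := mk (3 / 4) (by norm_num) (by norm_num)
  obtain ⟨c', hc', hc0'⟩ := mk (1 / 4) (by norm_num) (by norm_num)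
  obtain ⟨γ, rfl⟩ := PQ.mk_surjective a
  obtain ⟨δ, rfl⟩ := PQ.mk_surjective b
  obtain ⟨γ', h1, h2⟩ := exists_concentrated hc κ γ
  obtain ⟨δ', h3, h4⟩ := exists_concentrated hc' κ δ
  rw [PQ.eq.2 h1, PQ.eq.2 h3, FundamentalGroup.mul_def, FundamentalGroup.mul_def]
  refine (trans_homotopic_of_disjoint κ γ' δ' h2 (fun y t hy => h4 y t ?_)
    (fun y hy => gauge'_bd hc hy)).symm
  by_contra hlt
  have h5 := coord_le_of_gauge'_lt hc hy 0
  have h6 := coord_le_of_gauge'_lt hc' (not_le.1 hlt).le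
  have h7 : ∑ i, (1 - 1 / 4) * c'.1 i ≤ ∑ i, y.1 i - y.1 0 + (1 - 1 / 4) * c'.1 0 := by
    rw [Fin.sum_univ_succ, Fin.sum_univ_succ (fun i => y.1 i)]
    have := sum_le_sum fun (i : Fin (r + 1)) (_ : i ∈ univ) => h6 i.succ
    linarith
  rw [← mul_sum, c'.2.2, y.2.2, hc0'] at h7
  rw [hc0] at h5
  linarith

end Commute

/-! ### Skeleta of the standard simplex -/

section Skeleta

variable {m : ℕ}

/-- The points of the simplex with at most `q` non-zero coordinates. -/
def Sk (q m : ℕ) : Set (Δ m) := {x | (univ.filter fun i => 0 < x.1 i).card ≤ q}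

/-- The `(q+1)`-st largest coordinate (zero if there are at most `q` coordinates). -/
def lev (q : ℕ) (x : Δ m) : ℝ :=
  (univ.filter fun S : Finset (Fin (m + 1)) => S.card ≤ q).inf' ⟨∅, by simp⟩ fun S =>
    univ.sup' Finset.univ_nonempty fun i => if i ∈ S then 0 else x.1 i

lemma continuous_lev (q : ℕ) : Continuous (lev q : Δ m → ℝ) := by
  refine Continuous.finset_inf'_apply _ fun S _ => Continuous.finset_sup'_apply _ fun i _ => ?_
  split_ifs
  · exact continuous_const
  · exact (continuous_apply i).comp continuous_subtype_val

lemma lev_le_iff {q : ℕ} {x : Δ m} {t : ℝ} (ht : 0 ≤ t) :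
    lev q x ≤ t ↔ (univ.filter fun i => t < x.1 i).card ≤ q := by
  refine (Finset.inf'_le_iff _).trans ?_
  simp only [Finset.sup'_le_iff, mem_filter, mem_univ, true_and, true_implies]
  constructor
  · rintro ⟨S, hS, h⟩
    refine (Finset.card_le_card fun i hi => ?_).trans hS
    by_contra hiS
    have := h i
    rw [if_neg hiS] at this
    exact absurd (mem_filter.1 hi).2 (not_lt.2 this)
  · intro h
    refine ⟨_, h, fun i => ?_⟩
    split_ifs with hi
    · exact ht
    · simpa using hi

lemma lev_nonneg (q : ℕ) (x : Δ m) : 0 ≤ lev q x := by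
  refine Finset.le_inf' _ _ fun S _ => ?_
  refine le_trans ?_ (Finset.le_sup' (fun i => if i ∈ S then (0 : ℝ) else x.1 i) (mem_univ 0))
  split_ifs
  · exact le_rfl
  · exact x.2.1 0

lemma lev_eq_zero {q : ℕ} {x : Δ m} (h : x ∈ Sk q m) : lev q x = 0 :=
  le_antisymm ((lev_le_iff le_rfl).2 h) (lev_nonneg q x)

lemma lev_face (q : ℕ) (i : Fin (m + 2)) (x : Δ m) : lev q (face i x) = lev q x := by
  have h : ∀ t : ℝ, 0 ≤ t → (lev q (face i x) ≤ t ↔ lev q x ≤ t) := fun t ht => by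
    rw [lev_le_iff ht, lev_le_iff ht, Finset.card_filter, Finset.card_filter,
      Fin.sum_univ_succAbove _ i]
    simp [face, not_lt.2 ht]
  exact le_antisymm ((h _ (lev_nonneg _ _)).2 le_rfl) ((h _ (lev_nonneg _ _)).1 le_rfl)

lemma le_lev_zero (x : Δ m) (i : Fin (m + 1)) : x.1 i ≤ lev 0 x := by
  have h := (lev_le_iff (lev_nonneg 0 x)).1 le_rfl
  rw [Nat.le_zero, Finset.card_eq_zero] at h
  by_contra hi
  have : i ∈ univ.filter fun i => lev 0 x < x.1 i := by simpa using hi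
  rw [h] at this
  simp at this

lemma lev_zero_pos (x : Δ m) : 0 < lev 0 x := by
  by_contra h
  have h1 : ∑ i, x.1 i ≤ 0 := Finset.sum_nonpos fun i _ => (le_lev_zero x i).trans (not_lt.1 h)
  rw [x.2.2] at h1
  linarith

/-- The amount by which the coordinates are decreased by `pmap`. -/
def shift (q : ℕ) (l : I01) (x : Δ m) : ℝ := min (lev q x) (l.1 * lev 0 x / 2)

lemma shift_nonneg (q : ℕ) (l : I01) (x : Δ m) : 0 ≤ shift q l x :=
  le_min (lev_nonneg q x) (by have := mul_nonneg l.2.1 (lev_nonneg 0 x); linarith)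

lemma sum_shift_pos (q : ℕ) (l : I01) (x : Δ m) : 0 < ∑ i, max 0 (x.1 i - shift q l x) := by
  refine Finset.sum_pos' (fun i _ => le_max_left _ _) ?_
  by_contra! h
  have h1 : ∀ i, x.1 i ≤ lev 0 x / 2 := fun i => by
    have h2 := (le_max_right _ _).trans (h i (mem_univ i))
    have h3 : shift q l x ≤ l.1 * lev 0 x / 2 := min_le_right _ _
    have h4 := mul_le_mul_of_nonneg_right l.2.2 (lev_nonneg 0 x)
    linarith
  have h2 := lev_zero_pos x
  have h3 : lev 0 x ≤ lev 0 x / 2 := (lev_le_iff (by linarith)).2 (by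
    rw [Nat.le_zero, Finset.card_eq_zero, Finset.filter_eq_empty_iff]
    exact fun i _ => not_lt.2 (h1 i))
  linarith

/-- The deformation of the simplex towards its skeleton. -/
def pmap (q : ℕ) (l : I01) (x : Δ m) : Δ m :=
  ⟨fun i => max 0 (x.1 i - shift q l x) / ∑ i, max 0 (x.1 i - shift q l x),
    fun i => div_nonneg (le_max_left _ _) (sum_shift_pos q l x).le, by
      rw [← Finset.sum_div, div_self (sum_shift_pos q l x).ne']⟩

lemma continuous_pmap {W : Type} [TopologicalSpace W] (q : ℕ) {l : W → I01} {x : W → Δ m}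
    (hl : Continuous l) (hx : Continuous x) : Continuous fun w => pmap q (l w) (x w) := by
  have h1 : ∀ i, Continuous fun w => (x w).1 i := fun i =>
    (continuous_apply i).comp (continuous_subtype_val.comp hx)
  have h2 : Continuous fun w => shift q (l w) (x w) := ((continuous_lev q).comp hx).min
      (((continuous_subtype_val.comp hl).mul ((continuous_lev 0).comp hx)).div_const 2)
  refine Continuous.subtype_mk (continuous_pi fun i => ?_) _
  exact (continuous_const.max ((h1 i).sub h2)).div
    (continuous_finsetSum _ fun i _ => continuous_const.max ((h1 i).sub h2))
    fun w => (sum_shift_pos q (l w) (x w)).ne'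

lemma pmap_eq_self {q : ℕ} {l : I01} {x : Δ m} (h : shift q l x = 0) : pmap q l x = x := by
  refine Subtype.ext (funext fun i => ?_)
  simp only [pmap, h, sub_zero]
  simp only [max_eq_right (x.2.1 _), x.2.2, div_one]

lemma shift_face (q : ℕ) (l : I01) (i : Fin (m + 2)) (x : Δ m) :
    shift q l (face i x) = shift q l x := by simp only [shift, lev_face]

lemma pmap_face (q : ℕ) (l : I01) (i : Fin (m + 2)) (x : Δ m) :
    pmap q l (face i x) = face i (pmap q l x) := by
  have h1 : max 0 ((face i x).1 i - shift q l x) = 0 := by simp [face, shift_nonneg]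
  have h2 : ∀ j, (face i x).1 (i.succAbove j) = x.1 j := fun j => by simp [face]
  refine Subtype.ext (funext fun j => ?_)
  simp only [pmap, shift_face]
  rw [Fin.sum_univ_succAbove _ i, h1, zero_add]
  simp only [h2]
  refine Fin.succAboveCases i ?_ (fun j => ?_) j
  · rw [h1, zero_div]
    simp [face]
  · rw [h2]
    simp [face]

/-- The remaining time after the deformation. -/
def rtime (q : ℕ) (l : I01) (x : Δ m) : I01 := projIcc 0 1 zero_le_one (l.1 - 2 * lev q x / lev 0 x)

lemma continuous_rtime {W : Type} [TopologicalSpace W] (q : ℕ) {l : W → I01} {x : W → Δ m}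
    (hl : Continuous l) (hx : Continuous x) : Continuous fun w => rtime q (l w) (x w) :=
  continuous_projIcc.comp ((continuous_subtype_val.comp hl).sub
    ((continuous_const.mul ((continuous_lev q).comp hx)).div ((continuous_lev 0).comp hx)
      fun w => (lev_zero_pos (x w)).ne'))

lemma rtime_face (q : ℕ) (l : I01) (i : Fin (m + 2)) (x : Δ m) :
    rtime q l (face i x) = rtime q l x := by simp only [rtime, lev_face]

lemma rtime_eq_zero {q : ℕ} {l : I01} {x : Δ m} (h : l.1 * lev 0 x / 2 ≤ lev q x) :
    rtime q l x = 0 := by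
  refine projIcc_of_le_left _ ?_
  have : l.1 ≤ 2 * lev q x / lev 0 x := by
    rw [le_div_iff₀ (lev_zero_pos x)]
    linarith
  linarith

lemma rtime_of_lev_eq_zero {q : ℕ} {l : I01} {x : Δ m} (h : lev q x = 0) : rtime q l x = l := by
  simp only [rtime, h, mul_zero, zero_div, sub_zero]
  exact Set.projIcc_val zero_le_one l

/-- The `r`-dimensional faces of the `m`-simplex. -/
abbrev Face (r m : ℕ) := Fin (r + 1) ↪o Fin (m + 1)

/-- The inclusion of a face spanned by given vertices. -/
def fmap {r : ℕ} (F : Face r m) : C(Δ r, Δ m) :=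
  aff (convex_simplex m) fun j => vtx m (F j)

variable {r : ℕ}

lemma fmap_apply (F : Face r m) (y : Δ r) (j : Fin (r + 1)) :
    (fmap F y).1 (F j) = y.1 j := by
  simp [fmap, aff, vtx, Finset.sum_apply, Pi.single_apply]

lemma fmap_apply_of_notMem (F : Face r m) (y : Δ r) {i : Fin (m + 1)}
    (hi : i ∉ range F) : (fmap F y).1 i = 0 := by
  simp only [fmap, aff, vtx, coe_mk, Finset.sum_apply, Pi.smul_apply, smul_eq_mul, Pi.single_apply]
  refine Finset.sum_eq_zero fun j _ => ?_
  rw [if_neg fun h => hi ⟨j, h.symm⟩, mul_zero]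

lemma face_comp_fmap (F : Face r m) (i : Fin (m + 2)) :
    (face i).comp (fmap F) = fmap (F.trans (Fin.succAboveOrderEmb i)) := by
  rw [fmap, comp_aff _ (convex_simplex _) _ (isAff_face i)]
  congr 1
  ext1 j
  exact face_vtx i (F j)

/-- A continuous left inverse of `fmap`. -/
def fret (F : Face r m) (x : Δ m) : Δ r :=
  ⟨fun j => x.1 (F j) + (1 - ∑ j, x.1 (F j)) / (r + 1), fun j => by
    have h1 : ∑ j, x.1 (F j) ≤ 1 := by
      rw [← x.2.2]
      exact (Finset.sum_map univ F.toEmbedding x.1).symm.trans_le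
        (Finset.sum_le_univ_sum_of_nonneg x.2.1)
    have h2 := x.2.1 (F j)
    have h3 : 0 ≤ (1 - ∑ j, x.1 (F j)) / ((r : ℝ) + 1) := div_nonneg (by linarith) (by positivity)
    linarith, by
    have : (r : ℝ) + 1 ≠ 0 := by positivity
    rw [sum_add_distrib]
    simp only [sum_const, card_univ, Fintype.card_fin, nsmul_eq_mul]
    push_cast
    rw [mul_div_cancel₀ _ this]
    ring⟩

lemma continuous_fret (F : Face r m) : Continuous (fret F) := by
  refine Continuous.subtype_mk (continuous_pi fun i => ?_) _
  have h : ∀ j, Continuous fun x : Δ m => x.1 (F j) := fun j =>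
    (continuous_apply (F j)).comp continuous_subtype_val
  exact (h i).add ((continuous_const.sub (continuous_finsetSum _ fun j _ => h j)).div_const _)

lemma fret_fmap (F : Face r m) (y : Δ r) : fret F (fmap F y) = y := by
  refine Subtype.ext (funext fun j => ?_)
  simp only [fret, fmap_apply, y.2.2, sub_self, zero_div, add_zero]

lemma fmap_fret {F : Face r m} {x : Δ m} (h : ∀ i, i ∉ range F → x.1 i = 0) :
    fmap F (fret F x) = x := by
  have h1 : ∑ j, x.1 (F j) = 1 := by
    rw [← x.2.2]
    refine (Finset.sum_map univ F.toEmbedding x.1).symm.trans ?_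
    refine Finset.sum_subset (Finset.subset_univ _) fun i _ hi => h i ?_
    rintro ⟨j, rfl⟩
    exact hi (Finset.mem_map_of_mem _ (mem_univ j))
  refine Subtype.ext (funext fun i => ?_)
  by_cases hi : i ∈ range F
  · obtain ⟨j, rfl⟩ := hi
    rw [fmap_apply]
    simp only [fret, h1, sub_self, zero_div, add_zero]
  · rw [fmap_apply_of_notMem F _ hi, h i hi]

/-- A point of the `r`-skeleton lies in an `r`-dimensional face. -/
lemma exists_fmap_eq (hr : r ≤ m) {x : Δ m} {S : Finset (Fin (m + 1))} (hS : S.card ≤ r + 1)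
    (h : ∀ i, i ∉ S → x.1 i = 0) : ∃ (F : Face r m) (y : Δ r), fmap F y = x := by
  obtain ⟨T, hST, hT⟩ := Finset.exists_superset_card_eq hS (by simpa using hr)
  refine ⟨T.orderEmbOfFin hT, _, fmap_fret fun i hi => h i fun hiS => hi ?_⟩
  rw [Finset.range_orderEmbOfFin]
  exact hST hiS

lemma exists_fmap_of_mem_Sk (hr : r ≤ m) {x : Δ m} (hx : x ∈ Sk (r + 1) m) :
    ∃ (F : Face r m) (y : Δ r), fmap F y = x :=
  exists_fmap_eq hr hx fun i hi => by
    have := x.2.1 i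
    simp only [mem_filter, mem_univ, true_and, not_lt] at hi
    exact le_antisymm hi this

lemma exists_fmap_eq_pmap (hr : r ≤ m) {l : I01} {x : Δ m} (h : lev (r + 1) x ≤ l.1 * lev 0 x / 2) :
    ∃ (F : Face r m) (y : Δ r), fmap F y = pmap (r + 1) l x := by
  refine exists_fmap_eq hr ((lev_le_iff (lev_nonneg _ x)).1 le_rfl) fun i hi => ?_
  simp only [mem_filter, mem_univ, true_and, not_lt] at hi
  simp only [pmap, shift, min_eq_left h]
  rw [max_eq_left (by linarith), zero_div]

lemma mem_Sk_of_bd (F : Face r m) {y : Δ r} (hy : y ∈ bd r) :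
    fmap F y ∈ Sk r m := by
  obtain ⟨j, hj⟩ := hy
  have h1 : (univ.filter fun i => 0 < (fmap F y).1 i) ⊆
      (univ.erase j).map F.toEmbedding := fun i hi => by
    have hi' := (mem_filter.1 hi).2
    by_cases h : i ∈ range F
    · obtain ⟨j', rfl⟩ := h
      refine Finset.mem_map_of_mem _ (Finset.mem_erase.2 ⟨?_, mem_univ _⟩)
      rintro rfl
      rw [fmap_apply, hj] at hi'
      exact lt_irrefl _ hi'
    · rw [fmap_apply_of_notMem F _ h] at hi'
      exact absurd hi' (lt_irrefl _)
  refine (Finset.card_le_card h1).trans ?_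
  rw [Finset.card_map, Finset.card_erase_of_mem (mem_univ j)]
  simp

end Skeleta

/-! ### Extension of homotopies from the skeleton, naturally in the faces -/

section Act

variable {m r : ℕ}

/-- The homotopies `h F` of the `r`-dimensional faces fix the boundary and start at `K`. -/
structure ActOK (K : Δ m → X) (h : Face r m → Δ r → I01 → X) : Prop where
  zero : ∀ F y, h F y 0 = K (fmap F y)
  bd : ∀ F, ∀ y ∈ bd r, ∀ t, h F y t = K (fmap F y)

open Classical in
/-- The extension to the simplex of homotopies of the `r`-dimensional faces. -/
def act (K : Δ m → X) (h : Face r m → Δ r → I01 → X) (l : I01) (x : Δ m) : X :=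
  if H : ∃ F : Face r m, pmap (r + 1) l x ∈ range (fmap F) then
    h H.choose (fret H.choose (pmap (r + 1) l x)) (rtime (r + 1) l x)
  else K (pmap (r + 1) l x)

variable {K : Δ m → X} {h : Face r m → Δ r → I01 → X}

lemma act_eq_h (ok : ActOK K h) {l : I01} {x : Δ m} {F : Face r m} {y : Δ r}
    (hy : fmap F y = pmap (r + 1) l x) : act K h l x = h F y (rtime (r + 1) l x) := by
  have H : ∃ F : Face r m, pmap (r + 1) l x ∈ range (fmap F) := ⟨F, y, hy⟩
  rw [act, dif_pos H]
  obtain ⟨y', hy'⟩ := H.choose_spec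
  generalize H.choose = F' at hy' ⊢
  rw [← hy', fret_fmap]
  by_cases hF : F' = F
  · subst hF
    rw [show y' = y by rw [← fret_fmap F' y', hy', ← hy, fret_fmap]]
  · have key : ∀ (F F' : Face r m) (y y' : Δ r), F' ≠ F →
        fmap F' y' = fmap F y → y ∈ bd r := by
      intro F F' y y' hne he
      by_contra hy
      apply hne
      have h1 : range F ⊆ range F' := by
        rintro _ ⟨j, rfl⟩
        by_contra hj
        apply hy
        refine ⟨j, ?_⟩
        rw [← fmap_apply F y j, ← he, fmap_apply_of_notMem F' _ hj]
      have h2 : range F = range F' := by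
        refine Set.eq_of_subset_of_ncard_le h1 ?_
        rw [Set.ncard_range_of_injective F.injective, Set.ncard_range_of_injective F'.injective]
      exact (OrderEmbedding.range_inj.1 h2).symm
    rw [ok.bd F y (key F F' y y' hF (hy'.trans hy.symm)),
      ok.bd F' y' (key F' F y' y (Ne.symm hF) (hy.trans hy'.symm)), hy, hy']

lemma act_eq_K (ok : ActOK K h) {l : I01} {x : Δ m} (hl : l.1 * lev 0 x / 2 ≤ lev (r + 1) x) :
    act K h l x = K (pmap (r + 1) l x) := by
  by_cases H : ∃ F : Face r m, pmap (r + 1) l x ∈ range (fmap F)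
  · obtain ⟨F, y, hy⟩ := H
    rw [act_eq_h ok hy, rtime_eq_zero hl, ok.zero, hy]
  · rw [act, dif_neg H]

lemma act_zero (ok : ActOK K h) (x : Δ m) : act K h 0 x = K x := by
  have h0 : ((0 : I01) : ℝ) = 0 := rfl
  rw [act_eq_K ok (by rw [h0, zero_mul, zero_div]; exact lev_nonneg _ _), pmap_eq_self]
  rw [shift, h0, zero_mul, zero_div, min_eq_right (lev_nonneg _ _)]

lemma act_fmap (ok : ActOK K h) {l : I01} {x : Δ m} (hx : x ∈ Sk (r + 1) m)
    {F : Face r m} {y : Δ r} (hy : fmap F y = x) : act K h l x = h F y l := by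
  have h0 := lev_eq_zero hx
  rw [act_eq_h ok (F := F) (y := y), rtime_of_lev_eq_zero h0]
  rw [hy, pmap_eq_self]
  rw [shift, h0, min_eq_left]
  have := mul_nonneg l.2.1 (lev_nonneg 0 x)
  linarith

lemma act_face (hr : r ≤ m) {K : Δ (m + 1) → X}
    {h : (Fin (r + 1) ↪o Fin (m + 2)) → Δ r → I01 → X} (ok : ActOK K h) (i : Fin (m + 2))
    {K' : Δ m → X} {h' : Face r m → Δ r → I01 → X} (ok' : ActOK K' h')
    (hK : ∀ x, K' x = K (face i x))
    (hh : ∀ F y t, h' F y t = h (F.trans (Fin.succAboveOrderEmb i)) y t) (l : I01) (x : Δ m) :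
    act K h l (face i x) = act K' h' l x := by
  rcases le_total (l.1 * lev 0 x / 2) (lev (r + 1) x) with hl | hl
  · rw [act_eq_K ok' hl, act_eq_K ok (by rwa [lev_face, lev_face]), pmap_face, hK]
  · obtain ⟨F, y, hy⟩ := exists_fmap_eq_pmap hr hl
    rw [act_eq_h ok' hy, act_eq_h ok (F := F.trans (Fin.succAboveOrderEmb i)) (y := y), hh,
      rtime_face]
    rw [← face_comp_fmap, pmap_face, ← hy]
    rfl

lemma continuous_act (hr : r ≤ m) {W : Type} [TopologicalSpace W] {K : W → Δ m → X}
    {h : W → Face r m → Δ r → I01 → X} (ok : ∀ w, ActOK (K w) (h w))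
    (hK : Continuous fun p : W × Δ m => K p.1 p.2)
    (hh : ∀ F, Continuous fun p : W × (Δ r × I01) => h p.1 F p.2.1 p.2.2)
    {l : W → I01} {x : W → Δ m} (hl : Continuous l) (hx : Continuous x) :
    Continuous fun w => act (K w) (h w) (l w) (x w) := by
  have hp := continuous_pmap (r + 1) hl hx
  let A : Option (Face r m) → Set W := fun o => o.elim
    {w | (l w).1 * lev 0 (x w) / 2 ≤ lev (r + 1) (x w)}
    fun F => {w | pmap (r + 1) (l w) (x w) ∈ range (fmap F)}
  refine (locallyFinite_of_finite A).continuous ?_ ?_ ?_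
  · refine Set.eq_univ_of_forall fun w => mem_iUnion.2 ?_
    rcases le_total ((l w).1 * lev 0 (x w) / 2) (lev (r + 1) (x w)) with h | h
    · exact ⟨none, h⟩
    · obtain ⟨F, y, hy⟩ := exists_fmap_eq_pmap hr h
      exact ⟨some F, y, hy⟩
  · rintro (_ | F)
    · exact isClosed_le (((continuous_subtype_val.comp hl).mul
        ((continuous_lev 0).comp hx)).div_const 2) ((continuous_lev _).comp hx)
    · exact (isCompact_range (fmap F).continuous).isClosed.preimage hp
  · rintro (_ | F)
    · refine ContinuousOn.congr (f := fun w => K w (pmap (r + 1) (l w) (x w))) ?_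
        fun w hw => act_eq_K (ok w) hw
      exact (hK.comp (continuous_id.prodMk hp)).continuousOn
    · refine ContinuousOn.congr (f := fun w => h w F (fret F (pmap (r + 1) (l w) (x w)))
        (rtime (r + 1) (l w) (x w))) ?_ ?_
      · exact ((hh F).comp (continuous_id.prodMk (((continuous_fret F).comp hp).prodMk
          (continuous_rtime (r + 1) hl hx)))).continuousOn
      · rintro w ⟨y, hy⟩
        simp only
        rw [act_eq_h (ok w) hy, ← hy, fret_fmap]

end Act

/-! ### Homotopy invariance of bounded cocycles relative to skeleta -/

section Cochains

/-- Real singular cochains. -/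
abbrev Cochain (X : Type) [TopologicalSpace X] (n : ℕ) := SChain ℝ X n →ₗ[ℝ] ℝ

/-- Homotopy of simplices relative to the points with at most `q` non-zero coordinates. -/
def HomRel (q : ℕ) {m : ℕ} (σ σ' : SSimplex X m) : Prop :=
  ∃ H : C(Δ m × I01, X), (∀ x, H (x, 0) = σ x) ∧ (∀ x, H (x, 1) = σ' x) ∧
    ∀ x ∈ Sk q m, ∀ t, H (x, t) = σ x

/-- The cochain takes the same values on simplices homotopic relative to `Sk q`. -/
def Inv (q : ℕ) {n : ℕ} (β : Cochain X n) : Prop :=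
  ∀ σ σ' : SSimplex X n, HomRel q σ σ' → β (sgl ℝ σ) = β (sgl ℝ σ')

/-- Cocycles. -/
def Cocyc {n : ℕ} (β : Cochain X n) : Prop := ∀ c, β (bdry ℝ X n c) = 0

/-- The cochain is bounded by `C`. -/
def BddBy (C : ℝ) {n : ℕ} (β : Cochain X n) : Prop := ∀ σ, |β (sgl ℝ σ)| ≤ C

lemma abs_le_l1 {C : ℝ} {n : ℕ} {β : Cochain X n} (h : BddBy C β) (c : SChain ℝ X n) :
    |β c| ≤ C * l1 c := by
  conv_lhs => rw [chain_eq_sum c, map_sum]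
  rw [l1, Finsupp.sum, mul_sum]
  refine (Finset.abs_sum_le_sum_abs _ _).trans (sum_le_sum fun σ _ => ?_)
  rw [map_smul, smul_eq_mul, abs_mul, mul_comm]
  exact mul_le_mul_of_nonneg_right (h σ) (abs_nonneg _)

/-- A bounded cochain is uniformly bounded on the push-forwards of a chain. -/
lemma BddBy.push {C : ℝ} {n : ℕ} {β : Cochain X n} (h : BddBy C β) {Z : Type}
    [TopologicalSpace Z] (u : SChain ℝ Z n) : ∃ B, ∀ f : C(Z, X), |β (push ℝ f n u)| ≤ B :=
  ⟨C * l1 u, fun f => abs_le_l1 (β := β.comp (BddCoh.push ℝ f n)) (fun σ => by simpa using h _) u⟩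

lemma BddBy.prism {C : ℝ} {m : ℕ} {β : Cochain X (m + 1)} (h : BddBy C β) :
    ∃ B, ∀ H : C(Δ m × I01, X), |β (prism ℝ H)| ≤ B := by
  obtain ⟨B, hB⟩ := h.push (real ℝ (convex_Pr m)
    (tprism (prSlice m 0) (prSlice m 1) (single (vtx m) 1)))
  exact ⟨B, fun H => hB _⟩

lemma Cocyc.add_comp_bdry {n : ℕ} {β : Cochain X (n + 1)} (h : Cocyc β)
    (η : Cochain X n) : Cocyc (β + η.comp (bdry ℝ X n)) := fun c => by
  rw [ladd, h c, comp_apply, bdry_bdry, map_zero, add_zero]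

/-- Homotopies with the same sides have the same effect on a cocycle. -/
lemma Cocyc.slice_sub {n : ℕ} {β : Cochain X (n + 1)} (h : Cocyc β)
    (H : C(Δ (n + 1) × I01, X)) : β (sgl ℝ (slice H 1)) = β (sgl ℝ (slice H 0)) +
      ∑ i : Fin (n + 2), (-1 : ℝ) ^ (i : ℕ) * β (prism ℝ (faceH H i)) := by
  have h1 := h (prism ℝ H)
  rw [bdry_prism, map_sub, map_sub, map_sum] at h1
  simp only [map_smul, smul_eq_mul] at h1
  linarith

lemma Cocyc.inv {n : ℕ} {β : Cochain X (n + 1)} (h : Cocyc β) : Inv (n + 1) β := by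
  rintro σ σ' ⟨H, h0, h1, hs⟩
  let H' : C(Δ (n + 1) × I01, X) := σ.comp ContinuousMap.fst
  have e0 : slice H 0 = σ := ContinuousMap.ext h0
  have e1 : slice H 1 = σ' := ContinuousMap.ext h1
  have e2 : slice H' 0 = σ := rfl
  have e3 : slice H' 1 = σ := rfl
  have e4 : ∀ i, faceH H i = faceH H' i := fun i => by
    ext ⟨x, t⟩
    rw [faceH_apply, hs]
    · rfl
    · have h1 : (univ.filter fun j => 0 < (face i x).1 j) ⊆ univ.erase i := fun j hj => by
          refine Finset.mem_erase.2 ⟨?_, mem_univ _⟩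
          rintro rfl
          have := (mem_filter.1 hj).2
          simp [face] at this
      refine (Finset.card_le_card h1).trans ?_
      rw [Finset.card_erase_of_mem (mem_univ i)]
      simp
  have h2 := h.slice_sub H
  have h3 := h.slice_sub H'
  simp only [e4] at h2
  rw [e0, e1] at h2
  rw [e2, e3] at h3
  linarith

end Cochains

/-! ### Averaging over the homotopies of faces -/

section Average

variable {m r : ℕ}

/-- The restriction of a simplex to a face. -/
def resF (σ : SSimplex X m) (F : Face r m) : RelMap r X := σ.comp (fmap F)

lemma resF_faceOf (σ : SSimplex X (m + 1)) (i : Fin (m + 2)) (F : Face r m) :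
    resF (faceOf σ i) F = resF σ (F.trans (Fin.succAboveOrderEmb i)) := by
  rw [resF, resF, faceOf, ContinuousMap.comp_assoc, face_comp_fmap]

lemma actOK_path (σ : SSimplex X m) {p : Face r m → RelMap r X}
    (u : ∀ F, Path (resF σ F) (p F)) : ActOK σ fun F y t => (u F t).toMap y where
  zero F y := by rw [(u F).source]; rfl
  bd F y hy t := by rw [RelMap.path_bd _ hy]; rfl

/-- The homotopy of a simplex extending given homotopies of its `r`-dimensional faces. -/
def hAct (hr : r ≤ m) (σ : SSimplex X m) {p : Face r m → RelMap r X}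
    (u : ∀ F, Path (resF σ F) (p F)) : C(Δ m × I01, X) where
  toFun z := act σ (fun F y t => (u F t).toMap y) z.2 z.1
  continuous_toFun := continuous_act hr (K := fun _ => σ)
    (h := fun _ F y t => (u F t).toMap y) (fun _ => actOK_path σ u)
    (σ.continuous.comp continuous_snd) (fun F => (RelMap.continuous_path (u F)).comp continuous_snd)
    continuous_snd continuous_fst

lemma hAct_congr (hr : r ≤ m) (σ : SSimplex X m)
    {p p' : Face r m → RelMap r X} (u : ∀ F, Path (resF σ F) (p F))
    (u' : ∀ F, Path (resF σ F) (p' F)) (h : ∀ F t, (u F t : RelMap r X) = u' F t) :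
    hAct hr σ u = hAct hr σ u' := by
  ext ⟨x, t⟩
  show act σ (fun F y t => (u F t).toMap y) t x = act σ (fun F y t => (u' F t).toMap y) t x
  simp only [h]

lemma slice_hAct_zero (hr : r ≤ m) (σ : SSimplex X m)
    {p : Face r m → RelMap r X} (u : ∀ F, Path (resF σ F) (p F)) :
    slice (hAct hr σ u) 0 = σ := ContinuousMap.ext fun x => act_zero (actOK_path σ u) x

lemma faceH_hAct (hr : r ≤ m) (σ : SSimplex X (m + 1))
    {p : (Fin (r + 1) ↪o Fin (m + 2)) → RelMap r X} (u : ∀ F, Path (resF σ F) (p F))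
    (i : Fin (m + 2)) {p' : Face r m → RelMap r X}
    (u' : ∀ F, Path (resF (faceOf σ i) F) (p' F))
    (h : ∀ F t, (u' F t : RelMap r X) = u (F.trans (Fin.succAboveOrderEmb i)) t) :
    faceH (hAct (hr.trans m.le_succ) σ u) i = hAct hr (faceOf σ i) u' := by
  ext ⟨x, t⟩
  exact act_face hr (actOK_path σ u) i (actOK_path _ u') (fun _ => rfl) (fun F y t => by rw [h]) t x

/-- A family of homotopies of faces, constant at the end, gives homotopic results. -/
lemma homRel_act (hr : r ≤ m) {K : I01 → Δ m → X}
    {h : I01 → Face r m → Δ r → I01 → X} (ok : ∀ a, ActOK (K a) (h a))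
    (hK : Continuous fun p : I01 × Δ m => K p.1 p.2)
    (hh : ∀ F, Continuous fun p : I01 × (Δ r × I01) => h p.1 F p.2.1 p.2.2)
    (h1 : ∀ a F y, h a F y 1 = h 0 F y 1) {σ σ' : SSimplex X m}
    (hσ : ∀ x, σ x = act (K 0) (h 0) 1 x) (hσ' : ∀ x, σ' x = act (K 1) (h 1) 1 x) :
    HomRel (r + 1) σ σ' := by
  refine ⟨⟨fun z => act (K z.2) (h z.2) 1 z.1, ?_⟩, fun x => (hσ x).symm, fun x => (hσ' x).symm, ?_⟩
  · exact continuous_act hr (K := fun z : Δ m × I01 => K z.2) (h := fun z => h z.2)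
      (fun z => ok z.2) (hK.comp ((continuous_snd.comp continuous_fst).prodMk continuous_snd))
      (fun F => (hh F).comp ((continuous_snd.comp continuous_fst).prodMk continuous_snd))
      continuous_const continuous_fst
  · intro x hx a
    obtain ⟨F, y, hy⟩ := exists_fmap_of_mem_Sk hr hx
    show act (K a) (h a) 1 x = _
    rw [hσ, act_fmap (ok a) hx hy, act_fmap (ok 0) hx hy, h1]

lemma homRel_hAct_of_homotopic (hr : r ≤ m) (σ : SSimplex X m)
    {p : Face r m → RelMap r X} (u u' : ∀ F, Path (resF σ F) (p F))
    (h : ∀ F, (u F).Homotopic (u' F)) :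
    HomRel (r + 1) (slice (hAct hr σ u) 1) (slice (hAct hr σ u') 1) := by
  let G : ∀ F, (u F).Homotopy (u' F) := fun F => (h F).some
  have hG : ∀ F, Continuous fun z : Δ r × (I01 × I01) => ((G F) z.2 : RelMap r X).toMap z.1 :=
    fun F => RelMap.continuous_eval (G F).continuous
  have hbd : ∀ F, ∀ y ∈ bd r, ∀ z : I01 × I01,
      ((G F) z : RelMap r X).toMap y = (resF σ F).toMap y := fun F y hy z => by
    rw [RelMap.eval_bd_eq (G F).continuous hy z (0, 0), (G F).source]
  refine homRel_act hr (K := fun _ => σ) (h := fun a F y t => ((G F) (a, t) : RelMap r X).toMap y)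
    (fun a => ⟨fun F y => ?_, fun F y hy t => hbd F y hy _⟩) (σ.continuous.comp continuous_snd)
    (fun F => ?_) (fun a F y => ?_) (fun x => ?_) (fun x => ?_)
  · rw [(G F).source]; rfl
  · exact (hG F).comp ((continuous_fst.comp continuous_snd).prodMk
      (continuous_fst.prodMk (continuous_snd.comp continuous_snd)))
  · rw [(G F).target, (G F).target]
  · simp only [(G _).apply_zero]; rfl
  · simp only [(G _).apply_one]; rfl

/-- The homotopies of the faces induced by a homotopy relative to the lower skeleton. -/
def resPath {σ σ' : SSimplex X m} (H : C(Δ m × I01, X)) (h0 : ∀ x, H (x, 0) = σ x)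
    (h1 : ∀ x, H (x, 1) = σ' x) (hs : ∀ x ∈ Sk r m, ∀ t, H (x, t) = σ x)
    (F : Face r m) : Path (resF σ F) (resF σ' F) :=
  RelMap.mkPath (H.comp ((fmap F).prodMap (ContinuousMap.id _))) (fun _ => h0 _) (fun _ => h1 _)
    (fun _ hy t => hs _ (mem_Sk_of_bd F hy) t)

lemma homRel_hAct_trans (hr : r ≤ m) {σ σ' : SSimplex X m} (H : C(Δ m × I01, X))
    (h0 : ∀ x, H (x, 0) = σ x) (h1 : ∀ x, H (x, 1) = σ' x)
    (hs : ∀ x ∈ Sk r m, ∀ t, H (x, t) = σ x)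
    {p : Face r m → RelMap r X} (u : ∀ F, Path (resF σ' F) (p F)) :
    HomRel (r + 1) (slice (hAct hr σ fun F => (resPath H h0 h1 hs F).trans (u F)) 1)
      (slice (hAct hr σ' u) 1) := by
  let U := fun F => (resPath H h0 h1 hs F).trans (u F)
  let s : I01 → I01 → I01 := fun a t => ⟨(a.1 + (2 - a.1) * t.1) / 2, by
    have ha := a.2; have ht := t.2
    have h2 := mul_nonneg (sub_nonneg.2 (ha.2.trans one_le_two)) ht.1
    have h3 := mul_le_mul_of_nonneg_left ht.2 (sub_nonneg.2 (ha.2.trans one_le_two))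
    constructor
    · linarith [ha.1]
    · linarith⟩
  have hsc : Continuous fun z : I01 × I01 => s z.1 z.2 := Continuous.subtype_mk (by fun_prop) _
  have hU : ∀ F (a : I01) y, (U F (s a 0)).toMap y = H (fmap F y, a) := fun F a y => by
    have e : s a 0 = ⟨a.1 / 2, by have := a.2; constructor <;> linarith [this.1, this.2]⟩ :=
      Subtype.ext (by simp [s])
    have h2 : a.1 / 2 ≤ 1 / 2 := by linarith [a.2.2]
    rw [e]
    show (((resPath H h0 h1 hs F).trans (u F)) _).toMap y = _
    rw [Path.trans_apply, dif_pos h2]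
    show H (fmap F y, _) = _
    congr 2
    refine Subtype.ext ?_
    show 2 * (a.1 / 2) = a.1
    ring
  have e1 : ∀ a, s a 1 = 1 := fun a => Subtype.ext (by simp [s])
  refine homRel_act hr (K := fun a x => H (x, a)) (h := fun a F y t => (U F (s a t)).toMap y)
    (fun a => ⟨fun F y => hU F a y, fun F y hy t => ?_⟩) (H.continuous.comp continuous_swap)
    (fun F => ?_) (fun a F y => ?_) (fun x => ?_) (fun x => ?_)
  · rw [← hU, RelMap.path_bd _ hy, RelMap.path_bd _ hy]
  · exact (RelMap.continuous_path (U F)).comp ((continuous_fst.comp continuous_snd).prodMk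
      (hsc.comp (continuous_fst.prodMk (continuous_snd.comp continuous_snd))))
  · simp only [e1]
  · have e : ∀ t, s 0 t = t := fun t => Subtype.ext (by simp [s])
    simp only [e, h0]; rfl
  · have e : ∀ F (t : I01), U F (s 1 t) = u F t := fun F t => by
      show ((resPath H h0 h1 hs F).trans (u F)) _ = _
      rw [Path.trans_apply]
      have hv : (s 1 t).1 = (1 + t.1) / 2 := by simp [s]; ring
      split_ifs with h
      · have ht : t = 0 := Subtype.ext (le_antisymm (by rw [hv] at h; simp; linarith) t.2.1)
        subst ht
        rw [(u F).source]
        convert (resPath H h0 h1 hs F).target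
        rw [hv]; simp
      · congr 1
        exact Subtype.ext (by simp only [hv]; ring)
    simp only [e, h1]; rfl

/-- A representative of the path component. -/
def rep {Z : Type} [TopologicalSpace Z] (g : Z) : Z := (Quotient.mk (pathSetoid Z) g).out

lemma joined_rep {Z : Type} [TopologicalSpace Z] (g : Z) : Joined g (rep g) :=
  (Quotient.exact (Quotient.out_eq (Quotient.mk (pathSetoid Z) g))).symm

lemma rep_eq {Z : Type} [TopologicalSpace Z] {g g' : Z} (h : Joined g g') : rep g = rep g' := by
  rw [rep, rep, Quotient.sound (s := pathSetoid Z) h]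

/-- The labels of the averaging group. -/
abbrev Lab (r : ℕ) (X : Type) [TopologicalSpace X] := RelMap r X × (Fin (r + 1) → ℕ)

/-- The group over which bounded cochains are averaged. -/
abbrev AvGroup (r : ℕ) (X : Type) [TopologicalSpace X] :=
  ∀ p : Lab r X, FundamentalGroup (RelMap r X) p.1

/-- The class of paths determined by an element of the averaging group. -/
def lampQ (γ : AvGroup r X) (w : Fin (r + 1) → ℕ) {g p : RelMap r X} (h : Joined g p) : PQ g p :=
  (PQ.mk h.somePath).trans (γ (p, w))

/-- The path determined by an element of the averaging group. -/
def lamp (γ : AvGroup r X) (w : Fin (r + 1) → ℕ) {g p : RelMap r X} (h : Joined g p) : Path g p :=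
  (lampQ γ w h).out

lemma mk_lamp (γ : AvGroup r X) (w : Fin (r + 1) → ℕ) {g p : RelMap r X} (h : Joined g p) :
    PQ.mk (lamp γ w h) = lampQ γ w h := Quotient.out_eq _

/-- The homotopy of a simplex determined by an element of the averaging group. -/
def hAv (hr : r ≤ m) (γ : AvGroup r X) (z : Fin (m + 1) → ℕ) (σ : SSimplex X m) : C(Δ m × I01, X) :=
  hAct hr σ fun F => lamp γ (z ∘ F) (joined_rep (resF σ F))

lemma faceH_hAv (hr : r ≤ m) (γ : AvGroup r X) (z : Fin (m + 2) → ℕ) (σ : SSimplex X (m + 1))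
    (i : Fin (m + 2)) : faceH (hAv (hr.trans m.le_succ) γ z σ) i =
      hAv hr γ (fun j => z (i.succAbove j)) (faceOf σ i) := by
  refine faceH_hAct hr σ _ i _ fun F t => ?_
  have key : ∀ (g g' : RelMap r X), g = g' → ∀ w, (lamp γ w (joined_rep g) t : RelMap r X) =
      lamp γ w (joined_rep g') t := by
    rintro g _ rfl w; rfl
  exact key _ _ (resF_faceOf σ i F) _

lemma exists_extend_pi {ι A : Type} {B : A → Type} [∀ a, Nonempty (B a)] {f : ι → A}
    (hf : Injective f) (b : ∀ i, B (f i)) : ∃ a : ∀ p, B p, ∀ i, a (f i) = b i := by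
  classical
  have h : ∀ p, ∃ c : B p, ∀ i (hi : f i = p), c = hi ▸ b i := fun p => by
    by_cases hp : ∃ i, f i = p
    · obtain ⟨i, rfl⟩ := hp
      refine ⟨b i, fun i' hi' => ?_⟩
      obtain rfl := hf hi'
      rfl
    · exact ⟨Classical.arbitrary _, fun i hi => absurd ⟨i, hi⟩ hp⟩
  choose a ha using h
  exact ⟨a, fun i => ha _ i rfl⟩

lemma lampQ_mul (γ a : AvGroup r X) {w : Fin (r + 1) → ℕ} {g g' p : RelMap r X} (h' : Joined g' p)
    (h : Joined g p) {a₀ : FundamentalGroup (RelMap r X) p} (ha : a (p, w) = a₀)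
    (P : PQ g g')
    (ha₀ : a₀ = (PQ.mk h.somePath).symm.trans (P.trans (PQ.mk h'.somePath))) :
    lampQ (γ * a) w h = P.trans (lampQ γ w h') := by
  have e : (γ * a) (p, w) = PQ.trans a₀ (γ (p, w)) := by rw [Pi.mul_apply, ha]; rfl
  rw [lampQ, lampQ, e, ha₀, PQ.trans_assoc, ← PQ.trans_assoc, PQ.trans_symm,
    PQ.refl_trans, PQ.trans_assoc]

/-- A homotopy relative to the lower skeleton translates the averaging group. -/
lemma exists_translate (hr : r ≤ m) {β : Cochain X m} (hβ : Inv (r + 1) β)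
    {σ σ' : SSimplex X m} (hσ : HomRel r σ σ') {z : Fin (m + 1) → ℕ} (hz : Injective z) :
    ∃ a : AvGroup r X, ∀ γ, β (sgl ℝ (slice (hAv hr γ z σ') 1)) =
      β (sgl ℝ (slice (hAv hr (γ * a) z σ) 1)) := by
  obtain ⟨H, h0, h1, hs⟩ := hσ
  let P := fun F => resPath (r := r) H h0 h1 hs F
  have hjoin : ∀ F, Joined (resF σ' F) (rep (resF σ F)) := fun F =>
    (Joined.symm ⟨P F⟩).trans (joined_rep _)
  have hrep : ∀ F, rep (resF σ' F) = rep (resF σ F) := fun F => (rep_eq ⟨P F⟩).symm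
  let a₀ : ∀ F, FundamentalGroup (RelMap r X) (rep (resF σ F)) := fun F =>
    (PQ.mk (joined_rep (resF σ F)).somePath).symm.trans
      ((PQ.mk (P F)).trans (PQ.mk (hjoin F).somePath))
  obtain ⟨a, ha⟩ := exists_extend_pi (B := fun p : Lab r X => FundamentalGroup (RelMap r X) p.1)
    (f := fun F : Face r m => (rep (resF σ F), z ∘ F)) (fun F F' h => by
      ext j
      exact congrArg Fin.val (hz (congrFun (congrArg Prod.snd h) j))) a₀
  refine ⟨a, fun γ => ?_⟩
  have e1 : hAv hr γ z σ' = hAct hr σ' fun F => lamp γ (z ∘ F) (hjoin F) := by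
    have key : ∀ (g p p' : RelMap r X) (h : Joined g p) (h' : Joined g p') (w) (t : I01), p = p' →
        (lamp γ w h t : RelMap r X) = lamp γ w h' t := by
      rintro g p _ h h' w t rfl; rfl
    exact hAct_congr hr σ' _ _ fun F t => key _ _ _ _ _ _ _ (hrep F)
  rw [e1, ← hβ _ _ (homRel_hAct_trans hr H h0 h1 hs _)]
  refine hβ _ _ (homRel_hAct_of_homotopic hr σ _ _ fun F => ?_)
  refine PQ.eq.1 ?_
  rw [PQ.mk_trans, mk_lamp, mk_lamp]
  exact (lampQ_mul γ a (hjoin F) (joined_rep _) (ha F) _ rfl).symm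

/-- Bounded cocycles can be made invariant under homotopies of the faces of a given dimension. -/
theorem exists_inv_of_inv_succ {n : ℕ} (hr : r + 1 ≤ n) {β : Cochain X (n + 1)}
    (hβ : Cocyc β) {C : ℝ} (hC : BddBy C β) (hinv : Inv (r + 1 + 1) β) :
    ∃ (η : Cochain X n) (B : ℝ), BddBy B η ∧
      BddBy C (β + η.comp (bdry ℝ X n)) ∧ Inv (r + 1) (β + η.comp (bdry ℝ X n)) := by
  obtain ⟨M, hM⟩ := exists_mean_of_comm (G := AvGroup (r + 1) X)
    fun a b => funext fun p => RelMap.mul_comm p.1 (a p) (b p)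
  obtain ⟨L, hL⟩ := exists_free_mean
  obtain ⟨B, hB⟩ := hC.prism
  let η : Cochain X n := clift fun τ => (Mean.iter (n + 1) fun _ => L).E fun z =>
    M.E fun γ => β (prism ℝ (hAv hr γ z τ))
  have hη : ∀ τ, η (sgl ℝ τ) = (Mean.iter (n + 1) fun _ => L).E fun z =>
    M.E fun γ => β (prism ℝ (hAv hr γ z τ)) := fun τ => clift_sgl _ _
  have key : ∀ σ, (β + η.comp (bdry ℝ X n)) (sgl ℝ σ) = (Mean.iter (n + 2) fun _ => L).E fun z =>
      M.E fun γ => β (sgl ℝ (slice (hAv (hr.trans n.le_succ) γ z σ) 1)) := fun σ => by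
    have h1 : ∀ z γ, β (sgl ℝ (slice (hAv (hr.trans n.le_succ) γ z σ) 1)) = β (sgl ℝ σ) +
        ∑ i : Fin (n + 2), (-1 : ℝ) ^ (i : ℕ) *
          β (prism ℝ (hAv hr γ (fun j => z (i.succAbove j)) (faceOf σ i))) := fun z γ => by
      rw [hβ.slice_sub, hAv, slice_hAct_zero]
      congr 1
      exact sum_congr rfl fun i _ => by rw [← faceH_hAv]; rfl
    simp only [h1, Mean.E_add, Mean.const, Mean.E_sum, Mean.E_mul]
    rw [ladd, comp_apply, bdry_sgl, map_sum]
    congr 1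
    refine sum_congr rfl fun i _ => ?_
    rw [map_smul, smul_eq_mul, hη]
    congr 1
    exact (Mean.iter_removeNth (fun _ => L) i
      fun z => M.E fun γ => β (prism ℝ (hAv hr γ z (faceOf σ i)))).symm
  refine ⟨η, B, fun τ => ?_, fun σ => ?_, fun σ σ' h => ?_⟩
  · rw [hη]
    exact Mean.bound _ _ _ fun z => M.bound _ _ fun γ => hB _
  · rw [key]
    exact Mean.bound _ _ _ fun z => M.bound _ _ fun γ => hC _
  · rw [key, key]
    refine iter_free_congr hL _ _ fun z hz => ?_
    obtain ⟨a, ha⟩ := exists_translate (hr.trans n.le_succ) hinv h hz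
    simp only [ha]
    exact (hM a (fun γ => β (sgl ℝ (slice (hAv (hr.trans n.le_succ) γ z σ) 1)))
      ⟨C, fun γ => hC _⟩).symm

/-- Bounded cocycles can be made invariant under homotopies relative to the vertices. -/
theorem exists_inv_one {n : ℕ} {β : Cochain X (n + 1)}
    (hβ : Cocyc β) {C : ℝ} (hC : BddBy C β) :
    ∃ (η : Cochain X n) (B : ℝ), BddBy B η ∧
      BddBy C (β + η.comp (bdry ℝ X n)) ∧ Inv 1 (β + η.comp (bdry ℝ X n)) := by
  have key : ∀ q, q ≤ n → ∃ (η : Cochain X n) (B : ℝ), BddBy B η ∧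
      BddBy C (β + η.comp (bdry ℝ X n)) ∧ Inv (n - q + 1) (β + η.comp (bdry ℝ X n)) := by
    intro q
    induction q with
    | zero =>
      intro _
      refine ⟨0, 0, fun σ => by simp, ?_, ?_⟩ <;> rw [LinearMap.zero_comp, add_zero]
      · exact hC
      · exact hβ.inv
    | succ q ih =>
      intro hq
      obtain ⟨η, B, h1, h2, h3⟩ := ih (by omega)
      have e : n - q + 1 = n - (q + 1) + 1 + 1 := by omega
      rw [e] at h3
      obtain ⟨η', B', h1', h2', h3'⟩ := exists_inv_of_inv_succ (by omega) (hβ.add_comp_bdry η) h2 h3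
      refine ⟨η + η', B + B', fun σ => ?_, ?_, ?_⟩
      · rw [ladd]
        exact (abs_add_le _ _).trans (add_le_add (h1 σ) (h1' σ))
      · rwa [LinearMap.add_comp, ← add_assoc]
      · rwa [LinearMap.add_comp, ← add_assoc]
  simpa using key n le_rfl

end Average

/-! ### Star-shaped simplices -/

section Star

variable {m : ℕ}

/-- The parameter on the `i`-th leg. -/
def leg (x : Δ m) (i : Fin (m + 1)) : I01 := projIcc 0 1 zero_le_one (2 * x.1 i - 1)

open Classical in
/-- The star-shaped map with centre `q` and legs `G i`. -/
def star (q : X) (G : Fin (m + 1) → I01 → X) (x : Δ m) : X :=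
  if h : ∃ i, 1 / 2 < x.1 i then G h.choose (leg x h.choose) else q

lemma coord_add_le (x : Δ m) {i j : Fin (m + 1)} (h : i ≠ j) : x.1 i + x.1 j ≤ 1 := by
  rw [← x.2.2, ← Finset.sum_pair h]
  exact Finset.sum_le_univ_sum_of_nonneg x.2.1

lemma star_eq {q : X} {G : Fin (m + 1) → I01 → X} (hG : ∀ i, G i 0 = q) {x : Δ m}
    {i : Fin (m + 1)} (hi : 1 / 2 ≤ x.1 i) : star q G x = G i (leg x i) := by
  rcases hi.eq_or_lt with hi | hi
  · have h : ¬ ∃ i, 1 / 2 < x.1 i := by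
      rintro ⟨k, hk⟩
      have hne : i ≠ k := by rintro rfl; linarith
      have := coord_add_le x hne
      linarith
    rw [star, dif_neg h]
    have : leg x i = 0 := projIcc_of_le_left _ (by linarith)
    rw [this, hG]
  · have h : ∃ i, 1 / 2 < x.1 i := ⟨i, hi⟩
    rw [star, dif_pos h]
    have : h.choose = i := by
      by_contra hne
      have := coord_add_le x hne
      have := h.choose_spec
      linarith
    rw [this]

lemma star_eq_centre {q : X} {G : Fin (m + 1) → I01 → X} {x : Δ m} (h : ∀ i, x.1 i ≤ 1 / 2) :
    star q G x = q := by
  rw [star, dif_neg]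
  rintro ⟨i, hi⟩
  exact absurd hi (not_lt.2 (h i))

lemma continuous_star {W : Type} [TopologicalSpace W] {q : W → X} {G : W → Fin (m + 1) → I01 → X}
    (hG : ∀ w i, G w i 0 = q w) (hq : Continuous q)
    (hGc : ∀ i, Continuous fun p : W × I01 => G p.1 i p.2) {x : W → Δ m} (hx : Continuous x) :
    Continuous fun w => star (q w) (G w) (x w) := by
  have hxi : ∀ i, Continuous fun w => (x w).1 i := fun i =>
    (continuous_apply i).comp (continuous_subtype_val.comp hx)
  let A : Option (Fin (m + 1)) → Set W := fun o => o.elim {w | ∀ i, (x w).1 i ≤ 1 / 2}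
    fun i => {w | 1 / 2 ≤ (x w).1 i}
  refine (locallyFinite_of_finite A).continuous ?_ ?_ ?_
  · refine Set.eq_univ_of_forall fun w => mem_iUnion.2 ?_
    by_cases h : ∀ i, (x w).1 i ≤ 1 / 2
    · exact ⟨none, h⟩
    · push Not at h
      obtain ⟨i, hi⟩ := h
      exact ⟨some i, hi.le⟩
  · rintro (_ | i)
    · show IsClosed {w | ∀ i, (x w).1 i ≤ 1 / 2}
      simp only [Set.ofPred_forall]
      exact isClosed_iInter fun i => isClosed_le (hxi i) continuous_const
    · exact isClosed_le continuous_const (hxi i)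
  · rintro (_ | i)
    · exact hq.continuousOn.congr fun w hw => star_eq_centre hw
    · refine ContinuousOn.congr (f := fun w => G w i (leg (x w) i)) ?_ fun w hw => star_eq (hG w) hw
      have h1 : Continuous fun w => leg (x w) i :=
        continuous_projIcc.comp ((continuous_const.mul (hxi i)).sub continuous_const)
      exact ((hGc i).comp (continuous_id.prodMk h1)).continuousOn

lemma leg_face (k : Fin (m + 2)) (x : Δ m) (i : Fin (m + 1)) :
    leg (face k x) (k.succAbove i) = leg x i := by
  simp [leg, face]

lemma star_face {q : X} {G : Fin (m + 2) → I01 → X} (hG : ∀ i, G i 0 = q) (k : Fin (m + 2))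
    (x : Δ m) : star q G (face k x) = star q (fun i => G (k.succAbove i)) x := by
  by_cases h : ∀ i, x.1 i ≤ 1 / 2
  · rw [star_eq_centre h, star_eq_centre]
    intro i
    refine Fin.succAboveCases k ?_ (fun i => ?_) i
    · simp [face]
    · simpa [face] using h i
  · push Not at h
    obtain ⟨i, hi⟩ := h
    rw [star_eq (fun i => hG _) hi.le, star_eq hG (i := k.succAbove i) (by simpa [face] using hi.le),
      leg_face]

lemma vtx_of_mem_Sk {x : Δ m} (hx : x ∈ Sk 1 m) : ∃ i, x = vtx m i := by
  obtain ⟨F, y, rfl⟩ := exists_fmap_of_mem_Sk (Nat.zero_le m) hx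
  have hy : y.1 0 = 1 := by simpa using y.2.2
  refine ⟨F 0, Subtype.ext (funext fun k => ?_)⟩
  by_cases hk : k ∈ range F
  · obtain ⟨j, rfl⟩ := hk
    obtain rfl : j = 0 := Fin.eq_zero j
    rw [fmap_apply, hy]
    simp [vtx]
  · rw [fmap_apply_of_notMem F y hk]
    have : k ≠ F 0 := fun h => hk ⟨0, h.symm⟩
    simp [vtx, this]

lemma star_vtx {q : X} {G : Fin (m + 1) → I01 → X} (hG : ∀ i, G i 0 = q) (i : Fin (m + 1)) :
    star q G (vtx m i) = G i 1 := by
  have h : (vtx m i).1 i = 1 := by simp [vtx]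
  rw [star_eq hG (i := i) (by rw [h]; norm_num)]
  congr 1
  exact projIcc_of_right_le _ (by rw [h]; norm_num)

/-- The star-shaped simplex with given legs. -/
def starS {q : X} {p : Fin (m + 1) → X} (γ : ∀ i, Path q (p i)) : SSimplex X m where
  toFun x := star q (fun i t => γ i t) x
  continuous_toFun := continuous_star (q := fun _ => q) (G := fun _ i t => γ i t)
    (fun _ i => (γ i).source) continuous_const (fun i => (γ i).continuous.comp continuous_snd)
    continuous_id

lemma starS_apply {q : X} {p : Fin (m + 1) → X} (γ : ∀ i, Path q (p i)) (x : Δ m) :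
    starS γ x = star q (fun i t => γ i t) x := rfl

lemma faceOf_starS {q : X} {p : Fin (m + 2) → X} (γ : ∀ i, Path q (p i)) (k : Fin (m + 2)) :
    faceOf (starS γ) k = starS fun i => γ (k.succAbove i) :=
  ContinuousMap.ext fun x => star_face (fun i => (γ i).source) k x

lemma homRel_star {q : I01 → X} {G : I01 → Fin (m + 1) → I01 → X}
    (hG : ∀ w i, G w i 0 = q w) (hq : Continuous q)
    (hGc : ∀ i, Continuous fun p : I01 × I01 => G p.1 i p.2) (h1 : ∀ w i, G w i 1 = G 0 i 1)
    {σ σ' : SSimplex X m} (hσ : ∀ x, σ x = star (q 0) (G 0) x)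
    (hσ' : ∀ x, σ' x = star (q 1) (G 1) x) : HomRel 1 σ σ' := by
  refine ⟨⟨fun z => star (q z.2) (G z.2) z.1, ?_⟩, fun x => (hσ x).symm, fun x => (hσ' x).symm, ?_⟩
  · exact continuous_star (q := fun z : Δ m × I01 => q z.2) (G := fun z => G z.2)
      (fun z => hG z.2) (hq.comp continuous_snd)
      (fun i => (hGc i).comp ((continuous_snd.comp continuous_fst).prodMk continuous_snd))
      continuous_fst
  · intro x hx w
    obtain ⟨i, rfl⟩ := vtx_of_mem_Sk hx
    show star (q w) (G w) _ = _
    rw [hσ, star_vtx (hG w), star_vtx (hG 0), h1]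

lemma homRel_starS_of_homotopic {q : X} {p : Fin (m + 1) → X} {γ γ' : ∀ i, Path q (p i)}
    (h : ∀ i, (γ i).Homotopic (γ' i)) : HomRel 1 (starS γ) (starS γ') := by
  let H := fun i => (h i).some
  refine homRel_star (q := fun _ => q) (G := fun w i t => H i (w, t)) (fun w i => (H i).source w)
    continuous_const (fun i => (H i).continuous) (fun w i => ?_) (fun x => ?_) (fun x => ?_)
  · rw [(H i).target, (H i).target]
  · simp only [(H _).apply_zero]; rfl
  · simp only [(H _).apply_one]; rfl

lemma homRel_starS_trans {q q' : X} (g : Path q' q) {p : Fin (m + 1) → X} (γ : ∀ i, Path q (p i)) :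
    HomRel 1 (starS fun i => g.trans (γ i)) (starS γ) := by
  let s : I01 → I01 → I01 := fun a t => ⟨(a.1 + (2 - a.1) * t.1) / 2, by
    have ha := a.2; have ht := t.2
    have h2 := mul_nonneg (sub_nonneg.2 (ha.2.trans one_le_two)) ht.1
    have h3 := mul_le_mul_of_nonneg_left ht.2 (sub_nonneg.2 (ha.2.trans one_le_two))
    constructor
    · linarith [ha.1]
    · linarith⟩
  have hsc : Continuous fun z : I01 × I01 => s z.1 z.2 := Continuous.subtype_mk (by fun_prop) _
  have h0 : ∀ (a : I01) i, (g.trans (γ i)) (s a 0) = g a := fun a i => by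
    have hv : (s a 0).1 = a.1 / 2 := by simp [s]
    rw [Path.trans_apply, dif_pos (by rw [hv]; linarith [a.2.2])]
    congr 1
    exact Subtype.ext (by simp only [hv]; ring)
  have h1 : ∀ a, s a 1 = 1 := fun a => Subtype.ext (by simp [s])
  refine homRel_star (q := g) (G := fun w i t => (g.trans (γ i)) (s w t)) h0 g.continuous
    (fun i => (g.trans (γ i)).continuous.comp hsc) (fun w i => by rw [h1, h1])
    (fun x => ?_) (fun x => ?_)
  · have e : ∀ t, s 0 t = t := fun t => Subtype.ext (by simp [s])
    simp only [e, g.source]; rfl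
  · have e : ∀ i (t : I01), (g.trans (γ i)) (s 1 t) = γ i t := fun i t => by
      have hv : (s 1 t).1 = (1 + t.1) / 2 := by simp [s]; ring
      rw [Path.trans_apply]
      split_ifs with h
      · have ht : t = 0 := Subtype.ext (le_antisymm (by rw [hv] at h; simp; linarith) t.2.1)
        subst ht
        rw [(γ i).source]
        convert g.target
        rw [hv]; simp
      · congr 1
        exact Subtype.ext (by simp only [hv]; ring)
    simp only [e, g.target]; rfl

end Star

/-! ### Cochains as functions of path classes -/

section Tuples

variable {m : ℕ}

/-- Homotopy classes of paths starting at a given point. -/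
abbrev UCov (q : X) := Σ p : X, PQ q p

/-- Precomposition with a path class. -/
def lmul {q q' : X} (g : PQ q' q) (t : UCov q) : UCov q' := ⟨t.1, g.trans t.2⟩

/-- Functions on tuples of path classes with common starting point. -/
abbrev TFun (X : Type) [TopologicalSpace X] (m : ℕ) := ∀ q : X, (Fin m → UCov q) → ℝ

/-- The coboundary of a function on tuples. -/
abbrev dT {V : Type} (K : (Fin m → V) → ℝ) (x : Fin (m + 1) → V) : ℝ :=
  ∑ i : Fin (m + 1), (-1 : ℝ) ^ (i : ℕ) * K fun j => x (i.succAbove j)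

/-- Invariance of functions on tuples of path classes under change of the starting point. -/
def LInv (K : TFun X m) : Prop :=
  ∀ (q q' : X) (g : PQ q' q) (t : Fin m → UCov q), K q' (fun i => lmul g (t i)) = K q t

instance : SimplyConnectedSpace (Δ m) :=
  have := (convex_simplex m).contractibleSpace ⟨_, (vtx m 0).2⟩
  inferInstance

lemma qmap_trans {Y : Type} [TopologicalSpace Y] {x y z : X} (p : PQ x y)
    (p' : PQ y z) (f : C(X, Y)) :
    (p.trans p').map f = (p.map f).trans (p'.map f) := by
  obtain ⟨p, rfl⟩ := PQ.mk_surjective p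
  obtain ⟨p', rfl⟩ := PQ.mk_surjective p'
  rw [← PQ.mk_trans, ← PQ.mk_map, Path.map_trans]
  rfl

/-- The class of the image of paths joining two points of the simplex. -/
def ecl (σ : SSimplex X m) (x y : Δ m) : PQ (σ x) (σ y) :=
  PQ.map (.mk (PathConnectedSpace.somePath x y)) σ

lemma map_eq_ecl (σ : SSimplex X m) {x y : Δ m} (p : PQ x y) : p.map σ = ecl σ x y := by
  rw [ecl]
  congr 1
  exact Subsingleton.elim _ _

lemma ecl_trans (σ : SSimplex X m) (x y z : Δ m) : (ecl σ x y).trans (ecl σ y z) = ecl σ x z := by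
  rw [ecl, ecl, ← qmap_trans]
  exact map_eq_ecl σ _

lemma ecl_comp {k : ℕ} (σ : SSimplex X m) (f : C(Δ k, Δ m)) (x y : Δ k) :
    ecl (σ.comp f) x y = ecl σ (f x) (f y) := by
  rw [ecl, ← map_eq_ecl σ ((PQ.mk (PathConnectedSpace.somePath x y)).map f)]
  rfl

/-- The vertices of a simplex, joined to the zeroth vertex. -/
def edges (σ : SSimplex X m) (i : Fin (m + 1)) : UCov (σ (vtx m 0)) :=
  ⟨σ (vtx m i), ecl σ (vtx m 0) (vtx m i)⟩

/-- The cochain determined by a function on tuples. -/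
def pull {n : ℕ} (K : TFun X (n + 1)) : Cochain X n :=
  clift fun σ => K _ (edges σ)

@[simp] lemma pull_sgl {n : ℕ} (K : TFun X (n + 1)) (σ : SSimplex X n) :
    pull K (sgl ℝ σ) = K _ (edges σ) := clift_sgl _ _

lemma edges_faceOf {n : ℕ} (σ : SSimplex X (n + 1)) (i : Fin (n + 2)) (j : Fin (n + 1)) :
    lmul (ecl σ (vtx (n + 1) 0) (face i (vtx n 0))) (edges (faceOf σ i) j) =
      edges σ (i.succAbove j) := by
  have h1 : edges (faceOf σ i) j = ⟨_, ecl σ (face i (vtx n 0)) (face i (vtx n j))⟩ := by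
    exact Sigma.ext rfl (heq_of_eq (ecl_comp σ (face i) (vtx n 0) (vtx n j)))
  rw [h1]
  show (⟨_, (ecl σ _ _).trans (ecl σ _ _)⟩ : UCov (σ (vtx (n + 1) 0))) = _
  rw [ecl_trans]
  exact congrArg (fun x => (⟨σ x, ecl σ (vtx (n + 1) 0) x⟩ : UCov (σ (vtx (n + 1) 0))))
    (face_vtx i j)

lemma pull_bdry {n : ℕ} {K : TFun X (n + 1)} (hK : LInv K)
    (σ : SSimplex X (n + 1)) : pull K (bdry ℝ X n (sgl ℝ σ)) = dT (K _) (edges σ) := by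
  rw [bdry_sgl, map_sum]
  refine sum_congr rfl fun i _ => ?_
  rw [map_smul, pull_sgl, smul_eq_mul]
  congr 1
  refine (hK _ _ (ecl σ (vtx (n + 1) 0) (face i (vtx n 0))) (edges (faceOf σ i))).symm.trans ?_
  congr 1
  exact funext fun j => edges_faceOf σ i j

variable {n : ℕ} {β : Cochain X n}

/-- The function on tuples of path classes determined by a cochain. -/
def tupf (β : Cochain X n) (q : X) (t : Fin (n + 1) → UCov q) : ℝ :=
  β (sgl ℝ (starS fun i => (t i).2.out))

lemma Inv.tupf_eq (hβ : Inv 1 β) {q : X} {p : Fin (n + 1) → X} (γ : ∀ i, Path q (p i)) :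
    tupf β q (fun i => ⟨p i, .mk (γ i)⟩) = β (sgl ℝ (starS γ)) :=
  hβ _ _ (homRel_starS_of_homotopic fun i => PQ.eq.1 (Quotient.out_eq _))

lemma Inv.lInv_tupf (hβ : Inv 1 β) : LInv (tupf β) := by
  intro q q' g t
  obtain ⟨g, rfl⟩ := PQ.mk_surjective g
  have h1 : (fun i => lmul (.mk g) (t i)) =
      fun i => (⟨(t i).1, .mk (g.trans (t i).2.out)⟩ : UCov q') := by
    funext i
    rw [PQ.mk_trans]
    have : PQ.mk (t i).2.out = (t i).2 := Quotient.out_eq _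
    rw [this]
    rfl
  rw [h1, hβ.tupf_eq]
  exact hβ _ _ (homRel_starS_trans g _)

lemma tupf_cocycle (hβ : Cocyc β) {q : X} (t : Fin (n + 2) → UCov q) :
    dT (tupf β q) t = 0 := by
  have h := hβ (sgl ℝ (starS fun j => (t j).2.out))
  rw [bdry_sgl, map_sum] at h
  simp only [map_smul, smul_eq_mul, faceOf_starS] at h
  exact h

lemma Inv.pull_tupf (hβ : Inv 1 β) : pull (tupf β) = β := by
  refine chain_hom_ext fun σ => ?_
  rw [pull_sgl]
  let γ : ∀ i, Path (vtx n 0) (vtx n i) := fun i => PathConnectedSpace.somePath _ _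
  have h1 : edges σ = fun i => (⟨σ (vtx n i), .mk ((γ i).map σ.continuous)⟩ : UCov _) := rfl
  rw [h1, hβ.tupf_eq]
  symm
  have hconv : ∀ (x y : Δ n) (w : I01), (1 - w.1) • x.1 + w.1 • y.1 ∈ Δ n := fun x y w =>
    convex_simplex n x.2 y.2 (sub_nonneg.2 w.2.2) w.2.1 (by ring)
  have hR : ∀ x, starS (fun i => (γ i).map σ.continuous) x = σ (starS γ x) := fun x => by
    by_cases h : ∀ i, x.1 i ≤ 1 / 2
    · rw [starS_apply, starS_apply, star_eq_centre h, star_eq_centre h]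
    · push Not at h
      obtain ⟨i, hi⟩ := h
      rw [starS_apply, starS_apply, star_eq (fun i => Path.source _) hi.le,
        star_eq (fun i => Path.source _) hi.le]
      rfl
  refine hβ _ _ ⟨⟨fun z => σ ⟨(1 - z.2.1) • z.1.1 + z.2.1 • (starS γ z.1).1, hconv _ _ _⟩, ?_⟩,
    fun x => ?_, fun x => ?_, fun x hx w => ?_⟩
  · exact σ.continuous.comp (Continuous.subtype_mk (by fun_prop) _)
  · exact congrArg σ (Subtype.ext (by simp))
  · exact (congrArg σ (Subtype.ext (by simp))).trans (hR x).symm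
  · obtain ⟨i, rfl⟩ := vtx_of_mem_Sk hx
    refine congrArg σ (Subtype.ext ?_)
    have : starS γ (vtx n i) = vtx n i := (star_vtx (fun i => (γ i).source) i).trans (γ i).target
    show (1 - w.1) • (vtx n i).1 + w.1 • (starS γ (vtx n i)).1 = _
    rw [this, ← add_smul, sub_add_cancel, one_smul]

end Tuples

/-! ### Alternation of tuples -/

section Alternation

open Equiv

variable {V W : Type} {m : ℕ}

/-- The linear extension of a function on tuples. -/
def lin (K : (Fin m → V) → ℝ) : TC ℝ V m →ₗ[ℝ] ℝ := linearCombination ℝ K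

@[simp] lemma lin_single (K : (Fin m → V) → ℝ) (x : Fin m → V) :
    lin K (single x 1) = K x := by simp [lin]

lemma lin_tmap (K : (Fin m → W) → ℝ) (f : V → W) (c : TC ℝ V m) :
    lin K (tmap f c) = lin (fun x => K (f ∘ x)) c := by
  apply tc_ext c
  intro x
  simp

lemma lin_td (K : (Fin m → V) → ℝ) (x : Fin (m + 1) → V) :
    lin K (td (single x 1)) = dT K x := by
  simp only [td_single, map_sum, map_smul, lin_single, smul_eq_mul]

lemma lin_bound (u : TC ℝ W m) (C : ℝ) : ∃ B, ∀ (V : Type) (K : (Fin m → V) → ℝ),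
    (∀ x, |K x| ≤ C) → ∀ f : W → V, |lin K (tmap f u)| ≤ B := by
  refine ⟨∑ x ∈ u.support, |u x| * C, fun V K hK f => ?_⟩
  rw [lin_tmap, lin, Finsupp.linearCombination_apply, Finsupp.sum]
  refine (Finset.abs_sum_le_sum_abs _ _).trans (sum_le_sum fun x _ => ?_)
  rw [smul_eq_mul, abs_mul]
  exact mul_le_mul_of_nonneg_left (hK _) (abs_nonneg _)

/-- Permutation of the entries of tuples. -/
def tperm (π : Perm (Fin m)) : TC ℝ V m →ₗ[ℝ] TC ℝ V m := lmapDomain ℝ ℝ fun x => x ∘ π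

@[simp] lemma tperm_single (π : Perm (Fin m)) (x : Fin m → V) (r : ℝ) :
    tperm π (single x r) = single (x ∘ π) r := by
  simp [tperm]

/-- The sign of a permutation as a real number. -/
def sgn (π : Perm (Fin m)) : ℝ := ((Perm.sign π : ℤ) : ℝ)

lemma sgn_mul (π ρ : Perm (Fin m)) : sgn (π * ρ) = sgn π * sgn ρ := by simp [sgn, Perm.sign_mul]

lemma abs_sgn (π : Perm (Fin m)) : |sgn π| = 1 := by
  rcases Int.units_eq_one_or (Perm.sign π) with h | h <;> simp [sgn, h]

/-- The alternation operator. -/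
def talt : TC ℝ V m →ₗ[ℝ] TC ℝ V m := ((m.factorial : ℝ)⁻¹) • ∑ π : Perm (Fin m), sgn π • tperm π

lemma talt_single (x : Fin m → V) : talt (single x 1) =
    ((m.factorial : ℝ)⁻¹) • ∑ π : Perm (Fin m), sgn π • single (x ∘ π) (1 : ℝ) := by
  simp only [talt, lsmul, LinearMap.sum_apply, tperm_single]

lemma talt_zero (c : TC ℝ V 0) : talt c = c := by
  apply tc_ext c
  intro y
  rw [talt_single]
  simp [sgn]

lemma tmap_talt (f : V → W) (c : TC ℝ V m) : tmap f (talt c) = talt (tmap f c) := by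
  apply tc_ext c
  intro x
  simp only [tmap_single, talt_single, map_smul, map_sum]
  rfl

lemma lin_talt_eq_zero {K : (Fin m → V) → ℝ} {x : Fin m → V} {i k : Fin m} (hik : i ≠ k)
    (h : ∀ π : Perm (Fin m), K (x ∘ swap i k ∘ π) = K (x ∘ π)) :
    lin K (talt (single x 1)) = 0 := by
  rw [talt_single, map_smul, map_sum]
  simp only [map_smul, lin_single, smul_eq_mul]
  have h1 : ∑ π : Perm (Fin m), sgn π * K (x ∘ π) = -∑ π : Perm (Fin m), sgn π * K (x ∘ π) := by
    conv_lhs => rw [← Equiv.sum_comp (Equiv.mulLeft (swap i k))]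
    rw [← Finset.sum_neg_distrib]
    refine sum_congr rfl fun π _ => ?_
    have e : x ∘ (Equiv.mulLeft (swap i k) π) = x ∘ swap i k ∘ π := rfl
    have e' : sgn (Equiv.mulLeft (swap i k) π) = - sgn π := by
      rw [Equiv.coe_mulLeft, sgn_mul]
      simp [sgn, Perm.sign_swap hik]
    rw [e, e', h, neg_mul]
  have h2 : ∑ π : Perm (Fin m), sgn π * K (x ∘ π) = 0 := by linarith
  rw [h2, mul_zero]

lemma lin_talt_bound {K : (Fin m → V) → ℝ} {C : ℝ} (hK : ∀ x, |K x| ≤ C) (x : Fin m → V) :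
    |lin K (talt (single x 1))| ≤ C := by
  rw [talt_single, map_smul, map_sum, smul_eq_mul, abs_mul]
  have h0 : (0 : ℝ) < m.factorial := by exact_mod_cast m.factorial_pos
  have h1 : |∑ π : Perm (Fin m), lin K (sgn π • single (x ∘ π) (1 : ℝ))| ≤ m.factorial * C := by
    refine (Finset.abs_sum_le_sum_abs _ _).trans ((sum_le_sum fun π _ => ?_).trans_eq
      (b := ∑ _ : Perm (Fin m), C) ?_)
    · rw [map_smul, lin_single, smul_eq_mul, abs_mul, abs_sgn, one_mul]
      exact hK _
    · rw [sum_const, card_univ, Fintype.card_perm, Fintype.card_fin, nsmul_eq_mul]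
  rw [abs_of_pos (inv_pos.2 h0)]
  calc _ ≤ (m.factorial : ℝ)⁻¹ * (m.factorial * C) := mul_le_mul_of_nonneg_left h1 (inv_pos.2 h0).le
    _ = C := by field_simp

lemma sum_perm_succ {N : Type} [AddCommGroup N] (F : Perm (Fin (m + 1)) → N) :
    ∑ π, F π = ∑ i : Fin (m + 1), ∑ ρ : Perm (Fin m),
      F (i.cycleRange.symm * Perm.decomposeFin.symm (0, ρ)) := by
  rw [← Fintype.sum_prod_type' fun (i : Fin (m + 1)) (ρ : Perm (Fin m)) =>
    F (i.cycleRange.symm * Perm.decomposeFin.symm (0, ρ))]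
  symm
  refine Fintype.sum_bijective
    (fun p : Fin (m + 1) × Perm (Fin m) => p.1.cycleRange.symm * Perm.decomposeFin.symm (0, p.2))
    ?_ _ _ fun _ => rfl
  rw [Fintype.bijective_iff_injective_and_card]
  constructor
  · rintro ⟨i, ρ⟩ ⟨i', ρ'⟩ h
    simp only at h
    have h0 : ∀ (i : Fin (m + 1)) (ρ : Perm (Fin m)),
        (i.cycleRange.symm * Perm.decomposeFin.symm (0, ρ)) 0 = i := fun i ρ => by
      rw [Perm.mul_apply, Perm.decomposeFin_symm_apply_zero, Fin.cycleRange_symm_zero]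
    obtain rfl : i = i' := by rw [← h0 i ρ, h, h0]
    have h1 := Perm.decomposeFin.symm.injective (mul_left_cancel h)
    exact Prod.ext rfl (Prod.ext_iff.1 h1).2
  · rw [Fintype.card_prod, Fintype.card_perm, Fintype.card_perm, Fintype.card_fin, Fintype.card_fin,
      Nat.factorial_succ]

lemma sgn_cycleRange_symm (i : Fin (m + 1)) : sgn i.cycleRange.symm = (-1) ^ (i : ℕ) := by
  simp [sgn, Perm.sign_symm, Fin.sign_cycleRange]

lemma td_talt (c : TC ℝ V (m + 1)) : td (talt c) = talt (td c) := by
  apply tc_ext c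
  intro x
  let S : TC ℝ V m := ∑ π : Perm (Fin (m + 1)), sgn π • single (x ∘ π ∘ Fin.succ) (1 : ℝ)
  have h1 : td (talt (single x 1)) = (((m + 1).factorial : ℝ)⁻¹) • ((m + 1 : ℕ) : ℝ) • S := by
    rw [talt_single, map_smul, map_sum]
    congr 1
    simp only [map_smul, td_single, smul_sum]
    rw [Finset.sum_comm]
    have : ∀ i : Fin (m + 1), ∑ π : Perm (Fin (m + 1)), sgn π • (-1 : ℝ) ^ (i : ℕ) •
        single (fun j => (x ∘ π) (i.succAbove j)) (1 : ℝ) = S := fun i => by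
      symm
      simp only [S]
      rw [← Equiv.sum_comp (Equiv.mulRight i.cycleRange.symm)]
      refine sum_congr rfl fun π _ => ?_
      rw [Equiv.coe_mulRight, sgn_mul, sgn_cycleRange_symm, smul_smul]
      congr 2
      funext j
      simp [Fin.cycleRange_symm_succ]
    simp only [this, sum_const, card_univ, Fintype.card_fin]
    rw [Nat.cast_smul_eq_nsmul]
  have h2 : talt (td (single x 1)) = ((m.factorial : ℝ)⁻¹) • S := by
    rw [td_single, map_sum]
    simp only [map_smul, talt_single]
    simp only [S]
    rw [sum_perm_succ, smul_sum]
    refine sum_congr rfl fun i _ => ?_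
    rw [smul_comm]
    congr 1
    rw [smul_sum]
    refine sum_congr rfl fun ρ _ => ?_
    rw [sgn_mul, sgn_cycleRange_symm, mul_smul]
    have e : sgn (Perm.decomposeFin.symm (0, ρ)) = sgn ρ := by simp [sgn]
    rw [e]
    congr 3
    funext j
    simp [Fin.cycleRange_symm_succ]
  rw [h1, h2, smul_smul, Nat.factorial_succ]
  congr 1
  push_cast
  field_simp

/-- The homotopy from the identity to the alternation operator. -/
def thom : (m : ℕ) → TC ℝ V m →ₗ[ℝ] TC ℝ V (m + 1)
  | 0 => 0
  | m + 1 => linearCombination ℝ fun x =>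
      tcons (x 0) (talt (single x 1) - single x 1 - thom m (td (single x 1)))

lemma thom_single (x : Fin (m + 1) → V) : thom (m + 1) (single x 1) = tcons (x 0)
    (talt (single x 1) - single x 1 - thom m (td (single x 1))) := by
  simp [thom]

lemma td_thom (c : TC ℝ V (m + 1)) : td (thom (m + 1) c) = talt c - c - thom m (td c) := by
  induction m with
  | zero =>
    apply tc_ext c
    intro x
    rw [thom_single, td_tcons]
    simp only [map_sub]
    rw [td_talt]
    simp [talt_zero, thom]
  | succ m ih =>
    apply tc_ext c
    intro x
    rw [thom_single, td_tcons]
    simp only [map_sub]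
    rw [td_talt, ih, td_td, map_zero]
    simp

lemma tmap_thom (f : V → W) (c : TC ℝ V m) : tmap f (thom m c) = thom m (tmap f c) := by
  induction m with
  | zero => simp [thom]
  | succ m ih =>
    apply tc_ext c
    intro x
    rw [thom_single, tmap_tcons]
    simp only [map_sub]
    rw [tmap_talt, ih, ← td_tmap, tmap_single, thom_single]
    simp only [map_sub]
    rfl

end Alternation

/-! ### Averaging over amenable subspaces -/

section Averaging

variable {Y : Type} [TopologicalSpace Y] (ι : C(Y, X))

/-- Classes of paths ending in the subspace. -/
abbrev VCov (q : X) := Σ y : Y, PQ q (ι y)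

variable {ι} {q q' : X}

/-- Forget that the end point lies in the subspace. -/
def VCov.toU (x : VCov ι q) : UCov q := ⟨ι x.1, x.2⟩

/-- Prolong by a path of the subspace. -/
def VCov.rmul (x : VCov ι q) {y : Y} (s : PQ x.1 y) : VCov ι q := ⟨y, x.2.trans (s.map ι)⟩

/-- Precomposition with a path class. -/
def VCov.lmul (g : PQ q' q) (x : VCov ι q) : VCov ι q' := ⟨x.1, g.trans x.2⟩

/-- Two classes differ by a path of the subspace. -/
def VRel (x x' : VCov ι q) : Prop := ∃ s : PQ x.1 x'.1, x' = x.rmul s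

lemma VCov.lmul_rmul (g : PQ q' q) (x : VCov ι q) {y : Y}
    (s : PQ x.1 y) : (x.lmul g).rmul s = (x.rmul s).lmul g := by
  simp only [rmul, lmul, PQ.trans_assoc]

lemma VRel.refl (x : VCov ι q) : VRel x x := ⟨.refl _, by
  obtain ⟨y, t⟩ := x
  show (⟨y, t⟩ : VCov ι q) = ⟨y, t.trans (.refl _)⟩
  rw [PQ.trans_refl]⟩

lemma VRel.symm {x x' : VCov ι q} (h : VRel x x') : VRel x' x := by
  obtain ⟨y, t⟩ := x
  obtain ⟨y', t'⟩ := x'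
  obtain ⟨s, hs⟩ := h
  change PQ y y' at s
  obtain rfl : t' = t.trans (s.map ι) := eq_of_heq (Sigma.ext_iff.1 hs).2
  refine ⟨s.symm, ?_⟩
  show (⟨y, t⟩ : VCov ι q) = ⟨y, (t.trans (s.map ι)).trans (s.symm.map ι)⟩
  rw [PQ.trans_assoc, ← qmap_trans, PQ.trans_symm, show (PQ.refl y).map ι = .refl (ι y) from rfl,
    PQ.trans_refl]

/-- The properties of averaged cochains. -/
structure Averaged (ι : C(Y, X)) (n : ℕ) (C : ℝ) (b : ∀ q : X, (Fin n → VCov ι q) → ℝ) : Prop where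
  bound : ∀ q x, |b q x| ≤ C
  left : ∀ q q' (g : PQ q' q) x, b q' (fun i => (x i).lmul g) = b q x
  right : ∀ q x x', (∀ i, VRel (x i) (x' i)) → b q x = b q x'
  alt : ∀ q x i k, i ≠ k → VRel (x i) (x k) → b q x = 0
  cocycle : ∀ q x, dT (b q) x = 0

/-- Families of means on the fundamental groups. -/
abbrev Means (Y : Type) [TopologicalSpace Y] := ∀ y : Y, Mean (FundamentalGroup Y y)

/-- An invariant family of means on classes of paths of the subspace. -/
def pathMean (M : Means Y) (y : Y) : Mean (PQ y (rep y)) :=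
  (M (rep y)).map fun γ => (PQ.mk (joined_rep y).somePath).trans γ

lemma pathMean_inv {M : Means Y} (hM : ∀ y, RightInvariant (M y))
    {y y' : Y} (s : PQ y y') (F : (Σ z : Y, PQ y z) → ℝ)
    {C : ℝ} (hF : ∀ z, |F z| ≤ C) : (pathMean M y).E (fun δ => F ⟨_, δ⟩) =
      (pathMean M y').E (fun δ => F ⟨_, s.trans δ⟩) := by
  have key : ∀ (p p' : Y) (h : Joined y p) (h' : Joined y' p'), p = p' →
      (M p).E (fun γ => F ⟨p, (PQ.mk h.somePath).trans γ⟩) =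
      (M p').E (fun γ => F ⟨p', s.trans ((PQ.mk h'.somePath).trans γ)⟩) := by
    rintro p _ h h' rfl
    let a : FundamentalGroup Y p := (PQ.mk h.somePath).symm.trans (s.trans (PQ.mk h'.somePath))
    rw [← hM p a (fun γ => F ⟨p, (PQ.mk h.somePath).trans γ⟩) ⟨C, fun γ => hF _⟩]
    congr 1
    funext γ
    have e : γ * a = PQ.trans a γ := rfl
    rw [e]
    simp only [a]
    rw [PQ.trans_assoc, ← PQ.trans_assoc, PQ.trans_symm, PQ.refl_trans, PQ.trans_assoc]
  refine key _ _ _ _ (rep_eq ?_)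
  obtain ⟨s, -⟩ := PQ.mk_surjective s
  exact ⟨s⟩

/-- The mean over the prolongations of a path class. -/
def prolMean (M : Means Y) (x : VCov ι q) : Mean (VCov ι q) :=
  (pathMean M x.1).map fun δ => x.rmul δ

lemma prolMean_rmul {M : Means Y} (hM : ∀ y, RightInvariant (M y))
    (x : VCov ι q) {y : Y} (s : PQ x.1 y) (f : VCov ι q → ℝ) {C : ℝ}
    (hf : ∀ z, |f z| ≤ C) : (prolMean M x).E f = (prolMean M (x.rmul s)).E f := by
  refine (pathMean_inv hM s (fun z => f (x.rmul z.2)) (C := C) (fun z => hf _)).trans ?_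
  refine congrArg (pathMean M y).E (funext fun δ => congrArg f ?_)
  show (⟨_, x.2.trans ((s.trans δ).map ι)⟩ : VCov ι q) = ⟨_, (x.2.trans (s.map ι)).trans (δ.map ι)⟩
  rw [qmap_trans, PQ.trans_assoc]

lemma prolMean_inv {M : Means Y} (hM : ∀ y, RightInvariant (M y))
    {x x' : VCov ι q} (h : VRel x x') (f : VCov ι q → ℝ) {C : ℝ} (hf : ∀ z, |f z| ≤ C) :
    (prolMean M x).E f = (prolMean M x').E f := by
  obtain ⟨s, hs⟩ := h
  rw [hs]
  exact prolMean_rmul hM x s f hf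

lemma prolMean_lmul (M : Means Y) (g : PQ q' q)
    (x : VCov ι q) : prolMean M (x.lmul g) = (prolMean M x).map (VCov.lmul g) := by
  have : (fun δ => (x.lmul g).rmul δ : PQ x.1 (rep x.1) → VCov ι q') =
      fun δ => (x.rmul δ).lmul g := funext fun δ => VCov.lmul_rmul g x δ
  exact congrArg (fun F => Mean.map F (pathMean M x.1)) this

/-- Prolong a path class to end in the subspace. -/
def typ (c : ∀ p : X, VCov ι p) (t : UCov q) : VCov ι q := (c t.1).lmul t.2

lemma typ_lmul (c : ∀ p : X, VCov ι p) (g : PQ q' q) (t : UCov q) :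
    typ c (lmul g t) = (typ c t).lmul g := by
  simp only [typ, lmul, VCov.lmul, PQ.trans_assoc]

lemma toU_lmul (g : PQ q' q) (x : VCov ι q) : (x.lmul g).toU = lmul g x.toU := rfl

variable {n : ℕ}

/-- The average of a function on tuples over all prolongations. -/
def avgf (M : Means Y) (f : TFun X n) (q : X)
    (x : Fin n → VCov ι q) : ℝ :=
  (Mean.iter n fun i => prolMean M (x i)).E fun w => f q fun i => (w i).toU

/-- The prism of a function on tuples. -/
def prismf (f : TFun X (n + 1)) (q : X) (t w : Fin n → UCov q) : ℝ :=
  lin (f q) (tprism t w (single id 1))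

section Functions

variable {f : TFun X n} {C : ℝ} {M : Means Y}

lemma avgf_bound (hf : ∀ q t, |f q t| ≤ C) (q : X) (x : Fin n → VCov ι q) : |avgf M f q x| ≤ C :=
  Mean.bound _ _ _ fun _ => hf _ _

lemma avgf_lmul (hf : LInv f) (g : PQ q' q) (x : Fin n → VCov ι q) :
    avgf M f q' (fun i => (x i).lmul g) = avgf M f q x := by
  simp only [avgf, prolMean_lmul, Mean.iter_map, toU_lmul]
  exact congrArg _ (funext fun w => hf q q' g _)

lemma avgf_congr (hM : ∀ y, RightInvariant (M y)) (hf : ∀ q t, |f q t| ≤ C)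
    {x x' : Fin n → VCov ι q} (h : ∀ i, VRel (x i) (x' i)) : avgf M f q x = avgf M f q x' :=
  Mean.iter_congr _ _ (fun i F _ hF => prolMean_inv hM (h i) F hF) _ C fun _ => hf _ _

lemma lin_td_eq_zero {V : Type} {K : (Fin n → V) → ℝ} (h : ∀ x, dT K x = 0)
    (u : TC ℝ V (n + 1)) : lin K (td u) = 0 := by
  apply tc_ext u
  intro t
  rw [lin_td, h]

lemma avgf_cocycle (hf : ∀ t, dT (f q) t = 0) (x : Fin (n + 1) → VCov ι q) :
    dT (avgf M f q) x = 0 := by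
  have h1 : ∀ i : Fin (n + 1), avgf M f q (fun j => x (i.succAbove j)) =
      (Mean.iter (n + 1) fun i => prolMean M (x i)).E fun w =>
        f q fun j => (w (i.succAbove j)).toU := fun i =>
    (Mean.iter_removeNth (fun i => prolMean M (x i)) i fun w => f q fun j => (w j).toU).symm
  simp only [dT, h1, ← Mean.E_mul, ← Mean.E_sum]
  refine (congrArg _ (funext fun w : Fin (n + 1) → VCov ι q => hf fun i => (w i).toU)).trans ?_
  exact Mean.const _ 0

lemma prismf_spec {f : TFun X (n + 1)}
    (hf : ∀ t, dT (f q) t = 0) (t w : Fin (n + 1) → UCov q) :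
    f q w = f q t + ∑ i : Fin (n + 1), (-1 : ℝ) ^ (i : ℕ) *
      prismf f q (fun j => t (i.succAbove j)) (fun j => w (i.succAbove j)) := by
  have h1 := lin_td_eq_zero hf (tprism t w (single id 1))
  rw [td_tprism, map_sub, map_sub, tmap_single, tmap_single, td_single, map_sum, map_sum,
    lin_single, lin_single] at h1
  have h2 : ∀ i : Fin (n + 1), lin (f q) (tprism t w ((-1 : ℝ) ^ (i : ℕ) •
      single (fun j => id (i.succAbove j)) (1 : ℝ))) = (-1 : ℝ) ^ (i : ℕ) *
        prismf f q (fun j => t (i.succAbove j)) (fun j => w (i.succAbove j)) := fun i => by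
    rw [map_smul, map_smul, smul_eq_mul]
    congr 1
    have h3 := tprism_tmap t w (fun j => t (i.succAbove j)) (fun j => w (i.succAbove j))
      i.succAbove id (fun _ => rfl) (fun _ => rfl) (single id (1 : ℝ))
    rw [tmap_single] at h3
    refine (congrArg (lin (f q)) h3).trans ?_
    rw [lin_tmap]
    rfl
  simp only [h2, Function.comp_id] at h1
  linarith

lemma prismf_bound (n : ℕ) (C : ℝ) : ∃ B, ∀ f : TFun X (n + 1),
    (∀ q t, |f q t| ≤ C) → ∀ q t w, |prismf f q t w| ≤ B := by
  obtain ⟨B, hB⟩ := lin_bound (W := Fin n ⊕ Fin n) (tprism Sum.inl Sum.inr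
    (single (id : Fin n → Fin n) (1 : ℝ))) C
  refine ⟨B, fun f hf q t w => ?_⟩
  have h3 := tprism_tmap t w Sum.inl Sum.inr id (Sum.elim t w) (fun _ => rfl) (fun _ => rfl)
    (single (id : Fin n → Fin n) (1 : ℝ))
  rw [tmap_single] at h3
  have h4 := hB _ (f q) (hf q) (Sum.elim t w)
  rw [← h3] at h4
  exact h4

lemma prismf_lmul {f : TFun X (n + 1)} (hf : LInv f)
    (g : PQ q' q) (t w : Fin n → UCov q) :
    prismf f q' (fun i => lmul g (t i)) (fun i => lmul g (w i)) = prismf f q t w := by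
  have h3 := tprism_tmap (fun i => lmul g (t i)) (fun i => lmul g (w i)) t w id (lmul g)
    (fun _ => rfl) (fun _ => rfl) (single (id : Fin n → Fin n) (1 : ℝ))
  rw [tmap_single] at h3
  refine (congrArg (lin (f q')) h3).trans ?_
  rw [lin_tmap]
  exact congrArg (fun F => lin F _) (funext fun x => hf q q' g x)

/-- The primitive of the difference of a function and its averaged alternation. -/
def avgPrim (M : Means Y) (c : ∀ p : X, VCov ι p)
    (f : TFun X (n + 1)) (q : X) (t : Fin n → UCov q) : ℝ :=
  (Mean.iter n fun i => prolMean M (typ c (t i))).E (fun w => prismf f q t fun i => (w i).toU) +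
    lin (avgf M f q) (thom n (single (fun i => typ c (t i)) 1))

lemma avgPrim_bound (n : ℕ) (C : ℝ) (M : Means Y)
    (c : ∀ p : X, VCov ι p) : ∃ B, ∀ f : TFun X (n + 1),
      (∀ q t, |f q t| ≤ C) → ∀ q t, |avgPrim M c f q t| ≤ B := by
  obtain ⟨B₁, hB₁⟩ := prismf_bound (X := X) n C
  obtain ⟨B₂, hB₂⟩ := lin_bound (thom n (single (id : Fin n → Fin n) (1 : ℝ))) C
  refine ⟨B₁ + B₂, fun f hf q t => (abs_add_le _ _).trans
    (add_le_add (Mean.bound _ _ _ fun w => hB₁ f hf _ _ _) ?_)⟩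
  have h : thom n (single (fun i => typ c (t i)) (1 : ℝ)) =
      tmap (fun i => typ c (t i)) (thom n (single id 1)) := by
    rw [tmap_thom, tmap_single, Function.comp_id]
  rw [h]
  exact hB₂ _ _ (avgf_bound hf q) _

lemma single_lmul (g : PQ q' q) (x : Fin n → VCov ι q) : single (fun i => (x i).lmul g) (1 : ℝ) =
      tmap (VCov.lmul g) (single x (1 : ℝ)) := by
  rw [tmap_single]; rfl

lemma avgPrim_lInv (c : ∀ p : X, VCov ι p) {f : TFun X (n + 1)}
    (hf : LInv f) : LInv (avgPrim M c f) := fun q q' g t => by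
  simp only [avgPrim, typ_lmul, prolMean_lmul, Mean.iter_map, toU_lmul, prismf_lmul hf]
  congr 1
  rw [single_lmul, ← tmap_thom, lin_tmap]
  exact congrArg (fun F => lin F _) (funext fun x => avgf_lmul hf g x)

lemma lin_avgf_typ (c : ∀ p : X, VCov ι p) {f : TFun X (n + 1)}
    (hf : ∀ t, dT (f q) t = 0) (t : Fin (n + 1) → UCov q) :
    lin (avgf M f q) (talt (.single (fun i => typ c (t i)) 1)) = f q t + dT (avgPrim M c f q) t := by
  have h1 : avgf M f q (fun i => typ c (t i)) = f q t + ∑ i : Fin (n + 1), (-1 : ℝ) ^ (i : ℕ) *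
      (Mean.iter n fun j => prolMean M (typ c (t (i.succAbove j)))).E
        (fun w => prismf f q (fun j => t (i.succAbove j)) fun j => (w j).toU) := by
    have h2 : ∀ w : Fin (n + 1) → VCov ι q, f q (fun i => (w i).toU) = f q t +
        ∑ i : Fin (n + 1), (-1 : ℝ) ^ (i : ℕ) * prismf f q (fun j => t (i.succAbove j))
          (fun j => (w (i.succAbove j)).toU) := fun w => prismf_spec hf t _
    simp only [avgf, h2, Mean.E_add, Mean.const, Mean.E_sum, Mean.E_mul]
    congr 1
    refine sum_congr rfl fun i _ => ?_
    congr 1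
    exact Mean.iter_removeNth (fun i => prolMean M (typ c (t i))) i
      fun w => prismf f q (fun j => t (i.succAbove j)) fun j => (w j).toU
  have h2 := lin_td_eq_zero (avgf_cocycle (M := M) hf)
    (thom (n + 1) (single (fun i => typ c (t i)) 1))
  rw [td_thom, map_sub, map_sub, lin_single, td_single, map_sum, map_sum] at h2
  simp only [map_smul, smul_eq_mul] at h2
  simp only [dT, avgPrim, mul_add, sum_add_distrib]
  linarith

lemma averaged_lin (hM : ∀ y, RightInvariant (M y)) (hfC : ∀ q t, |f q t| ≤ C) (hfl : LInv f)
    (hf : ∀ q t, dT (f q) t = 0) : Averaged ι n C fun q x => lin (avgf M f q) (talt (.single x 1)) where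
  bound q x := lin_talt_bound (avgf_bound hfC q) x
  left q q' g x := by
    rw [single_lmul, ← tmap_talt, lin_tmap]
    exact congrArg (fun F => lin F _) (funext fun x => avgf_lmul hfl g x)
  right q x x' h := by
    simp only [talt_single, map_smul, map_sum, lin_single]
    congr 1
    refine sum_congr rfl fun π _ => ?_
    rw [avgf_congr hM hfC (x := x ∘ π) (x' := x' ∘ π) fun i => h (π i)]
  alt q x i k hik h := by
    refine lin_talt_eq_zero hik fun π => avgf_congr hM hfC fun l => ?_
    simp only [Function.comp_apply]
    rcases eq_or_ne (π l) i with hl | hl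
    · rw [hl, Equiv.swap_apply_left]
      exact h.symm
    · rcases eq_or_ne (π l) k with hl' | hl'
      · rw [hl', Equiv.swap_apply_right]
        exact h
      · rw [Equiv.swap_apply_of_ne_of_ne hl hl']
        exact VRel.refl _
  cocycle q x := by
    have h2 : dT (fun x => lin (avgf M f q) (talt (.single x 1))) x =
        lin (avgf M f q) (talt (td (single x 1))) := by
      simp only [td_single, map_sum, map_smul, smul_eq_mul]
    cases n with
    | zero =>
      rw [h2, talt_zero]
      exact lin_td_eq_zero (avgf_cocycle (hf q)) _
    | succ n => rw [h2, ← td_talt, lin_td_eq_zero (avgf_cocycle (hf q))]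

end Functions

/-- Bounded cocycles can be averaged over an amenable subspace. -/
theorem exists_averaged (hY : ∀ y : Y, IsAmenable (FundamentalGroup Y y)) (c : ∀ p : X, VCov ι p)
    {β : Cochain X (n + 1)} (hβ : Cocyc β) {C : ℝ} (hC : BddBy C β) :
    ∃ b, Averaged ι (n + 2) C b ∧ ∃ (η : Cochain X n) (B : ℝ), BddBy B η ∧
      ∀ σ, (β + η.comp (bdry ℝ X n)) (sgl ℝ σ) = b _ fun i => typ c (edges σ i) := by
  obtain ⟨η₀, B₀, hB₀, hC₁, hinv⟩ := exists_inv_one hβ hC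
  have hcoc := hβ.add_comp_bdry η₀
  generalize hβ₁ : β + η₀.comp (bdry ℝ X n) = β₁ at hC₁ hinv hcoc
  choose M hM using fun y => exists_mean_of_isAmenable (hY y)
  have hfC : ∀ q t, |tupf β₁ q t| ≤ C := fun q t => hC₁ _
  obtain ⟨B₁, hB₁⟩ := avgPrim_bound (n + 1) C M c
  refine ⟨_, averaged_lin hM hfC hinv.lInv_tupf fun q => tupf_cocycle hcoc,
    η₀ + pull (avgPrim M c (tupf β₁)), B₀ + B₁, fun σ => ?_, fun σ => ?_⟩
  · rw [ladd, pull_sgl]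
    exact (abs_add_le _ _).trans (add_le_add (hB₀ σ) (hB₁ _ hfC _ _))
  · rw [lin_avgf_typ c (tupf_cocycle hcoc), LinearMap.add_comp, ← add_assoc, hβ₁,
      ladd, comp_apply, pull_bdry (avgPrim_lInv c hinv.lInv_tupf)]
    congr 1
    conv_lhs => rw [← hinv.pull_tupf]
    exact pull_sgl _ _

lemma Averaged.typ_eq_zero {C : ℝ} {b : ∀ q : X, (Fin (n + 2) → VCov ι q) → ℝ}
    (hb : Averaged ι (n + 2) C b) {c : ∀ p : X, VCov ι p} (hc : ∀ y, c (ι y) = ⟨y, .refl _⟩)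
    (τ : SSimplex Y (n + 1)) : b _ (fun i => typ c (edges (ι.comp τ) i)) = 0 := by
  have h : ∀ i, typ c (edges (ι.comp τ) i) = ⟨τ (vtx _ i), (ecl τ (vtx _ 0) (vtx _ i)).map ι⟩ :=
    fun i => (congrArg (VCov.lmul _) (hc (τ (vtx _ i)))).trans (Sigma.ext rfl (heq_of_eq
      (PQ.trans_refl ((ecl τ (vtx _ 0) (vtx _ i)).map ι))))
  refine hb.alt _ _ 0 1 (by simp) ?_
  rw [h, h]
  refine ⟨ecl τ (vtx _ 0) (vtx _ 1), Sigma.ext rfl (heq_of_eq ?_)⟩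
  exact (congrArg (fun p => PQ.map p ι) (ecl_trans τ _ _ _).symm).trans (qmap_trans _ _ _)

lemma cocycle_apply_cycle_eq_zero (hX : ∀ x : X, IsAmenable (FundamentalGroup X x))
    {η : Cochain X (n + 1)} (hη : Cocyc η) {B : ℝ} (hB : BddBy B η)
    {z : SChain ℝ X (n + 1)} (hz : bdry ℝ X n z = 0) : η z = 0 := by
  let c : ∀ p : X, VCov (ContinuousMap.id X) p := fun p => ⟨p, .refl p⟩
  obtain ⟨b, hb, θ, -, -, h⟩ := exists_averaged hX c hη hB
  have h0 : η + θ.comp (bdry ℝ X n) = 0 := chain_hom_ext fun σ =>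
    (h σ).trans (hb.typ_eq_zero (fun y => rfl) σ)
  have h1 := LinearMap.congr_fun h0 z
  rw [ladd, comp_apply, hz, map_zero, add_zero] at h1
  exact h1

lemma apply_cycle_eq_zero_of_amenable {S : Set X}
    (hS : ∀ y : S, IsAmenable (FundamentalGroup S y)) {η : Cochain X (n + 1)} {B : ℝ}
    (hB : BddBy B η) (hη : ∀ c ∈ chainsIn ℝ X S (n + 2), η (bdry ℝ X (n + 1) c) = 0)
    {z : SChain ℝ X (n + 1)} (hz : z ∈ chainsIn ℝ X S (n + 1)) (h0 : bdry ℝ X n z = 0) :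
    η z = 0 := by
  have hr : range (subIncl S) = S := Subtype.range_val
  have hemb : IsEmbedding (subIncl S) := IsEmbedding.subtypeVal
  obtain ⟨w, -, rfl⟩ := exists_push_eq hemb hr.ge hz
  refine cocycle_apply_cycle_eq_zero (η := η.comp (push ℝ (subIncl S) (n + 1))) hS
    (fun c => ?_) (B := B) (fun σ => ?_) ?_
  · rw [comp_apply, ← push_bdry]
    have := push_mem_chainsIn_range (R := ℝ) (subIncl S) c
    rw [hr] at this
    exact hη _ this
  · rw [comp_apply, push_sgl]
    exact hB _
  · refine push_injective (R := ℝ) hemb.injective n ?_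
    rw [← push_bdry, h0, map_zero]

end Averaging

/-! ### Good neighbourhoods in manifolds -/

/-- Paths in the set are determined up to homotopy by their end points, and points of `B` in the
set can be joined inside `B`. -/
structure IsGood (B C : Set X) : Prop where
  exists_path : ∀ {b b' : X}, b ∈ C → b' ∈ C → ∃ γ : Path b b', ∀ t, γ t ∈ C
  homotopic : ∀ {b b' : X} (γ γ' : Path b b'), (∀ t, γ t ∈ C) → (∀ t, γ' t ∈ C) → γ.Homotopic γ'
  exists_bdry_path : ∀ y z : B, y.1 ∈ C → z.1 ∈ C → ∃ γ : Path y z, ∀ t, (γ t).1 ∈ C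

lemma exists_good_nhd {n : ℕ} {B : Set X} (h : IsTopMfdWithBdry (n + 1) X B) (x : X) {W : Set X}
    (hW : W ∈ nhds x) : ∃ C, IsOpen C ∧ x ∈ C ∧ C ⊆ W ∧ IsGood B C := by
  obtain ⟨p, r, hp, φ, hr, hφ, rfl, hφW, hB⟩ := exists_chart h x hW
  have hconv := convex_halfBall p r
  have := hconv.contractibleSpace ⟨p, hp⟩
  have hlift : ∀ {b b' : halfBall p r} (γ : Path (φ b) (φ b')), (∀ t, γ t ∈ range φ) →
      ∃ δ : Path b b', δ.map φ.continuous = γ := by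
    intro b b' γ hγ
    have hs : ∀ b (hb : φ b ∈ range φ), hφ.isEmbedding.toHomeomorph.symm ⟨φ b, hb⟩ = b := fun b _ =>
      hφ.isEmbedding.toHomeomorph.symm_apply_apply b
    refine ⟨⟨⟨fun t => hφ.isEmbedding.toHomeomorph.symm ⟨γ t, hγ t⟩, by fun_prop⟩, ?_, ?_⟩, ?_⟩
    · simp only [γ.source, hs]
    · simp only [γ.target, hs]
    · ext t
      exact congrArg Subtype.val (hφ.isEmbedding.toHomeomorph.apply_symm_apply ⟨γ t, hγ t⟩)
  refine ⟨range φ, hφ.isOpen_range, ⟨_, rfl⟩, hφW, ?_, ?_, ?_⟩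
  · rintro _ _ ⟨b, rfl⟩ ⟨b', rfl⟩
    exact ⟨(PathConnectedSpace.somePath b b').map φ.continuous, fun t => ⟨_, rfl⟩⟩
  · intro b b' γ γ' hγ hγ'
    obtain ⟨b, rfl⟩ := γ.source ▸ hγ 0
    obtain ⟨b', rfl⟩ := γ.target ▸ hγ 1
    obtain ⟨δ, rfl⟩ := hlift γ hγ
    obtain ⟨δ', rfl⟩ := hlift γ' hγ'
    exact (SimplyConnectedSpace.paths_homotopic δ δ').map φ
  · rintro ⟨_, hy⟩ ⟨_, hz⟩ ⟨y, rfl⟩ ⟨z, rfl⟩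
    have hy0 := (hB y).1 hy
    have hz0 := (hB z).1 hz
    let δ : I01 → halfBall p r := fun t => ⟨(1 - t.1) • y.1 + t.1 • z.1,
      hconv y.2 z.2 (sub_nonneg.2 t.2.2) t.2.1 (by ring)⟩
    have hδ : Continuous δ := Continuous.subtype_mk (by fun_prop) _
    refine ⟨⟨⟨fun t => ⟨φ (δ t), (hB _).2 (by simp [δ, hy0, hz0])⟩, by fun_prop⟩, ?_, ?_⟩,
      fun t => ⟨_, rfl⟩⟩
    · exact Subtype.ext (congrArg φ (Subtype.ext (by simp [δ])))
    · exact Subtype.ext (congrArg φ (Subtype.ext (by simp [δ])))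

lemma IsGood.mk_eq {B C : Set X} (h : IsGood B C) {b b₁ b₂ : X} (e : b₁ = b₂) (γ₁ : Path b b₁)
    (γ₂ : Path b b₂) (h₁ : ∀ t, γ₁ t ∈ C) (h₂ : ∀ t, γ₂ t ∈ C) :
    (⟨b₁, .mk γ₁⟩ : UCov b) = ⟨b₂, .mk γ₂⟩ := by
  subst e
  rw [PQ.eq.2 (h.homotopic γ₁ γ₂ h₁ h₂)]

lemma path_trans_mem {C : Set X} {x y z : X} {γ : Path x y} {γ' : Path y z} (h : ∀ t, γ t ∈ C)
    (h' : ∀ t, γ' t ∈ C) (t : I01) : γ.trans γ' t ∈ C := by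
  have : γ.trans γ' t ∈ range (γ.trans γ') := ⟨t, rfl⟩
  rw [Path.trans_range] at this
  rcases this with ⟨s, hs⟩ | ⟨s, hs⟩
  · exact hs ▸ h s
  · exact hs ▸ h' s

/-- The image of a path class. -/
def umap {Y : Type} [TopologicalSpace Y] (f : C(X, Y)) {x : X} (t : UCov x) : UCov (f x) :=
  ⟨f t.1, t.2.map f⟩

/-! ### Folded manifolds -/

/-- A manifold with boundary together with a quotient obtained by identifying boundary points by
means of an involution of the boundary. -/
structure Fold (n : ℕ) (N M : Type) [TopologicalSpace N] [TopologicalSpace M] where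
  π : C(N, M)
  B : Set N
  opp : C(B, B)
  opp_opp : ∀ y, opp (opp y) = y
  proj_opp : ∀ y, π (opp y) = π y
  eq_or : ∀ {a b}, π a = π b → a = b ∨ ∃ h : a ∈ B, (opp ⟨a, h⟩ : N) = b
  opp_eq : ∀ {y z : B}, Joined y z → opp y = y → opp z = z
  pos : Set B
  pos_of_joined : ∀ {y z : B}, Joined y z → y ∈ pos → z ∈ pos
  pos_opp : ∀ {y : B}, opp y ≠ y → (opp y ∈ pos ↔ y ∉ pos)
  surj : Surjective π
  closed : IsClosedMap π
  mfd : IsTopMfdWithBdry (n + 1) N B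
  mfd' : ∃ C : Set M, IsTopMfdWithBdry (n + 1) M C

namespace Fold

variable {n : ℕ} {N M : Type} [TopologicalSpace N] [TopologicalSpace M] (F : Fold n N M)

/-- The inclusion of the boundary. -/
abbrev ι : C(F.B, N) := subIncl F.B

/-- Neighbourhoods of the preimages of a point, compatible with the involution. -/
lemma exists_compatible_nhds (x : M) {O : Set M} (hO : IsOpen O) (hx : x ∈ O) :
    ∃ C : N → Set N, (∀ a, F.π a = x → IsOpen (C a) ∧ a ∈ C a ∧ C a ⊆ F.π ⁻¹' O ∧
        IsGood F.B (C a)) ∧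
      (∀ a a', F.π a = x → F.π a' = x → a ≠ a' → Disjoint (C a) (C a')) ∧
      ∀ a, F.π a = x → ∀ y : F.B, y.1 ∈ C a → (∃ a', F.π a' = x ∧ (F.opp y).1 ∈ C a') →
        ∃ (z : F.B) (s : Path y z), z.1 = a ∧ (∀ t, (s t).1 ∈ C a) ∧
          ∀ t, (F.opp (s t)).1 ∈ C (F.opp z) := by
  classical
  have := F.mfd.1
  obtain ⟨a, rfl⟩ := F.surj x
  have hOa : F.π ⁻¹' O ∈ nhds a := (hO.preimage F.π.continuous).mem_nhds hx
  by_cases ha : ∃ h : a ∈ F.B, F.opp ⟨a, h⟩ ≠ ⟨a, h⟩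
  · obtain ⟨haB, hne⟩ := ha
    set z : F.B := ⟨a, haB⟩
    have hpre : ∀ a', F.π a' = F.π a → a' = z.1 ∨ a' = (F.opp z).1 := fun a' h => by
      rcases F.eq_or h.symm with h | ⟨h, h'⟩
      · exact Or.inl h.symm
      · exact Or.inr h'.symm
    have hne' : z.1 ≠ (F.opp z).1 := fun h => hne (Subtype.ext h.symm)
    obtain ⟨U, V, hU, hV, hzU, hzV, hUV⟩ := t2_separation hne'
    have hO' : F.π ⁻¹' O ∈ nhds (F.opp z).1 := (hO.preimage F.π.continuous).mem_nhds (by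
      show F.π (F.opp z).1 ∈ O
      rw [F.proj_opp]; exact hx)
    have hnb : ∀ (w : F.B) (S : Set N), IsOpen S → (F.opp w).1 ∈ S →
        ∃ T : Set N, IsOpen T ∧ w.1 ∈ T ∧ ∀ y : F.B, y.1 ∈ T → (F.opp y).1 ∈ S := by
      intro w S hS hw
      obtain ⟨T, hT, h⟩ := isOpen_induced_iff.1
        (hS.preimage (continuous_subtype_val.comp F.opp.continuous))
      exact ⟨T, hT, (Set.ext_iff.1 h w).2 hw, fun y hy => (Set.ext_iff.1 h y).1 hy⟩
    obtain ⟨T, hT, hzT, hTV⟩ := hnb z V hV hzV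
    obtain ⟨C₀, hC₀, hz₀, hC₀s, hg₀⟩ := exists_good_nhd F.mfd z.1
      (Filter.inter_mem hOa (Filter.inter_mem (hU.mem_nhds hzU) (hT.mem_nhds hzT)))
    obtain ⟨T', hT', hzT', hTC⟩ := hnb (F.opp z) C₀ hC₀ (by rw [F.opp_opp]; exact hz₀)
    obtain ⟨C₁, hC₁, hz₁, hC₁s, hg₁⟩ := exists_good_nhd F.mfd (F.opp z).1
      (Filter.inter_mem hO' (Filter.inter_mem (hV.mem_nhds hzV) (hT'.mem_nhds hzT')))
    have hd : Disjoint C₀ C₁ := hUV.mono (fun b hb => (hC₀s hb).2.1) fun b hb => (hC₁s hb).2.1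
    obtain ⟨C, h0, h1⟩ : ∃ C : N → Set N, C z.1 = C₀ ∧ C (F.opp z).1 = C₁ :=
      ⟨fun b => if b = z.1 then C₀ else C₁, if_pos rfl, if_neg hne'.symm⟩
    refine ⟨C, ?_, ?_, ?_⟩
    · intro b hb
      rcases hpre b hb with h | h <;> rw [h]
      · rw [h0]
        exact ⟨hC₀, hz₀, fun b hb => (hC₀s hb).1, hg₀⟩
      · rw [h1]
        exact ⟨hC₁, hz₁, fun b hb => (hC₁s hb).1, hg₁⟩
    · intro b b' hb hb' hbb
      rcases hpre b hb with h | h <;> rcases hpre b' hb' with h' | h'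
      · exact absurd (h.trans h'.symm) hbb
      · rw [h, h', h0, h1]; exact hd
      · rw [h, h', h0, h1]; exact hd.symm
      · exact absurd (h.trans h'.symm) hbb
    · rintro b hb y hy ⟨b', hb', hy'⟩
      rcases hpre b hb with h | h
      · rw [h, h0] at hy
        have hy1 : (F.opp y).1 ∈ C₁ := by
          rcases hpre b' hb' with h' | h' <;> rw [h'] at hy'
          · rw [h0] at hy'
            exact (Set.disjoint_left.1 hUV (hC₀s hy').2.1 (hTV y (hC₀s hy).2.2)).elim
          · rwa [h1] at hy'
        obtain ⟨s, hs⟩ := hg₁.exists_bdry_path (F.opp y) (F.opp z) hy1 hz₁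
        refine ⟨z, (s.map F.opp.continuous).cast (F.opp_opp y).symm (F.opp_opp z).symm, h.symm,
          ?_, ?_⟩
        · intro t
          rw [h, h0]
          exact hTC _ (hC₁s (hs t)).2.2
        · intro t
          rw [h1]
          show (F.opp (F.opp (s t))).1 ∈ C₁
          rw [F.opp_opp]
          exact hs t
      · rw [h, h1] at hy
        obtain ⟨s, hs⟩ := hg₁.exists_bdry_path y (F.opp z) hy hz₁
        refine ⟨F.opp z, s, h.symm, ?_, ?_⟩
        · intro t
          rw [h, h1]
          exact hs t
        · intro t
          rw [F.opp_opp, h0]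
          exact hTC _ (hC₁s (hs t)).2.2
  · push Not at ha
    have hpre : ∀ a', F.π a' = F.π a → a' = a := fun a' h => by
      rcases F.eq_or h.symm with h | ⟨h, h'⟩
      · exact h.symm
      · rw [← h', ha h]
    have hTo : ∃ T : Set N, T ∈ nhds a ∧ ∀ b ∈ T, b ∈ F.B → a ∈ F.B := by
      by_cases h : a ∈ F.B
      · exact ⟨Set.univ, Filter.univ_mem, fun _ _ _ => h⟩
      · exact ⟨F.Bᶜ, (isClosed_mfdBdry F.mfd).isOpen_compl.mem_nhds h, fun b hb hb' => (hb hb').elim⟩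
    obtain ⟨T, hT, hTB⟩ := hTo
    obtain ⟨C, hC, haC, hCs, hg⟩ := exists_good_nhd F.mfd a (Filter.inter_mem hOa hT)
    refine ⟨fun _ => C, ?_, ?_, ?_⟩
    · intro b hb
      obtain rfl := hpre b hb
      exact ⟨hC, haC, fun b hb => (hCs hb).1, hg⟩
    · intro b b' hb hb' hbb
      exact absurd ((hpre b hb).trans (hpre b' hb').symm) hbb
    · rintro b hb y hy -
      obtain rfl := hpre b hb
      have hbB := hTB y (hCs hy).2 y.2
      obtain ⟨s, hs⟩ := hg.exists_bdry_path y ⟨b, hbB⟩ hy haC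
      refine ⟨⟨b, hbB⟩, s, rfl, hs, fun t => ?_⟩
      have : F.opp (s t) = s t := F.opp_eq (y := ⟨b, hbB⟩)
        ⟨(s.subpath 1 t).cast s.target.symm rfl⟩ (ha hbB)
      rw [this]
      exact hs t

/-- Neighbourhoods `W` of the points of the quotient over which points can be retracted to the
preimages of the centre in a coherent way. -/
structure Retr (x : M) (O W : Set M) (r : ∀ b : N, UCov b) : Prop where
  isOpen : IsOpen W
  mem : x ∈ W
  sub : W ⊆ O
  center : ∀ b, F.π b ∈ W → F.π (r b).1 = x
  exists_path : ∀ b, F.π b ∈ W → ∃ γ : Path b (r b).1, (r b).2 = .mk γ ∧ ∀ t, F.π (γ t) ∈ O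
  lmul : ∀ {b b'} (γ : Path b b'), (∀ t, F.π (γ t) ∈ W) → lmul (.mk γ) (r b') = r b
  bdry : ∀ y : F.B, F.π y.1 ∈ W → ∃ s : UCov y, r (F.ι y) = umap F.ι s ∧
    r (F.ι (F.opp y)) = umap F.ι (umap F.opp s)
  lmul_proj : ∀ {b b'} (γ : Path (F.π b) (F.π b')), (∀ t, γ t ∈ W) →
    BddCoh.lmul (.mk γ) (umap F.π (r b')) = umap F.π (r b)

theorem exists_retr (x : M) {O : Set M} (hO : IsOpen O) (hx : x ∈ O) :
    ∃ (W : Set M) (r : ∀ b : N, UCov b), F.Retr x O W r := by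
  classical
  obtain ⟨_, hM⟩ := F.mfd'
  obtain ⟨O', hO', hx', hO's, hg⟩ := exists_good_nhd hM x (hO.mem_nhds hx)
  obtain ⟨C, hC, hd, hm⟩ := F.exists_compatible_nhds x hO' hx'
  have hex : ∀ b, ∃ r : UCov b, ∀ a, F.π a = x → b ∈ C a → r.1 = a ∧
      ∃ γ : Path b r.1, r.2 = .mk γ ∧ ∀ t, γ t ∈ C a := by
    intro b
    by_cases h : ∃ a, F.π a = x ∧ b ∈ C a
    · obtain ⟨a, ha, hb⟩ := h
      obtain ⟨γ, hγ⟩ := (hC a ha).2.2.2.exists_path hb (hC a ha).2.1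
      refine ⟨⟨a, .mk γ⟩, fun a' ha' hb' => ?_⟩
      obtain rfl : a = a' := by
        by_contra hne
        exact Set.disjoint_left.1 (hd a a' ha ha' hne) hb hb'
      exact ⟨rfl, γ, rfl, hγ⟩
    · exact ⟨⟨b, .refl b⟩, fun a ha hb => (h ⟨a, ha, hb⟩).elim⟩
  choose r hr using hex
  let W : Set M := (F.π '' {b | ∃ a, F.π a = x ∧ b ∈ C a}ᶜ)ᶜ
  have hUo : IsOpen {b | ∃ a, F.π a = x ∧ b ∈ C a} := by
    rw [isOpen_iff_mem_nhds]
    rintro b ⟨a, ha, hb⟩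
    exact Filter.mem_of_superset ((hC a ha).1.mem_nhds hb) fun b' hb' => ⟨a, ha, hb'⟩
  have hW : ∀ b, F.π b ∈ W → ∃ a, F.π a = x ∧ b ∈ C a := fun b hb => by
    by_contra h
    exact hb ⟨b, h, rfl⟩
  have hWO : W ⊆ O' := fun w hw => by
    obtain ⟨b, rfl⟩ := F.surj w
    obtain ⟨a, ha, hb⟩ := hW b hw
    exact (hC a ha).2.2.1 hb
  refine ⟨W, r, ?_, ?_, hWO.trans hO's, ?_, ?_, ?_, ?_, ?_⟩
  · exact (F.closed _ hUo.isClosed_compl).isOpen_compl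
  · rintro ⟨b, hb, rfl⟩
    exact hb ⟨b, rfl, (hC b rfl).2.1⟩
  · intro b hb
    obtain ⟨a, ha, hb⟩ := hW b hb
    rw [(hr b a ha hb).1, ha]
  · intro b hb
    obtain ⟨a, ha, hb⟩ := hW b hb
    obtain ⟨-, γ, h, hγ⟩ := hr b a ha hb
    exact ⟨γ, h, fun t => hO's ((hC a ha).2.2.1 (hγ t))⟩
  · intro b b' γ hγ
    obtain ⟨a, ha, hb⟩ := hW b (γ.source ▸ hγ 0)
    have hall : ∀ t, γ t ∈ C a := by
      have hcl : IsClopen {t | γ t ∈ C a} := by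
        refine ⟨⟨?_⟩, (hC a ha).1.preimage γ.continuous⟩
        rw [isOpen_iff_mem_nhds]
        intro t ht
        obtain ⟨a', ha', hb'⟩ := hW _ (hγ t)
        have hne : a ≠ a' := fun h => ht (h ▸ hb')
        exact Filter.mem_of_superset (((hC a' ha').1.preimage γ.continuous).mem_nhds hb')
          fun t' ht' ht'' => Set.disjoint_left.1 (hd a a' ha ha' hne) ht'' ht'
      have := hcl.eq_univ ⟨0, show γ 0 ∈ C a by rw [γ.source]; exact hb⟩
      exact fun t => Set.eq_univ_iff_forall.1 this t
    obtain ⟨h1, δ, h2, hδ⟩ := hr b a ha hb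
    obtain ⟨h1', δ', h2', hδ'⟩ := hr b' a ha (γ.target ▸ hall 1)
    have e : ∀ b, r b = ⟨(r b).1, (r b).2⟩ := fun b => rfl
    rw [e b, e b', h2, h2']
    show (⟨_, (PQ.mk γ).trans (.mk δ')⟩ : UCov b) = _
    rw [← PQ.mk_trans]
    exact (hC a ha).2.2.2.mk_eq (h1'.trans h1.symm) _ _ (path_trans_mem hall hδ') hδ
  · intro y hy
    obtain ⟨a, ha, hya⟩ := hW _ hy
    have hy' : F.π (F.opp y).1 ∈ W := by rw [F.proj_opp]; exact hy
    obtain ⟨z, s, hz, hs, hs'⟩ := hm a ha y hya (hW _ hy')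
    refine ⟨⟨z, .mk s⟩, ?_, ?_⟩
    · obtain ⟨h1, δ, h2, hδ⟩ := hr y a ha hya
      have e : r (F.ι y) = ⟨(r y).1, (r y).2⟩ := rfl
      rw [e, h2]
      exact (hC a ha).2.2.2.mk_eq (h1.trans hz.symm) δ (s.map F.ι.continuous) hδ hs
    · have hoz : F.π (F.opp z).1 = x := by rw [F.proj_opp, hz, ha]
      obtain ⟨h1, δ, h2, hδ⟩ := hr (F.opp y) _ hoz (by have := hs' 0; rwa [s.source] at this)
      have e : r (F.ι (F.opp y)) = ⟨(r (F.opp y)).1, (r (F.opp y)).2⟩ := rfl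
      rw [e, h2]
      exact (hC _ hoz).2.2.2.mk_eq h1 δ ((s.map F.opp.continuous).map F.ι.continuous) hδ hs'
  · intro b b' γ hγ
    have hb := γ.source ▸ hγ 0
    have hb' := γ.target ▸ hγ 1
    obtain ⟨a, ha, hb⟩ := hW b hb
    obtain ⟨a', ha', hb'⟩ := hW b' hb'
    obtain ⟨h1, δ, h2, hδ⟩ := hr b a ha hb
    obtain ⟨h1', δ', h2', hδ'⟩ := hr b' a' ha' hb'
    have e : ∀ b, r b = ⟨(r b).1, (r b).2⟩ := fun b => rfl
    rw [e b, e b', h2, h2']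
    exact hg.mk_eq (by rw [h1, h1', ha, ha']) (γ.trans (δ'.map F.π.continuous))
      (δ.map F.π.continuous) (path_trans_mem (fun t => hWO (hγ t))
        fun t => (hC a' ha').2.2.1 (hδ' t)) (fun t => (hC a ha).2.2.1 (hδ t))

end Fold

/-! ### Initial segments of paths -/

section Segments

variable {a b : X}

lemma lmul_lmul {x y z : X} (g : PQ x y) (h : PQ y z)
    (t : UCov z) : lmul g (lmul h t) = lmul (g.trans h) t := by
  simp only [lmul, PQ.trans_assoc]

/-- The class of an initial segment of a path. -/
def initc (γ : Path a b) (t : I01) : PQ a (γ t) := .mk ((γ.subpath 0 t).cast γ.source.symm rfl)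

lemma initc_trans (γ : Path a b) (t t' : I01) :
    (initc γ t).trans (.mk (γ.subpath t t')) = initc γ t' := by
  rw [initc, initc, ← PQ.mk_trans, PQ.eq]
  have h : ((γ.subpath 0 t).trans (γ.subpath t t')).Homotopic (γ.subpath 0 t') :=
    ⟨Path.Homotopy.subpathTransSubpath γ 0 t t'⟩
  exact ⟨h.some.pathCast γ.source.symm rfl⟩

lemma initc_zero (γ : Path a b) : (⟨γ 0, initc γ 0⟩ : UCov a) = ⟨a, .refl a⟩ := by
  refine Sigma.ext γ.source ?_
  rw [initc, PQ.mk_cast, Path.subpath_self]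
  have : ∀ (c : X) (h : a = c), HEq ((PQ.mk (Path.refl c)).cast h rfl) (PQ.refl a) := by
    rintro c rfl
    exact heq_of_eq (PQ.cast_rfl_rfl _)
  exact this _ γ.source.symm

lemma initc_one (γ : Path a b) : (⟨γ 1, initc γ 1⟩ : UCov a) = ⟨b, .mk γ⟩ := by
  refine Sigma.ext γ.target ?_
  rw [initc, Path.subpath_zero_one]
  show HEq (PQ.mk (γ.cast rfl γ.target)) _
  rw [PQ.mk_cast]
  exact PQ.cast_heq _ _

lemma eventually_subpath_mem (γ : Path a b) (t₀ : I01) {V : Set X} (hV : IsOpen V)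
    (h : γ t₀ ∈ V) : ∀ᶠ t in nhds t₀, ∀ s, γ.subpath t₀ t s ∈ V := by
  have hc : Continuous fun z : I01 × I01 => γ.subpath t₀ z.1 z.2 :=
    γ.subpath_continuous_family.comp (by fun_prop : Continuous fun z : I01 × I01 => (t₀, z.1, z.2))
  have := isCompact_univ.eventually_forall_of_forall_eventually (x₀ := t₀)
    (P := fun t s => γ.subpath t₀ t s ∈ V) fun s _ => by
      refine hc.continuousAt.preimage_mem_nhds (hV.mem_nhds ?_)
      show γ.subpath t₀ t₀ s ∈ V
      rw [Path.subpath_self]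
      exact h
  filter_upwards [this] with t ht s
  exact ht s trivial

lemma unitInterval_induction {P : I01 → Prop} (h0 : P 0)
    (h : ∀ t₀, ∀ᶠ t in nhds t₀, (P t₀ ↔ P t)) (t : I01) : P t := by
  have hcl : IsClopen {t | P t} := by
    refine ⟨⟨?_⟩, ?_⟩ <;> rw [isOpen_iff_mem_nhds] <;> intro t ht
    · filter_upwards [h t] with s hs hs'
      exact ht (hs.2 hs')
    · filter_upwards [h t] with s hs
      exact hs.1 ht
  exact Set.eq_univ_iff_forall.1 (hcl.eq_univ ⟨0, h0⟩) t

end Segments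

/-! ### Transport in local systems -/

/-- The transport determined by locally constant transition functions. -/
theorem exists_transport {Ω : Type} {W : X → Set X} (hW : ∀ x, IsOpen (W x))
    (hxW : ∀ x, x ∈ W x) (ψ : X → X → Equiv.Perm Ω)
    (hψ : ∀ i j y, y ∈ W i → y ∈ W j → ∀ᶠ y' in nhds y, ψ j y' * (ψ i y')⁻¹ = ψ j y * (ψ i y)⁻¹) :
    ∃ Φ : ∀ {x y : X}, PQ x y → Ω → Ω, (∀ {x y z : X} (p : PQ x y) (q : PQ y z) ω,
        Φ (p.trans q) ω = Φ q (Φ p ω)) ∧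
      ∀ {x y : X} (γ : Path x y) (h : I01 → Ω), (∀ t₀, ∀ᶠ t in nhds t₀,
        ψ (γ t₀) (γ t) (h t) = ψ (γ t₀) (γ t₀) (h t₀)) → Φ (.mk γ) (h 0) = h 1 := by
  let _ : TopologicalSpace Ω := ⊥
  have : DiscreteTopology Ω := ⟨rfl⟩
  let Z : FiberBundleCore X X Ω :=
    { baseSet := W
      isOpen_baseSet := hW
      indexAt := id
      mem_baseSet_at := hxW
      coordChange := fun i j y f => (ψ j y * (ψ i y)⁻¹) f
      coordChange_self := fun i x _ v => by simp
      continuousOn_coordChange := fun i j => by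
        rintro ⟨y, f⟩ ⟨⟨hi, hj⟩, -⟩
        refine ContinuousAt.continuousWithinAt ?_
        refine (continuousAt_const (y := (ψ j y * (ψ i y)⁻¹) f)).congr ?_
        have h1 : ∀ᶠ z : X × Ω in nhds (y, f), ψ j z.1 * (ψ i z.1)⁻¹ = ψ j y * (ψ i y)⁻¹ :=
          (continuous_fst.tendsto (y, f)).eventually (hψ i j y hi hj)
        have h2 : ∀ᶠ z : X × Ω in nhds (y, f), z.2 = f :=
          ((isOpen_discrete ({f} : Set Ω)).preimage continuous_snd).mem_nhds rfl
        filter_upwards [h1, h2] with z hz hz'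
        rw [hz, hz']
      coordChange_comp := fun i j k x _ v => by simp [Equiv.Perm.mul_apply] }
  have cov : IsCoveringMap (Bundle.TotalSpace.proj : Z.TotalSpace → X) :=
    FiberBundle.isCoveringMap (F := Ω) (E := Z.Fiber)
  let toE : ∀ x, Ω → (Bundle.TotalSpace.proj : Z.TotalSpace → X) ⁻¹' {x} :=
    fun x h => ⟨⟨x, ψ x x h⟩, rfl⟩
  let ofE : Z.TotalSpace → Ω := fun e => (ψ e.1 e.1)⁻¹ e.2
  have hto : ∀ {x} (e : (Bundle.TotalSpace.proj : Z.TotalSpace → X) ⁻¹' {x}),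
      toE x (ofE e.1) = e := by
    rintro x ⟨⟨y, f⟩, rfl⟩
    refine Subtype.ext ?_
    show (⟨y, ψ y y ((ψ y y)⁻¹ f)⟩ : Z.TotalSpace) = ⟨y, f⟩
    exact congrArg (Bundle.TotalSpace.mk y) ((ψ y y).apply_symm_apply f)
  refine ⟨fun {x y} p ω => ofE (cov.monodromy p (toE x ω)).1, ?_, ?_⟩
  · intro x y z p q ω
    show ofE (cov.monodromy _ _).1 = ofE (cov.monodromy q (toE y (ofE _))).1
    rw [cov.monodromy_trans_apply, hto]
  · intro x y γ h hh
    let Γ : I01 → Z.TotalSpace := fun t => ⟨γ t, ψ (γ t) (γ t) (h t)⟩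
    have hΓ : Continuous Γ := by
      rw [continuous_iff_continuousAt]
      intro t₀
      rw [FiberBundle.continuousAt_totalSpace]
      refine ⟨γ.continuous.continuousAt, ?_⟩
      refine (continuousAt_const (y := ψ (γ t₀) (γ t₀) (h t₀))).congr ?_
      filter_upwards [hh t₀] with t ht
      rw [← ht]
      show _ = (ψ (γ t₀) (γ t) * (ψ (γ t) (γ t))⁻¹) (ψ (γ t) (γ t) (h t))
      exact congrArg (ψ (γ t₀) (γ t)) ((ψ (γ t) (γ t)).symm_apply_apply (h t)).symm
    have h0 : Γ 0 = (toE x (h 0)).1 := by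
      show (⟨γ 0, ψ (γ 0) (γ 0) (h 0)⟩ : Z.TotalSpace) = ⟨x, ψ x x (h 0)⟩
      rw [γ.source]
    have h1 := (cov.eq_liftPath_iff (γ := γ) (e := (toE x (h 0)).1) (Γ := Γ) γ.source).2
      ⟨hΓ, rfl, h0⟩
    have h2 : (cov.monodromy (.mk γ) (toE x (h 0))).1 = Γ 1 := (congrFun h1 1).symm
    show ofE _ = _
    rw [h2]
    exact (ψ (γ 1) (γ 1)).symm_apply_apply (h 1)

namespace Fold

variable {n : ℕ} {N M : Type} [TopologicalSpace N] [TopologicalSpace M] (F : Fold n N M)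

/-- Local systems on a manifold which agree along the identified boundary points descend. -/
theorem exists_descent {Ω : Type} (φ : ∀ {a b : N}, PQ a b → Equiv.Perm Ω)
    (hφ : ∀ {a b c : N} (p : PQ a b) (q : PQ b c), φ (p.trans q) = φ q * φ p)
    (hB : ∀ {y z : F.B} (s : PQ y z), φ (s.map F.ι) = φ ((s.map F.opp).map F.ι)) :
    ∃ Φ : ∀ {x y : M}, PQ x y → Ω → Ω, (∀ {x y z : M} (p : PQ x y) (q : PQ y z) ω,
        Φ (p.trans q) ω = Φ q (Φ p ω)) ∧
      ∀ {a b : N} (p : PQ a b) ω, Φ (p.map F.π) ω = φ p ω := by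
  choose W r hr using fun x => F.exists_retr x isOpen_univ trivial
  choose sec hsec using F.surj
  let φU : ∀ {a : N}, UCov a → Equiv.Perm Ω := fun t => φ t.2
  have hφU : ∀ {a b : N} (p : PQ a b) (t : UCov b),
      φU (lmul p t) = φU t * φ p := fun p t => hφ p t.2
  let ψ : M → M → Equiv.Perm Ω := fun x y => φU (r x (sec y))
  have hψ : ∀ x b, F.π b ∈ W x → φU (r x b) = ψ x (F.π b) := fun x b hb => by
    rcases F.eq_or (hsec (F.π b)).symm with h | ⟨h, h'⟩
    · show _ = φU (r x (sec (F.π b)))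
      rw [← h]
    · obtain ⟨s, h1, h2⟩ := (hr x).bdry ⟨b, h⟩ hb
      show _ = φU (r x (sec (F.π b)))
      rw [← h']
      exact (congrArg φU h1).trans ((hB s.2).trans (congrArg φU h2).symm)
  obtain ⟨Φ, hΦ, hΦγ⟩ := exists_transport (fun x => (hr x).isOpen) (fun x => (hr x).mem) ψ (by
    intro i j y hi hj
    obtain ⟨W', r', hr'⟩ := F.exists_retr y ((hr i).isOpen.inter (hr j).isOpen) ⟨hi, hj⟩
    filter_upwards [hr'.isOpen.mem_nhds hr'.mem] with y' hy'
    rw [← hsec y'] at hy'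
    obtain ⟨γ, -, hγ⟩ := hr'.exists_path _ hy'
    have key : ∀ x, W' ⊆ W x → y ∈ W x → (∀ t, F.π (γ t) ∈ W x) → ψ x y' = ψ x y * φ (.mk γ) := by
      intro x hx hy h
      have h1 := (hr x).lmul γ h
      have h2 := hψ x (r' (sec y')).1 (by rw [hr'.center _ hy']; exact hy)
      rw [hr'.center _ hy'] at h2
      show φU (r x (sec y')) = _
      rw [← h1, hφU, h2]
    rw [key i (fun z hz => (hr'.sub hz).1) hi fun t => (hγ t).1,
      key j (fun z hz => (hr'.sub hz).2) hj fun t => (hγ t).2]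
    group)
  refine ⟨@Φ, @hΦ, fun {a b} p ω => ?_⟩
  obtain ⟨γ, rfl⟩ := PQ.mk_surjective p
  have h := hΦγ (γ.map F.π.continuous) (fun t => φ (initc γ t) ω) (fun t₀ => by
    have hmem : γ t₀ ∈ F.π ⁻¹' W (F.π (γ t₀)) := (hr _).mem
    filter_upwards [eventually_subpath_mem γ t₀ ((hr _).isOpen.preimage F.π.continuous) hmem]
      with t ht
    have h1 := (hr (F.π (γ t₀))).lmul (γ.subpath t₀ t) ht
    have ht1 : F.π (γ t) ∈ W (F.π (γ t₀)) := by
      have := ht 1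
      rwa [(γ.subpath t₀ t).target] at this
    show ψ (F.π (γ t₀)) (F.π (γ t)) (φ (initc γ t) ω) =
      ψ (F.π (γ t₀)) (F.π (γ t₀)) (φ (initc γ t₀) ω)
    rw [← hψ _ _ ht1, ← hψ _ _ hmem, ← h1, hφU, ← initc_trans γ t₀ t, hφ]
    rfl)
  have h0 : φ (initc γ 0) ω = ω := by
    have h1 : φ (initc γ 0) = φ (.refl a) := congrArg φU (initc_zero γ)
    have h2 := hφ (.refl a) (.refl a)
    rw [PQ.refl_trans, left_eq_mul] at h2
    rw [h1, h2]
    rfl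
  have h1 : φ (initc γ 1) = φ (.mk γ) := congrArg φU (initc_one γ)
  rw [h0, h1] at h
  exact h

/-- Two lifts are related by a path of the manifold or by an identification. -/
def Step {x : M} (v v' : VCov F.π x) : Prop := VRel v v' ∨ v.toU = v'.toU

/-- Two lifts are connected by steps. -/
def Reach {x : M} : VCov F.π x → VCov F.π x → Prop := Relation.ReflTransGen F.Step

variable {F}

lemma Step.symm {x : M} {v v' : VCov F.π x} (h : F.Step v v') : F.Step v' v :=
  h.imp VRel.symm Eq.symm

lemma Reach.symm {x : M} {v v' : VCov F.π x} (h : F.Reach v v') : F.Reach v' v :=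
  have : Std.Symm (F.Step (x := x)) := ⟨fun _ _ h => h.symm⟩
  (Relation.ReflTransGen.stdSymm (r := F.Step)).symm _ _ h

lemma vrel_rmul {Y : Type} [TopologicalSpace Y] {ι : C(Y, X)} {q : X} (v : VCov ι q) {y : Y}
    (s : PQ v.1 y) : VRel v (v.rmul s) := ⟨s, rfl⟩

lemma reach_of_retr {x₀ : M} {O W : Set M} {r : ∀ b : N, UCov b} (hr : F.Retr x₀ O W r) {x z z' : M}
    {p : PQ x z} {δ : Path z z'} (hδ : ∀ t, δ t ∈ W) {w w' : VCov F.π x}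
    (hw : w.toU = ⟨z, p⟩) (hw' : w'.toU = ⟨z', p.trans (.mk δ)⟩) : F.Reach w w' := by
  obtain ⟨b, u⟩ := w
  obtain ⟨b', u'⟩ := w'
  change (⟨F.π b, u⟩ : UCov x) = _ at hw
  change (⟨F.π b', u'⟩ : UCov x) = _ at hw'
  obtain ⟨rfl, h⟩ := Sigma.mk.inj_iff.1 hw
  obtain rfl := eq_of_heq h
  obtain ⟨rfl, h'⟩ := Sigma.mk.inj_iff.1 hw'
  obtain rfl := eq_of_heq h'
  have e1 : F.Step (⟨b, u⟩ : VCov F.π x) (VCov.rmul ⟨b, u⟩ (r b).2) := Or.inl (vrel_rmul _ _)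
  have e3 : F.Step (VCov.rmul (⟨b', u.trans (.mk δ)⟩ : VCov F.π x) (r b').2)
      ⟨b', u.trans (.mk δ)⟩ := Or.inl (VRel.symm (vrel_rmul _ _))
  refine .tail (.tail (.single e1) (Or.inr ?_)) e3
  have h1 : lmul u (lmul (.mk δ) (umap F.π (r b'))) = lmul u (umap F.π (r b)) :=
    congrArg (lmul u) (hr.lmul_proj δ hδ)
  refine Eq.trans (b := lmul u (umap F.π (r b))) rfl (h1.symm.trans ?_)
  exact lmul_lmul u (.mk δ) (umap F.π (r b'))

theorem reach {x : M} (v v' : VCov F.π x) : F.Reach v v' := by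
  obtain ⟨a, u⟩ := v
  obtain ⟨a', u'⟩ := v'
  obtain ⟨γ, hγ⟩ := PQ.mk_surjective (u.symm.trans u')
  have key := unitInterval_induction (P := fun t => ∀ w : VCov F.π x,
    w.toU = ⟨γ t, u.trans (initc γ t)⟩ → F.Reach ⟨a, u⟩ w) ?_ ?_ 1
  · refine key ⟨a', u'⟩ ?_
    have h1 := congrArg (lmul u) (initc_one γ)
    refine Eq.trans ?_ h1.symm
    show (⟨_, u'⟩ : UCov x) = ⟨_, u.trans (PQ.mk γ)⟩
    rw [hγ, ← PQ.trans_assoc, PQ.trans_symm, PQ.refl_trans]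
  · intro w hw
    refine .single (Or.inr (Eq.trans ?_ hw.symm))
    refine Eq.trans ?_ (congrArg (lmul u) (initc_zero γ)).symm
    show (⟨_, u⟩ : UCov x) = ⟨_, u.trans (.refl _)⟩
    rw [PQ.trans_refl]
  · intro t₀
    obtain ⟨W, r, hr⟩ := F.exists_retr (γ t₀) isOpen_univ trivial
    filter_upwards [eventually_subpath_mem γ t₀ hr.isOpen hr.mem] with t ht
    have hkey : ∀ w w' : VCov F.π x, w.toU = ⟨γ t₀, u.trans (initc γ t₀)⟩ →
        w'.toU = ⟨γ t, u.trans (initc γ t)⟩ → F.Reach w w' := fun w w' hw hw' => by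
      refine reach_of_retr hr ht hw ?_
      rw [hw', ← initc_trans γ t₀ t, PQ.trans_assoc]
    have hex : ∀ s : UCov x, ∃ w : VCov F.π x, w.toU = s := by
      rintro ⟨z, p⟩
      obtain ⟨b, rfl⟩ := F.surj z
      exact ⟨⟨b, p⟩, rfl⟩
    constructor
    · intro h w' hw'
      obtain ⟨w, hw⟩ := hex ⟨γ t₀, u.trans (initc γ t₀)⟩
      exact (h w hw).trans (hkey w w' hw hw')
    · intro h w hw
      obtain ⟨w', hw'⟩ := hex ⟨γ t, u.trans (initc γ t)⟩
      exact (h w' hw').trans (hkey w w' hw hw').symm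

end Fold

lemma _root_.Path.Homotopic.Quotient.symm_cancel {x y z : X} (p : PQ x y) (q : PQ y z) : p.symm.trans (p.trans q) = q := by
  rw [← PQ.trans_assoc, PQ.symm_trans, PQ.refl_trans]

lemma _root_.Path.Homotopic.Quotient.cancel_symm {x y z : X} (p : PQ x y) (q : PQ x z) : p.trans (p.symm.trans q) = q := by
  rw [← PQ.trans_assoc, PQ.trans_symm, PQ.refl_trans]

lemma _root_.Path.Homotopic.Quotient.cancel_right {x y z : X} (p : PQ x y) (q : PQ y z) : (p.trans q).trans q.symm = p := by
  rw [PQ.trans_assoc, PQ.trans_symm, PQ.trans_refl]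

lemma _root_.Path.Homotopic.Quotient.cancel_right' {x y z : X} (p : PQ x y) (q : PQ z y) : (p.trans q.symm).trans q = p := by
  rw [PQ.trans_assoc, PQ.symm_trans, PQ.trans_refl]

lemma _root_.Path.Homotopic.Quotient.left_cancel {x y z : X} (p : PQ x y) {q q' : PQ y z} (h : p.trans q = p.trans q') :
    q = q' := by
  rw [← p.symm_cancel q, h, p.symm_cancel]

lemma _root_.Path.Homotopic.Quotient.joined {x y : X} (p : PQ x y) : Joined x y := by
  obtain ⟨γ, -⟩ := PQ.mk_surjective p
  exact ⟨γ⟩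

/-- Classes of paths with a given end point. -/
abbrev Into (a : X) := Σ c : X, PQ c a

/-- Prolongation of classes of paths. -/
def intoEquiv {a b : X} (p : PQ a b) : Into a ≃ Into b where
  toFun u := ⟨u.1, u.2.trans p⟩
  invFun u := ⟨u.1, u.2.trans p.symm⟩
  left_inv u := by simp only [PQ.cancel_right]
  right_inv u := by simp only [PQ.cancel_right']

lemma exists_prod_equiv {A Ω : Type} [Nonempty A] [Infinite Ω] (f : Ω → A)
    (hf : Surjective f) : Nonempty (A × Ω ≃ Ω) := by
  rw [← Cardinal.eq, Cardinal.mk_prod, Cardinal.lift_id, Cardinal.lift_id]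
  exact Cardinal.mul_eq_right (Cardinal.aleph0_le_mk Ω) (Cardinal.mk_le_of_surjective hf)
    (Cardinal.mk_ne_zero A)

lemma exists_large {I : Type} (A : I → Type) [∀ i, Nonempty (A i)] :
    ∃ Ω : Type, Infinite Ω ∧ ∀ i, ∃ f : Ω → A i, Surjective f := by
  classical
  refine ⟨(Σ i, A i) ⊕ ℕ, inferInstance, fun i => ⟨fun x => match x with
    | .inl x => if h : x.1 = i then h ▸ x.2 else Classical.arbitrary _
    | .inr _ => Classical.arbitrary _, fun u => ⟨.inl ⟨i, u⟩, ?_⟩⟩⟩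
  simp

namespace Fold

variable {n : ℕ} {N M : Type} [TopologicalSpace N] [TopologicalSpace M] (F : Fold n N M)

/-- Local systems with identifications along the boundary descend. -/
theorem exists_gauged_descent {Ω : Type} (φ : ∀ {a b : N}, PQ a b → Equiv.Perm Ω)
    (hφ : ∀ {a b c : N} (p : PQ a b) (q : PQ b c), φ (p.trans q) = φ q * φ p)
    (T : F.B → Equiv.Perm Ω) (hT : ∀ {y z : F.B} (s : PQ y z), y ∈ F.pos → F.opp y ≠ y →
      T z * φ (s.map F.ι) = φ ((s.map F.opp).map F.ι) * T y) :
    ∃ (Φ : ∀ {x y : M}, PQ x y → Ω → Ω) (θ : N → Equiv.Perm Ω),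
      (∀ {x y z : M} (p : PQ x y) (q : PQ y z) ω, Φ (p.trans q) ω = Φ q (Φ p ω)) ∧
      (∀ {a b : N} (p : PQ a b) ω, θ b (Φ (p.map F.π) ω) = φ p (θ a ω)) ∧
      ∀ y ∈ F.pos, F.opp y ≠ y → θ (F.opp y) = T y * θ y := by
  classical
  let θ : N → Equiv.Perm Ω := fun b =>
    if h : ∃ y ∈ F.pos, F.opp y ≠ y ∧ (F.opp y).1 = b then T h.choose else 1
  have hθ1 : ∀ y ∈ F.pos, F.opp y ≠ y → θ (F.opp y) = T y := fun y hy hne => by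
    have h : ∃ z ∈ F.pos, F.opp z ≠ z ∧ (F.opp z).1 = (F.opp y).1 := ⟨y, hy, hne, rfl⟩
    have e : h.choose = y := by
      have := congrArg F.opp (Subtype.ext h.choose_spec.2.2 : F.opp h.choose = F.opp y)
      rwa [F.opp_opp, F.opp_opp] at this
    simp only [θ, dif_pos h]
    rw [e]
  have hθ0 : ∀ y : F.B, (y ∈ F.pos ∨ F.opp y = y) → θ y = 1 := fun y hy => by
    have h : ¬∃ z ∈ F.pos, F.opp z ≠ z ∧ (F.opp z).1 = y.1 := by
      rintro ⟨z, hz, hne, h⟩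
      have h : F.opp z = y := Subtype.ext h
      rcases hy with hy | hy
      · exact (F.pos_opp hne).1 (h ▸ hy) hz
      · rw [← h, F.opp_opp] at hy
        exact hne hy.symm
    simp only [θ, dif_neg h]
  have hθ2 : ∀ y ∈ F.pos, F.opp y ≠ y → θ (F.opp y) = T y * θ y := fun y hy hne => by
    rw [hθ1 y hy hne, hθ0 y (Or.inl hy), mul_one]
  have hopp : ∀ y, F.opp y ≠ y → F.opp (F.opp y) ≠ F.opp y := fun y hy h => by
    rw [F.opp_opp] at h
    exact hy h.symm
  have hmem : ∀ {y z : F.B} (s : PQ y z), y ∈ F.pos → F.opp y ≠ y → (θ z)⁻¹ * φ (s.map F.ι) * θ y =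
        (θ (F.opp z))⁻¹ * φ ((s.map F.opp).map F.ι) * θ (F.opp y) := fun {y z} s hy hne => by
    have hz := F.pos_of_joined s.joined hy
    have hzne : F.opp z ≠ z := fun h => hne (F.opp_eq s.joined.symm h)
    rw [hθ2 y hy hne, hθ2 z hz hzne, mul_inv_rev, ← mul_assoc, mul_assoc _ _ (T y), ← hT s hy hne]
    group
  obtain ⟨Φ, hΦ, hΦφ⟩ := F.exists_descent (fun {a b} p => (θ b)⁻¹ * φ p * θ a)
    (fun p q => by rw [hφ]; group) (fun {y z} s => by
      obtain ⟨σ, rfl⟩ := PQ.mk_surjective s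
      have key : ∀ y' z' (σ' : Path y' z'), y = y' → z = z' → (∀ t, σ' t = σ t) →
          (θ z)⁻¹ * φ (PQ.map (.mk σ) F.ι) * θ y = (θ z')⁻¹ * φ (PQ.map (.mk σ') F.ι) * θ y' := by
        rintro y' z' σ' rfl rfl h
        rw [Path.ext (funext h)]
      by_cases hne : F.opp y = y
      · exact key _ _ (σ.map F.opp.continuous) hne.symm (F.opp_eq ⟨σ⟩ hne).symm fun t =>
          F.opp_eq (y := y) ⟨(σ.subpath 0 t).cast σ.source.symm rfl⟩ hne
      · by_cases hy : y ∈ F.pos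
        · exact hmem _ hy hne
        · exact (key _ _ ((σ.map F.opp.continuous).map F.opp.continuous) (F.opp_opp y).symm
            (F.opp_opp z).symm fun t => F.opp_opp _).trans
            (hmem (.mk (σ.map F.opp.continuous)) ((F.pos_opp hne).2 hy) (hopp y hne)).symm)
  refine ⟨@Φ, θ, @hΦ, fun p ω => ?_, hθ2⟩
  rw [hΦφ]
  simp [Equiv.Perm.mul_apply]

section Injective

variable {Y : Type} [TopologicalSpace Y] {Ω : Type}

/-- Classes of paths up to prolongation by loops of a subspace. -/
def loopSetoid (f : C(Y, N)) (y : Y) : Setoid (Into (f y)) where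
  r u v := ∃ g : PQ y y, v = ⟨u.1, u.2.trans (g.map f)⟩
  iseqv := by
    refine ⟨fun u => ⟨.refl y, ?_⟩, ?_, ?_⟩
    · exact Sigma.ext rfl (heq_of_eq (PQ.trans_refl _).symm)
    · rintro u _ ⟨g, rfl⟩
      refine ⟨g.symm, Sigma.ext rfl (heq_of_eq ?_)⟩
      show u.2 = (u.2.trans (g.map f)).trans (g.symm.map f)
      rw [PQ.trans_assoc, ← qmap_trans, PQ.trans_symm]
      exact (PQ.trans_refl _).symm
    · rintro u _ _ ⟨g, rfl⟩ ⟨g', rfl⟩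
      refine ⟨g.trans g', Sigma.ext rfl (heq_of_eq ?_)⟩
      show (u.2.trans (g.map f)).trans (g'.map f) = _
      rw [PQ.trans_assoc, ← qmap_trans]

/-- The orbit of a class of paths. -/
abbrev Orb (f : C(Y, N)) (y : Y) := Quotient (loopSetoid f y)

/-- The prolongation of the representative of an orbit. -/
def orbPath (f : C(Y, N)) {y₀ y : Y} (o : Orb f y₀) (s : PQ y₀ y) : Into (f y) :=
  ⟨o.out.1, o.out.2.trans (s.map f)⟩

lemma exists_orbPath (f : C(Y, N)) {y₀ y : Y} (w : PQ y₀ y) (u : Into (f y)) :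
    ∃ (o : Orb f y₀) (s : PQ y₀ y), orbPath f o s = u := by
  obtain ⟨g, hg⟩ := Quotient.mk_out (s := loopSetoid f y₀) ((intoEquiv (w.map f)).symm u)
  refine ⟨Quotient.mk (loopSetoid f y₀) ((intoEquiv (w.map f)).symm u), g.trans w, ?_⟩
  refine Eq.trans ?_ ((congrArg (intoEquiv (w.map f)) hg.symm).trans
    ((intoEquiv (w.map f)).apply_symm_apply u))
  simp only [orbPath, intoEquiv, Equiv.coe_fn_mk, qmap_trans, PQ.trans_assoc]

lemma qmap_symm {y y' : Y} (f : C(Y, N)) (p : PQ y y') : p.symm.map f = (p.map f).symm := by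
  obtain ⟨γ, rfl⟩ := PQ.mk_surjective p
  rfl

lemma orbPath_inj {f : C(Y, N)} {y₀ y : Y} {o o' : Orb f y₀} {s s' : PQ y₀ y}
    (h : orbPath f o s = orbPath f o' s') : o = o' ∧ s.map f = s'.map f := by
  have h1 : o = o' := by
    rw [← o.out_eq, ← o'.out_eq]
    refine Quotient.sound ⟨s.trans s'.symm, ?_⟩
    have h2 := congrArg (intoEquiv (s'.map f)).symm h
    refine (((intoEquiv (s'.map f)).symm_apply_apply o'.out).symm.trans h2.symm).trans ?_
    show (⟨_, (o.out.2.trans (s.map f)).trans (s'.map f).symm⟩ : Into (f y₀)) = _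
    rw [PQ.trans_assoc, qmap_trans, qmap_symm]
  subst h1
  exact ⟨rfl, PQ.left_cancel _ (eq_of_heq (Sigma.ext_iff.1 h).2)⟩

lemma exists_orb_map {f f' : C(Y, N)} {y₀ y : Y} (w : PQ y₀ y)
    (hc : ∀ s s' : PQ y₀ y, s.map f = s'.map f → s.map f' = s'.map f')
    (e : Orb f y₀ × Ω → Orb f' y₀ × Ω) : ∃ T : Into (f y) × Ω → Into (f' y) × Ω,
      ∀ o s ω, T (orbPath f o s, ω) = (orbPath f' (e (o, ω)).1 s, (e (o, ω)).2) := by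
  choose o s hos using exists_orbPath f w
  refine ⟨fun x => (orbPath f' (e (o x.1, x.2)).1 (s x.1), (e (o x.1, x.2)).2), fun o' s' ω => ?_⟩
  obtain ⟨h1, h2⟩ := orbPath_inj (hos (orbPath f o' s'))
  have h3 : ∀ o, orbPath f' o (s (orbPath f o' s')) = orbPath f' o s' := fun o => by
    unfold orbPath at h2 ⊢
    rw [hc _ _ h2]
  show (orbPath f' (e (o (orbPath f o' s'), ω)).1 (s (orbPath f o' s')), _) = _
  rw [h3, h1]

lemma exists_orb_equiv {f f' : C(Y, N)} {y₀ : Y}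
    (hc : ∀ {y} (s s' : PQ y₀ y), s.map f = s'.map f ↔ s.map f' = s'.map f')
    (e : Orb f y₀ × Ω ≃ Orb f' y₀ × Ω) :
    ∃ T : ∀ {y : Y}, PQ y₀ y → (Into (f y) × Ω ≃ Into (f' y) × Ω),
      ∀ {y z : Y} (w : PQ y₀ y) (w' : PQ y₀ z) (s : PQ y z) u ω, T w' (intoEquiv (s.map f) u, ω) =
        (intoEquiv (s.map f') (T w (u, ω)).1, (T w (u, ω)).2) := by
  have hex : ∀ {y : Y} (w : PQ y₀ y), ∃ T : Into (f y) × Ω ≃ Into (f' y) × Ω,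
      ∀ o s ω, T (orbPath f o s, ω) = (orbPath f' (e (o, ω)).1 s, (e (o, ω)).2) := by
    intro y w
    obtain ⟨T, hT⟩ := exists_orb_map w (fun s s' => (hc s s').1) e
    obtain ⟨T', hT'⟩ := exists_orb_map w (fun s s' => (hc s s').2) e.symm
    refine ⟨⟨T, T', fun ⟨u, ω⟩ => ?_, fun ⟨u, ω⟩ => ?_⟩, hT⟩
    · obtain ⟨o, s, rfl⟩ := exists_orbPath f w u
      rw [hT, hT', Prod.mk.eta, e.symm_apply_apply]
    · obtain ⟨o, s, rfl⟩ := exists_orbPath f' w u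
      rw [hT', hT, Prod.mk.eta, e.apply_symm_apply]
  choose T hT using @hex
  refine ⟨@T, fun {y z} w w' s u ω => ?_⟩
  obtain ⟨o, s', rfl⟩ := exists_orbPath f w u
  have h : ∀ (g : C(Y, N)) (o : Orb g y₀), intoEquiv (s.map g) (orbPath g o s') =
      orbPath g o (s'.trans s) := fun g o => by
    simp only [orbPath, intoEquiv, Equiv.coe_fn_mk, qmap_trans, PQ.trans_assoc]
  rw [hT, h, hT, h]

/-- Compatibility of the identifications with the kernels. -/
def Compat : Prop := ∀ {y z : F.B} (s s' : PQ y z), s.map F.ι = s'.map F.ι →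
  (s.map F.opp).map F.ι = (s'.map F.opp).map F.ι

variable {F}

lemma Compat.iff (hF : F.Compat) {y z : F.B} (s s' : PQ y z) : s.map F.ι = s'.map F.ι ↔
    s.map (F.ι.comp F.opp) = s'.map (F.ι.comp F.opp) := by
  have hm : ∀ s : PQ y z, s.map (F.ι.comp F.opp) = (s.map F.opp).map F.ι := fun s => by
    obtain ⟨σ, rfl⟩ := PQ.mk_surjective s
    rfl
  rw [hm, hm]
  refine ⟨hF s s', fun h => ?_⟩
  have h' := hF _ _ h
  have key : ∀ y' z' (s₁ s₁' : PQ y' z'), y = y' → z = z' → HEq s s₁ → HEq s' s₁' →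
      s₁.map F.ι = s₁'.map F.ι → s.map F.ι = s'.map F.ι := by
    rintro y' z' s₁ s₁' rfl rfl h1 h2 h3
    rw [eq_of_heq h1, eq_of_heq h2, h3]
  have hq : ∀ s : PQ y z, HEq s ((s.map F.opp).map F.opp) := by
    intro s
    obtain ⟨σ, rfl⟩ := PQ.mk_surjective s
    have : ∀ y' z' (σ' : Path y' z'), y = y' → z = z' → (∀ t, σ' t = σ t) →
        HEq (PQ.mk σ) (PQ.mk σ') := by
      rintro y' z' σ' rfl rfl h
      rw [Path.ext (funext h)]
    exact this _ _ ((σ.map F.opp.continuous).map F.opp.continuous) (F.opp_opp y).symm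
      (F.opp_opp z).symm fun t => F.opp_opp _
  exact key _ _ _ _ (F.opp_opp y).symm (F.opp_opp z).symm (hq s) (hq s') h'

theorem Compat.injective (hF : F.Compat) {a b : N} {p p' : PQ a b}
    (h : p.map F.π = p'.map F.π) : p = p' := by
  have hinto : ∀ a : N, Nonempty (Into a) := fun a => ⟨⟨a, .refl a⟩⟩
  obtain ⟨Ω, hΩ, hsurj⟩ := exists_large fun a : N => Into a
  have hE : ∀ a : N, Nonempty (Into a × Ω ≃ Ω) := fun a => by
    obtain ⟨f, hf⟩ := hsurj a
    exact exists_prod_equiv f hf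
  let E : ∀ a : N, Into a × Ω ≃ Ω := fun a => (hE a).some
  let φ : ∀ {a b : N}, PQ a b → Equiv.Perm Ω := fun {a b} p =>
    ((E a).symm.trans ((intoEquiv p).prodCongr (Equiv.refl Ω))).trans (E b)
  have hφ : ∀ {a b : N} (p : PQ a b) u ω, φ p (E a (u, ω)) = E b (intoEquiv p u, ω) :=
    fun p u ω => by simp [φ]
  have horb : ∀ (f : C(F.B, N)) y, Nonempty (Orb f y × Ω ≃ Ω) := fun f y => by
    obtain ⟨g, hg⟩ := hsurj (f y)
    have : Nonempty (Orb f y) := (hinto (f y)).map (Quotient.mk _)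
    exact exists_prod_equiv _ (Quotient.mk_surjective.comp hg)
  choose T₀ hT₀ using fun y₀ : F.B => exists_orb_equiv (y₀ := y₀) (Ω := Ω)
    (fun s s' => hF.iff s s') ((horb F.ι y₀).some.trans (horb (F.ι.comp F.opp) y₀).some.symm)
  let rep : F.B → F.B := fun y => (Quotient.mk (pathSetoid F.B) y).out
  have hrep : ∀ y, Joined (rep y) y := fun y => Quotient.mk_out (s := pathSetoid F.B) y
  let W : ∀ y, PQ (rep y) y := fun y => .mk (hrep y).somePath
  let T : F.B → Equiv.Perm Ω := fun y => ((E (F.ι y)).symm.trans (T₀ (rep y) (W y))).trans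
    (E (F.ι (F.opp y)))
  have hT : ∀ y u ω, T y (E (F.ι y) (u, ω)) = E (F.ι (F.opp y)) (T₀ (rep y) (W y) (u, ω)) :=
    fun y u ω => by simp [T]
  have key : ∀ {y z : F.B} (s : PQ y z) (r r' : F.B) (w : PQ r y) (w' : PQ r' z) (_ : r = r') u ω,
      T₀ r' w' (intoEquiv (s.map F.ι) u, ω) =
        (intoEquiv ((s.map F.opp).map F.ι) (T₀ r w (u, ω)).1, (T₀ r w (u, ω)).2) := by
    rintro y z s r r' w w' rfl u ω
    rw [hT₀ r w w' s]
    obtain ⟨σ, rfl⟩ := PQ.mk_surjective s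
    rfl
  obtain ⟨Φ, θ, -, hΦ, -⟩ := F.exists_gauged_descent @φ (fun {a b c} p q => by
      refine Equiv.ext fun ω => ?_
      obtain ⟨⟨u, ω⟩, rfl⟩ := (E a).surjective ω
      rw [Equiv.Perm.mul_apply, hφ, hφ, hφ]
      simp only [intoEquiv, Equiv.coe_fn_mk, PQ.trans_assoc]) T (fun {y z} s _ _ => by
    refine Equiv.ext fun ω => ?_
    obtain ⟨⟨u, ω⟩, rfl⟩ := (E (F.ι y)).surjective ω
    rw [Equiv.Perm.mul_apply, Equiv.Perm.mul_apply, hφ, hT, hT,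
      key s _ _ (W y) (W z) (congrArg Quotient.out (Quotient.sound s.joined))]
    exact (hφ _ _ _).symm)
  have h1 : φ p = φ p' := Equiv.ext fun ω => by
    obtain ⟨ω, rfl⟩ := (θ a).surjective ω
    rw [← hΦ, ← hΦ, h]
  have h2 := (hφ p ⟨a, .refl a⟩ (Classical.arbitrary Ω)).symm.trans
    ((Equiv.congr_fun h1 _).trans (hφ p' _ _))
  have h3 := eq_of_heq (Sigma.ext_iff.1 (congrArg Prod.fst ((E b).injective h2))).2
  exact PQ.left_cancel (.refl a) h3

end Injective

end Fold

/-! ### Trees of vertices and doors -/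

/-- A tree, presented by its vertices and by the doors at the vertices; an edge consists of two
opposite doors, and a door which is its own opposite leads nowhere. -/
structure DoorTree (V D : Type) where
  pt : D → V
  opp : D → D
  opp_opp : ∀ t, opp (opp t) = t
  conn : ∀ v v', Relation.ReflTransGen (fun v v' => ∃ t, opp t ≠ t ∧ pt t = v ∧ pt (opp t) = v') v v'
  split : ∀ d, ∃ f : V → Prop, ∀ t, opp t ≠ t → (f (pt (opp t)) ↔ ¬(f (pt t) ↔ (t = d ∨ t = opp d)))

namespace DoorTree

variable {V D : Type} (G : DoorTree V D)

/-- The vertices beyond a door. -/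
structure IsSide (d : D) (f : V → Prop) : Prop where
  pt : ¬f (G.pt d)
  opp : ∀ t, G.opp t ≠ t → (f (G.pt (G.opp t)) ↔ ¬(f (G.pt t) ↔ (t = d ∨ t = G.opp d)))

lemma exists_isSide (d : D) : ∃ f, G.IsSide d f := by
  obtain ⟨f, hf⟩ := G.split d
  by_cases h : f (G.pt d)
  · exact ⟨fun v => ¬f v, by simpa using h, fun t ht => by have := hf t ht; tauto⟩
  · exact ⟨f, h, hf⟩

variable {G}

lemma IsSide.unique {d : D} {f g : V → Prop} (hf : G.IsSide d f) (hg : G.IsSide d g) : f = g := by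
  funext v
  refine propext ?_
  induction G.conn (G.pt d) v with
  | refl => exact iff_of_false hf.pt hg.pt
  | tail _ h ih =>
    obtain ⟨t, ht, rfl, rfl⟩ := h
    rw [hf.opp t ht, hg.opp t ht, ih]

variable (G)

/-- The vertices beyond a door. -/
def side (d : D) : V → Prop := (G.exists_isSide d).choose

lemma isSide (d : D) : G.IsSide d (G.side d) := (G.exists_isSide d).choose_spec

variable {G}

lemma side_step {d t : D} (ht : G.opp t ≠ t) (h1 : t ≠ d) (h2 : t ≠ G.opp d) :
    G.side d (G.pt (G.opp t)) ↔ G.side d (G.pt t) := by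
  have := (G.isSide d).opp t ht
  tauto

lemma side_opp {t : D} (ht : G.opp t ≠ t) : G.side t (G.pt (G.opp t)) := by
  have := (G.isSide t).opp t ht
  have := (G.isSide t).pt
  tauto

lemma pt_opp_ne {t : D} (ht : G.opp t ≠ t) : G.pt (G.opp t) ≠ G.pt t := fun h =>
  (G.isSide t).pt (h ▸ side_opp ht)

lemma exists_side (v u : V) (h : u ≠ v) : ∃ s, G.pt s = v ∧ G.side s u := by
  induction G.conn v u with
  | refl => exact absurd rfl h
  | @tail u u' _ h' ih =>
    obtain ⟨t, ht, rfl, rfl⟩ := h'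
    by_cases hv : G.pt t = v
    · exact ⟨t, hv, side_opp ht⟩
    · obtain ⟨s, rfl, hs⟩ := ih hv
      refine ⟨s, rfl, (side_step ht (fun e => hv (e ▸ rfl)) fun e => h ?_).2 hs⟩
      rw [e, G.opp_opp]

lemma side_unique {s s' : D} {u : V} (hss : G.pt s = G.pt s') (h : G.side s u) (h' : G.side s' u) :
    s = s' := by
  by_contra hne
  induction G.conn (G.pt s) u with
  | refl => exact (G.isSide s).pt h
  | tail _ hst ih =>
    obtain ⟨t, ht, rfl, rfl⟩ := hst
    have key : ∀ s s', G.pt s = G.pt s' → s ≠ s' → G.side s (G.pt (G.opp t)) →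
        G.side s' (G.pt (G.opp t)) → G.side s (G.pt t) := fun s s' hss hne h h' => by
      by_cases h1 : t = s
      · subst h1
        exact absurd ((side_step ht hne fun e => pt_opp_ne (t := s') (fun e' => hne (e.trans e'))
          (e ▸ hss)).1 h') (hss ▸ (G.isSide s').pt)
      · by_cases h2 : t = G.opp s
        · rw [h2, G.opp_opp] at h
          exact absurd h (G.isSide s).pt
        · exact (side_step ht h1 h2).1 h
    exact ih (key s s' hss hne h h') (key s' s hss.symm (Ne.symm hne) h' h)

lemma side_of_not_side {s s' : D} (h : G.side s (G.pt s')) (h' : G.side s' (G.pt s)) {x : V}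
    (hx : ¬G.side s' x) : G.side s x := by
  induction G.conn (G.pt s') x with
  | refl => exact h
  | tail _ hst ih =>
    obtain ⟨t, ht, rfl, rfl⟩ := hst
    by_cases h1 : t = s'
    · exact absurd (h1 ▸ side_opp ht) hx
    · by_cases h2 : t = G.opp s'
      · rwa [h2, G.opp_opp]
      · have hx' := hx ∘ (side_step ht h1 h2).2
        refine (side_step ht (fun e => hx' (e ▸ h')) fun e => hx ?_).2 (ih hx')
        rwa [e, G.opp_opp]

open Classical in
/-- The door of a vertex which leads to a given door. -/
def gate (v : V) (d : D) : D := if h : G.pt d ≠ v then (G.exists_side v (G.pt d) h).choose else d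

lemma gate_spec (v : V) (d : D) : G.pt (G.gate v d) = v ∧
    (G.gate v d = d ∨ G.pt d ≠ v ∧ G.side (G.gate v d) (G.pt d)) := by
  unfold gate
  split_ifs with h
  · exact ⟨(G.exists_side v _ h).choose_spec.1, Or.inr ⟨h, (G.exists_side v _ h).choose_spec.2⟩⟩
  · exact ⟨not_not.1 h, Or.inl rfl⟩

lemma gate_eq_self {d : D} : G.gate (G.pt d) d = d := dif_neg (not_not.2 rfl)

lemma gate_eq {d s : D} (h : G.side s (G.pt d)) : G.gate (G.pt s) d = s := by
  obtain ⟨h1, h2 | ⟨-, h2⟩⟩ := G.gate_spec (G.pt s) d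
  · rw [h2] at h1
    exact absurd (h1 ▸ h) (G.isSide s).pt
  · exact side_unique h1 h2 h

lemma gate_opp (v : V) (t : D) : G.gate v (G.opp t) = G.gate v t := by
  by_cases ht : G.opp t = t
  · rw [ht]
  have ht' : G.opp (G.opp t) ≠ G.opp t := by rw [G.opp_opp]; exact Ne.symm ht
  by_cases h : G.pt t = v
  · subst h
    rw [gate_eq_self, gate_eq (side_opp ht)]
  by_cases h' : G.pt (G.opp t) = v
  · subst h'
    have := side_opp ht'
    rw [G.opp_opp] at this
    rw [gate_eq_self, gate_eq this]
  obtain ⟨s, rfl, hs⟩ := G.exists_side v _ h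
  rw [gate_eq hs, gate_eq ((side_step ht (fun e => h (e ▸ rfl)) fun e => h' ?_).2 hs)]
  rw [e, G.opp_opp]

lemma gate_eq_of_pt_eq {d d' : D} (h : G.pt d = G.pt d') {v : V} (hv : G.pt d ≠ v) :
    G.gate v d = G.gate v d' := by
  obtain ⟨s, rfl, hs⟩ := G.exists_side v _ hv
  rw [gate_eq hs, gate_eq (h ▸ hs)]

lemma gate_or {s s' : D} (h : G.side s (G.pt s')) (h' : G.side s' (G.pt s)) (d : D) :
    G.gate (G.pt s) d = s ∨ G.gate (G.pt s') d = s' := by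
  by_cases hd : G.side s' (G.pt d)
  · exact Or.inr (gate_eq hd)
  · exact Or.inl (gate_eq (side_of_not_side h h' hd))

lemma gate_map {V' D' : Type} {G' : DoorTree V' D'} {eV : V → V'} {eD : D → D'}
    (hD : Injective eD) (hpt : ∀ d, G'.pt (eD d) = eV (G.pt d))
    (hopp : ∀ d, G'.opp (eD d) = eD (G.opp d)) (v : V) (d : D) :
    G'.gate (eV v) (eD d) = eD (G.gate v d) := by
  have hs : ∀ s, G.IsSide s (G'.side (eD s) ∘ eV) := fun s => ⟨by
    have := (G'.isSide (eD s)).pt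
    rwa [hpt] at this, fun t ht => by
    have := (G'.isSide (eD s)).opp (eD t) (by rw [hopp]; exact fun e => ht (hD e))
    rwa [hopp, hopp, hpt, hpt, hD.eq_iff, hD.eq_iff] at this⟩
  by_cases h : G.pt d = v
  · subst h
    rw [← hpt, gate_eq_self, gate_eq_self]
  · obtain ⟨s, rfl, hs'⟩ := G.exists_side v _ h
    rw [gate_eq hs', ← hpt, gate_eq]
    rw [(G.isSide s).unique (hs s)] at hs'
    rwa [hpt]

/-- At most one vertex contributes to an alternating sum over the vertices of a tree. -/
lemma eq_zero_or_eq_zero {m : ℕ} {b : V → (Fin (m + 3) → D) → ℝ}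
    (hb : ∀ v T i j, i ≠ j → T i = T j → b v T = 0) (T : Fin (m + 3) → D) {v u : V} (hvu : v ≠ u) :
    b v (fun i => G.gate v (T i)) = 0 ∨ b u (fun i => G.gate u (T i)) = 0 := by
  obtain ⟨s, rfl, hs⟩ := G.exists_side v u hvu.symm
  obtain ⟨s', rfl, hs'⟩ := G.exists_side u (G.pt s) hvu
  have h := fun i => gate_or hs hs' (T i)
  have h01 : (0 : Fin (m + 3)) ≠ 1 := by simp
  let k : Fin (m + 3) := ⟨2, by omega⟩
  have h02 : 0 ≠ k := by simp [Fin.ext_iff, k]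
  have h12 : 1 ≠ k := by simp [Fin.ext_iff, k]
  rcases h 0 with h0 | h0 <;> rcases h 1 with h1 | h1 <;> rcases h k with h2 | h2
  · exact Or.inl (hb _ _ 0 1 h01 (h0.trans h1.symm))
  · exact Or.inl (hb _ _ 0 1 h01 (h0.trans h1.symm))
  · exact Or.inl (hb _ _ 0 _ h02 (h0.trans h2.symm))
  · exact Or.inr (hb _ _ 1 _ h12 (h1.trans h2.symm))
  · exact Or.inl (hb _ _ 1 _ h12 (h1.trans h2.symm))
  · exact Or.inr (hb _ _ 0 _ h02 (h0.trans h2.symm))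
  · exact Or.inr (hb _ _ 0 1 h01 (h0.trans h1.symm))
  · exact Or.inr (hb _ _ 0 1 h01 (h0.trans h1.symm))

variable (G) in
/-- The sum over all vertices of a function of the doors at each vertex. -/
def total {m : ℕ} (b : V → (Fin m → D) → ℝ) (T : Fin m → D) : ℝ := ∑ᶠ v, b v fun i => G.gate v (T i)

section Total

variable {m : ℕ} {b : V → (Fin (m + 3) → D) → ℝ}

lemma total_eq_or (hb : ∀ v T i j, i ≠ j → T i = T j → b v T = 0) (T : Fin (m + 3) → D) :
    ∃ v : Option V, (∀ u ∉ v, b u (fun i => G.gate u (T i)) = 0) ∧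
      G.total b T = v.elim 0 fun v => b v fun i => G.gate v (T i) := by
  by_cases h : ∀ u, b u (fun i => G.gate u (T i)) = 0
  · exact ⟨none, fun u _ => h u, by simp [total, h]⟩
  · push Not at h
    obtain ⟨v, hv⟩ := h
    have hu : ∀ u, u ≠ v → b u (fun i => G.gate u (T i)) = 0 := fun u hu =>
      (eq_zero_or_eq_zero hb T hu).resolve_right hv
    exact ⟨some v, fun u h => hu u fun e => h (by rw [e]; rfl), finsum_eq_single _ _ hu⟩

lemma abs_total_le (hb : ∀ v T i j, i ≠ j → T i = T j → b v T = 0)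
    {C : ℝ} (hC : 0 ≤ C) (h : ∀ v T, |b v T| ≤ C) (T : Fin (m + 3) → D) :
    |G.total b T| ≤ C := by
  obtain ⟨_ | v, -, hv⟩ := G.total_eq_or hb T <;> rw [hv]
  · simpa using hC
  · exact h _ _

lemma total_cocycle (hb : ∀ v T i j, i ≠ j → T i = T j → b v T = 0)
    (hc : ∀ v (T : Fin (m + 4) → D), (∀ i, G.pt (T i) = v) → dT (b v) T = 0)
    (T : Fin (m + 4) → D) : dT (G.total b) T = 0 := by
  simp only [dT, total, ← smul_eq_mul, smul_finsum]
  rw [← finsum_sum_comm]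
  · exact (finsum_congr fun v => hc v (fun i => G.gate v (T i)) fun i => (G.gate_spec v _).1).trans
      finsum_zero
  · intro i _
    obtain ⟨v, hv, -⟩ := G.total_eq_or hb fun j => T (i.succAbove j)
    refine (Set.Finite.subset (s := {u | u ∈ v}) ?_ fun u hu => ?_)
    · cases v <;> simp
    · by_contra h
      exact hu (by simp only [hv u h, smul_zero])

lemma total_of_pt_eq (hb : ∀ v T i j, i ≠ j → T i = T j → b v T = 0)
    {T : Fin (m + 3) → D} {v : V} (h : ∀ i, G.pt (T i) = v) : G.total b T = b v T := by
  refine (finsum_eq_single _ v fun u hu => hb _ _ 0 1 (by simp) ?_).trans ?_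
  · exact gate_eq_of_pt_eq ((h 0).trans (h 1).symm) (by rw [h 0]; exact hu.symm)
  · congr 1
    funext i
    rw [← h i, gate_eq_self]

lemma total_map {V' D' : Type} {G' : DoorTree V' D'} {b' : V' → (Fin (m + 3) → D') → ℝ} {eV : V → V'}
    {eD : D → D'} (hV : Bijective eV) (hD : Injective eD)
    (hpt : ∀ d, G'.pt (eD d) = eV (G.pt d)) (hopp : ∀ d, G'.opp (eD d) = eD (G.opp d))
    (h : ∀ v T, (∀ i, G.pt (T i) = v) → b' (eV v) (fun i => eD (T i)) = b v T) (T : Fin (m + 3) → D) :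
    G'.total b' (fun i => eD (T i)) = G.total b T := by
  refine (finsum_comp (g := fun v => b' v fun i => G'.gate v (eD (T i))) eV hV).symm.trans ?_
  exact finsum_congr fun v => by
    simp only [gate_map hD hpt hopp]
    exact h v _ fun i => (gate_spec v _).1

end Total

end DoorTree

section Doors

variable {Y : Type} [TopologicalSpace Y] {ι : C(Y, X)} {q : X}

lemma VCov.ext {t t' : VCov ι q} (h : t.1 = t'.1) (h' : t.toU = t'.toU) : t = t' := by
  obtain ⟨y, u⟩ := t
  obtain ⟨y', u'⟩ := t'
  obtain rfl : y = y' := h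
  exact Sigma.ext rfl (Sigma.ext_iff.1 h').2

lemma VRel.exists_rmul {t t' : VCov ι q} (h : VRel t t') :
    ∃ (y : Y) (s : PQ t.1 y), t' = t.rmul s := ⟨_, h.choose, h.choose_spec⟩

lemma VRel.trans {t t' t'' : VCov ι q} (h : VRel t t') (h' : VRel t' t'') : VRel t t'' := by
  obtain ⟨y, s, rfl⟩ := h.exists_rmul
  obtain ⟨y', s', rfl⟩ := h'.exists_rmul
  change PQ y y' at s'
  refine ⟨s.trans s', ?_⟩
  show (⟨_, (t.2.trans (s.map ι)).trans (s'.map ι)⟩ : VCov ι q) =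
    ⟨_, t.2.trans ((s.trans s').map ι)⟩
  rw [qmap_trans, PQ.trans_assoc]

lemma VRel.lmul {q' : X} {t t' : VCov ι q} (h : VRel t t') (g : PQ q' q) :
    VRel (t.lmul g) (t'.lmul g) := by
  obtain ⟨y, s, rfl⟩ := h.exists_rmul
  exact ⟨s, (VCov.lmul_rmul g t s).symm⟩

/-- Classes of paths ending in the subspace, up to paths of the subspace. -/
instance vsetoid (ι : C(Y, X)) (q : X) : Setoid (VCov ι q) :=
  ⟨VRel, VRel.refl, VRel.symm, VRel.trans⟩

lemma vrel_iff {t t' : VCov ι q} :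
    Quotient.mk (vsetoid ι q) t = Quotient.mk (vsetoid ι q) t' ↔ VRel t t' := Quotient.eq

/-- Precomposition with a path class. -/
def qlmul {q' : X} (g : PQ q' q) : Quotient (vsetoid ι q) → Quotient (vsetoid ι q') :=
  Quotient.map (VCov.lmul g) fun _ _ h => VRel.lmul h g

lemma qlmul_bijective {q' : X} (g : PQ q' q) : Bijective (qlmul (ι := ι) g) := by
  refine Function.bijective_iff_has_inverse.2 ⟨qlmul g.symm, ?_, ?_⟩
  · exact Quotient.ind fun v => congrArg (Quotient.mk _) (by simp only [VCov.lmul, PQ.symm_cancel])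
  · exact Quotient.ind fun v => congrArg (Quotient.mk _) (by simp only [VCov.lmul, PQ.cancel_symm])

lemma mk_cast_eq {a b : X} (h : b = a) (u : PQ q a) : (⟨b, u.cast rfl h⟩ : UCov q) = ⟨a, u⟩ := by
  subst h
  rw [PQ.cast_rfl_rfl]

lemma trans_mk_congr {a b a' b' : X} (hb : b' = b) {γ : Path a b} {γ' : Path a' b'}
    (h : ∀ t, γ' t = γ t) {u : PQ q a} {u' : PQ q a'} (hu : (⟨a', u'⟩ : UCov q) = ⟨a, u⟩) :
    (⟨b', u'.trans (.mk γ')⟩ : UCov q) = ⟨b, u.trans (.mk γ)⟩ := by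
  subst hb
  obtain ⟨rfl, hu⟩ := Sigma.mk.inj_iff.1 hu
  obtain rfl := eq_of_heq hu
  rw [Path.ext (funext h)]

/-- Transport of classes of paths along an equality. -/
def castI {a b : X} (h : b = a) : Into a ≃ Into b where
  toFun u := ⟨u.1, u.2.cast rfl h⟩
  invFun u := ⟨u.1, u.2.cast rfl h.symm⟩
  left_inv u := by subst h; simp
  right_inv u := by subst h; simp

lemma castI_intoEquiv {a b a' b' : X} (ha : a' = a) (hb : b' = b) {γ : Path a b} {γ' : Path a' b'}
    (h : ∀ t, γ' t = γ t) (u : Into a) :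
    castI hb (intoEquiv (.mk γ) u) = intoEquiv (.mk γ') (castI ha u) := by
  subst ha hb
  rw [Path.ext (funext h)]
  simp [castI]

end Doors

namespace Fold

variable {n : ℕ} {N M : Type} [TopologicalSpace N] [TopologicalSpace M] (F : Fold n N M) {x : M}

/-- Classes of paths ending at a boundary point. -/
abbrev Dr (x : M) := VCov (F.π.comp F.ι) x

/-- Forget that the end point lies in the boundary. -/
def drPt (t : F.Dr x) : VCov F.π x := ⟨t.1.1, t.2⟩

/-- Apply the involution to the end point. -/
def drOpp (t : F.Dr x) : F.Dr x := ⟨F.opp t.1, t.2.cast rfl (F.proj_opp t.1)⟩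

variable {F}

lemma drOpp_toU (t : F.Dr x) : (F.drOpp t).toU = t.toU := mk_cast_eq (F.proj_opp t.1) t.2

lemma drOpp_drOpp (t : F.Dr x) : F.drOpp (F.drOpp t) = t :=
  VCov.ext (F.opp_opp t.1) ((drOpp_toU _).trans (drOpp_toU t))

lemma drOpp_eq {t : F.Dr x} (h : F.opp t.1 = t.1) : F.drOpp t = t := VCov.ext h (drOpp_toU t)

lemma drOpp_lmul {x' : M} (g : PQ x' x) (t : F.Dr x) : F.drOpp (t.lmul g) = (F.drOpp t).lmul g :=
  VCov.ext rfl ((drOpp_toU _).trans ((congrArg (lmul g) (drOpp_toU t).symm)))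

lemma drPt_rel {t t' : F.Dr x} (h : VRel t t') : VRel (F.drPt t) (F.drPt t') := by
  obtain ⟨y, s, rfl⟩ := h.exists_rmul
  refine ⟨s.map F.ι, ?_⟩
  obtain ⟨σ, rfl⟩ := PQ.mk_surjective s
  rfl

lemma drOpp_rel {t t' : F.Dr x} (h : VRel t t') : VRel (F.drOpp t) (F.drOpp t') := by
  obtain ⟨y, s, rfl⟩ := h.exists_rmul
  refine ⟨s.map F.opp, VCov.ext rfl ((drOpp_toU _).trans ?_)⟩
  obtain ⟨σ, rfl⟩ := PQ.mk_surjective s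
  exact (trans_mk_congr (F.proj_opp _) (γ := σ.map (F.π.comp F.ι).continuous)
    (γ' := (σ.map F.opp.continuous).map (F.π.comp F.ι).continuous) (fun t => F.proj_opp _)
    (drOpp_toU t)).symm

lemma not_rel_drOpp {t : F.Dr x} (h : F.opp t.1 ≠ t.1) : ¬VRel (F.drOpp t) t := by
  rintro ⟨s, -⟩
  have h0 : Joined (F.opp t.1) t.1 := PQ.joined s
  have h1 : F.opp t.1 ∈ F.pos ↔ t.1 ∈ F.pos := ⟨F.pos_of_joined h0, F.pos_of_joined h0.symm⟩
  have := F.pos_opp h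
  tauto

/-- Every symmetric set of doors is the set of doors separating two complementary sets. -/
theorem exists_split (χ : F.Dr x → Prop) (hχ : ∀ {t t'}, VRel t t' → χ t → χ t')
    (hopp : ∀ t, χ t → χ (F.drOpp t)) :
    ∃ f : VCov F.π x → Prop, (∀ v v', VRel v v' → f v → f v') ∧ ∀ t : F.Dr x, F.opp t.1 ≠ t.1 →
      (f (F.drPt (F.drOpp t)) ↔ ¬(f (F.drPt t) ↔ χ t)) := by
  have hne : ∀ a : N, Nonempty (Into (F.π a) × Prop) := fun a => ⟨⟨_, .refl _⟩, False⟩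
  obtain ⟨Ω, hΩ, hsurj⟩ := exists_large fun a : N => Into (F.π a) × Prop
  let E : ∀ a : N, (Into (F.π a) × Prop) × Ω ≃ Ω := fun a =>
    (exists_prod_equiv _ (hsurj a).choose_spec).some
  let φ : ∀ {a b : N}, PQ a b → Equiv.Perm Ω := fun {a b} p => ((E a).symm.trans
    (((intoEquiv (p.map F.π)).prodCongr (.refl Prop)).prodCongr (.refl Ω))).trans (E b)
  have hφ : ∀ {a b : N} (p : PQ a b) u P ω, φ p (E a ((u, P), ω)) =
      E b ((intoEquiv (p.map F.π) u, P), ω) := fun p u P ω => by simp [φ]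
  let χ' : ∀ y : F.B, Into (F.π y) → Prop := fun y u => ∃ q : PQ x (F.π y), u = ⟨x, q⟩ ∧ χ ⟨y, q⟩
  have hχ' : ∀ {y z : F.B} (s : PQ y z) u, χ' y u → χ' z (intoEquiv ((s.map F.ι).map F.π) u) := by
    rintro y z s _ ⟨q, rfl, hq⟩
    refine ⟨q.trans ((s.map F.ι).map F.π), rfl, hχ ⟨s, ?_⟩ hq⟩
    obtain ⟨σ, rfl⟩ := PQ.mk_surjective s
    rfl
  have hP : ∀ P Q : Prop, (¬(¬(P ↔ Q) ↔ Q)) = P := fun P Q => propext (by tauto)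
  let T : ∀ y : F.B, Equiv.Perm Ω := fun y => ((E y).symm.trans (Equiv.prodCongr
    ⟨fun v => (castI (F.proj_opp y) v.1, ¬(v.2 ↔ χ' y v.1)),
      fun v => ((castI (F.proj_opp y)).symm v.1, ¬(v.2 ↔ χ' y ((castI (F.proj_opp y)).symm v.1))),
      fun v => Prod.ext (by simp) (by simp [hP]),
      fun v => Prod.ext (by simp) (by simp [hP])⟩ (.refl Ω))).trans (E (F.opp y))
  have hT : ∀ (y : F.B) u P ω, T y (E y ((u, P), ω)) =
      E (F.opp y) ((castI (F.proj_opp y) u, ¬(P ↔ χ' y u)), ω) := fun y u P ω => by simp [T]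
  obtain ⟨Φ, θ, hΦ, hΦφ, hθ⟩ := F.exists_gauged_descent @φ (fun {a b c} p q => by
      refine Equiv.ext fun ω => ?_
      obtain ⟨⟨⟨u, P⟩, ω⟩, rfl⟩ := (E a).surjective ω
      rw [Equiv.Perm.mul_apply, hφ, hφ, hφ, qmap_trans]
      simp only [intoEquiv, Equiv.coe_fn_mk, PQ.trans_assoc]) T (fun {y z} s _ _ => by
    refine Equiv.ext fun ω => ?_
    obtain ⟨⟨⟨u, P⟩, ω⟩, rfl⟩ := (E y).surjective ω
    rw [Equiv.Perm.mul_apply, Equiv.Perm.mul_apply, hT]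
    refine (congrArg (T z) (hφ (s.map F.ι) u P ω)).trans ((hT z _ _ _).trans (Eq.trans ?_
      (hφ ((s.map F.opp).map F.ι) _ _ _).symm))
    have h1 : χ' z (intoEquiv ((s.map F.ι).map F.π) u) ↔ χ' y u := by
      refine ⟨fun h => ?_, hχ' s u⟩
      have h2 := hχ' s.symm _ h
      simp only [qmap_symm] at h2
      rwa [show intoEquiv ((s.map F.ι).map F.π).symm (intoEquiv ((s.map F.ι).map F.π) u) = u from
        (intoEquiv ((s.map F.ι).map F.π)).symm_apply_apply u] at h2
    rw [h1]
    congr 3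
    obtain ⟨σ, rfl⟩ := PQ.mk_surjective s
    exact castI_intoEquiv (F.proj_opp y) (F.proj_opp z)
      (γ := (σ.map F.ι.continuous).map F.π.continuous)
      (γ' := ((σ.map F.opp.continuous).map F.ι.continuous).map F.π.continuous)
      (fun t => F.proj_opp _) u)
  obtain ⟨a₀, rfl⟩ := F.surj x
  let ω₀ : Ω := (θ a₀).symm (E a₀ ((⟨_, .refl _⟩, False), Classical.arbitrary Ω))
  let st : ∀ v : VCov F.π (F.π a₀), (Into (F.π v.1) × Prop) × Ω := fun v =>
    (E v.1).symm (θ v.1 (Φ v.2 ω₀))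
  have hst : ∀ v {b : N} (s : PQ v.1 b), st (v.rmul s) =
      ((intoEquiv (s.map F.π) (st v).1.1, (st v).1.2), (st v).2) := fun v b s => by
    show (E b).symm (θ b (Φ (v.2.trans (s.map F.π)) ω₀)) = _
    rw [Equiv.symm_apply_eq, hΦ, hΦφ, ← hφ]
    exact congrArg _ ((E v.1).apply_symm_apply _).symm
  have hsto : ∀ t : F.Dr (F.π a₀), t.1 ∈ F.pos → F.opp t.1 ≠ t.1 → st (F.drPt (F.drOpp t)) =
      ((castI (F.proj_opp t.1) (st (F.drPt t)).1.1,
        ¬((st (F.drPt t)).1.2 ↔ χ' t.1 (st (F.drPt t)).1.1)), (st (F.drPt t)).2) := by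
    intro t ht hne
    show (E (F.opp t.1)).symm (θ (F.opp t.1) (Φ (F.drOpp t).2 ω₀)) = _
    have h1 : Φ (F.drOpp t).2 ω₀ = Φ t.2 ω₀ :=
      congrArg (fun u : UCov (F.π a₀) => Φ u.2 ω₀) (drOpp_toU t)
    rw [Equiv.symm_apply_eq, hθ _ ht hne, h1, Equiv.Perm.mul_apply]
    exact (congrArg (T t.1) ((E t.1).apply_symm_apply _).symm).trans (hT t.1 _ _ _)
  have hgo : ∀ t : F.Dr (F.π a₀), t.1 ∈ F.pos → F.opp t.1 ≠ t.1 →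
      ((st (F.drPt (F.drOpp t))).1.1 = ⟨_, (F.drOpp t).2⟩ ↔ (st (F.drPt t)).1.1 = ⟨_, t.2⟩) := by
    intro t ht hne
    rw [hsto t ht hne]
    exact (castI (F.proj_opp t.1)).injective.eq_iff (b := ⟨_, t.2⟩)
  have hgood : ∀ v, (st v).1.1 = ⟨_, v.2⟩ := fun v => by
    induction F.reach ⟨a₀, .refl _⟩ v with
    | refl =>
      have h1 : θ a₀ (Φ ((PQ.refl a₀).map F.π) ω₀) = _ := hΦφ (.refl a₀) ω₀
      have h2 : st ⟨a₀, .refl _⟩ = (E a₀).symm (φ (.refl a₀) (θ a₀ ω₀)) := congrArg (E a₀).symm h1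
      rw [h2, Equiv.apply_symm_apply, hφ, Equiv.symm_apply_apply]
      show (⟨_, (PQ.refl _).trans (.refl _)⟩ : Into (F.π a₀)) = ⟨_, .refl _⟩
      rw [PQ.trans_refl]
    | @tail v w _ h ih =>
      rcases h with h | h
      · obtain ⟨y, s, rfl⟩ := h.exists_rmul
        rw [hst, ih]
        rfl
      · rcases F.eq_or (Sigma.ext_iff.1 h).1 with e | ⟨hv, e⟩
        · rwa [← VCov.ext e h]
        · let t : F.Dr (F.π a₀) := ⟨⟨v.1, hv⟩, v.2⟩
          obtain rfl : F.drPt (F.drOpp t) = w := VCov.ext e ((drOpp_toU t).trans h)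
          by_cases hne : F.opp t.1 = t.1
          · rw [drOpp_eq hne]
            exact ih
          · by_cases hp : t.1 ∈ F.pos
            · exact (hgo t hp hne).2 ih
            · have := hgo (F.drOpp t) ((F.pos_opp hne).2 hp) (by
                rw [show F.opp (F.drOpp t).1 = t.1 from F.opp_opp _]
                exact Ne.symm hne)
              rw [drOpp_drOpp] at this
              exact this.1 ih
  refine ⟨fun v => (st v).1.2, ?_, ?_⟩
  · intro v v' h hv
    obtain ⟨y, s, rfl⟩ := h.exists_rmul
    show (st (v.rmul s)).1.2
    rwa [hst]
  · have key : ∀ t : F.Dr (F.π a₀), t.1 ∈ F.pos → F.opp t.1 ≠ t.1 →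
        ((st (F.drPt (F.drOpp t))).1.2 ↔ ¬((st (F.drPt t)).1.2 ↔ χ t)) := fun t ht hne => by
      have h1 : χ' t.1 (st (F.drPt t)).1.1 ↔ χ t := by
        rw [hgood]
        refine ⟨fun ⟨q, hq, h⟩ => ?_, fun h => ⟨t.2, rfl, h⟩⟩
        obtain rfl : t.2 = q := eq_of_heq (Sigma.ext_iff.1 hq).2
        exact h
      rw [hsto t ht hne, h1]
    intro t hne
    by_cases hp : t.1 ∈ F.pos
    · exact key t hp hne
    · have h1 := key (F.drOpp t) ((F.pos_opp hne).2 hp) (by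
        rw [show F.opp (F.drOpp t).1 = t.1 from F.opp_opp _]
        exact Ne.symm hne)
      have h2 : χ (F.drOpp t) ↔ χ t := ⟨fun h => drOpp_drOpp t ▸ hopp _ h, hopp t⟩
      rw [drOpp_drOpp] at h1
      tauto

end Fold

namespace Fold

variable {n : ℕ} {N M : Type} [TopologicalSpace N] [TopologicalSpace M] {F : Fold n N M} {x : M}

/-- Vertices of the tree of the fold. -/
abbrev Vx (F : Fold n N M) (x : M) := Quotient (vsetoid F.π x)

/-- Doors of the tree of the fold. -/
abbrev Dx (F : Fold n N M) (x : M) := Quotient (vsetoid (F.π.comp F.ι) x)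

variable (F x) in
/-- The tree of the fold. -/
def tree : DoorTree (F.Vx x) (F.Dx x) where
  pt := Quotient.map F.drPt fun _ _ => drPt_rel
  opp := Quotient.map F.drOpp fun _ _ => drOpp_rel
  opp_opp := Quotient.ind fun t => congrArg _ (drOpp_drOpp t)
  conn := by
    refine Quotient.ind fun v => Quotient.ind fun v' => ?_
    induction F.reach v v' with
    | refl => exact .refl
    | @tail v w _ h ih =>
      rcases h with h | h
      · rwa [← Quotient.sound (s := vsetoid F.π x) h]
      · rcases F.eq_or (Sigma.ext_iff.1 h).1 with e | ⟨hv, e⟩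
        · rwa [← VCov.ext e h]
        · let t : F.Dr x := ⟨⟨v.1, hv⟩, v.2⟩
          obtain rfl : F.drPt (F.drOpp t) = w := VCov.ext e ((drOpp_toU t).trans h)
          by_cases hne : F.opp t.1 = t.1
          · rw [drOpp_eq hne]
            exact ih
          · exact ih.tail ⟨Quotient.mk _ t, fun e => not_rel_drOpp hne (Quotient.exact e), rfl, rfl⟩
  split := Quotient.ind fun d => by
    obtain ⟨f, hf, hf'⟩ := exists_split (fun t : F.Dr x => VRel t d ∨ VRel t (F.drOpp d))
      (fun h h' => h'.imp h.symm.trans h.symm.trans) fun t h => h.symm.imp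
        (fun h => drOpp_drOpp d ▸ drOpp_rel h) drOpp_rel
    refine ⟨Quotient.lift f fun v v' h => propext ⟨hf _ _ h, hf _ _ h.symm⟩, Quotient.ind fun t ht => ?_⟩
    refine (hf' t fun h => ht (congrArg _ (drOpp_eq h))).trans ?_
    exact not_congr (iff_congr Iff.rfl (or_congr vrel_iff.symm vrel_iff.symm))

/-- Prolongation by a class of paths of the manifold ending in its boundary. -/
def prol {a : N} (u : PQ x (F.π a)) (z : VCov F.ι a) : F.Dr x := ⟨z.1, u.trans (z.2.map F.π)⟩

lemma prol_lmul {a a' : N} (u : PQ x (F.π a)) (p : PQ a a') (z : VCov F.ι a') :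
    prol u (z.lmul p) = prol (u.trans (p.map F.π)) z := by
  simp only [prol, VCov.lmul, qmap_trans, PQ.trans_assoc]

lemma lmul_prol {x' : M} {a : N} (g : PQ x' x) (u : PQ x (F.π a)) (z : VCov F.ι a) :
    (prol u z).lmul g = prol (g.trans u) z := by
  simp only [prol, VCov.lmul, PQ.trans_assoc]

lemma exists_prol {a : N} {u : PQ x (F.π a)} {t : F.Dr x}
    (h : VRel (⟨a, u⟩ : VCov F.π x) (F.drPt t)) : ∃ z, prol u z = t := by
  obtain ⟨s, hs⟩ := h
  exact ⟨⟨t.1, s⟩, VCov.ext rfl (congrArg VCov.toU hs).symm⟩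

lemma Compat.rel_of_prol (hF : F.Compat) {a : N} {u : PQ x (F.π a)} {z z' : VCov F.ι a}
    (h : VRel (prol u z) (prol u z')) : VRel z z' := by
  obtain ⟨s, hs⟩ := h
  change PQ z.1 z'.1 at s
  refine ⟨s, Sigma.ext rfl (heq_of_eq (hF.injective (PQ.left_cancel u ?_)))⟩
  refine (eq_of_heq (Sigma.ext_iff.1 hs).2).trans ?_
  show (u.trans (z.2.map F.π)).trans (s.map (F.π.comp F.ι)) = u.trans ((z.2.trans (s.map F.ι)).map F.π)
  rw [qmap_trans, PQ.trans_assoc]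
  obtain ⟨σ, rfl⟩ := PQ.mk_surjective s
  rfl

variable {m : ℕ} {C : ℝ} {b : ∀ a : N, (Fin m → VCov F.ι a) → ℝ}

open Classical in
/-- The function on tuples of doors at a vertex. -/
def atv (b : ∀ a : N, (Fin m → VCov F.ι a) → ℝ) (v : F.Vx x) (T : Fin m → F.Dx x) : ℝ :=
  if h : ∃ z : Fin m → VCov F.ι v.out.1, ∀ i, Quotient.mk _ (prol v.out.2 (z i)) = T i then
    b _ h.choose else 0

lemma atv_mk (hF : F.Compat) (hb : Averaged F.ι m C b) {a : N} (u : PQ x (F.π a))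
    (z : Fin m → VCov F.ι a) :
    atv b (Quotient.mk _ ⟨a, u⟩ : F.Vx x) (fun i => Quotient.mk _ (prol u (z i))) = b a z := by
  have key : ∀ o : VCov F.π x, VRel o ⟨a, u⟩ → ∃ z' : Fin m → VCov F.ι o.1,
      (∀ i, prol o.2 (z' i) = prol u (z i)) ∧ b _ z' = b a z := fun o ho => by
    obtain ⟨a', p, h⟩ := ho.exists_rmul
    obtain ⟨rfl, h⟩ := Sigma.mk.inj_iff.1 h
    obtain rfl := eq_of_heq h
    exact ⟨fun i => (z i).lmul p, fun i => prol_lmul _ _ _, hb.left _ _ p z⟩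
  obtain ⟨z', hz', hbz⟩ := key _ (Quotient.mk_out (s := vsetoid F.π x) ⟨a, u⟩)
  have h : ∃ z'' : Fin m → VCov F.ι (Quotient.mk (vsetoid F.π x) ⟨a, u⟩).out.1, ∀ i,
      Quotient.mk (vsetoid (F.π.comp F.ι) x) (prol _ (z'' i)) = Quotient.mk _ (prol u (z i)) :=
    ⟨z', fun i => congrArg _ (hz' i)⟩
  rw [atv, dif_pos h, ← hbz]
  refine hb.right _ _ _ fun i => hF.rel_of_prol (vrel_iff.1 ((h.choose_spec i).trans ?_))
  rw [hz']

lemma exists_eq_prol {a : N} {u : PQ x (F.π a)} {T : Fin m → F.Dx x}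
    (h : ∀ i, (F.tree x).pt (T i) = Quotient.mk _ ⟨a, u⟩) :
    ∃ z : Fin m → VCov F.ι a, T = fun i => Quotient.mk _ (prol u (z i)) := by
  have h' : ∀ i, ∃ z, T i = Quotient.mk _ (prol u z) := fun i => by
    obtain ⟨t, ht⟩ := Quotient.mk_surjective (T i)
    have h1 := h i
    rw [← ht] at h1 ⊢
    obtain ⟨z, rfl⟩ := exists_prol (Quotient.exact h1).symm
    exact ⟨z, rfl⟩
  choose z hz using h'
  exact ⟨z, funext hz⟩

lemma pt_prol {a : N} (u : PQ x (F.π a)) (z : VCov F.ι a) :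
    (F.tree x).pt (Quotient.mk _ (prol u z)) = Quotient.mk _ ⟨a, u⟩ :=
  Quotient.sound (VRel.symm ⟨z.2, rfl⟩)

lemma atv_alt (hF : F.Compat) (hb : Averaged F.ι m C b) (v : F.Vx x) (T : Fin m → F.Dx x)
    (i j : Fin m) (hij : i ≠ j) (h : T i = T j) : atv b v T = 0 := by
  unfold atv
  split_ifs with hz
  · refine hb.alt _ _ i j hij (hF.rel_of_prol (u := v.out.2) (vrel_iff.1 ?_))
    exact (hz.choose_spec i).trans (h.trans (hz.choose_spec j).symm)
  · rfl

lemma atv_bound (hC : 0 ≤ C) (hb : Averaged F.ι m C b) (v : F.Vx x) (T : Fin m → F.Dx x) :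
    |atv b v T| ≤ C := by
  unfold atv
  split_ifs
  · exact hb.bound _ _
  · simpa

/-- Averaged cocycles of a manifold with boundary descend to compatible quotients. -/
theorem Compat.exists_combination {m : ℕ} (hF : F.Compat) (hC : 0 ≤ C)
    {b : ∀ a : N, (Fin (m + 3) → VCov F.ι a) → ℝ} (hb : Averaged F.ι (m + 3) C b)
    {c : ∀ a : N, VCov F.ι a} (hc : ∀ y : F.B, c (F.ι y) = ⟨y, .refl _⟩) :
    ∃ β : Cochain M (m + 2), BddBy C β ∧ Cocyc β ∧
      ∀ τ : SSimplex N (m + 2), β (sgl ℝ (F.π.comp τ)) = b _ fun i => typ c (edges τ i) := by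
  let cM : ∀ p : M, F.Dr p := fun p =>
    prol ((PQ.refl p).cast rfl (F.surj p).choose_spec) (c (F.surj p).choose)
  have hcM : ∀ {x : M} (a' : N) (u : PQ x (F.π a')), (cM (F.π a')).lmul u = prol u (c a') ∨
      (cM (F.π a')).lmul u = F.drOpp (prol u (c a')) := by
    intro x a' u
    have key : ∀ (a : N) (h : F.π a = F.π a'),
        (prol ((PQ.refl (F.π a')).cast rfl h) (c a)).lmul u = prol u (c a') ∨
        (prol ((PQ.refl (F.π a')).cast rfl h) (c a)).lmul u = F.drOpp (prol u (c a')) := by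
      intro a h
      rw [lmul_prol]
      have h0 : (⟨F.π a, u.trans ((PQ.refl (F.π a')).cast rfl h)⟩ : UCov x) = ⟨F.π a', u⟩ := by
        refine (congrArg (lmul u) (mk_cast_eq h (.refl _))).trans ?_
        exact Sigma.ext rfl (heq_of_eq (PQ.trans_refl u))
      rcases F.eq_or h with rfl | ⟨ha, rfl⟩
      · left
        exact congrArg (fun w => prol w (c a)) (eq_of_heq (Sigma.ext_iff.1 h0).2)
      · right
        have h1 : ∀ (y : F.B) (w : PQ x (F.π y)), prol w (c y) = ⟨y, w⟩ := fun y w =>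
          (congrArg (prol w) (hc y)).trans (Sigma.ext rfl (heq_of_eq (PQ.trans_refl w)))
        refine ((h1 ⟨a, ha⟩ _).trans (VCov.ext ?_ ?_)).trans (congrArg _ (h1 (F.opp ⟨a, ha⟩) u).symm)
        · exact (F.opp_opp _).symm
        · exact h0.trans (drOpp_toU (⟨F.opp ⟨a, ha⟩, u⟩ : F.Dr x)).symm
    exact key _ _
  let K : ∀ q : M, (Fin (m + 3) → UCov q) → ℝ := fun q t =>
    (F.tree q).total (atv b) fun i => Quotient.mk _ (typ cM (t i))
  have hK : LInv K := fun q q' g t => by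
    have h1 := DoorTree.total_map (G := F.tree q) (G' := F.tree q') (b := atv b) (b' := atv b)
      (qlmul_bijective g) (qlmul_bijective g).1 (Quotient.ind fun d => rfl)
      (Quotient.ind fun d => congrArg _ (drOpp_lmul g d)) ?_ fun i => Quotient.mk _ (typ cM (t i))
    · simp only [K, typ_lmul]
      exact h1
    · refine Quotient.ind fun ⟨a, u⟩ T hT => ?_
      obtain ⟨z, rfl⟩ := exists_eq_prol hT
      refine Eq.trans ?_ ((atv_mk hF hb (g.trans u) z).trans (atv_mk hF hb u z).symm)
      exact congrArg (atv b _) (funext fun i => congrArg _ (lmul_prol g u (z i)))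
  refine ⟨pull K, fun σ => ?_, fun z => ?_, fun τ => ?_⟩
  · rw [pull_sgl]
    exact DoorTree.abs_total_le (atv_alt hF hb) hC (atv_bound hC hb) _
  · apply chain_ext z
    intro σ
    refine (pull_bdry hK σ).trans (DoorTree.total_cocycle (atv_alt hF hb)
      (Quotient.ind fun ⟨a, u⟩ T hT => ?_) fun i => Quotient.mk _ (typ cM (edges σ i)))
    obtain ⟨z, rfl⟩ := exists_eq_prol hT
    refine Eq.trans ?_ (hb.cocycle a z)
    exact sum_congr rfl fun i _ => congrArg _ (atv_mk hF hb u fun j => z (i.succAbove j))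
  · rw [pull_sgl]
    let T : Fin (m + 3) → F.Dx (F.π (τ (vtx _ 0))) := fun i =>
      Quotient.mk _ (prol (.refl _) (typ c (edges τ i)))
    have hT : ∀ i, (F.tree _).pt (T i) = Quotient.mk _ ⟨_, .refl _⟩ := fun i => pt_prol _ _
    have h1 : K _ (edges (F.π.comp τ)) = (F.tree _).total (atv b) T := finsum_congr fun v =>
      congrArg (atv b v) (funext fun i => by
        have h2 : T i = Quotient.mk _ (prol ((ecl τ (vtx _ 0) (vtx _ i)).map F.π)
            (c (τ (vtx _ i)))) := by
          refine congrArg _ ((prol_lmul _ _ _).trans ?_)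
          rw [PQ.refl_trans]
          rfl
        rw [h2]
        rcases hcM (τ (vtx _ i)) ((ecl τ (vtx _ 0) (vtx _ i)).map F.π) with h | h
        · exact congrArg (fun t => DoorTree.gate v (Quotient.mk _ t)) h
        · exact (congrArg (fun t => DoorTree.gate v (Quotient.mk _ t)) h).trans
            (DoorTree.gate_opp (G := F.tree _) v (Quotient.mk _ (prol _ _))))
    rw [h1, DoorTree.total_of_pt_eq (atv_alt hF hb) hT]
    exact atv_mk hF hb _ _

end Fold

lemma mk_eq_refl_congr {a a' : X} (h : a' = a) {γ : Path a a} {γ' : Path a' a'}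
    (hγ : ∀ t, γ' t = γ t) (h1 : (.mk γ : PQ a a) = .refl a) : (.mk γ' : PQ a' a') = .refl a' := by
  subst h
  rwa [Path.ext (funext hγ)]

namespace GluingData

variable {k : ℕ} (D : GluingData k)

/-- The disjoint union of the boundaries of the pieces. -/
def B : Set D.Tot := {p | p.2 ∈ D.bdry p.1}

lemma proj_image_B : D.proj '' D.B = D.walls := by
  refine Set.Subset.antisymm ?_ fun x hx => ?_
  · rintro _ ⟨p, hp, rfl⟩
    exact D.emb_mem_walls_iff.2 hp
  · obtain ⟨j, y, hy, rfl⟩ := mem_iUnion.1 hx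
    exact ⟨⟨j, y⟩, hy, rfl⟩

lemma isTopMfdWithBdry_sigma {n : ℕ} (hmfd : ∀ j, IsTopMfdWithBdry n (D.piece j) (D.bdry j)) :
    IsTopMfdWithBdry n D.Tot D.B := by
  have := fun j => (hmfd j).1
  refine ⟨inferInstance, fun ⟨j, x⟩ => ?_⟩
  obtain ⟨U, V, e, hU, hV, hx, he⟩ := (hmfd j).2 x
  have hs : IsOpenEmbedding (Sigma.mk j : D.piece j → D.Tot) := .sigmaMk
  let f : U ≃ₜ (Sigma.mk j '' U : Set D.Tot) := hs.isEmbedding.homeomorphImage U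
  refine ⟨Sigma.mk j '' U, V, f.symm.trans e, hs.isOpenMap _ hU, hV, ⟨x, hx, rfl⟩, fun y => ?_⟩
  obtain ⟨y, rfl⟩ := f.surjective y
  simp only [Homeomorph.trans_apply, Homeomorph.symm_apply_apply]
  exact he y

/-- The inclusion of an end of a gluing. -/
def inc (a : D.End) : C(D.eS a, D.B) := ⟨fun s => ⟨⟨D.ej a, s⟩, D.eS_subset a s.2⟩, by fun_prop⟩

lemma isEmbedding_inc (a : D.End) : IsEmbedding (D.inc a) :=
  .of_comp (D.inc a).continuous continuous_subtype_val
    (IsEmbedding.sigmaMk.comp IsEmbedding.subtypeVal)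

lemma inc_unique {a b : D.End} {s : D.eS a} {t : D.eS b} (h : D.inc a s = D.inc b t) : a = b :=
  D.end_unique s.2 t.2 (congrArg Subtype.val h)

lemma exists_lift_path {y z : D.B} (γ : Path y z) : ∃ (j : Fin k) (g : C(I01, D.piece j)),
    ∀ t, (γ t).1 = ⟨j, g t⟩ := by
  obtain ⟨j, g, h⟩ := ((⟨_, continuous_subtype_val⟩ : C(D.B, _)).comp γ.toContinuousMap).exists_lift_sigma
  exact ⟨j, g, fun t => DFunLike.congr_fun h t⟩

lemma exists_lift_component {j : Fin k} {s : D.piece j} (hs : s ∈ D.bdry j) {z : D.B}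
    (γ : Path (⟨⟨j, s⟩, hs⟩ : D.B) z) : ∃ g : C(I01, D.piece j),
      (∀ t, (γ t).1 = ⟨j, g t⟩) ∧ ∀ t, g t ∈ connectedComponentIn (D.bdry j) s := by
  obtain ⟨i, g, hg⟩ := D.exists_lift_path γ
  have h0 := hg 0
  rw [γ.source] at h0
  obtain ⟨rfl, h0⟩ := Sigma.mk.inj_iff.1 h0
  obtain rfl := eq_of_heq h0
  refine ⟨g, hg, fun t => ?_⟩
  refine (isPreconnected_range g.continuous).subset_connectedComponentIn ⟨0, rfl⟩ ?_ ⟨t, rfl⟩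
  rintro _ ⟨t, rfl⟩
  have h1 := (γ t).2
  rwa [hg t] at h1

lemma exists_lift_end {a : D.End} {s : D.eS a} {z : D.B} (γ : Path (D.inc a s) z) :
    ∃ t : D.eS a, D.inc a t = z ∧ ∃ δ : Path s t, ∀ r, D.inc a (δ r) = γ r := by
  obtain ⟨g, hg, hc⟩ := D.exists_lift_component (D.eS_subset a s.2) γ
  rw [← D.eS_eq a s.2] at hc
  have h : ∀ r, D.inc a ⟨g r, hc r⟩ = γ r := fun r => Subtype.ext (hg r).symm
  refine ⟨⟨g 1, hc 1⟩, (h 1).trans γ.target, ⟨⟨fun r => ⟨g r, hc r⟩, by fun_prop⟩, ?_, rfl⟩, h⟩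
  exact (D.isEmbedding_inc a).injective ((h 0).trans γ.source)

lemma exists_inc_of_joined {a : D.End} {y z : D.B} (h : Joined y z) :
    (∃ s, D.inc a s = y) ↔ ∃ s, D.inc a s = z := by
  have key : ∀ {y z : D.B}, Joined y z → (∃ s, D.inc a s = y) → ∃ s, D.inc a s = z := by
    rintro _ z ⟨γ⟩ ⟨s, rfl⟩
    obtain ⟨t, ht, -⟩ := D.exists_lift_end γ
    exact ⟨t, ht⟩
  exact ⟨key h, key h.symm⟩

open Classical in
/-- The involution of the boundary defined by the gluings. -/
def opp (y : D.B) : D.B := if h : ∃ (a : D.End) (s : D.eS a), D.inc a s = y then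
    D.inc h.choose.swap (D.eglue h.choose h.choose_spec.choose) else y

lemma opp_inc (a : D.End) (s : D.eS a) : D.opp (D.inc a s) = D.inc a.swap (D.eglue a s) := by
  have h : ∃ (b : D.End) (t : D.eS b), D.inc b t = D.inc a s := ⟨a, s, rfl⟩
  rw [opp, dif_pos h]
  have key : ∀ (b : D.End) (t : D.eS b), D.inc b t = D.inc a s →
      D.inc b.swap (D.eglue b t) = D.inc a.swap (D.eglue a s) := fun b t e => by
    obtain rfl := D.inc_unique e
    rw [(D.isEmbedding_inc b).injective e]
  exact key _ _ h.choose_spec.choose_spec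

lemma opp_of_not {y : D.B} (h : ∀ a s, D.inc a s ≠ y) : D.opp y = y :=
  dif_neg fun ⟨a, s, e⟩ => h a s e

lemma opp_inc_ne (a : D.End) (s : D.eS a) : D.opp (D.inc a s) ≠ D.inc a s := fun h => by
  rw [opp_inc] at h
  have := D.inc_unique h
  cases a <;> cases this

lemma exists_inc_of_opp_ne {y : D.B} (h : D.opp y ≠ y) : ∃ a s, D.inc a s = y := by
  by_contra hn
  push Not at hn
  exact h (D.opp_of_not hn)

lemma opp_opp (y : D.B) : D.opp (D.opp y) = y := by
  by_cases h : D.opp y = y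
  · rw [h, h]
  · obtain ⟨a, s, rfl⟩ := D.exists_inc_of_opp_ne h
    rw [opp_inc, opp_inc]
    exact Subtype.ext (D.eglue_eglue a s)

/-- The boundary points which are not on a target of a gluing. -/
def pos : Set D.B := {y | ∀ e s, D.inc (.inr e) s ≠ y}

lemma pos_opp {y : D.B} (h : D.opp y ≠ y) : D.opp y ∈ D.pos ↔ y ∉ D.pos := by
  obtain ⟨a, s, rfl⟩ := D.exists_inc_of_opp_ne h
  have hl : ∀ e s, D.inc (.inl e) s ∈ D.pos := fun e s e' s' h => by cases D.inc_unique h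
  have hr : ∀ e s, D.inc (.inr e) s ∉ D.pos := fun e s h => h e s rfl
  rw [opp_inc]
  cases a with
  | inl e => exact iff_of_false (hr _ _) (not_not.2 (hl _ _))
  | inr e => exact iff_of_true (hl _ _) (hr _ _)

lemma isOpen_of_joined {n : ℕ} (hmfd : D.Mfd n)
    {U : Set D.B} (hU : ∀ y z, Joined y z → y ∈ U → z ∈ U) : IsOpen U :=
  isOpen_iff_mem_nhds.2 fun y hy => by
    obtain ⟨C, hC, hyC, -, hg⟩ := exists_good_nhd (D.isTopMfdWithBdry_sigma hmfd) y.1 Filter.univ_mem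
    filter_upwards [(hC.preimage continuous_subtype_val).mem_nhds hyC] with z hz
    obtain ⟨γ, -⟩ := hg.exists_bdry_path y z hyC hz
    exact hU y z ⟨γ⟩ hy

lemma continuous_opp {n : ℕ} (hmfd : D.Mfd n) : Continuous D.opp := by
  refine continuous_iff_continuousAt.2 fun y => ?_
  by_cases h : ∃ a s, D.inc a s = y
  · obtain ⟨a, s, rfl⟩ := h
    have ho : IsOpen (range (D.inc a)) :=
      D.isOpen_of_joined hmfd fun y z h => (D.exists_inc_of_joined h).1
    have he : IsOpenEmbedding (D.inc a) := ⟨D.isEmbedding_inc a, ho⟩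
    rw [← he.continuousAt_iff]
    exact (((D.inc a.swap).continuous.comp (D.eglue a).continuous).congr
      fun s => (D.opp_inc a s).symm).continuousAt
  · have ho : IsOpen {y | ¬∃ a s, D.inc a s = y} := D.isOpen_of_joined hmfd fun y z h hy ⟨a, hz⟩ =>
      hy ⟨a, (D.exists_inc_of_joined h).2 hz⟩
    refine continuousAt_id.congr ?_
    filter_upwards [ho.mem_nhds h] with z hz
    push Not at hz
    exact (D.opp_of_not hz).symm

lemma proj_opp (y : D.B) : D.proj (D.opp y) = D.proj y := by
  by_cases h : D.opp y = y
  · rw [h]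
  · obtain ⟨a, s, rfl⟩ := D.exists_inc_of_opp_ne h
    rw [opp_inc]
    exact D.emb_eglue a s

lemma proj_eq {p q : D.Tot} (h : D.proj p = D.proj q) :
    p = q ∨ ∃ h : p ∈ D.B, (D.opp ⟨p, h⟩ : D.Tot) = q := by
  rcases (D.mk_eq_iff (p := p) (q := q)).1 h with h | ⟨a, s, rfl, rfl⟩
  · exact Or.inl h
  · exact Or.inr ⟨D.eS_subset a s.2, congrArg Subtype.val (D.opp_inc a s)⟩

lemma exists_sec {n : ℕ} [T2Space D.Glued] (hcomp : D.Cpt) (hmfd : D.Mfd n) :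
    ∃ f : C(D.proj '' D.B, D.B), ∀ x, D.proj (f x) = x := by
  have hcl : IsClosed D.pos := isOpen_compl_iff.1 (D.isOpen_of_joined hmfd fun y z h hy hz =>
    hy fun e s hs => by
      obtain ⟨t, ht⟩ := (D.exists_inc_of_joined h).1 ⟨s, hs⟩
      exact hz e t ht)
  have : CompactSpace D.B := isCompact_iff_compactSpace.1
    (isClosed_mfdBdry (D.isTopMfdWithBdry_sigma hmfd)).isCompact
  have : CompactSpace D.pos := isCompact_iff_compactSpace.1 hcl.isCompact
  let f : D.pos → D.proj '' D.B := fun y => ⟨D.proj y.1, y.1, y.1.2, rfl⟩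
  have hf : Continuous f := by fun_prop
  have hbij : Bijective f := by
    refine ⟨fun y z h => ?_, ?_⟩
    · rcases D.proj_eq (congrArg Subtype.val h) with h | ⟨_, h'⟩
      · exact Subtype.ext (Subtype.ext h)
      · have h : D.opp y = z := Subtype.ext h'
        by_cases hy : D.opp y.1 = y
        · exact Subtype.ext (hy.symm.trans h)
        · exact absurd y.2 ((D.pos_opp hy).1 (h ▸ z.2))
    · rintro ⟨_, y, hy, rfl⟩
      by_cases h : (⟨y, hy⟩ : D.B) ∈ D.pos
      · exact ⟨⟨_, h⟩, rfl⟩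
      · have hne : D.opp ⟨y, hy⟩ ≠ ⟨y, hy⟩ := fun e => h fun e' s hs =>
          D.opp_inc_ne (.inr e') s (hs ▸ e)
        exact ⟨⟨_, (D.pos_opp hne).2 h⟩, Subtype.ext (D.proj_opp ⟨y, hy⟩)⟩
  let g := hf.homeoOfEquivCompactToT2 (f := Equiv.ofBijective f hbij)
  exact ⟨⟨fun x => (g.symm x).1, by fun_prop⟩, fun x => congrArg Subtype.val (g.apply_symm_apply x)⟩

/-- The fold defined by a gluing. -/
def fold {n : ℕ} (hcomp : D.Cpt) (hmfd : D.Mfd n)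
    (hg : IsTopMfdWithBdry (n + 1) D.Glued D.gluedBdry) : Fold n D.Tot D.Glued :=
  have := hg.1
  { π := D.proj
    B := D.B
    opp := ⟨D.opp, D.continuous_opp hmfd⟩
    opp_opp := D.opp_opp
    proj_opp := D.proj_opp
    eq_or := D.proj_eq
    opp_eq := fun h hy => D.opp_of_not fun a s hs => by
      obtain ⟨t, rfl⟩ := (D.exists_inc_of_joined h).2 ⟨s, hs⟩
      exact D.opp_inc_ne a t hy
    pos := D.pos
    pos_of_joined := fun h hy e s hs => by
      obtain ⟨t, ht⟩ := (D.exists_inc_of_joined h).2 ⟨s, hs⟩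
      exact hy e t ht
    pos_opp := D.pos_opp
    surj := D.proj_surjective
    closed := D.proj.continuous.isClosedMap
    mfd := D.isTopMfdWithBdry_sigma hmfd
    mfd' := ⟨_, hg⟩ }

variable {D}

lemma Compatible.eglue (h : D.Compatible) {a : D.End} {t : D.eS a} (δ : PQ t t)
    (hδ : δ.map (subIncl (D.eS a)) = .refl _) :
    (δ.map (D.eglue a : C(D.eS a, D.eS a.swap))).map (subIncl (D.eS a.swap)) = .refl _ := by
  cases a with
  | inl e =>
    have h1 := (h e t).le (Subgroup.mem_map.2 ⟨(δ : FundamentalGroup (D.S₁ e) t), hδ, rfl⟩)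
    exact h1
  | inr e =>
    obtain ⟨s, rfl⟩ := (D.glue e).surjective t
    obtain ⟨δ', h1, h2⟩ := (h e s).ge (x := (δ : FundamentalGroup (D.S₂ e) _)) hδ
    obtain ⟨γ, rfl⟩ := PQ.mk_surjective δ'
    subst h2
    exact mk_eq_refl_congr (γ := γ.map continuous_subtype_val) (by exact congrArg Subtype.val ((D.glue e).symm_apply_apply s))
      (fun r => congrArg Subtype.val ((D.glue e).symm_apply_apply (γ r))) h1

lemma map_sigma_injective {j : Fin k} {s : D.piece j} {γ : Path s s}
    (h : (.mk (γ.map continuous_sigmaMk) : PQ (⟨j, s⟩ : D.Tot) _) = .refl _) :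
    (.mk γ : PQ s s) = .refl s := by
  classical
  let r : C(D.Tot, D.piece j) := ⟨fun p => if h : p.1 = j then h ▸ p.2 else s, by
    refine continuous_sigma fun i => ?_
    by_cases h : i = j
    · subst h
      simpa using continuous_id'
    · simpa [h] using continuous_const⟩
  have hr : ∀ x, r ⟨j, x⟩ = x := fun x => by simp [r]
  exact mk_eq_refl_congr (γ := (γ.map continuous_sigmaMk).map r.continuous) (hr s).symm
    (fun t => (hr _).symm) (congrArg (fun p => PQ.map p r) h)

lemma Compatible.compat {n : ℕ} (h : D.Compatible) (hcomp : D.Cpt) (hmfd : D.Mfd n)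
    (hg : IsTopMfdWithBdry (n + 1) D.Glued D.gluedBdry) : (D.fold hcomp hmfd hg).Compat := by
  let F := D.fold hcomp hmfd hg
  intro (y : F.B) (z : F.B) s s' hs
  have key : ∀ g : PQ y y, g.map F.ι = .refl _ → (g.map F.opp).map F.ι = .refl _ := by
    intro g hg
    obtain ⟨γ, rfl⟩ := PQ.mk_surjective g
    by_cases hy : F.opp y = y
    · refine mk_eq_refl_congr (γ := γ.map continuous_subtype_val) (congrArg Subtype.val hy)
        (fun t => congrArg Subtype.val ?_) hg
      exact F.opp_eq (y := y) ⟨(γ.subpath 0 t).cast γ.source.symm rfl⟩ hy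
    · obtain ⟨a, t, rfl⟩ := D.exists_inc_of_opp_ne hy
      obtain ⟨t', ht', δ, hδ⟩ := D.exists_lift_end γ
      obtain rfl := (D.isEmbedding_inc a).injective ht'
      have h1 : (.mk δ : PQ t' t').map (subIncl (D.eS a)) = .refl _ :=
        map_sigma_injective (γ := δ.map continuous_subtype_val)
          (mk_eq_refl_congr (γ := γ.map continuous_subtype_val) rfl (fun r => congrArg Subtype.val (hδ r)) hg)
      have h2 := congrArg (fun p => PQ.map p
        (⟨_, continuous_sigmaMk⟩ : C(D.piece (D.ej a.swap), D.Tot))) (h.eglue _ h1)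
      refine mk_eq_refl_congr (γ := ((δ.map (D.eglue a).continuous).map
        continuous_subtype_val).map continuous_sigmaMk) (congrArg Subtype.val (D.opp_inc a t'))
        (fun r => ?_) h2
      exact congrArg Subtype.val ((congrArg D.opp (hδ r)).symm.trans (D.opp_inc a (δ r)))
  have h1 := key (s.trans s'.symm) (by rw [qmap_trans, Fold.qmap_symm, hs, PQ.trans_symm])
  rw [qmap_trans, qmap_trans, Fold.qmap_symm, Fold.qmap_symm] at h1
  rw [← PQ.cancel_right' ((s.map F.opp).map F.ι) ((s'.map F.opp).map F.ι), h1, PQ.refl_trans]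

variable (D) in
lemma isAmenable_B (h : ∀ j, AmenableComponents (D.bdry j)) (y : D.B) :
    IsAmenable (FundamentalGroup D.B y) := by
  obtain ⟨⟨j, s⟩, hs⟩ := y
  change s ∈ D.bdry j at hs
  let f : C(connectedComponent (⟨s, hs⟩ : D.bdry j), D.B) := ⟨fun x => ⟨⟨j, x.1.1⟩, x.1.2⟩, by fun_prop⟩
  refine (h j ⟨s, hs⟩).of_surjective (pi1Map f ⟨⟨s, hs⟩, mem_connectedComponent⟩) fun g => ?_
  obtain ⟨γ, rfl⟩ := PQ.mk_surjective g
  obtain ⟨g, hg, hc⟩ := D.exists_lift_component hs γ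
  have hc' : ∀ t, ∃ h : g t ∈ D.bdry j, ⟨g t, h⟩ ∈ connectedComponent (⟨s, hs⟩ : D.bdry j) := fun t => by
    have := hc t
    rw [connectedComponentIn_eq_image hs] at this
    obtain ⟨x, hx, e⟩ := this
    exact ⟨e ▸ x.2, by simpa [← e] using hx⟩
  have e : ∀ t, f ⟨⟨g t, (hc' t).choose⟩, (hc' t).choose_spec⟩ = γ t := fun t => Subtype.ext (hg t).symm
  have hinj : ∀ t x, γ t = f x → (⟨⟨g t, (hc' t).choose⟩, (hc' t).choose_spec⟩ : connectedComponent _) = x := by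
    intro t x hx
    rw [← e t] at hx
    refine Subtype.ext (Subtype.ext ?_)
    exact sigma_mk_injective (congrArg Subtype.val hx)
  refine ⟨.mk ⟨⟨fun t => ⟨⟨g t, (hc' t).choose⟩, (hc' t).choose_spec⟩, by fun_prop⟩, hinj 0 _ γ.source,
    hinj 1 _ γ.target⟩, ?_⟩
  exact congrArg PQ.mk (Path.ext (funext e))

end GluingData

/-! ### Duality -/

section Duality

variable {n : ℕ}

lemma l1_eq_sum {c : SChain ℝ X n} {s : Finset (SSimplex X n)}
    (h : ((chainEquiv ℝ X n).symm c).support ⊆ s) : l1 c = ∑ σ ∈ s, |(chainEquiv ℝ X n).symm c σ| :=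
  Finsupp.sum_of_support_subset _ h _ fun _ _ => abs_zero

lemma l1_add_le (c c' : SChain ℝ X n) : l1 (c + c') ≤ l1 c + l1 c' := by
  classical
  let f := (chainEquiv ℝ X n).symm
  rw [l1_eq_sum (s := (f c).support ∪ (f c').support) (by rw [map_add]; exact Finsupp.support_add),
    l1_eq_sum (c := c) Finset.subset_union_left, l1_eq_sum (c := c') Finset.subset_union_right,
    ← sum_add_distrib]
  exact sum_le_sum fun σ _ => by rw [map_add]; exact abs_add_le _ _

lemma l1_smul {a : ℝ} (ha : 0 < a) (c : SChain ℝ X n) : l1 (a • c) = a * l1 c := by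
  rw [l1_eq_sum (s := ((chainEquiv ℝ X n).symm c).support)
    (by rw [map_smul]; exact Finsupp.support_smul), l1, Finsupp.sum, mul_sum]
  exact sum_congr rfl fun σ _ => by
    rw [map_smul, Finsupp.smul_apply, smul_eq_mul, abs_mul, abs_of_pos ha]

lemma l1_nonneg (c : SChain ℝ X n) : 0 ≤ l1 c := Finset.sum_nonneg fun _ _ => abs_nonneg _

variable {Y : Set X}

lemma l1HomNorm_le (c : relCycles ℝ X Y n) : l1HomNorm (relHomClass c) ≤ l1 c.1 :=
  csInf_le ⟨0, by rintro _ ⟨c, -, rfl⟩; exact l1_nonneg _⟩ ⟨c, rfl, rfl⟩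

lemma apply_le_l1HomNorm {β : Cochain X (n + 1)} (hβ : Cocyc β) (h1 : BddBy 1 β)
    (hY : ∀ c ∈ chainsIn ℝ X Y (n + 1), β c = 0) (c : relCycles ℝ X Y n) :
    β c ≤ l1HomNorm (relHomClass c) := by
  refine le_csInf ⟨_, c, rfl, rfl⟩ ?_
  rintro _ ⟨c', hc', rfl⟩
  rw [← eq_of_relHomClass_eq hβ hY hc']
  exact (le_abs_self _).trans ((abs_le_l1 h1 _).trans (one_mul _).le)

lemma exists_dual (z : relCycles ℝ X Y n) : ∃ β : Cochain X (n + 1), Cocyc β ∧ BddBy 1 β ∧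
    (∀ c ∈ chainsIn ℝ X Y (n + 1), β c = 0) ∧ β z = l1HomNorm (relHomClass z) := by
  have hcl : ∀ r ∈ relBdries ℝ X Y n, l1HomNorm (relHomClass z) ≤ l1 (z.1 + r) := fun r hr => by
    have e : relHomClass ⟨z.1 + r, add_mem z.2 (relBdries_le_relCycles Y n hr)⟩ =
        relHomClass z := (Submodule.Quotient.eq _).2 (by simpa using hr)
    rw [← e]
    exact l1HomNorm_le _
  have h0 : 0 ≤ l1HomNorm (relHomClass z) := Real.sInf_nonneg (by
    rintro _ ⟨c, -, rfl⟩
    exact l1_nonneg _)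
  by_cases hz : z.1 ∈ relBdries ℝ X Y n
  · have := hcl (-z.1) (neg_mem hz)
    rw [add_neg_cancel, show l1 (0 : SChain ℝ X (n + 1)) = 0 by simp [l1]] at this
    exact ⟨0, fun _ => rfl, fun σ => by simp, fun _ _ => rfl, h0.antisymm this⟩
  · let f₀ : SChain ℝ X (n + 1) →ₗ.[ℝ] ℝ := ⟨relBdries ℝ X Y n, 0⟩
    let f := f₀.supSpanSingleton z.1 (l1HomNorm (relHomClass z)) hz
    obtain ⟨g, hg, hgl⟩ := exists_extension_of_le_sublinear f l1 (fun a ha c => l1_smul ha c)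
      l1_add_le (fun ⟨x, hx⟩ => by
        obtain ⟨r, hr, w, hw, rfl⟩ := mem_sup.1 hx
        obtain ⟨a, rfl⟩ := Submodule.mem_span_singleton.1 hw
        refine (LinearPMap.supSpanSingleton_apply_mk f₀ _ _ hz r hr a).trans_le ?_
        rw [show f₀ ⟨r, hr⟩ = 0 from rfl, zero_add]
        show a * _ ≤ l1 (r + a • z.1)
        rcases le_or_gt a 0 with ha | ha
        · exact (mul_nonpos_of_nonpos_of_nonneg ha h0).trans (l1_nonneg _)
        · have e : r + a • z.1 = a • (z.1 + a⁻¹ • r) := by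
            rw [smul_add, smul_inv_smul₀ ha.ne', add_comm r]
          rw [e, l1_smul ha]
          exact mul_le_mul_of_nonneg_left (hcl _ (Submodule.smul_mem _ _ hr)) ha.le)
    have hgr : ∀ r ∈ relBdries ℝ X Y n, g r = 0 := fun r hr =>
      (hg ⟨r, mem_sup_left hr⟩).trans (LinearPMap.supSpanSingleton_apply_mk_of_mem f₀ _ hz hr)
    have hs : ∀ (σ : SSimplex X (n + 1)) (a : ℝ), l1 (a • sgl ℝ σ) = |a| := fun σ a => by
      simp [l1, sgl, Finsupp.sum_single_index]
    refine ⟨g, fun c => hgr _ (bdry_mem_relBdries c), fun σ => abs_le.2 ⟨?_, ?_⟩, fun c hc =>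
      hgr _ (mem_relBdries_of_chainsIn hc), ?_⟩
    · have := hgl ((-1 : ℝ) • sgl ℝ σ)
      rw [hs, map_smul] at this
      simp at this
      linarith
    · have := hgl ((1 : ℝ) • sgl ℝ σ)
      rw [hs, map_smul] at this
      simpa using this
    · exact (hg ⟨z.1, mem_sup_right (Submodule.mem_span_singleton_self _)⟩).trans
        (LinearPMap.supSpanSingleton_apply_self f₀ _ hz)

end Duality

/-- Relative cocycles can be averaged over an amenable subspace without changing their values on
relative cycles. -/
lemma exists_rel_averaged {n : ℕ} {S Y : Set X} (hS : ∀ y : S, IsAmenable (FundamentalGroup S y))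
    (hY : ∀ y : Y, IsAmenable (FundamentalGroup Y y)) (hYS : Y ⊆ S) (hj : ∀ p : X, ∃ y : S, Joined p y)
    {β : Cochain X (n + 2)} (hβ : Cocyc β) (h1 : BddBy 1 β)
    (h0 : ∀ c ∈ chainsIn ℝ X Y (n + 2), β c = 0) :
    ∃ (β' : Cochain X (n + 2)) (c : ∀ p, VCov (subIncl S) p)
      (b : ∀ q, (Fin (n + 3) → VCov (subIncl S) q) → ℝ), Averaged (subIncl S) (n + 3) 1 b ∧
      (∀ y, c (subIncl S y) = ⟨y, .refl _⟩) ∧ Cocyc β' ∧ BddBy 1 β' ∧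
      (∀ σ, β' (sgl ℝ σ) = b _ fun i => typ c (edges σ i)) ∧
      (∀ w ∈ chainsIn ℝ X S (n + 2), β' w = 0) ∧ ∀ z : relCycles ℝ X Y (n + 1), β' z = β z := by
  classical
  let c : ∀ p, VCov (subIncl S) p := fun p =>
    if h : p ∈ S then ⟨⟨p, h⟩, .refl p⟩ else ⟨(hj p).choose, .mk (hj p).choose_spec.somePath⟩
  have hc : ∀ y, c (subIncl S y) = ⟨y, .refl _⟩ := fun y => dif_pos y.2
  obtain ⟨b, hb, η, B, hη, hbc⟩ := exists_averaged hS c hβ h1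
  have hv : ∀ w ∈ chainsIn ℝ X S (n + 2), (β + η.comp (bdry ℝ X (n + 1))) w = 0 := fun w hw => by
    refine (mem_bot ℝ).1 (map_mem_of_chainsIn _ ⊥ (fun σ hσ => ?_) hw)
    rw [hbc, mem_bot]
    exact hb.typ_eq_zero hc ⟨fun x => ⟨σ x, hσ ⟨x, rfl⟩⟩, by fun_prop⟩
  refine ⟨_, c, b, hb, hc, hβ.add_comp_bdry η, fun σ => (hbc σ).symm ▸ hb.bound _ _, hbc, hv,
    fun z => ?_⟩
  have h2 : η (bdry ℝ X (n + 1) z) = 0 := apply_cycle_eq_zero_of_amenable hY hη (fun w hw => by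
    have := hv w (chainsIn_mono hYS _ hw)
    rwa [ladd, h0 w hw, zero_add] at this) z.2 (bdry_bdry _)
  rw [ladd, comp_apply, h2, add_zero]

namespace GluingData

variable {k d : ℕ} (D : GluingData k)

lemma exists_joined_B (hconn : D.Conn) (hmfd : D.Mfd d) (hne : ∀ j, (D.bdry j).Nonempty)
    (p : D.Tot) : ∃ y : D.B, Joined p y := by
  obtain ⟨j, x⟩ := p
  obtain ⟨s, hs⟩ := hne j
  have hop : ∀ P : Prop, IsOpen {y | Joined y s ↔ P} := fun P => isOpen_iff_mem_nhds.2 fun y hy => by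
    obtain ⟨C, hC, hyC, -, hg⟩ := exists_good_nhd (hmfd j) y Filter.univ_mem
    filter_upwards [hC.mem_nhds hyC] with z hz
    obtain ⟨γ, -⟩ := hg.exists_path hyC hz
    exact ⟨fun h => hy.1 (Joined.trans ⟨γ⟩ h), fun h => Joined.trans ⟨γ.symm⟩ (hy.2 h)⟩
  have hcl : IsClopen {y | Joined y s} :=
    ⟨⟨by simpa only [iff_false] using! hop False⟩, by simpa using! hop True⟩
  have := hconn j
  obtain ⟨γ⟩ : Joined x s := (hcl.eq_univ ⟨s, Joined.refl s⟩).ge trivial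
  exact ⟨⟨⟨j, s⟩, hs⟩, ⟨γ.map continuous_sigmaMk⟩⟩

lemma nonempty_bdry (hcomp : D.Cpt) (hconn : D.Conn)
    [T2Space D.Glued] [ConnectedSpace D.Glued] (y : D.B) (j : Fin k) : (D.bdry j).Nonempty := by
  by_contra hj
  have hj : ∀ x, x ∉ D.bdry j := fun x hx => hj ⟨x, hx⟩
  have hcl : IsClopen (range (D.emb j)) := by
    refine ⟨(isCompact_range (D.emb j).continuous).isClosed, D.isOpen_iff_preimage.2 fun i => ?_⟩
    by_cases hi : i = j
    · subst hi
      rw [Set.preimage_range]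
      exact isOpen_univ
    · convert isOpen_empty
      refine Set.eq_empty_of_forall_notMem fun x ⟨x', h⟩ => hi ?_
      exact congrArg Sigma.fst (D.eq_of_emb_eq (hj x') h.symm)
  have := hconn j
  obtain ⟨x, hx⟩ := (hcl.eq_univ (Set.range_nonempty _)).ge (Set.mem_univ (D.proj y))
  have := D.eq_of_emb_eq (hj x) hx.symm
  obtain ⟨⟨i, s⟩, hs⟩ := y
  obtain ⟨rfl, -⟩ := Sigma.mk.inj_iff.1 this
  exact hj s hs

lemma proj_mem_gluedSet_iff (y : D.B) : D.proj y ∈ D.gluedSet ↔ ∃ a s, D.inc a s = y := by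
  constructor
  · intro h
    obtain ⟨e, s, hs, h⟩ := mem_iUnion.1 h
    rcases D.proj_eq (p := (D.inc (.inl e) ⟨s, hs⟩).1) h with h | ⟨_, h⟩
    · exact ⟨_, _, Subtype.ext h⟩
    · exact ⟨_, _, (D.opp_inc _ _).symm.trans (Subtype.ext h)⟩
  · rintro ⟨e | e, s, rfl⟩
    · exact mem_iUnion.2 ⟨e, s.1, s.2, rfl⟩
    · exact mem_iUnion.2 ⟨e, (D.eglue (.inr e) s).1, (D.eglue (.inr e) s).2, D.emb_eglue (.inr e) s⟩

/-- Unions of images of components of the boundary are amenable. -/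
lemma isAmenable_of_subset [T2Space D.Glued] (hcomp : D.Cpt) (hmfd : D.Mfd d)
    (h : ∀ j, AmenableComponents (D.bdry j)) {T : Set D.Glued} (hT : T ⊆ D.walls)
    (hsat : ∀ y z : D.B, Joined y z → D.proj y ∈ T → D.proj z ∈ T) (x : T) :
    IsAmenable (FundamentalGroup T x) := by
  classical
  obtain ⟨f, hf⟩ := D.exists_sec hcomp hmfd
  let f' : C(T, D.B) := f.comp ⟨fun x => ⟨x, D.proj_image_B ▸ hT x.2⟩, by fun_prop⟩
  have hf' : ∀ x, D.proj (f' x) = x := fun x => hf _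
  let r : D.B → T := fun y => if h : D.proj y ∈ T then ⟨D.proj y, h⟩ else x
  have hr : Continuous r := continuous_iff_continuousAt.2 fun y => by
    have ho : ∀ P : Prop, IsOpen {y : D.B | D.proj y ∈ T ↔ P} := fun P =>
      D.isOpen_of_joined hmfd fun y z h hy =>
        ⟨fun hz => hy.1 (hsat z y h.symm hz), fun hP => hsat y z h (hy.2 hP)⟩
    by_cases hy : D.proj y ∈ T
    · refine Topology.IsInducing.subtypeVal.continuousAt_iff.2
        ((D.proj.continuous.comp continuous_subtype_val).continuousAt.congr ?_)
      filter_upwards [(ho True).mem_nhds (iff_true_intro hy)] with z hz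
      simp [r, hz.2 trivial]
    · refine continuousAt_const.congr (f := fun _ => x) ?_
      filter_upwards [(ho False).mem_nhds (iff_false_intro hy)] with z hz
      simp [r, show D.proj z ∉ T from hz.1]
  have hrf : ∀ x, r (f' x) = x := fun x => Subtype.ext (by simp [r, hf'])
  suffices ∀ x', x' = x → IsAmenable (FundamentalGroup T x') from this x rfl
  intro x' hx'
  obtain rfl : x' = r (f' x) := hx'.trans (hrf x).symm
  refine (D.isAmenable_B h (f' x)).of_surjective (pi1Map ⟨r, hr⟩ (f' x)) fun g => ?_
  obtain ⟨γ, rfl⟩ := PQ.mk_surjective g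
  refine ⟨.mk ((γ.map f'.continuous).cast (by rw [hrf]) (by rw [hrf])), ?_⟩
  exact congrArg PQ.mk (Path.ext (funext fun t => hrf _))

lemma exists_cochain {n : ℕ} (f : ∀ j, Cochain (D.piece j) n) :
    ∃ β : Cochain D.Tot n, ∀ j c, β (push ℝ (sigmaMk j) n c) = f j c := by
  choose i g hg using fun τ : SSimplex D.Tot n => τ.exists_lift_sigma
  refine ⟨clift fun τ => f (i τ) (sgl ℝ (g τ)), fun j c => ?_⟩
  apply chain_ext c
  intro σ
  rw [push_sgl, clift_sgl]
  have key : ∀ i (τ : SSimplex (D.piece i) n), (sigmaMk j).comp σ =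
      (sigmaMk i).comp τ → f i (sgl ℝ τ) = f j (sgl ℝ σ) := by
    intro i τ h
    obtain rfl : j = i := congrArg Sigma.fst (DFunLike.congr_fun h (vtx n 0))
    rw [show σ = τ from ContinuousMap.ext fun x =>
      sigma_mk_injective (DFunLike.congr_fun h x)]
  exact key _ _ (hg _)

lemma exists_rel_walls (hcomp : D.Cpt) (hconn : D.Conn) [ConnectedSpace D.Glued]
    (hmfd : D.Mfd (d + 1)) [T2Space D.Glued]
    (h : ∀ j, AmenableComponents (D.bdry j)) {β : Cochain D.Glued (d + 2)} (hβ : Cocyc β)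
    (h1 : BddBy 1 β) (h0 : ∀ c ∈ chainsIn ℝ _ D.gluedBdry (d + 2), β c = 0)
    (z : relCycles ℝ D.Glued D.gluedBdry (d + 1)) : ∃ β' : Cochain D.Glued (d + 2),
      Cocyc β' ∧ BddBy 1 β' ∧ (∀ c ∈ chainsIn ℝ _ D.walls (d + 2), β' c = 0) ∧ β' z = β z := by
  have hw : ∀ y : D.B, D.proj y ∈ D.walls := fun y => D.emb_mem_walls_iff.2 y.2
  by_cases hB : Nonempty D.B
  · obtain ⟨y⟩ := hB
    have hj : ∀ p : D.Glued, ∃ y : D.walls, Joined p y := fun p => by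
      obtain ⟨a, rfl⟩ := D.proj_surjective p
      obtain ⟨y, ⟨γ⟩⟩ := D.exists_joined_B hconn hmfd (D.nonempty_bdry hcomp hconn y) a
      exact ⟨⟨_, hw y⟩, ⟨γ.map D.proj.continuous⟩⟩
    have hsat : ∀ y z : D.B, Joined y z → D.proj y ∈ D.gluedBdry → D.proj z ∈ D.gluedBdry :=
      fun y z hyz hy => ⟨hw z, fun hz => hy.2 <| by
        obtain ⟨a, ha⟩ := (D.proj_mem_gluedSet_iff z).1 hz
        exact (D.proj_mem_gluedSet_iff y).2 ⟨a, (D.exists_inc_of_joined hyz).2 ha⟩⟩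
    obtain ⟨β', -, -, -, -, h2, h3, -, h4, h5⟩ := exists_rel_averaged
      (D.isAmenable_of_subset hcomp hmfd h subset_rfl fun _ z _ _ => hw z)
      (D.isAmenable_of_subset hcomp hmfd h D.gluedBdry_subset hsat) D.gluedBdry_subset hj hβ h1 h0
    exact ⟨β', h2, h3, h4, h5 z⟩
  · refine ⟨β, hβ, h1, fun c hc => h0 c (chainsIn_mono (fun x hx => ?_) _ hc), rfl⟩
    rw [← proj_image_B] at hx
    obtain ⟨y, hy, -⟩ := hx
    exact (hB ⟨⟨y, hy⟩⟩).elim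

lemma exists_glued_cochain (hcomp : D.Cpt) (hconn : D.Conn) [ConnectedSpace D.Glued]
    (hmfd : D.Mfd (d + 1))
    (hg : IsTopMfdWithBdry (d + 2) D.Glued D.gluedBdry) (hcompat : D.Compatible)
    (h : ∀ j, AmenableComponents (D.bdry j)) {f : ∀ j, Cochain (D.piece j) (d + 2)}
    (hf : ∀ j, Cocyc (f j)) (h1 : ∀ j, BddBy 1 (f j))
    (h0 : ∀ j, ∀ c ∈ chainsIn ℝ _ (D.bdry j) (d + 2), f j c = 0)
    (z : ∀ j, relCycles ℝ (D.piece j) (D.bdry j) (d + 1)) :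
    ∃ β : Cochain D.Glued (d + 2), Cocyc β ∧ BddBy 1 β ∧
      (∀ c ∈ chainsIn ℝ _ D.walls (d + 2), β c = 0) ∧
      ∀ j, β (push ℝ (D.emb j) (d + 2) (z j)) = f j (z j) := by
  have := hg.1
  obtain ⟨γ, hγ⟩ := D.exists_cochain f
  have hγs : ∀ j (σ : SSimplex (D.piece j) (d + 2)),
      γ (sgl ℝ ((sigmaMk j).comp σ)) = f j (sgl ℝ σ) := fun j σ => by
    rw [← hγ, push_sgl]
  have hγc : Cocyc γ := fun c => by
    apply chain_ext c
    intro τ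
    obtain ⟨j, σ, rfl⟩ := τ.exists_lift_sigma
    rw [← push_sgl, push_bdry, hγ]
    exact hf j _
  have hγ1 : BddBy 1 γ := fun τ => by
    obtain ⟨j, σ, rfl⟩ := τ.exists_lift_sigma
    rw [hγs]
    exact h1 j σ
  have hsplit : ∀ (β : Cochain D.Glued (d + 2)) j c, β (push ℝ (D.emb j) (d + 2) c) =
      (β.comp (push ℝ D.proj (d + 2))) (push ℝ (sigmaMk j) (d + 2) c) :=
    fun β j c => (congrArg β (push_push D.proj (.sigmaMk j) c)).symm
  by_cases hB : Nonempty D.B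
  · obtain ⟨y⟩ := hB
    obtain ⟨γ', c, b, hb, hc, h2, -, h4, h5, h6⟩ := exists_rel_averaged (D.isAmenable_B h)
      (D.isAmenable_B h) subset_rfl (D.exists_joined_B hconn hmfd (D.nonempty_bdry hcomp hconn y))
      hγc hγ1 fun w hw => (mem_bot ℝ).1 (map_mem_of_chainsIn _ ⊥ (fun τ hτ => by
        obtain ⟨j, σ, rfl⟩ := τ.exists_lift_sigma
        rw [mem_bot, hγs]
        refine h0 j _ (sgl_mem_chainsIn ?_)
        rintro _ ⟨x, rfl⟩
        exact hτ ⟨x, rfl⟩) hw)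
    obtain ⟨β, hβ1, hβ, hβτ⟩ := Fold.Compat.exists_combination
      (F := D.fold hcomp hmfd hg) (hcompat.compat hcomp hmfd hg) zero_le_one hb hc
    have hβγ : β.comp (push ℝ D.proj (d + 2)) = γ' := chain_hom_ext fun τ => by
      rw [comp_apply, push_sgl, h4]
      exact hβτ τ
    refine ⟨β, hβ, hβ1, fun w hw => (mem_bot ℝ).1 (map_mem_of_chainsIn _ ⊥ (fun σ hσ => ?_) hw),
      fun j => ?_⟩
    · rw [← proj_image_B] at hσ
      obtain ⟨s, hs⟩ := D.exists_sec hcomp hmfd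
      let τ : SSimplex D.Tot (d + 2) := ⟨fun x => s ⟨σ x, hσ ⟨x, rfl⟩⟩, by fun_prop⟩
      have hτ : D.proj.comp τ = σ := ContinuousMap.ext fun x => hs _
      rw [mem_bot, ← hτ, ← push_sgl, ← comp_apply, hβγ]
      refine h5 _ (sgl_mem_chainsIn ?_)
      rintro _ ⟨x, rfl⟩
      exact (s _).2
    · rw [hsplit, hβγ, ← hγ]
      have hm : MapsTo (sigmaMk j) (D.bdry j) D.B := fun x hx => hx
      exact h6 ⟨_, push_mem_relCycles _ hm (z j).2⟩
  · have hinj : Injective D.proj := fun p q e =>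
      (D.proj_eq e).resolve_right fun ⟨hp, _⟩ => hB ⟨⟨p, hp⟩⟩
    let e := D.proj.continuous.homeoOfEquivCompactToT2
      (f := Equiv.ofBijective D.proj ⟨hinj, D.proj_surjective⟩)
    let g : C(D.Glued, D.Tot) := ⟨e.symm, e.symm.continuous⟩
    have hge : g.comp D.proj = .id _ := ContinuousMap.ext e.symm_apply_apply
    refine ⟨γ.comp (push ℝ g (d + 2)), fun c => ?_, fun σ => ?_, fun w hw =>
      (mem_bot ℝ).1 (map_mem_of_chainsIn _ ⊥ (fun σ hσ => ?_) hw), fun j => ?_⟩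
    · rw [comp_apply, ← push_bdry, hγc]
    · rw [comp_apply, push_sgl]
      exact hγ1 _
    · rw [← proj_image_B] at hσ
      obtain ⟨y, hy, -⟩ := hσ ⟨vtx _ 0, rfl⟩
      exact (hB ⟨⟨y, hy⟩⟩).elim
    · rw [hsplit, comp_apply, comp_apply, push_push g, hge, push_id, hγ]

end GluingData

open GluingData in
/-- **Gromov Additivity Theorem (additivity for compatible gluings).**
Let `M₁, …, M_k` be compact connected oriented `n`-dimensional manifolds, `n = d + 2 ≥ 2`,
such that the fundamental group of every boundary component of every `M_j` is amenable,
and let `M` be the (connected, oriented) manifold obtained by gluing the `M_j` along some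
of their boundary components (realized as the quotient `D.Glued`; its orientability,
guaranteed by the fact that the gluing homeomorphisms are orientation-reversing, enters
through the hypothesis that `(M, ∂M)` admits a fundamental class, and the simplicial
volumes do not depend on the choices of the fundamental classes). If all the gluings are
compatible, i.e. every gluing map `f : S₁ → S₂` satisfies `f_*(K₁) = K₂` where `K_i` is
the kernel of the map induced on fundamental groups by the inclusion of the boundary
component `S_i` into the manifold containing it, then
`‖M, ∂M‖ = ‖M₁, ∂M₁‖ + … + ‖M_k, ∂M_k‖`. -/
theorem gromov_additivity_eq
    (d k : ℕ) (D : GluingData k)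
    (hcomp : ∀ j, CompactSpace (D.piece j))
    (hconn : ∀ j, ConnectedSpace (D.piece j))
    (hmfd : ∀ j, IsTopMfdWithBdry (d + 2) (D.piece j) (D.bdry j))
    (hamen : ∀ j, AmenableComponents ↥(D.bdry j))
    (hcompat : D.Compatible)
    (hgconn : ConnectedSpace D.Glued)
    (hgmfd : IsTopMfdWithBdry (d + 2) D.Glued D.gluedBdry)
    (μ : relHomology ℝ D.Glued D.gluedBdry (d + 1))
    (hμ : IsFundClass D.Glued D.gluedBdry (d + 1) μ)
    (μp : ∀ j, relHomology ℝ (D.piece j) (D.bdry j) (d + 1))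
    (hμp : ∀ j, IsFundClass (D.piece j) (D.bdry j) (d + 1) (μp j)) :
    l1HomNorm μ = ∑ j, l1HomNorm (μp j) := by
  have := hgmfd.1
  obtain ⟨ε, hε, hsign⟩ := D.exists_signs hcomp hconn hmfd hgmfd hμ hμp
  obtain ⟨z, rfl⟩ : ∃ z, relHomClass z = μ := Submodule.Quotient.mk_surjective _ μ
  have hex : ∀ j, ∃ z, relHomClass z = μp j := fun j => Submodule.Quotient.mk_surjective _ _
  choose zp hzp using hex
  have hεb : ∀ {Y : Type} [TopologicalSpace Y] {β : SChain ℝ Y (d + 2) →ₗ[ℝ] ℝ} j,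
      BddBy 1 β → BddBy 1 (ε j • β) := fun j h σ => by
    rcases hε j with e | e <;> simpa [e] using h σ
  refine le_antisymm ?_ ?_
  · obtain ⟨β, hβ, h1, h0, hz⟩ := exists_dual z
    obtain ⟨β', hβ', h1', h0', hz'⟩ := D.exists_rel_walls hcomp hconn hmfd hamen hβ h1 h0 z
    rw [← hz, ← hz', hsign β' hβ' h0' z rfl zp hzp]
    refine Finset.sum_le_sum fun j _ => ?_
    rw [← hzp]
    refine apply_le_l1HomNorm (β := ε j • β'.comp (push ℝ (D.emb j) (d + 2))) (fun c => ?_)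
      (hεb j fun σ => ?_) (fun c hc => ?_) (zp j)
    · rw [LinearMap.smul_apply, LinearMap.comp_apply, ← push_bdry, hβ', smul_zero]
    · rw [LinearMap.comp_apply, push_sgl]
      exact h1' _
    · rw [LinearMap.smul_apply, LinearMap.comp_apply, h0' _ (push_mem_chainsIn _ (fun x hx =>
        D.emb_mem_walls_iff.2 hx) hc), smul_zero]
  · choose β hβ h1 h0 hz using fun j => exists_dual (zp j)
    obtain ⟨β', hβ', h1', h0', hz'⟩ := D.exists_glued_cochain hcomp hconn hmfd hgmfd hcompat hamen
      (f := fun j => ε j • β j) (fun j c => by rw [LinearMap.smul_apply, hβ, smul_zero])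
      (fun j => hεb j (h1 j)) (fun j c hc => by rw [LinearMap.smul_apply, h0 j c hc, smul_zero]) zp
    refine le_trans (Eq.le ?_) (apply_le_l1HomNorm hβ' h1' (fun c hc =>
      h0' c (chainsIn_mono D.gluedBdry_subset _ hc)) z)
    rw [hsign β' hβ' h0' z rfl zp hzp]
    refine Finset.sum_congr rfl fun j _ => ?_
    rw [hz', LinearMap.smul_apply, hz, hzp]
    rcases hε j with e | e <;> simp [e]

end BddCoh
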